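/- For every percolation parameter p with 1/2 < p < 1, there exists a deterministic constant c(p) ∈ (0, ∞) such that ℙ_p-almost surely, n·Φ_n converges to c(p) as n → ∞. (This settles Benjamini's conjecture in dimension two; the paper identifies c(p) = φ_p/θ_p, where θ_p = ℙ_p(0 ∈ C_∞) and φ_p is the optimal value of a continuum isoperimetric problem.) -/

import Mathlib

open MeasureTheory Set Filter

noncomputable section

/-- Vertices of the square lattice `ℤ²`. -/
abbrev Vert : Type := ℤ × ℤ

/-- Edges of `ℤ²`, encoded as a base vertex together with a direction:
`false` for the horizontal edge to `x + (1,0)`, `true` for the vertical edge to `x + (0,1)`. -/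
abbrev Edge : Type := Vert × Bool

/-- Percolation configurations: each edge is open (`true`) or closed (`false`). -/
abbrev Config : Type := Edge → Bool

/-- The second endpoint of an edge. -/
def edgeTip (e : Edge) : Vert := e.1 + (if e.2 then (0, 1) else (1, 0))

/-- `x` and `y` are joined by an open edge in the configuration `ω`. -/
def openAdj (ω : Config) (x y : Vert) : Prop :=
  ∃ e : Edge, ω e = true ∧ ((e.1 = x ∧ edgeTip e = y) ∨ (e.1 = y ∧ edgeTip e = x))

/-- The open cluster of a vertex `x`: all vertices joined to `x` by an open path. -/
def cluster (ω : Config) (x : Vert) : Set Vert :=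
  {y | Relation.ReflTransGen (openAdj ω) x y}

/-- The union of the infinite open clusters (a.s. the unique infinite cluster `C∞`
in the supercritical regime). -/
def Cinf (ω : Config) : Set Vert := {x | (cluster ω x).Infinite}

/-- The box `[-n,n]²` of the lattice. -/
def latBox (n : ℕ) : Set Vert := {x | |x.1| ≤ (n : ℤ) ∧ |x.2| ≤ (n : ℤ)}

/-- The vertex set `C̃ₙ = C∞ ∩ [-n,n]²`. -/
def Ctilde (ω : Config) (n : ℕ) : Set Vert := Cinf ω ∩ latBox n

/-- Adjacency by an open edge within `C̃ₙ`. -/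
def adjIn (ω : Config) (n : ℕ) (x y : Vert) : Prop :=
  openAdj ω x y ∧ x ∈ Ctilde ω n ∧ y ∈ Ctilde ω n

/-- The connected component of `x` in the graph `C̃ₙ`. -/
def compIn (ω : Config) (n : ℕ) (x : Vert) : Set Vert :=
  {y | Relation.ReflTransGen (adjIn ω n) x y} ∩ Ctilde ω n

/-- The giant component `Cₙ`: a connected component of `C̃ₙ` of maximal cardinality. -/
def giant (ω : Config) (n : ℕ) : Set Vert :=
  compIn ω n (Classical.epsilon fun x =>
    x ∈ Ctilde ω n ∧ ∀ y ∈ Ctilde ω n, (compIn ω n y).ncard ≤ (compIn ω n x).ncard)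

/-- The set of open edges of the graph induced on `G` having exactly one endpoint in `H`. -/
def edgeBdry (ω : Config) (G H : Set Vert) : Set Edge :=
  {e | ω e = true ∧ e.1 ∈ G ∧ edgeTip e ∈ G ∧
    ((e.1 ∈ H ∧ edgeTip e ∉ H) ∨ (e.1 ∉ H ∧ edgeTip e ∈ H))}

/-- The Cheeger constant of the open subgraph of `ω` induced on the vertex set `G`:
the minimum of `|∂H|/|H|` over vertex sets `H ⊆ G` with `0 < |H| ≤ |G|/2`. -/
def cheeger (ω : Config) (G : Set Vert) : ℝ :=
  sInf {r : ℝ | ∃ H : Set Vert, H ⊆ G ∧ 0 < H.ncard ∧ 2 * H.ncard ≤ G.ncard ∧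
    r = ((edgeBdry ω G H).ncard : ℝ) / (H.ncard : ℝ)}

/-- `Φₙ`, the Cheeger constant of the giant component. -/
def Phi (ω : Config) (n : ℕ) : ℝ := cheeger ω (giant ω n)

/-- The set `𝒢ₙ` of Cheeger optimizers of the giant component. -/
def optimizers (ω : Config) (n : ℕ) : Set (Set Vert) :=
  {H | H ⊆ giant ω n ∧ 0 < H.ncard ∧ 2 * H.ncard ≤ (giant ω n).ncard ∧
    ((edgeBdry ω (giant ω n) H).ncard : ℝ) / (H.ncard : ℝ) = Phi ω n}

/-- `P` is the Bernoulli bond percolation measure with parameter `p`: a probability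
measure under which the states of the edges are i.i.d. Bernoulli(`p`). -/
def IsBernoulli (P : Measure Config) (p : ℝ) : Prop :=
  IsProbabilityMeasure P ∧
    ∀ (s : Finset Edge) (f : Edge → Bool),
      P {ω : Config | ∀ e ∈ s, ω e = f e} =
        ∏ e ∈ s, (if f e then ENNReal.ofReal p else ENNReal.ofReal (1 - p))

end



noncomputable section

namespace BP

/-! ### Product measures -/

/-- Bernoulli measure on `Bool`. -/
def bern (q : unitInterval) : Measure Bool :=
  ENNReal.ofReal (q : ℝ) • Measure.dirac true + ENNReal.ofReal (1 - (q : ℝ)) • Measure.dirac false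

lemma bern_apply (q : unitInterval) (t : Set Bool) :
    bern q t = ENNReal.ofReal (q : ℝ) * t.indicator 1 true
      + ENNReal.ofReal (1 - (q : ℝ)) * t.indicator 1 false := by
  simp [bern]

instance (q : unitInterval) : IsProbabilityMeasure (bern q) := by
  constructor
  rw [bern_apply]
  simp only [indicator_univ, Pi.one_apply, mul_one]
  rw [← ENNReal.ofReal_add q.2.1 (by linarith [q.2.2])]
  simp

/-- The Bernoulli product measure. -/
def mu (q : unitInterval) : Measure Config := Measure.infinitePi (fun _ : Edge => bern q)

instance (q : unitInterval) : IsProbabilityMeasure (mu q) := by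
  unfold mu; infer_instance

lemma mu_of_bernoulli {P : Measure Config} {p : ℝ} (h0 : 0 ≤ p) (h1 : p ≤ 1)
    (hP : IsBernoulli P p) : P = mu ⟨p, h0, h1⟩ := by
  obtain ⟨hPP, hP⟩ := hP
  -- enough on singletons cylinders; restrict to finite sets
  refine (Measure.isProjectiveLimit_infinitePi (fun _ : Edge => bern ⟨p, h0, h1⟩)).unique ?_ |>.symm
  intro I
  refine Measure.ext_of_singleton fun f => ?_
  rw [Measure.map_apply (Finset.measurable_restrict I) (measurableSet_singleton f),
    Measure.pi_singleton]
  classical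
  have := hP I (fun e => if h : e ∈ I then f ⟨e, h⟩ else false)
  have hs : (I.restrict ⁻¹' {f} : Set Config)
      = {ω : Config | ∀ e ∈ I, ω e = (if h : e ∈ I then f ⟨e, h⟩ else false)} := by
    ext ω
    simp only [mem_preimage, mem_singleton_iff, mem_ofPred_eq]
    constructor
    · rintro rfl e he
      simp [he]
    · intro h
      ext e
      have := h e.1 e.2
      simpa using this
  rw [hs, this, ← Finset.prod_coe_sort]
  refine Finset.prod_congr rfl fun e _ => ?_
  rw [bern_apply]
  simp only [Finset.coe_mem, dite_true, Subtype.coe_eta]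
  cases f e <;> simp

lemma mu_prod_map (q s r : unitInterval) (g : Edge → Bool → Bool → Bool)
    (h : ∀ e, ∀ t : Set Bool, ∑ a : Bool, ∑ b : Bool,
        bern q {a} * (bern s {b} * t.indicator 1 (g e a b)) = bern r t) :
    ((mu q).prod (mu s)).map (fun p e => g e (p.1 e) (p.2 e)) = mu r := by
  have hm : Measurable (fun (p : Config × Config) e => g e (p.1 e) (p.2 e)) := by
    refine measurable_pi_lambda _ fun e => ?_
    have h2 : Measurable (fun p : Config × Config => (p.1 e, p.2 e)) := by fun_prop
    exact (measurable_of_countable (fun z : Bool × Bool => g e z.1 z.2)).comp h2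
  refine Measure.eq_infinitePi _ fun F t ht => ?_
  have hS : MeasurableSet (Set.pi (F : Set Edge) t) :=
    MeasurableSet.pi F.countable_toSet fun i _ => ht i
  rw [Measure.map_apply hm hS, Measure.prod_apply (hm hS)]
  have hk : ∀ ω : Config, mu s (Prod.mk ω ⁻¹' ((fun (p : Config × Config) e =>
      g e (p.1 e) (p.2 e)) ⁻¹' Set.pi (F : Set Edge) t))
      = ∏ e ∈ F, (∑ b : Bool, bern s {b} * (t e).indicator 1 (g e (ω e) b)) := by
    intro ω
    have : (Prod.mk ω ⁻¹' ((fun (p : Config × Config) e =>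
      g e (p.1 e) (p.2 e)) ⁻¹' Set.pi (F : Set Edge) t))
      = Set.pi (F : Set Edge) (fun e => {b | g e (ω e) b ∈ t e}) := by
      ext η; simp [Set.mem_pi]
    rw [this, mu, Measure.infinitePi_pi]
    · refine Finset.prod_congr rfl fun e _ => ?_
      rw [bern_apply]
      simp [bern_apply, indicator]
    · intro i _; exact trivial
  simp_rw [hk]
  have hind := ProbabilityTheory.iIndepFun_infinitePi (P := fun _ : Edge => bern q)
    (X := fun e (a : Bool) => ∑ b : Bool, bern s {b} * (t e).indicator (1 : Bool → ENNReal) (g e a b))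
    (fun e => measurable_of_countable _)
  rw [mu, ProbabilityTheory.lintegral_prod_eq_prod_lintegral_of_indepFun F
    (fun e (ω : Config) => ∑ b : Bool, bern s {b} * (t e).indicator (1 : Bool → ENNReal) (g e (ω e) b)) hind]
  · refine Finset.prod_congr rfl fun e _ => ?_
    have := (measurePreserving_eval_infinitePi (fun _ : Edge => bern q) e).lintegral_comp
      (f := fun a : Bool => ∑ b : Bool, bern s {b} * (t e).indicator (1 : Bool → ENNReal) (g e a b))
      (measurable_of_countable _)
    simp only [Function.eval] at this
    rw [this, lintegral_fintype, ← h e (t e)]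
    refine Finset.sum_congr rfl fun a _ => ?_
    rw [Finset.sum_mul]
    refine Finset.sum_congr rfl fun b _ => ?_
    ring
  · intro e
    exact (measurable_of_countable (fun a : Bool => ∑ b : Bool, bern s {b} *
      (t e).indicator (1 : Bool → ENNReal) (g e a b))).comp (measurable_pi_apply e)

/-- `1-(1-q)(1-s)`. -/
def oplus (q s : unitInterval) : unitInterval :=
  ⟨1 - (1 - q) * (1 - s), by
    have := q.2.1; have := q.2.2; have := s.2.1; have := s.2.2
    constructor <;> nlinarith [mul_nonneg (sub_nonneg.2 q.2.2) (sub_nonneg.2 s.2.2),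
      mul_le_one₀ (show (1 - (q:ℝ)) ≤ 1 by linarith) (sub_nonneg.2 s.2.2) (show (1 - (s:ℝ)) ≤ 1 by linarith)]⟩

/-- pointwise or. -/
def cor (ω η : Config) : Config := fun e => ω e || η e

/-- pointwise negation. -/
def cnot (ω : Config) : Config := fun e => !ω e

/-- splice: `η` on `F`, `ω` elsewhere. -/
def splice (F : Set Edge) (ω η : Config) : Config := by
  classical exact fun e => if e ∈ F then η e else ω e

lemma mu_oplus (q s : unitInterval) :
    ((mu q).prod (mu s)).map (fun p => cor p.1 p.2) = mu (oplus q s) := by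
  refine mu_prod_map q s _ (fun _ a b => a || b) fun e t => ?_
  have hq := q.2.1; have hq' := q.2.2; have hs := s.2.1; have hs' := s.2.2
  simp only [Fintype.sum_bool, bern_apply, oplus]
  simp only [mem_singleton_iff, indicator, reduceCtorEq, if_true, if_false, mul_one, mul_zero, add_zero,
    zero_add, Bool.or_true, Bool.or_false, Bool.true_or, Bool.or_self, Pi.one_apply]
  have e1 : ENNReal.ofReal (1 - (1 - (q:ℝ)) * (1 - s))
     = ENNReal.ofReal q * ENNReal.ofReal s + ENNReal.ofReal q * ENNReal.ofReal (1 - s)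
      + ENNReal.ofReal (1 - q) * ENNReal.ofReal s := by
    rw [← ENNReal.ofReal_mul hq, ← ENNReal.ofReal_mul hq, ← ENNReal.ofReal_mul (by linarith),
      ← ENNReal.ofReal_add, ← ENNReal.ofReal_add]
    · congr 1; ring
    all_goals nlinarith [mul_nonneg hq hs, mul_nonneg hq (sub_nonneg.2 hs'), mul_nonneg (sub_nonneg.2 hq') hs]
  have e2 : ENNReal.ofReal (1 - (1 - (1 - (q:ℝ)) * (1 - s)))
     = ENNReal.ofReal (1 - q) * ENNReal.ofReal (1 - s) := by
    rw [← ENNReal.ofReal_mul (by linarith)]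
    congr 1; ring
  rw [e1, e2]
  rw [show (true || true) = true from rfl, show (true || false) = true from rfl,
    show (false || true) = true from rfl, show (false || false) = false from rfl]
  ring

lemma mu_splice (q : unitInterval) (F : Set Edge) :
    ((mu q).prod (mu q)).map (fun p => splice F p.1 p.2) = mu q := by
  classical
  refine mu_prod_map q q q (fun e a b => if e ∈ F then b else a) fun e t => ?_
  have hq := q.2.1; have hq' := q.2.2
  have e1 : ENNReal.ofReal (q:ℝ) + ENNReal.ofReal (1 - q) = 1 := by
    rw [← ENNReal.ofReal_add hq (by linarith)]; simp
  simp only [Fintype.sum_bool, bern_apply]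
  simp only [mem_singleton_iff, indicator, reduceCtorEq, if_true, if_false, mul_one, mul_zero, add_zero,
    zero_add, Pi.one_apply]
  set a := ENNReal.ofReal (q:ℝ)
  set b := ENNReal.ofReal (1 - (q:ℝ))
  by_cases hF : e ∈ F
  · simp only [hF, if_true]
    rw [← mul_add, ← mul_add, ← add_mul, e1, one_mul]
  · simp only [hF, if_false]
    by_cases h1 : true ∈ t <;> by_cases h2 : false ∈ t <;>
      simp [h1, h2, ← mul_add, e1]

lemma measurable_cor : Measurable (fun p : Config × Config => cor p.1 p.2) := by
  refine measurable_pi_lambda _ fun e => ?_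
  have h2 : Measurable (fun p : Config × Config => (p.1 e, p.2 e)) := by fun_prop
  exact (measurable_of_countable (fun z : Bool × Bool => z.1 || z.2)).comp h2

lemma measurable_cnot : Measurable cnot := by
  refine measurable_pi_lambda _ fun e => ?_
  exact (measurable_of_countable (fun z : Bool => !z)).comp (measurable_pi_apply e)

lemma measurable_splice (F : Set Edge) :
    Measurable (fun p : Config × Config => splice F p.1 p.2) := by
  classical
  refine measurable_pi_lambda _ fun e => ?_
  have h2 : Measurable (fun p : Config × Config => (p.1 e, p.2 e)) := by fun_prop
  exact (measurable_of_countable (fun z : Bool × Bool => if e ∈ F then z.2 else z.1)).comp h2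

lemma mu_not (q : unitInterval) : (mu q).map cnot = mu (unitInterval.symm q) := by
  unfold mu cnot
  rw [Measure.infinitePi_map_pi (f := fun (_ : Edge) (b : Bool) => !b) _
    (fun _ => measurable_of_countable _)]
  congr 1
  funext e
  refine Measure.ext_of_singleton fun b => ?_
  rw [Measure.map_apply (measurable_of_countable _) (measurableSet_singleton _), bern_apply, bern_apply]
  cases b <;> simp [indicator]

/-- reindexing by an injective map of edges preserves the law -/
lemma mu_reindex (q : unitInterval) (f : Edge → Edge) (hf : Function.Injective f) :
    (mu q).map (fun ω e => ω (f e)) = mu q := by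
  unfold mu
  exact Measure.map_infinitePi_infinitePi_of_inj (P := fun _ : Edge => bern q) hf

/-! ### Functions depending on finitely many edges -/

/-- `f` depends only on the edges in `F`. -/
def Dep {α : Sort*} (F : Set Edge) (f : Config → α) : Prop :=
  ∀ η η' : Config, (∀ e ∈ F, η e = η' e) → f η = f η'

lemma Dep.mono {α : Sort*} {F G : Set Edge} {f : Config → α} (h : Dep F f) (hFG : F ⊆ G) :
    Dep G f := fun η η' hh => h η η' fun e he => hh e (hFG he)

lemma Dep.comp {α β : Sort*} {F : Set Edge} {f : Config → α} (h : Dep F f) (g : α → β) :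
    Dep F (fun ω => g (f ω)) := fun η η' hh => by simp only [h η η' hh]

lemma Dep.comp2 {α β γ : Sort*} {F : Set Edge} {f : Config → α} {g : Config → β} (h : Dep F f)
    (h' : Dep F g) (k : α → β → γ) :
    Dep F (fun ω => k (f ω) (g ω)) := fun η η' hh => by simp only [h η η' hh, h' η η' hh]

lemma Dep.measurable {α : Type*} [MeasurableSpace α] {F : Finset Edge} {f : Config → α}
    (h : Dep (F : Set Edge) f) : Measurable f := by
  classical
  have : f = (fun g : F → Bool => f (fun e => if he : e ∈ F then g ⟨e, he⟩ else false)) ∘ F.restrict := by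
    funext ω
    refine h _ _ fun e he => ?_
    have he' : e ∈ F := he
    simp [he']
  rw [this]
  exact (measurable_of_countable _).comp (Finset.measurable_restrict F)

lemma Dep.finite_range {α : Type*} {F : Finset Edge} {f : Config → α}
    (h : Dep (F : Set Edge) f) : (range f).Finite := by
  classical
  have : range f ⊆ range (fun g : F → Bool => f (fun e => if he : e ∈ F then g ⟨e, he⟩ else false)) := by
    rintro _ ⟨ω, rfl⟩
    refine ⟨F.restrict ω, ?_⟩
    refine h _ _ fun e he => ?_
    have he' : e ∈ F := he
    simp [he']
  exact (Set.finite_range _).subset this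

lemma Dep.bound {F : Finset Edge} {f : Config → ℝ}
    (h : Dep (F : Set Edge) f) : ∃ C, ∀ ω, |f ω| ≤ C := by
  obtain ⟨C, hC⟩ := (h.comp (fun x => |x|)).finite_range.bddAbove
  exact ⟨C, fun ω => hC ⟨ω, rfl⟩⟩

lemma Dep.integrable {F : Finset Edge} {f : Config → ℝ} (h : Dep (F : Set Edge) f)
    (ν : Measure Config) [IsFiniteMeasure ν] : Integrable f ν := by
  obtain ⟨C, hC⟩ := h.bound
  exact Integrable.of_bound h.measurable.aestronglyMeasurable C (ae_of_all _ hC)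

lemma Dep.measurableSet {F : Finset Edge} {A : Set Config} (h : Dep (F : Set Edge) (· ∈ A)) :
    MeasurableSet A := by
  classical
  have : A = (fun ω => decide (ω ∈ A)) ⁻¹' {true} := by ext; simp
  rw [this]
  exact (Dep.measurable (F := F) (fun η η' hh => by simp only [h η η' hh])) (measurableSet_singleton _)

lemma integral_oplus (q s : unitInterval) (f : Config → ℝ) (hf : Measurable f) {C : ℝ}
    (hC : ∀ ω, |f ω| ≤ C) :
    ∫ ω, f ω ∂(mu (oplus q s)) = ∫ ω, ∫ η, f (cor ω η) ∂(mu s) ∂(mu q) := by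
  rw [← mu_oplus, integral_map measurable_cor.aemeasurable hf.aestronglyMeasurable,
    integral_prod]
  exact Integrable.of_bound (hf.comp measurable_cor).aestronglyMeasurable C
    (ae_of_all _ fun _ => hC _)

lemma integral_splice (q : unitInterval) (F : Set Edge) (f : Config → ℝ) (hf : Measurable f) {C : ℝ}
    (hC : ∀ ω, |f ω| ≤ C) :
    ∫ ω, f ω ∂(mu q) = ∫ ω, ∫ η, f (splice F ω η) ∂(mu q) ∂(mu q) := by
  conv_lhs => rw [← mu_splice q F]
  rw [integral_map (measurable_splice F).aemeasurable hf.aestronglyMeasurable, integral_prod]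
  exact Integrable.of_bound (hf.comp (measurable_splice F)).aestronglyMeasurable C
    (ae_of_all _ fun _ => hC _)

lemma splice_on {F : Set Edge} {ω η : Config} {e : Edge} (he : e ∈ F) :
    splice F ω η e = η e := by simp [splice, he]

lemma splice_off {F : Set Edge} {ω η : Config} {e : Edge} (he : e ∉ F) :
    splice F ω η e = ω e := by simp [splice, he]

/-- independence -/
lemma integral_mul_dep (q : unitInterval) {F G : Finset Edge} {f g : Config → ℝ}
    (hf : Dep (F : Set Edge) f) (hg : Dep (G : Set Edge) g) (hd : Disjoint F G) :
    ∫ ω, f ω * g ω ∂(mu q) = (∫ ω, f ω ∂(mu q)) * ∫ ω, g ω ∂(mu q) := by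
  obtain ⟨C, hC⟩ := hf.bound
  obtain ⟨D, hD⟩ := hg.bound
  rw [integral_splice q (G : Set Edge) (fun ω => f ω * g ω) (hf.measurable.mul hg.measurable)
    (C := C * D) (fun ω => by
      rw [abs_mul]
      exact mul_le_mul (hC _) (hD _) (abs_nonneg _) ((abs_nonneg _).trans (hC ω)))]
  have : ∀ ω η : Config, f (splice (G : Set Edge) ω η) * g (splice (G : Set Edge) ω η) = f ω * g η := by
    intro ω η
    rw [hf (splice (G : Set Edge) ω η) ω fun e he => splice_off
        (fun h => Finset.disjoint_left.1 hd he h),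
      hg (splice (G : Set Edge) ω η) η fun e he => splice_on he]
  simp_rw [this, integral_const_mul, integral_mul_const]

/-- The probability of an event as a real number. -/
def pr (q : unitInterval) (A : Set Config) : ℝ := (mu q).real A

/-- real indicator -/
def ind (A : Set Config) : Config → ℝ := by
  classical exact fun ω => if ω ∈ A then 1 else 0

lemma ind_eq (A : Set Config) : ind A = A.indicator (fun _ => (1:ℝ)) := by
  funext ω; simp [ind, indicator]

lemma ind_of_mem {A : Set Config} {ω : Config} (h : ω ∈ A) : ind A ω = 1 := by simp [ind, h]
lemma ind_of_notMem {A : Set Config} {ω : Config} (h : ω ∉ A) : ind A ω = 0 := by simp [ind, h]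
lemma ind_nonneg (A : Set Config) (ω : Config) : 0 ≤ ind A ω := by unfold ind; split_ifs <;> norm_num
lemma ind_le_one (A : Set Config) (ω : Config) : ind A ω ≤ 1 := by unfold ind; split_ifs <;> norm_num
lemma ind_abs_le_one (A : Set Config) (ω : Config) : |ind A ω| ≤ 1 := by
  rw [abs_of_nonneg (ind_nonneg _ _)]; exact ind_le_one _ _

lemma measurable_ind {A : Set Config} (hA : MeasurableSet A) : Measurable (ind A) := by
  rw [ind_eq]; exact measurable_const.indicator hA

lemma Dep.ind {F : Set Edge} {A : Set Config} (h : Dep F (· ∈ A)) : Dep F (ind A) := by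
  intro η η' hh
  have h1 : (η ∈ A) = (η' ∈ A) := h η η' hh
  by_cases h2 : η' ∈ A
  · rw [ind_of_mem h2, ind_of_mem (h1 ▸ h2)]
  · rw [ind_of_notMem h2, ind_of_notMem (h1 ▸ h2)]

lemma pr_eq_integral (q : unitInterval) {A : Set Config} (hA : MeasurableSet A) :
    pr q A = ∫ ω, ind A ω ∂(mu q) := by
  rw [ind_eq, integral_indicator_const _ hA]; simp [pr]

lemma pr_nonneg (q : unitInterval) (A : Set Config) : 0 ≤ pr q A := measureReal_nonneg
lemma pr_le_one (q : unitInterval) (A : Set Config) : pr q A ≤ 1 := measureReal_le_one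
lemma pr_mono (q : unitInterval) {A B : Set Config} (h : A ⊆ B) : pr q A ≤ pr q B :=
  measureReal_mono h
lemma pr_union_le (q : unitInterval) (A B : Set Config) : pr q (A ∪ B) ≤ pr q A + pr q B :=
  measureReal_union_le A B
lemma pr_compl (q : unitInterval) {A : Set Config} (h : MeasurableSet A) : pr q Aᶜ = 1 - pr q A := by
  unfold pr; rw [measureReal_compl h]; simp
lemma pr_biUnion_le (q : unitInterval) {ι : Type*} (s : Finset ι) (A : ι → Set Config) :
    pr q (⋃ i ∈ s, A i) ≤ ∑ i ∈ s, pr q (A i) := measureReal_biUnion_finset_le s A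

lemma pr_inter_dep (q : unitInterval) {F G : Finset Edge} {A B : Set Config}
    (hf : Dep (F : Set Edge) (· ∈ A)) (hg : Dep (G : Set Edge) (· ∈ B)) (hd : Disjoint F G) :
    pr q (A ∩ B) = pr q A * pr q B := by
  rw [pr_eq_integral q (hf.measurableSet.inter hg.measurableSet), pr_eq_integral q hf.measurableSet,
    pr_eq_integral q hg.measurableSet, ← integral_mul_dep q hf.ind hg.ind hd]
  congr 1
  funext ω
  by_cases h1 : ω ∈ A <;> by_cases h2 : ω ∈ B <;> simp [ind, h1, h2]

lemma pr_reindex (q : unitInterval) (f : Edge → Edge) (hf : Function.Injective f) {A : Set Config}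
    (hA : MeasurableSet A) : pr q {ω | (fun e => ω (f e)) ∈ A} = pr q A := by
  unfold pr
  conv_rhs => rw [← mu_reindex q f hf]
  rw [map_measureReal_apply _ hA]
  · rfl
  · exact measurable_pi_lambda _ fun e => measurable_pi_apply _

/-- increasing events -/
def Incr (A : Set Config) : Prop := ∀ ω η : Config, (∀ e, ω e = true → η e = true) → ω ∈ A → η ∈ A

lemma pr_mono_param {q r : unitInterval} (h : q ≤ r) {A : Set Config} (hA : MeasurableSet A)
    (hi : Incr A) : pr q A ≤ pr r A := by
  have hq1 : (q:ℝ) ≤ 1 := q.2.2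
  have hr1 : (r:ℝ) ≤ 1 := r.2.2
  have hqr : (q:ℝ) ≤ r := h
  rcases eq_or_lt_of_le hq1 with h1 | h1
  · have : q = r := Subtype.ext (by linarith)
    rw [this]
  · have hs : 0 ≤ ((r:ℝ) - q) / (1 - q) ∧ ((r:ℝ) - q) / (1 - q) ≤ 1 := by
      constructor
      · apply div_nonneg <;> linarith
      · rw [div_le_one (by linarith)]; linarith
    have : r = oplus q ⟨((r:ℝ) - q) / (1 - q), hs⟩ := by
      apply Subtype.ext
      have : (1 - (q:ℝ)) ≠ 0 := by linarith
      simp only [oplus]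
      field_simp
      ring
    rw [this, pr_eq_integral _ hA, pr_eq_integral _ hA, integral_oplus _ _ _ (measurable_ind hA)
      (ind_abs_le_one A)]
    refine integral_mono_of_nonneg (ae_of_all _ fun _ => ind_nonneg _ _) ?_ (ae_of_all _ fun ω => ?_)
    · refine Integrable.of_bound (C := 1) ?_ (ae_of_all _ fun ω => ?_)
      · exact ((measurable_ind hA).comp measurable_cor).stronglyMeasurable.integral_prod_right'.aestronglyMeasurable
      · rw [Real.norm_eq_abs, abs_of_nonneg (integral_nonneg fun _ => ind_nonneg _ _)]
        calc _ ≤ ∫ η, (1:ℝ) ∂(mu _) := integral_mono_of_nonneg (ae_of_all _ fun _ => ind_nonneg _ _)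
              (integrable_const _) (ae_of_all _ fun _ => ind_le_one _ _)
          _ = 1 := by simp
    · by_cases hω : ω ∈ A
      · have : ∀ η, ind A (cor ω η) = 1 := fun η =>
          ind_of_mem (hi ω _ (fun e he => by simp [cor, he]) hω)
        simp [this, ind_of_mem hω]
      · simp only [ind_of_notMem hω]
        exact integral_nonneg fun _ => ind_nonneg _ _

end BP

end



noncomputable section

namespace BP

/-! ### Averaging one edge, Harris, Efron–Stein, sprinkling -/

/-- force edge `e` to have state `b`. -/
def upd (e : Edge) (b : Bool) (ω : Config) : Config := Function.update ω e b

lemma upd_self (e : Edge) (b : Bool) (ω : Config) : upd e b ω e = b := by simp [upd]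
lemma upd_ne {e e' : Edge} (h : e' ≠ e) (b : Bool) (ω : Config) : upd e b ω e' = ω e' := by
  simp [upd, h]

/-- averaging over edge `e`. -/
def Av (q : unitInterval) (e : Edge) (f : Config → ℝ) (ω : Config) : ℝ :=
  q * f (upd e true ω) + (1 - q) * f (upd e false ω)

lemma Dep.upd {α : Sort*} {F : Finset Edge} {e : Edge} {f : Config → α}
    (hf : Dep ((insert e F : Finset Edge) : Set Edge) f) (b : Bool) :
    Dep (F : Set Edge) (fun ω => f (upd e b ω)) := by
  intro η η' h
  refine hf _ _ fun e' he' => ?_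
  by_cases h1 : e' = e
  · subst h1; simp [upd_self]
  · rw [upd_ne h1, upd_ne h1]
    refine h e' ?_
    simpa [h1] using he'

lemma Dep.upd' {α : Sort*} {F : Set Edge} {f : Config → α}
    (hf : Dep F f) (e : Edge) (b : Bool) :
    Dep F (fun ω => f (BP.upd e b ω)) := by
  intro η η' h
  refine hf _ _ fun e' he' => ?_
  by_cases h1 : e' = e
  · subst h1; simp [upd_self]
  · rw [upd_ne h1, upd_ne h1]
    exact h e' he'

lemma Dep.Av {F : Finset Edge} {e : Edge} {f : Config → ℝ}
    (hf : Dep ((insert e F : Finset Edge) : Set Edge) f) (q : unitInterval) :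
    Dep (F : Set Edge) (Av q e f) :=
  (hf.upd true).comp2 (hf.upd false) (fun a b => (q:ℝ) * a + (1 - q) * b)

lemma integral_edge (q : unitInterval) (e : Edge) (g : Bool → ℝ) :
    ∫ η, g (η e) ∂(mu q) = q * g true + (1 - q) * g false := by
  have h := measurePreserving_eval_infinitePi (fun _ : Edge => bern q) e
  have : ∫ η, g (η e) ∂(mu q) = ∫ b, g b ∂(bern q) := by
    rw [← h.map_eq, integral_map h.measurable.aemeasurable
      (measurable_of_countable g).aestronglyMeasurable]
    rfl
  have hq := q.2.1; have hq' := q.2.2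
  rw [this, bern, integral_add_measure, integral_smul_measure, integral_smul_measure,
    integral_dirac, integral_dirac]
  · simp [ENNReal.toReal_ofReal hq, ENNReal.toReal_ofReal (sub_nonneg.2 hq')]
  · exact Integrable.smul_measure (integrable_dirac (by simp)) ENNReal.ofReal_ne_top
  · exact Integrable.smul_measure (integrable_dirac (by simp)) ENNReal.ofReal_ne_top

lemma integral_Av (q : unitInterval) (e : Edge) {f : Config → ℝ} (hf : Measurable f) {C : ℝ}
    (hC : ∀ ω, |f ω| ≤ C) : ∫ ω, Av q e f ω ∂(mu q) = ∫ ω, f ω ∂(mu q) := by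
  rw [integral_splice q {e} f hf hC]
  congr 1
  funext ω
  have : ∀ η : Config, f (splice {e} ω η) = f (upd e (η e) ω) := by
    intro η
    congr 1
    funext e'
    by_cases h : e' = e
    · subst h; rw [upd_self, splice_on (mem_singleton _)]
    · rw [upd_ne h, splice_off (by simpa using h)]
  simp_rw [this]
  rw [integral_edge q e (fun b => f (upd e b ω))]
  rfl

lemma integral_Av_dep (q : unitInterval) (e : Edge) {F : Finset Edge} {f : Config → ℝ}
    (hf : Dep (F : Set Edge) f) : ∫ ω, Av q e f ω ∂(mu q) = ∫ ω, f ω ∂(mu q) := by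
  obtain ⟨C, hC⟩ := hf.bound
  exact integral_Av q e hf.measurable hC

lemma upd_mono (e : Edge) (b : Bool) : Monotone (upd e b) := by
  intro ω η h e'
  by_cases h1 : e' = e
  · subst h1; simp [upd_self]
  · rw [upd_ne h1, upd_ne h1]; exact h e'

lemma upd_false_le_true (e : Edge) (ω : Config) : upd e false ω ≤ upd e true ω := by
  intro e'
  by_cases h1 : e' = e
  · subst h1; simp [upd_self]
  · rw [upd_ne h1, upd_ne h1]

lemma const_of_dep_empty {f : Config → ℝ} (hf : Dep ((∅ : Finset Edge) : Set Edge) f) (ω : Config) :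
    f ω = f (fun _ => false) := hf _ _ (by simp)

theorem harris (q : unitInterval) (F : Finset Edge) : ∀ f g : Config → ℝ,
    Dep (F : Set Edge) f → Dep (F : Set Edge) g → Monotone f → Monotone g →
    (∫ ω, f ω ∂(mu q)) * (∫ ω, g ω ∂(mu q)) ≤ ∫ ω, f ω * g ω ∂(mu q) := by
  have hq := q.2.1; have hq' := q.2.2
  induction F using Finset.induction_on with
  | empty =>
    intro f g hf hg _ _
    have h1 := const_of_dep_empty hf
    have h2 := const_of_dep_empty hg
    simp_rw [h1, h2]
    simp
  | insert e F he ih =>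
    intro f g hf hg mf mg
    have hm : ∀ f : Config → ℝ, Monotone f → Monotone (Av q e f) := by
      intro f mf ω η h
      unfold Av
      have := mf (upd_mono e true h)
      have := mf (upd_mono e false h)
      nlinarith
    have := ih (Av q e f) (Av q e g) (hf.Av q) (hg.Av q) (hm f mf) (hm g mg)
    rw [integral_Av_dep q e hf, integral_Av_dep q e hg] at this
    refine this.trans ?_
    rw [← integral_Av_dep q e (hf.comp2 hg (fun a b => a * b))]
    refine integral_mono (((hf.Av q).comp2 (hg.Av q) (fun a b => a * b)).integrable _)
      (((hf.comp2 hg (fun a b => a * b)).Av q).integrable _) fun ω => ?_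
    have h1 := mf (upd_false_le_true e ω)
    have h2 := mg (upd_false_le_true e ω)
    simp only [Av]
    nlinarith [mul_nonneg (mul_nonneg hq (sub_nonneg.2 hq')) (mul_nonneg (sub_nonneg.2 h1) (sub_nonneg.2 h2))]

lemma Incr.monotone_ind {A : Set Config} (h : Incr A) : Monotone (ind A) := by
  intro ω η hle
  by_cases h1 : ω ∈ A
  · rw [ind_of_mem h1, ind_of_mem (h ω η (fun e he => by have := hle e; rw [he] at this; exact Bool.eq_true_of_true_le this) h1)]
  · rw [ind_of_notMem h1]; exact ind_nonneg _ _

lemma pr_harris (q : unitInterval) {F : Finset Edge} {A B : Set Config}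
    (hf : Dep (F : Set Edge) (· ∈ A)) (hg : Dep (F : Set Edge) (· ∈ B)) (hA : Incr A) (hB : Incr B) :
    pr q A * pr q B ≤ pr q (A ∩ B) := by
  rw [pr_eq_integral q (hf.measurableSet.inter hg.measurableSet), pr_eq_integral q hf.measurableSet,
    pr_eq_integral q hg.measurableSet]
  refine (harris q F _ _ hf.ind hg.ind hA.monotone_ind hB.monotone_ind).trans (le_of_eq ?_)
  congr 1
  funext ω
  by_cases h1 : ω ∈ A <;> by_cases h2 : ω ∈ B <;> simp [ind, h1, h2]

/-- discrete derivative -/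
def Dd (e : Edge) (f : Config → ℝ) (ω : Config) : ℝ := f (upd e true ω) - f (upd e false ω)

lemma upd_comm {e e' : Edge} (h : e ≠ e') (b b' : Bool) (ω : Config) :
    upd e b (upd e' b' ω) = upd e' b' (upd e b ω) := by
  unfold upd; exact Function.update_comm h _ _ _ |>.symm

theorem efron_stein (q : unitInterval) (F : Finset Edge) : ∀ f : Config → ℝ,
    Dep (F : Set Edge) f →
    (∫ ω, f ω ^ 2 ∂(mu q)) - (∫ ω, f ω ∂(mu q)) ^ 2 ≤
      ∑ e ∈ F, (q * (1 - q)) * ∫ ω, (Dd e f ω) ^ 2 ∂(mu q) := by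
  have hq := q.2.1; have hq' := q.2.2
  induction F using Finset.induction_on with
  | empty =>
    intro f hf
    have h1 := const_of_dep_empty hf
    simp_rw [h1]
    simp
  | insert e F he ih =>
    intro f hf
    have h1 := ih (Av q e f) (hf.Av q)
    rw [integral_Av_dep q e hf] at h1
    rw [Finset.sum_insert he]
    have h2 : ∫ ω, f ω ^ 2 ∂(mu q) = (∫ ω, (Av q e f ω) ^ 2 ∂(mu q))
        + (q * (1 - q)) * ∫ ω, (Dd e f ω) ^ 2 ∂(mu q) := by
      rw [← integral_Av_dep q e (hf.comp (fun a => a ^ 2)), ← integral_const_mul, ← integral_add]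
      · congr 1; funext ω; simp only [Av, Dd]; ring
      · exact ((hf.Av q).comp (fun a => a ^ 2)).integrable _
      · refine Integrable.const_mul ?_ _
        exact ((hf.upd true).comp2 (hf.upd false) (fun a b => (a - b) ^ 2)).integrable _
    have h3 : ∑ e' ∈ F, (q * (1 - q)) * ∫ ω, (Dd e' (Av q e f) ω) ^ 2 ∂(mu q)
        ≤ ∑ e' ∈ F, (q * (1 - q)) * ∫ ω, (Dd e' f ω) ^ 2 ∂(mu q) := by
      refine Finset.sum_le_sum fun e' he' => ?_
      refine mul_le_mul_of_nonneg_left ?_ (mul_nonneg hq (by linarith))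
      have hne : e' ≠ e := fun h => he (h ▸ he')
      have hd : Dep ((insert e F : Finset Edge) : Set Edge) (fun ω => (Dd e' f ω) ^ 2) :=
        (hf.upd' e' true).comp2 (hf.upd' e' false) (fun a b => (a - b) ^ 2)
      have hd' := hf.Av q
      rw [← integral_Av_dep q e hd]
      refine integral_mono ?_ ((hd.Av q).integrable _) fun ω => ?_
      · exact ((hd'.upd' e' true).comp2 (hd'.upd' e' false) (fun a b => (a - b) ^ 2)).integrable _
      · simp only [Av, Dd, upd_comm hne]
        generalize f (upd e true (upd e' true ω)) = a
        generalize f (upd e false (upd e' true ω)) = b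
        generalize f (upd e true (upd e' false ω)) = c
        generalize f (upd e false (upd e' false ω)) = d
        nlinarith [mul_nonneg (mul_nonneg hq (sub_nonneg.2 hq')) (sq_nonneg ((a - c) - (b - d)))]
    linarith

lemma pr_all_true (s : unitInterval) (F : Finset Edge) :
    pr s {η | ∀ e ∈ F, η e = true} = (s : ℝ) ^ F.card := by
  have : {η : Config | ∀ e ∈ F, η e = true} = Set.pi (F : Set Edge) (fun _ => {true}) := by
    ext η; simp [Set.mem_pi]
  unfold pr
  rw [this, measureReal_def, mu, Measure.infinitePi_pi _ (fun _ _ => measurableSet_singleton _)]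
  simp [bern_apply, ENNReal.toReal_ofReal s.2.1]

lemma measurableSet_all_true (F : Finset Edge) :
    MeasurableSet {η : Config | ∀ e ∈ F, η e = true} := by
  refine Dep.measurableSet (F := F) fun η η' h => ?_
  simp only [mem_ofPred_eq, eq_iff_iff]
  exact forall₂_congr fun e he => by rw [h e he]

lemma integrable_ind_cor (q s : unitInterval) {B : Set Config} (hB : MeasurableSet B) :
    Integrable (fun ω => ∫ η, ind B (cor ω η) ∂(mu s)) (mu q) := by
  refine Integrable.of_bound (C := 1) ?_ (ae_of_all _ fun ω => ?_)
  · exact ((measurable_ind hB).comp measurable_cor).stronglyMeasurable.integral_prod_right'.aestronglyMeasurable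
  · rw [Real.norm_eq_abs, abs_of_nonneg (integral_nonneg fun _ => ind_nonneg _ _)]
    calc _ ≤ ∫ η, (1:ℝ) ∂(mu _) := integral_mono_of_nonneg (ae_of_all _ fun _ => ind_nonneg _ _)
          (integrable_const _) (ae_of_all _ fun _ => ind_le_one _ _)
      _ = 1 := by simp

lemma integrable_ind_of {q : unitInterval} {B : Set Config} (hB : MeasurableSet B) :
    Integrable (ind B) (mu q) :=
  Integrable.of_bound (measurable_ind hB).aestronglyMeasurable 1 (ae_of_all _ (ind_abs_le_one B))

lemma measurable_cor_right (ω : Config) : Measurable (fun η => cor ω η) :=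
  measurable_cor.comp (measurable_const.prodMk measurable_id)

theorem sprinkle (q s : unitInterval) (k : ℕ) {A B : Set Config} (hA : MeasurableSet A)
    (hB : MeasurableSet B)
    (h : ∀ ω ∈ A, ∃ F : Finset Edge, F.card ≤ k ∧ ∀ η : Config, (∀ e ∈ F, η e = true) → cor ω η ∈ B) :
    (s : ℝ) ^ k * pr q A ≤ pr (oplus q s) B := by
  have hs := s.2.1; have hs' := s.2.2
  rw [pr_eq_integral _ hA, pr_eq_integral _ hB, integral_oplus _ _ _ (measurable_ind hB)
      (ind_abs_le_one B), ← integral_const_mul]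
  refine integral_mono ((integrable_ind_of hA).const_mul _) (integrable_ind_cor q s hB) fun ω => ?_
  by_cases hω : ω ∈ A
  · obtain ⟨F, hF, hFB⟩ := h ω hω
    simp only [ind_of_mem hω, mul_one]
    calc (s:ℝ) ^ k ≤ (s:ℝ) ^ F.card := pow_le_pow_of_le_one hs hs' hF
      _ = pr s {η | ∀ e ∈ F, η e = true} := (pr_all_true s F).symm
      _ = ∫ η, ind {η | ∀ e ∈ F, η e = true} η ∂(mu s) := pr_eq_integral _ (measurableSet_all_true F)
      _ ≤ ∫ η, ind B (cor ω η) ∂(mu s) := by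
        refine integral_mono (integrable_ind_of (measurableSet_all_true F)) ?_ fun η => ?_
        · exact Integrable.of_bound ((measurable_ind hB).comp (measurable_cor_right ω)).aestronglyMeasurable 1
            (ae_of_all _ fun η => ind_abs_le_one B _)
        · by_cases hη : η ∈ {η : Config | ∀ e ∈ F, η e = true}
          · rw [ind_of_mem hη, ind_of_mem (hFB η hη)]
          · rw [ind_of_notMem hη]; exact ind_nonneg _ _
  · simp only [ind_of_notMem hω, mul_zero]
    exact integral_nonneg fun _ => ind_nonneg _ _

end BP

end



noncomputable section

namespace BP

/-! ### The dual graph -/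

/-- second dual endpoint of the edge `e` (the first one is `e.1`). -/
def dB (e : Edge) : Vert := e.1 - (if e.2 then (1, 0) else (0, 1))

/-- `e` is dual to a step from `a` to `b`. -/
def dstep (e : Edge) (a b : Vert) : Prop := (a = e.1 ∧ b = dB e) ∨ (a = dB e ∧ b = e.1)

lemma dstep_symm {e : Edge} {a b : Vert} (h : dstep e a b) : dstep e b a := by
  unfold dstep at *; tauto

/-- sup-distance -/
def nd (a b : Vert) : ℕ := max (a.1 - b.1).natAbs (a.2 - b.2).natAbs

lemma nd_le {a b : Vert} {k : ℕ} : nd a b ≤ k ↔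
    a.1 - b.1 ≤ k ∧ b.1 - a.1 ≤ k ∧ a.2 - b.2 ≤ k ∧ b.2 - a.2 ≤ k := by
  unfold nd; omega

lemma nd_self (a : Vert) : nd a a = 0 := by unfold nd; omega
lemma nd_comm (a b : Vert) : nd a b = nd b a := by unfold nd; omega
lemma nd_tri (a b c : Vert) : nd a c ≤ nd a b + nd b c := by unfold nd; omega

lemma nd_eq_zero {a b : Vert} (h : nd a b = 0) : a = b := by
  ext <;> (unfold nd at h; omega)

lemma dB_true (x : Vert) : dB (x, true) = (x.1 - 1, x.2) := by ext <;> simp [dB]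
lemma dB_false (x : Vert) : dB (x, false) = (x.1, x.2 - 1) := by ext <;> simp [dB]

lemma nd_dB (e : Edge) : nd e.1 (dB e) = 1 := by
  obtain ⟨x, b⟩ := e
  cases b <;> simp [dB_true, dB_false, nd]

lemma dstep_nd {e : Edge} {a b : Vert} (h : dstep e a b) : nd a b = 1 := by
  rcases h with ⟨rfl, rfl⟩ | ⟨rfl, rfl⟩
  · exact nd_dB e
  · rw [nd_comm]; exact nd_dB e

/-- box of radius `m` around `c`. -/
def box (c : Vert) (m : ℕ) : Finset Vert :=
  Finset.Icc (c.1 - m) (c.1 + m) ×ˢ Finset.Icc (c.2 - m) (c.2 + m)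

lemma mem_box {c x : Vert} {m : ℕ} : x ∈ box c m ↔ nd c x ≤ m := by
  unfold box
  rw [Finset.mem_product, Finset.mem_Icc, Finset.mem_Icc, nd_le]; omega

lemma card_box (c : Vert) (m : ℕ) : (box c m).card = (2 * m + 1) ^ 2 := by
  unfold box
  rw [Finset.card_product, Int.card_Icc, Int.card_Icc, sq]
  congr 1 <;> omega

/-- occupied step inside `S` -/
def st (η : Config) (S : Set Vert) (x y : Vert) : Prop :=
  x ∈ S ∧ y ∈ S ∧ ∃ e, η e = true ∧ dstep e x y

/-- connection inside `S` -/
def cn (η : Config) (S : Set Vert) (a b : Vert) : Prop := Relation.ReflTransGen (st η S) a b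

lemma st_symm {η : Config} {S : Set Vert} {x y : Vert} (h : st η S x y) : st η S y x := by
  obtain ⟨h1, h2, e, he, hs⟩ := h
  exact ⟨h2, h1, e, he, dstep_symm hs⟩

lemma cn_symm {η : Config} {S : Set Vert} {x y : Vert} (h : cn η S x y) : cn η S y x := by
  induction h with
  | refl => exact Relation.ReflTransGen.refl
  | tail _ hbc ih => exact Relation.ReflTransGen.head (st_symm hbc) ih

lemma cn_trans {η : Config} {S : Set Vert} {x y z : Vert} (h : cn η S x y) (h' : cn η S y z) :
    cn η S x z := Relation.ReflTransGen.trans h h'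

lemma cn_refl {η : Config} {S : Set Vert} {x : Vert} : cn η S x x := Relation.ReflTransGen.refl

lemma cn_mono {η η' : Config} {S S' : Set Vert} {x y : Vert} (h : cn η S x y)
    (h1 : ∀ e, η e = true → η' e = true) (h2 : S ⊆ S') : cn η' S' x y := by
  refine Relation.ReflTransGen.mono (fun a b => ?_) _ _ h
  rintro ⟨ha, hb, e, he, hs⟩
  exact ⟨h2 ha, h2 hb, e, h1 e he, hs⟩

lemma cn_mem {η : Config} {S : Set Vert} {x y : Vert} (h : cn η S x y) (hx : x ∈ S) : y ∈ S := by
  rcases Relation.ReflTransGen.cases_tail h with h | ⟨c, _, hc⟩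
  · rw [h]; exact hx
  · exact hc.2.1

/-- dependence in a strong form -/
lemma cn_congr {η η' : Config} {S : Set Vert} {x y : Vert} (h : cn η S x y)
    (h1 : ∀ e, e.1 ∈ S → dB e ∈ S → η e = η' e) : cn η' S x y := by
  refine Relation.ReflTransGen.mono (fun a b => ?_) _ _ h
  rintro ⟨ha, hb, e, he, hs⟩
  refine ⟨ha, hb, e, ?_, hs⟩
  rw [← h1 e _ _, he]
  · rcases hs with ⟨rfl, rfl⟩ | ⟨rfl, rfl⟩ <;> assumption
  · rcases hs with ⟨rfl, rfl⟩ | ⟨rfl, rfl⟩ <;> assumption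

/-- exit lemma -/
lemma cn_exit {η : Config} {S U : Set Vert} {a b : Vert} (h : cn η S a b) (ha : a ∈ U) :
    cn η (S ∩ U) a b ∧ b ∈ U ∨ ∃ x y, x ∈ U ∧ y ∉ U ∧ cn η (S ∩ U) a x ∧ st η S x y ∧ cn η S y b := by
  induction h with
  | refl => exact Or.inl ⟨cn_refl, ha⟩
  | tail hab hbc ih =>
    rename_i b c
    rcases ih with ⟨h1, h2⟩ | ⟨x, y, hx, hy, hax, hxy, hyb⟩
    · by_cases hc : c ∈ U
      · left
        exact ⟨h1.tail ⟨⟨hbc.1, h2⟩, ⟨hbc.2.1, hc⟩, hbc.2.2⟩, hc⟩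
      · right
        exact ⟨b, c, h2, hc, h1, hbc, cn_refl⟩
    · right
      exact ⟨x, y, hx, hy, hax, hxy, Relation.ReflTransGen.tail hyb hbc⟩

lemma cn_map {η : Config} {S : Set Vert} {x y : Vert} (τ : Edge → Edge) (σ : Vert → Vert)
    (hτ : ∀ e x y, dstep e x y → dstep (τ e) (σ x) (σ y))
    (h : cn (fun e => η (τ e)) S x y) : cn η (Set.image σ S) (σ x) (σ y) := by
  refine Relation.ReflTransGen.lift σ (fun a b => ?_) _ _ h
  rintro ⟨ha, hb, e, he, hs⟩
  exact ⟨mem_image_of_mem _ ha, mem_image_of_mem _ hb, τ e, he, hτ e _ _ hs⟩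

/-- edges with both dual endpoints in `S` -/
def ev (S : Finset Vert) : Finset Edge := (S ×ˢ Finset.univ).filter (fun e => dB e ∈ S)

lemma mem_ev {S : Finset Vert} {e : Edge} : e ∈ ev S ↔ e.1 ∈ S ∧ dB e ∈ S := by
  simp [ev]

lemma dep_cn (S : Finset Vert) (a b : Vert) : Dep (ev S : Set Edge) (fun η => cn η (S : Set Vert) a b) := by
  intro η η' h
  have h1 : ∀ e : Edge, e.1 ∈ (S : Set Vert) → dB e ∈ (S : Set Vert) → η e = η' e :=
    fun e h1 h2 => h e (mem_ev.2 ⟨h1, h2⟩)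
  exact propext ⟨fun hh => cn_congr hh h1, fun hh => cn_congr hh fun e he he' => (h1 e he he').symm⟩

/-- one-arm event -/
def Arm (a : Vert) (n : ℕ) : Set Config := {η | ∃ b, n ≤ nd a b ∧ cn η (box a n : Set Vert) a b}

lemma dep_exists {ι : Sort*} {α : ι → Config → Prop} {F : Set Edge} (h : ∀ i, Dep F (α i)) :
    Dep F (fun ω => ∃ i, α i ω) := by
  intro η η' hh
  have : ∀ i, α i η = α i η' := fun i => h i η η' hh
  simp only [this]

lemma dep_and {α β : Config → Prop} {F : Set Edge} (h : Dep F α) (h' : Dep F β) :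
    Dep F (fun ω => α ω ∧ β ω) := h.comp2 h' (fun a b => a ∧ b)

lemma dep_const {α : Sort*} (c : α) (F : Set Edge) : Dep F (fun _ => c) := fun _ _ _ => rfl

lemma dep_arm (a : Vert) (n : ℕ) : Dep (ev (box a n) : Set Edge) (· ∈ Arm a n) :=
  dep_exists fun b => dep_and (dep_const _ _) (dep_cn _ a b)

lemma incr_arm (a : Vert) (n : ℕ) : Incr (Arm a n) := by
  rintro ω η h ⟨b, hb, hc⟩
  exact ⟨b, hb, cn_mono hc h subset_rfl⟩

lemma measurable_arm (a : Vert) (n : ℕ) : MeasurableSet (Arm a n) := (dep_arm a n).measurableSet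

lemma arm_of_cn {η : Config} {S : Set Vert} {a b : Vert} {n : ℕ} (h : cn η S a b) (hn : n ≤ nd a b) :
    ∃ b, n ≤ nd a b ∧ cn η (S ∩ (box a n : Set Vert)) a b := by
  rcases cn_exit (U := (box a n : Set Vert)) h (by simp [mem_box, nd_self]) with ⟨h1, h2⟩ | ⟨x, y, hx, hy, h1, h2, h3⟩
  · exact ⟨b, hn, h1⟩
  · -- x in the box, y outside
    obtain ⟨e, he, hs⟩ := h2.2.2
    have := dstep_nd hs
    have h4 : ¬ nd a y ≤ n := by simpa [mem_box] using hy
    have := nd_tri a x y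
    exact ⟨x, by omega, h1⟩

lemma arm_mem_of_cn {η : Config} {S : Set Vert} {a b : Vert} {n : ℕ} (h : cn η S a b) (hn : n ≤ nd a b) :
    η ∈ Arm a n := by
  obtain ⟨b, h1, h2⟩ := arm_of_cn h hn
  exact ⟨b, h1, cn_mono h2 (fun _ h => h) inter_subset_right⟩

/-- translation of edges -/
def tre (a : Vert) (e : Edge) : Edge := (e.1 + a, e.2)

lemma tre_inj (a : Vert) : Function.Injective (tre a) := by
  rintro ⟨x, b⟩ ⟨y, c⟩ h
  simp only [tre, Prod.mk.injEq] at h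
  ext1
  · simpa using h.1
  · exact h.2

lemma tre_dstep (a : Vert) (e : Edge) (x y : Vert) (h : dstep e x y) :
    dstep (tre a e) (x + a) (y + a) := by
  have : dB (tre a e) = dB e + a := by simp only [dB, tre]; abel
  unfold dstep at *
  rw [this]
  rcases h with ⟨rfl, rfl⟩ | ⟨rfl, rfl⟩ <;> simp [tre]

lemma nd_add (a x y : Vert) : nd (x + a) (y + a) = nd x y := by
  simp [nd]

lemma arm_tre {a c : Vert} {n : ℕ} {η : Config} (h : (fun e => η (tre a e)) ∈ Arm c n) :
    η ∈ Arm (c + a) n := by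
  obtain ⟨b, hb, hc⟩ := h
  have := cn_map (tre a) (· + a) (tre_dstep a) hc
  exact arm_mem_of_cn this (by rwa [nd_add])

lemma pr_arm_tre (q : unitInterval) (a c : Vert) (n : ℕ) : pr q (Arm (c + a) n) = pr q (Arm c n) := by
  rw [← pr_reindex q (tre a) (tre_inj a) (measurable_arm c n)]
  congr 1
  ext η
  constructor
  · intro h
    have : (fun e => η (tre a (tre (-a) e))) ∈ Arm (c + a) n := by simpa [tre] using h
    have := arm_tre (η := fun e => η (tre a e)) this
    simpa using this
  · intro h; exact arm_tre h

/-- one-arm probability -/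
def th (q : unitInterval) (n : ℕ) : ℝ := pr q (Arm 0 n)

lemma pr_arm (q : unitInterval) (a : Vert) (n : ℕ) : pr q (Arm a n) = th q n := by
  have := pr_arm_tre q a 0 n
  rwa [zero_add] at this

lemma arm_anti {a : Vert} {n m : ℕ} (h : n ≤ m) : Arm a m ⊆ Arm a n := by
  rintro η ⟨b, hb, hc⟩
  exact arm_mem_of_cn hc (h.trans hb)

lemma th_anti (q : unitInterval) {n m : ℕ} (h : n ≤ m) : th q m ≤ th q n := pr_mono q (arm_anti h)

/-! ### The Duminil-Copin–Tassion dichotomy -/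

/-- edges with exactly one endpoint in `S` -/
def bd (S : Finset Vert) : Finset Edge :=
  (S.biUnion fun x => {(x, true), (x, false), (x + (1, 0), true), (x + (0, 1), false)}).filter
    (fun e => ¬ (e.1 ∈ S ∧ dB e ∈ S))

lemma mem_bd {S : Finset Vert} {e : Edge} :
    e ∈ bd S ↔ (e.1 ∈ S ∧ dB e ∉ S) ∨ (e.1 ∉ S ∧ dB e ∈ S) := by
  obtain ⟨⟨x1, x2⟩, b⟩ := e
  simp only [bd, Finset.mem_filter, Finset.mem_biUnion, Finset.mem_insert, Finset.mem_singleton]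
  constructor
  · rintro ⟨⟨x, hx, h⟩, h2⟩
    rcases h with h | h | h | h
    · rw [Prod.mk.injEq] at h; rw [h.1] at h2 ⊢; tauto
    · rw [Prod.mk.injEq] at h; rw [h.1] at h2 ⊢; tauto
    · rw [Prod.mk.injEq] at h; obtain ⟨h, rfl⟩ := h
      have : dB ((x1, x2), true) = x := by rw [h, dB_true]; ext <;> simp
      rw [this] at h2 ⊢; tauto
    · rw [Prod.mk.injEq] at h; obtain ⟨h, rfl⟩ := h
      have : dB ((x1, x2), false) = x := by rw [h, dB_false]; ext <;> simp
      rw [this] at h2 ⊢; tauto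
  · rintro (h | h)
    · refine ⟨⟨(x1, x2), h.1, ?_⟩, by tauto⟩
      cases b <;> simp
    · refine ⟨⟨_, h.2, ?_⟩, by tauto⟩
      cases b
      · rw [dB_false]; simp
      · rw [dB_true]; simp

/-- endpoint in `S` -/
def inn (S : Finset Vert) (e : Edge) : Vert := if e.1 ∈ S then e.1 else dB e
/-- endpoint not in `S` -/
def out (S : Finset Vert) (e : Edge) : Vert := if e.1 ∈ S then dB e else e.1

lemma inn_mem {S : Finset Vert} {e : Edge} (h : e ∈ bd S) : inn S e ∈ S := by
  rw [mem_bd] at h; unfold inn; split_ifs <;> tauto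
lemma out_notMem {S : Finset Vert} {e : Edge} (h : e ∈ bd S) : out S e ∉ S := by
  rw [mem_bd] at h; unfold out; split_ifs <;> tauto
lemma dstep_inn_out (S : Finset Vert) (e : Edge) : dstep e (inn S e) (out S e) := by
  unfold dstep inn out; split_ifs <;> tauto

lemma bd_of_dstep {S : Finset Vert} {e : Edge} {x y : Vert} (h : dstep e x y) (hx : x ∈ S) (hy : y ∉ S) :
    e ∈ bd S ∧ inn S e = x ∧ out S e = y := by
  rcases h with ⟨rfl, rfl⟩ | ⟨rfl, rfl⟩
  · exact ⟨mem_bd.2 (Or.inl ⟨hx, hy⟩), by simp [inn, hx], by simp [out, hx]⟩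
  · exact ⟨mem_bd.2 (Or.inr ⟨hy, hx⟩), by simp [inn, hy], by simp [out, hy]⟩

/-- the functional `φ_q(S)` -/
def phi (q : unitInterval) (S : Finset Vert) : ℝ :=
  ∑ e ∈ bd S, q * pr q {η | cn η (S : Set Vert) 0 (inn S e)}

/-- cluster of the origin in `S` -/
def clu (S : Finset Vert) (η : Config) : Finset Vert := by
  classical exact S.filter (fun x => cn η (S : Set Vert) 0 x)

lemma mem_clu {S : Finset Vert} {η : Config} {x : Vert} :
    x ∈ clu S η ↔ x ∈ S ∧ cn η (S : Set Vert) 0 x := by simp [clu]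

lemma clu_aux {S C : Finset Vert} {η η' : Config} (h0 : (0 : Vert) ∈ S)
    (h : ∀ e ∈ (ev S).filter (fun e => e.1 ∈ C ∨ dB e ∈ C), η e = η' e) (hC : clu S η = C) :
    clu S η' = C := by
  have hagree : ∀ e x y, x ∈ S → y ∈ S → x ∈ C → dstep e x y → η e = η' e := by
    intro e x y hx hy hxC hs
    refine h e ?_
    rw [Finset.mem_filter, mem_ev]
    rcases hs with ⟨rfl, rfl⟩ | ⟨rfl, rfl⟩ <;> tauto
  have h0C : (0 : Vert) ∈ C := hC ▸ mem_clu.2 ⟨h0, cn_refl⟩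
  ext x
  constructor
  · intro hx
    obtain ⟨hxS, hx⟩ := mem_clu.1 hx
    rcases cn_exit (U := (C : Set Vert)) hx h0C with ⟨_, h2⟩ | ⟨y, z, hy, hz, _, ⟨hyS, hzS, e, he, hs⟩, _⟩
    · exact h2
    · exfalso
      have hy' : y ∈ clu S η := hC ▸ hy
      refine hz ?_
      have : z ∈ clu S η := mem_clu.2 ⟨hzS, (mem_clu.1 hy').2.tail ⟨hyS, hzS, e, ?_, hs⟩⟩
      · exact hC ▸ this
      · rw [hagree e y z hyS hzS hy hs]; exact he
  · intro hx
    rw [← hC] at hx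
    obtain ⟨hxS, hx2⟩ := mem_clu.1 hx
    refine mem_clu.2 ⟨hxS, ?_⟩
    clear hxS hx
    induction hx2 with
    | refl => exact cn_refl
    | tail hab hbc ih =>
      rename_i b c
      obtain ⟨hb, hc, e, he, hs⟩ := hbc
      have hbC : b ∈ C := hC ▸ mem_clu.2 ⟨hb, hab⟩
      exact Relation.ReflTransGen.tail ih ⟨hb, hc, e, (hagree e b c hb hc hbC hs) ▸ he, hs⟩

lemma dep_clu {S C : Finset Vert} (h0 : (0 : Vert) ∈ S) :
    Dep ((ev S).filter (fun e => e.1 ∈ C ∨ dB e ∈ C) : Set Edge) (fun η => clu S η = C) := by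
  intro η η' h
  have h' : ∀ e ∈ (ev S).filter (fun e => e.1 ∈ C ∨ dB e ∈ C), η e = η' e := fun e he => h e (by simpa using he)
  exact propext ⟨clu_aux h0 h', clu_aux h0 fun e he => (h' e he).symm⟩

end BP

end



noncomputable section

namespace BP

lemma pr_sum_eq {β : Type*} (q : unitInterval) (T : Finset β) (X : Config → β)
    (hX : ∀ c, MeasurableSet {ω | X ω = c}) (hT : ∀ ω, X ω ∈ T) (p : β → Prop) [DecidablePred p] :
    ∑ c ∈ T.filter p, pr q {ω | X ω = c} = pr q {ω | p (X ω)} := by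
  have : {ω | p (X ω)} = ⋃ c ∈ T.filter p, {ω | X ω = c} := by
    ext ω
    simp only [mem_ofPred_eq, mem_iUnion, Finset.mem_filter, exists_prop]
    constructor
    · intro h; exact ⟨X ω, ⟨hT ω, h⟩, rfl⟩
    · rintro ⟨c, ⟨_, hc⟩, rfl⟩; exact hc
  rw [this]
  unfold pr
  rw [measureReal_biUnion_finset]
  · intro c _ d _ hcd
    rw [Function.onFun, Set.disjoint_left]
    intro ω (h1 : X ω = c) (h2 : X ω = d)
    exact hcd (h1.symm.trans h2)
  · intro c _; exact hX c

lemma dep_edge (e : Edge) : Dep (({e} : Finset Edge) : Set Edge) (fun η => η e = true) := by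
  intro η η' h
  show (η e = true) = (η' e = true)
  rw [h e (by simp)]

lemma pr_edge (q : unitInterval) (e : Edge) : pr q {η | η e = true} = q := by
  have := pr_all_true q {e}
  simpa using this

lemma th_step (q : unitInterval) (S : Finset Vert) (L n : ℕ) (h0 : (0 : Vert) ∈ S)
    (hL : ∀ x ∈ S, nd 0 x + 1 ≤ L) : th q (n + L) ≤ phi q S * th q n := by
  classical
  let AO : Vert → Finset Vert → Set Config := fun y C =>
    {η | ∃ b, n ≤ nd y b ∧ cn η ((box y n \ C : Finset Vert) : Set Vert) y b}
  have dAO : ∀ y C, Dep (ev (box y n \ C) : Set Edge) (· ∈ AO y C) := fun y C =>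
    dep_exists fun b => dep_and (dep_const _ _) (dep_cn _ y b)
  have sub : Arm 0 (n + L) ⊆ ⋃ C ∈ S.powerset, ⋃ e ∈ (bd S).filter (fun e => inn S e ∈ C),
      ({η | clu S η = C} ∩ ({η | η e = true} ∩ AO (out S e) C)) := by
    rintro η ⟨b, hb, hc⟩
    have hb0 : b ∉ clu S η := fun h => by
      have := hL b (mem_clu.1 h).1
      omega
    have h0c : (0 : Vert) ∈ clu S η := mem_clu.2 ⟨h0, cn_refl⟩
    rcases cn_exit (U := ((clu S η : Finset Vert) : Set Vert)ᶜ) (cn_symm hc) (by simpa using hb0) with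
      ⟨_, h⟩ | ⟨y, x, hy, hx, hby, ⟨_, _, e, he, hs⟩, _⟩
    · exact absurd h0c (by simpa using h)
    · have hx' : x ∈ clu S η := by simpa using hx
      have hy' : y ∉ clu S η := by simpa using hy
      have hyS : y ∉ S := by
        intro hyS
        obtain ⟨hxS, hxc⟩ := mem_clu.1 hx'
        exact hy' (mem_clu.2 ⟨hyS, hxc.tail ⟨hxS, hyS, e, he, dstep_symm hs⟩⟩)
      obtain ⟨he1, he2, he3⟩ := bd_of_dstep (dstep_symm hs) (mem_clu.1 hx').1 hyS
      simp only [mem_iUnion]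
      refine ⟨clu S η, Finset.mem_powerset.2 (fun z hz => (mem_clu.1 hz).1), e,
        Finset.mem_filter.2 ⟨he1, he2 ▸ hx'⟩, rfl, he, ?_⟩
      rw [he3]
      have hn : n ≤ nd y b := by
        have h1 := hL x (mem_clu.1 hx').1
        have h2 := dstep_nd hs
        have h3 := nd_tri 0 x y
        have h4 := nd_tri 0 y b
        rw [nd_comm x y] at h3
        omega
      obtain ⟨b', hb', hc'⟩ := arm_of_cn (cn_symm hby) hn
      refine ⟨b', hb', cn_mono hc' (fun _ h => h) ?_⟩
      intro z hz
      simp only [Finset.coe_sdiff, mem_diff]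
      exact ⟨hz.2, hz.1.2⟩
  have hmeas : ∀ C, MeasurableSet {η | clu S η = C} := by
    intro C
    have := dep_clu (C := C) h0
    exact Dep.measurableSet this
  calc th q (n + L) ≤ ∑ C ∈ S.powerset, ∑ e ∈ (bd S).filter (fun e => inn S e ∈ C),
        pr q ({η | clu S η = C} ∩ ({η | η e = true} ∩ AO (out S e) C)) := by
        refine (pr_mono q sub).trans ((pr_biUnion_le q _ _).trans ?_)
        exact Finset.sum_le_sum fun C _ => pr_biUnion_le q _ _
    _ ≤ ∑ C ∈ S.powerset, ∑ e ∈ (bd S).filter (fun e => inn S e ∈ C),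
        pr q {η | clu S η = C} * (q * th q n) := by
        refine Finset.sum_le_sum fun C _ => Finset.sum_le_sum fun e he => ?_
        obtain ⟨he1, he2⟩ := Finset.mem_filter.1 he
        have ho := out_notMem he1
        have hs := dstep_inn_out S e
        have hin := inn_mem he1
        have hend : (e.1 ∈ C ∨ dB e ∈ C) ∧ ¬ (e.1 ∈ S ∧ dB e ∈ S) := by
          rcases hs with ⟨h1, h2⟩ | ⟨h1, h2⟩ <;> rw [← h1, ← h2] <;> tauto
        have d1 : Dep (({e} ∪ ev (box (out S e) n \ C) : Finset Edge) : Set Edge)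
            (· ∈ {η : Config | η e = true} ∩ AO (out S e) C) := by
          refine dep_and ((dep_edge e).mono ?_) ((dAO _ C).mono ?_) <;> intro z hz <;> simp at hz ⊢ <;> tauto
        have d2 := dep_clu (C := C) h0
        rw [pr_inter_dep q (A := {η | clu S η = C}) d2 d1, pr_inter_dep q (A := {η | η e = true}) (dep_edge e) (dAO _ C)]
        · refine mul_le_mul_of_nonneg_left ?_ (pr_nonneg _ _)
          have h1 : pr q {ω | ω ∈ {η : Config | η e = true}} = q := pr_edge q e
          change pr q {η : Config | η e = true} * _ ≤ _
          rw [pr_edge]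
          refine mul_le_mul_of_nonneg_left ?_ q.2.1
          rw [← pr_arm q (out S e) n]
          refine pr_mono q ?_
          rintro η ⟨b, hb, hc⟩
          exact arm_mem_of_cn hc hb
        · rw [Finset.disjoint_left]
          intro z hz hz2
          rw [Finset.mem_singleton] at hz
          subst hz
          rw [mem_ev, Finset.mem_sdiff, Finset.mem_sdiff] at hz2
          tauto
        · rw [Finset.disjoint_left]
          intro z hz hz2
          rw [Finset.mem_filter, mem_ev] at hz
          rw [Finset.mem_union, Finset.mem_singleton, mem_ev, Finset.mem_sdiff, Finset.mem_sdiff] at hz2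
          rcases hz2 with rfl | hz2 <;> tauto
    _ = phi q S * th q n := by
        simp_rw [Finset.sum_filter]
        rw [Finset.sum_comm]
        unfold phi
        rw [Finset.sum_mul]
        refine Finset.sum_congr rfl fun e he => ?_
        rw [← Finset.sum_filter, ← Finset.sum_mul, pr_sum_eq q S.powerset (clu S) hmeas
          (fun ω => Finset.mem_powerset.2 (fun z hz => (mem_clu.1 hz).1)) (fun C => inn S e ∈ C)]
        have : {ω | inn S e ∈ clu S ω} = {η | cn η (S : Set Vert) 0 (inn S e)} := by
          ext ω
          simp [mem_clu, inn_mem he]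
        rw [this]; ring

/-- vertices of the box not connected to distance `n` -/
def nc (n : ℕ) (η : Config) : Finset Vert := by
  classical exact (box 0 n).filter (fun x => ¬ ∃ b, n ≤ nd 0 b ∧ b ∈ box 0 n ∧ cn η (box 0 n : Set Vert) x b)

lemma mem_nc {n : ℕ} {η : Config} {x : Vert} : x ∈ nc n η ↔ x ∈ box 0 n ∧
    ¬ ∃ b, n ≤ nd 0 b ∧ b ∈ box 0 n ∧ cn η (box 0 n : Set Vert) x b := by simp [nc]

lemma nc_aux {n : ℕ} {S : Finset Vert} {η η' : Config}
    (h : ∀ e ∈ (ev (box 0 n)).filter (fun e => ¬ (e.1 ∈ S ∧ dB e ∈ S)), η e = η' e) (hC : nc n η = S) :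
    nc n η' = S := by
  have hagree : ∀ e x y, x ∈ box 0 n → y ∈ box 0 n → y ∉ S → dstep e x y → η e = η' e := by
    intro e x y hx hy hxC hs
    refine h e ?_
    rw [Finset.mem_filter, mem_ev]
    rcases hs with ⟨rfl, rfl⟩ | ⟨rfl, rfl⟩ <;> tauto
  have key : ∀ x ∈ box 0 n, x ∉ S → ∃ b, n ≤ nd 0 b ∧ b ∈ box 0 n ∧ cn η (box 0 n : Set Vert) x b := by
    intro x hx hxS
    by_contra hcon
    exact hxS (hC ▸ mem_nc.2 ⟨hx, hcon⟩)
  ext x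
  constructor
  · intro hx
    obtain ⟨hxB, hx2⟩ := mem_nc.1 hx
    by_contra hxS
    obtain ⟨b, hb, hbB, hc⟩ := key x hxB hxS
    refine hx2 ⟨b, hb, hbB, ?_⟩
    clear hx2 hx hxB hxS
    induction hc using Relation.ReflTransGen.head_induction_on with
    | refl => exact cn_refl
    | head hac hcb ih =>
      rename_i a c
      obtain ⟨ha, hc, e, he, hs⟩ := hac
      have hcS : c ∉ S := fun hcS => by
        rw [← hC] at hcS
        exact (mem_nc.1 hcS).2 ⟨b, hb, hbB, hcb⟩
      exact Relation.ReflTransGen.head ⟨ha, hc, e, (hagree e a c ha hc hcS hs) ▸ he, hs⟩ ih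
  · intro hx
    have hxB : x ∈ box 0 n := by rw [← hC] at hx; exact (mem_nc.1 hx).1
    refine mem_nc.2 ⟨hxB, ?_⟩
    rintro ⟨b, hb, hbB, hc⟩
    have hbS : b ∉ S := fun hbS => by
      rw [← hC] at hbS
      exact (mem_nc.1 hbS).2 ⟨b, hb, hbB, cn_refl⟩
    rcases cn_exit (U := (S : Set Vert)) hc hx with ⟨_, h2⟩ | ⟨y, z, hy, hz, _, ⟨hyB, hzB, e, he, hs⟩, _⟩
    · exact hbS h2
    · obtain ⟨b', hb', hbB', hc'⟩ := key z hzB hz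
      have hy' : y ∈ nc n η := hC ▸ hy
      refine (mem_nc.1 hy').2 ⟨b', hb', hbB', Relation.ReflTransGen.head ⟨hyB, hzB, e, ?_, hs⟩ hc'⟩
      rw [hagree e y z hyB hzB hz hs]; exact he

lemma dep_nc {n : ℕ} {S : Finset Vert} :
    Dep ((ev (box 0 n)).filter (fun e => ¬ (e.1 ∈ S ∧ dB e ∈ S)) : Finset Edge) (fun η => nc n η = S) := by
  intro η η' h
  exact propext ⟨nc_aux h, nc_aux fun e he => (h e he).symm⟩

lemma arm_iff_nc {n : ℕ} {η : Config} : η ∈ Arm 0 n ↔ (0 : Vert) ∉ nc n η := by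
  rw [mem_nc]
  have h0 : (0 : Vert) ∈ box 0 n := by rw [mem_box, nd_self]; omega
  constructor
  · rintro ⟨b, hb, hc⟩ h
    exact h.2 ⟨b, hb, cn_mem hc h0, hc⟩
  · intro h
    simp only [h0, true_and, not_not] at h
    obtain ⟨b, hb, _, hc⟩ := h
    exact ⟨b, hb, hc⟩

/-- closed pivotal-type edges -/
def piv (n : ℕ) (η : Config) : Finset Edge := by
  classical exact (ev (box 0 n)).filter (fun e => ∀ η', (∀ e, η e = true → η' e = true) → η' e = true → η' ∈ Arm 0 n)

lemma bern_ineq (s : ℝ) (h0 : 0 ≤ s) (h1 : s ≤ 1) (k : ℕ) : (1 - s) ^ k ≤ 1 - s * k + s ^ 2 * k ^ 2 := by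
  induction k with
  | zero => simp
  | succ k ih =>
    rw [pow_succ]
    push_cast
    have hk : (0:ℝ) ≤ k := Nat.cast_nonneg k
    calc (1 - s) ^ k * (1 - s) ≤ (1 - s * k + s ^ 2 * k ^ 2) * (1 - s) :=
          mul_le_mul_of_nonneg_right ih (by linarith)
      _ ≤ _ := by
        nlinarith [mul_nonneg (mul_nonneg h0 h0) hk, mul_nonneg (mul_nonneg h0 (mul_nonneg h0 h0)) (mul_nonneg hk hk), sq_nonneg s]

lemma dep_piv (n : ℕ) : Dep (ev (box 0 n) : Set Edge) (piv n) := by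
  have key : ∀ η η' : Config, (∀ e ∈ (ev (box 0 n) : Set Edge), η e = η' e) → ∀ e ∈ ev (box 0 n),
      (∀ ζ, (∀ e, η e = true → ζ e = true) → ζ e = true → ζ ∈ Arm 0 n) →
      (∀ ζ, (∀ e, η' e = true → ζ e = true) → ζ e = true → ζ ∈ Arm 0 n) := by
    intro η η' h e he hh ζ h1 h2
    have : (cor η ζ ∈ Arm 0 n) = (ζ ∈ Arm 0 n) := dep_arm 0 n _ _ (fun e' he' => by
      simp only [cor]
      cases h3 : η e'
      · simp
      · simp [h1 e' (h e' he' ▸ h3)])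
    rw [← this]
    exact hh _ (fun e he => by simp [cor, he]) (by simp [cor, h2])
  intro η η' h
  ext e
  simp only [piv, Finset.mem_filter]
  exact ⟨fun ⟨h1, h2⟩ => ⟨h1, key η η' h e h1 h2⟩,
    fun ⟨h1, h2⟩ => ⟨h1, key η' η (fun e he => (h e he).symm) e h1 h2⟩⟩

lemma pr_none_true (s : unitInterval) (F : Finset Edge) :
    pr s {η | ∀ e ∈ F, η e = false} = (1 - (s : ℝ)) ^ F.card := by
  have : {η : Config | ∀ e ∈ F, η e = false} = Set.pi (F : Set Edge) (fun _ => {false}) := by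
    ext η; simp [Set.mem_pi]
  unfold pr
  rw [this, measureReal_def, mu, Measure.infinitePi_pi _ (fun _ _ => measurableSet_singleton _)]
  simp [bern_apply, ENNReal.toReal_ofReal (sub_nonneg.2 s.2.2)]

lemma measurableSet_none_true (F : Finset Edge) :
    MeasurableSet {η : Config | ∀ e ∈ F, η e = false} := by
  refine Dep.measurableSet (F := F) fun η η' h => ?_
  simp only [mem_ofPred_eq, eq_iff_iff]
  exact forall₂_congr fun e he => by rw [h e he]

lemma th_grow1 (q s : unitInterval) (n : ℕ) :
    th q n + s * (∫ ω, (1 - ind (Arm 0 n) ω) * ((piv n ω).card : ℝ) ∂(mu q))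
      - s ^ 2 * (ev (box 0 n)).card ^ 2 ≤ th (oplus q s) n := by
  classical
  have hA := measurable_arm 0 n
  have hs := s.2.1; have hs' := s.2.2
  unfold th
  rw [pr_eq_integral _ hA, pr_eq_integral _ hA, integral_oplus _ _ _ (measurable_ind hA)
    (ind_abs_le_one _)]
  have d1 : Dep (ev (box 0 n) : Set Edge) (fun ω => (1 - ind (Arm 0 n) ω) * ((piv n ω).card : ℝ)) :=
    (dep_arm 0 n).ind.comp2 (dep_piv n) (fun a b => (1 - a) * (b.card : ℝ))
  rw [← integral_const_mul, ← integral_add (integrable_ind_of hA) ((d1.integrable _).const_mul _)]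
  have : (s:ℝ) ^ 2 * (ev (box 0 n)).card ^ 2 = ∫ ω, (s:ℝ) ^ 2 * (ev (box 0 n)).card ^ 2 ∂(mu q) := by simp
  have hI : Integrable (fun ω => ind (Arm 0 n) ω + s * ((1 - ind (Arm 0 n) ω) * ((piv n ω).card : ℝ))) (mu q) :=
    (integrable_ind_of hA).add ((d1.integrable _).const_mul _)
  rw [this, ← integral_sub hI (integrable_const _)]
  refine integral_mono (hI.sub (integrable_const _))
    (integrable_ind_cor q s hA) fun ω => ?_
  by_cases hω : ω ∈ Arm 0 n
  · have : ∀ η, ind (Arm 0 n) (cor ω η) = 1 := fun η =>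
      ind_of_mem (incr_arm 0 n ω _ (fun e he => by simp [cor, he]) hω)
    simp only [this, ind_of_mem hω, sub_self, zero_mul, mul_zero, add_zero, integral_const, probReal_univ,
      smul_eq_mul, mul_one]
    have : 0 ≤ (s:ℝ) ^ 2 * ((ev (box 0 n)).card : ℝ) ^ 2 := by positivity
    linarith
  · simp only [ind_of_notMem hω, sub_zero, one_mul, zero_add]
    set k := (piv n ω).card with hk
    have hkM : (k:ℝ) ≤ (ev (box 0 n)).card := by
      rw [hk]; exact_mod_cast Finset.card_le_card (Finset.filter_subset _ _)
    calc (s:ℝ) * k - s ^ 2 * ((ev (box 0 n)).card : ℝ) ^ 2 ≤ s * k - s ^ 2 * k ^ 2 := by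
          have : (k:ℝ) ^ 2 ≤ ((ev (box 0 n)).card : ℝ) ^ 2 := pow_le_pow_left₀ (Nat.cast_nonneg _) hkM 2
          nlinarith [sq_nonneg (s:ℝ)]
      _ ≤ 1 - (1 - (s:ℝ)) ^ k := by have := bern_ineq s hs hs' k; linarith
      _ = pr s {η | ∀ e ∈ piv n ω, η e = false}ᶜ := by
          rw [pr_compl s (measurableSet_none_true _), pr_none_true]
      _ = ∫ η, ind {η | ∀ e ∈ piv n ω, η e = false}ᶜ η ∂(mu s) :=
          pr_eq_integral _ (measurableSet_none_true _).compl
      _ ≤ ∫ η, ind (Arm 0 n) (cor ω η) ∂(mu s) := by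
        refine integral_mono (integrable_ind_of (measurableSet_none_true _).compl) ?_ fun η => ?_
        · exact Integrable.of_bound ((measurable_ind hA).comp (measurable_cor_right ω)).aestronglyMeasurable 1
            (ae_of_all _ fun η => ind_abs_le_one _ _)
        · by_cases hη : η ∈ {η : Config | ∀ e ∈ piv n ω, η e = false}ᶜ
          · rw [ind_of_mem hη, ind_of_mem]
            simp only [mem_compl_iff, mem_ofPred_eq, not_forall] at hη
            obtain ⟨e, he, hee⟩ := hη
            exact (Finset.mem_filter.1 he).2 _ (fun e he => by simp [cor, he])
              (by simp [cor, hee])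
          · rw [ind_of_notMem hη]; exact ind_nonneg _ _

lemma piv_lower (q : unitInterval) (n : ℕ) (hφ : ∀ S : Finset Vert, (0 : Vert) ∈ S → 1 ≤ phi q S) :
    1 - th q n ≤ ∫ ω, (1 - ind (Arm 0 n) ω) * ((piv n ω).card : ℝ) ∂(mu q) := by
  classical
  have hq1 : (q:ℝ) ≤ 1 := q.2.2
  have hm : ∀ S, MeasurableSet {ω | nc n ω = S} := fun S => (dep_nc (n := n) (S := S)).measurableSet
  have hm2 : ∀ S : Finset Vert, ∀ e, MeasurableSet {η | cn η (S : Set Vert) 0 (inn S e)} := fun S e =>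
    Dep.measurableSet (dep_cn S 0 (inn S e))
  have e1 : 1 - th q n = ∑ S ∈ ((box 0 n).powerset).filter (fun S => (0 : Vert) ∈ S), pr q {ω | nc n ω = S} := by
    rw [pr_sum_eq q (box 0 n).powerset (nc n) hm
      (fun ω => Finset.mem_powerset.2 (fun z hz => (mem_nc.1 hz).1)) (fun S => (0 : Vert) ∈ S)]
    unfold th
    rw [← pr_compl q (measurable_arm 0 n)]
    congr 1
    ext ω
    simp [arm_iff_nc]
  rw [e1]
  have e2 : ∀ S ∈ ((box 0 n).powerset).filter (fun S => (0 : Vert) ∈ S), pr q {ω | nc n ω = S} ≤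
      ∫ ω, ind {ω | nc n ω = S} ω * ∑ e ∈ bd S, ind {η | cn η (S : Set Vert) 0 (inn S e)} ω ∂(mu q) := by
    intro S hS
    have h0 := (Finset.mem_filter.1 hS).2
    have : ∀ ω, ind {ω | nc n ω = S} ω * ∑ e ∈ bd S, ind {η | cn η (S : Set Vert) 0 (inn S e)} ω
       = ∑ e ∈ bd S, ind {ω | nc n ω = S} ω * ind {η | cn η (S : Set Vert) 0 (inn S e)} ω := fun ω => Finset.mul_sum _ _ _
    simp_rw [this]
    have hd1 := (dep_nc (n := n) (S := S))
    rw [integral_finsetSum]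
    · have h2 : ∀ e, ∫ ω, ind {ω | nc n ω = S} ω * ind {η | cn η (S : Set Vert) 0 (inn S e)} ω ∂(mu q)
          = pr q {ω | nc n ω = S} * pr q {η | cn η (S : Set Vert) 0 (inn S e)} := by
        intro e
        rw [integral_mul_dep q (Dep.ind (A := {ω | nc n ω = S}) hd1)
          (Dep.ind (A := {η | cn η (S : Set Vert) 0 (inn S e)}) (dep_cn S 0 (inn S e))), pr_eq_integral q (hm S),
          pr_eq_integral q (hm2 S e)]
        rw [Finset.disjoint_left]
        intro z hz hz2
        rw [mem_ev] at hz2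
        exact (Finset.mem_filter.1 hz).2 hz2
      simp_rw [h2]
      rw [← Finset.mul_sum]
      have h3 := hφ S h0
      have h4 : phi q S ≤ ∑ e ∈ bd S, pr q {η | cn η (S : Set Vert) 0 (inn S e)} := by
        refine Finset.sum_le_sum fun e _ => ?_
        have := pr_nonneg q {η | cn η (S : Set Vert) 0 (inn S e)}
        nlinarith
      have := pr_nonneg q {ω | nc n ω = S}
      nlinarith
    · intro e _
      have : (fun ω => ind {ω | nc n ω = S} ω * ind {η | cn η (S : Set Vert) 0 (inn S e)} ω)
        = ind ({ω | nc n ω = S} ∩ {η | cn η (S : Set Vert) 0 (inn S e)}) := by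
        funext ω
        by_cases h1 : ω ∈ {ω | nc n ω = S} <;> by_cases h2 : ω ∈ {η : Config | cn η (S : Set Vert) 0 (inn S e)} <;> simp [ind, h1, h2]
      rw [this]
      exact integrable_ind_of ((hm S).inter (hm2 S e))
  refine (Finset.sum_le_sum e2).trans ?_
  have hIntg : ∀ S : Finset Vert, Integrable (fun ω => ind {ω | nc n ω = S} ω * ∑ e ∈ bd S, ind {η | cn η (S : Set Vert) 0 (inn S e)} ω) (mu q) := by
    intro S
    refine Integrable.of_bound (C := (bd S).card) ?_ (ae_of_all _ fun ω => ?_)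
    · exact ((measurable_ind (hm S)).mul (Finset.measurable_sum _ fun e _ => measurable_ind (hm2 S e))).aestronglyMeasurable
    · rw [Real.norm_eq_abs, abs_of_nonneg (mul_nonneg (ind_nonneg _ _) (Finset.sum_nonneg fun _ _ => ind_nonneg _ _))]
      calc _ ≤ 1 * ∑ e ∈ bd S, (1:ℝ) := mul_le_mul (ind_le_one _ _) (Finset.sum_le_sum fun _ _ => ind_le_one _ _)
            (Finset.sum_nonneg fun _ _ => ind_nonneg _ _) zero_le_one
        _ = _ := by simp
  rw [← integral_finsetSum _ (fun S _ => hIntg S)]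
  have d1 : Dep (ev (box 0 n) : Set Edge) (fun ω => (1 - ind (Arm 0 n) ω) * ((piv n ω).card : ℝ)) :=
    (dep_arm 0 n).ind.comp2 (dep_piv n) (fun a b => (1 - a) * (b.card : ℝ))
  refine integral_mono (integrable_finset_sum _ fun S _ => hIntg S) (d1.integrable _) fun ω => ?_
  by_cases hω : (0 : Vert) ∈ nc n ω
  · have hA : ω ∉ Arm 0 n := fun h => arm_iff_nc.1 h hω
    simp only [ind_of_notMem hA, sub_zero, one_mul]
    rw [Finset.sum_eq_single (nc n ω)]
    · rw [ind_of_mem (show ω ∈ {ω' | nc n ω' = nc n ω} from rfl), one_mul]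
      have : ∀ e ∈ bd (nc n ω), ind {η | cn η (nc n ω : Set Vert) 0 (inn (nc n ω) e)} ω
        ≤ if e ∈ piv n ω then 1 else 0 := by
        intro e he
        by_cases hc : cn ω (nc n ω : Set Vert) 0 (inn (nc n ω) e)
        · rw [ind_of_mem (show ω ∈ {η : Config | cn η (nc n ω : Set Vert) 0 (inn (nc n ω) e)} from hc), if_pos]
          have hin := inn_mem he
          have hout := out_notMem he
          have hs := dstep_inn_out (nc n ω) e
          obtain ⟨hiB, hi2⟩ := mem_nc.1 hin
          have hsub : (nc n ω : Set Vert) ⊆ (box 0 n : Set Vert) := fun z hz => (mem_nc.1 hz).1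
          have hi3 : nd 0 (inn (nc n ω) e) < n := by
            by_contra hcon
            exact hi2 ⟨_, not_lt.1 hcon, hiB, cn_refl⟩
          have hoB : out (nc n ω) e ∈ box 0 n := by
            rw [mem_box]
            have := nd_tri 0 (inn (nc n ω) e) (out (nc n ω) e)
            have := dstep_nd hs
            omega
          have hoc : ∃ b, n ≤ nd 0 b ∧ b ∈ box 0 n ∧ cn ω (box 0 n : Set Vert) (out (nc n ω) e) b := by
            by_contra hcon
            exact hout (mem_nc.2 ⟨hoB, hcon⟩)
          obtain ⟨b, hb, hbB, hcb⟩ := hoc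
          rw [piv, Finset.mem_filter, mem_ev]
          refine ⟨?_, fun η' h1 h2 => ⟨b, hb, ?_⟩⟩
          · rcases hs with ⟨h1, h2⟩ | ⟨h1, h2⟩ <;> rw [← h1, ← h2] <;> tauto
          · refine cn_trans (cn_mono hc h1 hsub) (Relation.ReflTransGen.head ⟨hiB, hoB, e, h2, hs⟩ (cn_mono hcb h1 subset_rfl))
        · rw [ind_of_notMem (show ω ∉ {η : Config | cn η (nc n ω : Set Vert) 0 (inn (nc n ω) e)} from hc)]
          split_ifs <;> norm_num
      refine (Finset.sum_le_sum this).trans ?_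
      rw [← Finset.sum_filter, Finset.sum_const, nsmul_eq_mul, mul_one]
      exact_mod_cast Finset.card_le_card (fun e he => (Finset.mem_filter.1 he).2)
    · intro S _ hS
      rw [ind_of_notMem (show ω ∉ {ω' | nc n ω' = S} from fun h => hS h.symm), zero_mul]
    · intro h
      exfalso
      exact h (Finset.mem_filter.2 ⟨Finset.mem_powerset.2 fun z hz => (mem_nc.1 hz).1, hω⟩)
  · have hA : ω ∈ Arm 0 n := arm_iff_nc.2 hω
    simp only [ind_of_mem hA, sub_self, zero_mul]
    refine le_of_eq (Finset.sum_eq_zero fun S hS => ?_)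
    rw [ind_of_notMem, zero_mul]
    intro (h : nc n ω = S)
    exact hω (h ▸ (Finset.mem_filter.1 hS).2)

end BP

end



noncomputable section

namespace BP

lemma measurable_cn (S : Finset Vert) (a b : Vert) : MeasurableSet {η | cn η (S : Set Vert) a b} :=
  Dep.measurableSet (dep_cn S a b)

lemma phi_mono {q r : unitInterval} (h : q ≤ r) (S : Finset Vert) : phi q S ≤ phi r S := by
  unfold phi
  refine Finset.sum_le_sum fun e _ => ?_
  have h1 := pr_mono_param h (measurable_cn S 0 (inn S e))
    (fun ω η hh hc => cn_mono hc hh subset_rfl)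
  exact mul_le_mul h h1 (pr_nonneg _ _) r.2.1

lemma le_oplus (q s : unitInterval) : q ≤ oplus q s := by
  show (q:ℝ) ≤ 1 - (1 - q) * (1 - s)
  have := q.2.1; have := q.2.2; have := s.2.1; have := s.2.2
  nlinarith

lemma th_grow (q s : unitInterval) (n : ℕ) (hφ : ∀ S : Finset Vert, (0 : Vert) ∈ S → 1 ≤ phi q S) :
    1 - th (oplus q s) n ≤ (1 - s) * (1 - th q n) + s ^ 2 * (ev (box 0 n)).card ^ 2 := by
  have h1 := th_grow1 q s n
  have h2 := piv_lower q n hφ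
  have := s.2.1
  nlinarith

lemma th_iter (q s : unitInterval) (n : ℕ) (hφ : ∀ S : Finset Vert, (0 : Vert) ∈ S → 1 ≤ phi q S) (k : ℕ) :
    ∃ r : unitInterval, q ≤ r ∧ 1 - (r:ℝ) = (1 - q) * (1 - s) ^ k ∧
      1 - th r n ≤ (1 - (s:ℝ)) ^ k + k * (s ^ 2 * (ev (box 0 n)).card ^ 2) := by
  have hs := s.2.1; have hs' := s.2.2
  induction k with
  | zero => exact ⟨q, le_rfl, by simp, by simp [th, pr_nonneg]⟩
  | succ k ih =>
    obtain ⟨r, h1, h2, h3⟩ := ih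
    refine ⟨oplus r s, h1.trans (le_oplus r s), ?_, ?_⟩
    · simp only [oplus]; rw [pow_succ]; linear_combination (1 - (s:ℝ)) * h2
    · refine (th_grow r s n fun S hS => (hφ S hS).trans (phi_mono h1 S)).trans ?_
      rw [pow_succ (1 - (s:ℝ)) k]; push_cast
      have h5 : (0:ℝ) ≤ k * (s ^ 2 * (ev (box 0 n)).card ^ 2) := by positivity
      generalize (s:ℝ) ^ 2 * ((ev (box 0 n)).card:ℝ) ^ 2 = Z at *
      have := mul_le_mul_of_nonneg_left h3 (sub_nonneg.2 hs')
      have := mul_nonneg hs h5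
      nlinarith

theorem th_lower {q q1 : unitInterval} (h : (q:ℝ) < q1) (h1 : (q1:ℝ) < 1)
    (hφ : ∀ S : Finset Vert, (0 : Vert) ∈ S → 1 ≤ phi q S) (n : ℕ) :
    ((q1:ℝ) - q) / (1 - q) ≤ th q1 n := by
  set a : ℝ := (1 - q1) / (1 - q) with ha
  have hq : 0 < 1 - (q:ℝ) := by linarith
  have ha0 : 0 < a := div_pos (by linarith) hq
  have ha1 : a < 1 := by rw [ha, div_lt_one hq]; linarith
  have key : ∀ k : ℕ, 0 < k → 1 - th q1 n ≤ a + (Real.log a ^ 2 * (ev (box 0 n)).card ^ 2) / k := by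
    intro k hk
    have hk' : (0:ℝ) < k := by exact_mod_cast hk
    set t : ℝ := a ^ ((k:ℝ)⁻¹) with ht
    have ht0 : 0 < t := Real.rpow_pos_of_pos ha0 _
    have ht1 : t ≤ 1 := Real.rpow_le_one ha0.le ha1.le (by positivity)
    have htk : t ^ k = a := Real.rpow_inv_natCast_pow ha0.le hk.ne'
    obtain ⟨r, hr1, hr2, hr3⟩ := th_iter q ⟨1 - t, by linarith, by linarith⟩ n hφ k
    simp only [sub_sub_cancel, htk] at hr2 hr3
    have : r = q1 := by
      apply Subtype.ext
      have : (1 - (q:ℝ)) * a = 1 - q1 := by rw [ha]; field_simp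
      linarith
    rw [this] at hr3
    refine hr3.trans ?_
    have hlog : 1 - t ≤ - Real.log a / k := by
      have := Real.add_one_le_exp (Real.log a / k)
      have h2 : Real.exp (Real.log a / k) = t := by
        rw [ht, Real.rpow_def_of_pos ha0]; rfl
      rw [h2] at this
      rw [neg_div]; linarith
    have h5 : (1 - t) ^ 2 ≤ (- Real.log a / k) ^ 2 := pow_le_pow_left₀ (by linarith) hlog 2
    have h6 : (k:ℝ) * ((- Real.log a / k) ^ 2 * ((ev (box 0 n)).card:ℝ) ^ 2) = (Real.log a ^ 2 * (ev (box 0 n)).card ^ 2) / k := by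
      generalize ((ev (box 0 n)).card:ℝ) = M
      generalize Real.log a = l
      field_simp
    rw [← h6]
    have hM : (0:ℝ) ≤ ((ev (box 0 n)).card:ℝ) ^ 2 := sq_nonneg _
    exact add_le_add le_rfl (mul_le_mul_of_nonneg_left (mul_le_mul_of_nonneg_right h5 hM) hk'.le)
  have lim : Tendsto (fun k : ℕ => a + (Real.log a ^ 2 * ((ev (box 0 n)).card:ℝ) ^ 2) / k) atTop (nhds (a + 0)) :=
    tendsto_const_nhds.add (tendsto_const_div_atTop_nhds_zero_nat _)
  have := ge_of_tendsto lim (eventually_atTop.2 ⟨1, fun k hk => key k hk⟩)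
  have h7 : ((q1:ℝ) - q) / (1 - q) = 1 - a := by rw [ha]; field_simp; ring
  linarith

theorem th_decay {q : unitInterval} {S : Finset Vert} (h0 : (0 : Vert) ∈ S) (hS : phi q S < 1) :
    ∃ C ρ : ℝ, 0 < C ∧ 0 < ρ ∧ ρ < 1 ∧ ∀ n, th q n ≤ C * ρ ^ n := by
  set L := S.sup (fun x => nd 0 x + 1) with hL
  have hL' : ∀ x ∈ S, nd 0 x + 1 ≤ L := fun x hx => Finset.le_sup (f := fun x => nd 0 x + 1) hx
  have hLpos : 0 < L := lt_of_lt_of_le (Nat.succ_pos _) (hL' 0 h0)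
  set f := max (phi q S) (1/2) with hf
  have hf0 : 0 < f := lt_of_lt_of_le (by norm_num) (le_max_right _ _)
  have hf1 : f < 1 := max_lt hS (by norm_num)
  have step : ∀ n, th q (n + L) ≤ f * th q n := fun n => (th_step q S L n h0 hL').trans
    (mul_le_mul_of_nonneg_right (le_max_left _ _) (pr_nonneg _ _))
  have it : ∀ k, th q (k * L) ≤ f ^ k := by
    intro k
    induction k with
    | zero => simpa [th] using pr_le_one q _
    | succ k ih =>
      rw [Nat.succ_mul, pow_succ, mul_comm (f ^ k)]
      exact (step _).trans (mul_le_mul_of_nonneg_left ih hf0.le)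
  set ρ := f ^ ((L:ℝ)⁻¹) with hρ
  have hρ0 : 0 < ρ := Real.rpow_pos_of_pos hf0 _
  have hρ1 : ρ < 1 := Real.rpow_lt_one hf0.le hf1 (by positivity)
  have hρL : ρ ^ L = f := Real.rpow_inv_natCast_pow hf0.le hLpos.ne'
  refine ⟨1 / f, ρ, by positivity, hρ0, hρ1, fun n => ?_⟩
  calc th q n ≤ th q (n / L * L) := th_anti q (Nat.div_mul_le_self n L)
    _ ≤ f ^ (n / L) := it _
    _ = 1 / f * ρ ^ (L * (n / L) + L) := by rw [pow_add, pow_mul, hρL]; field_simp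
    _ ≤ 1 / f * ρ ^ n := by
      refine mul_le_mul_of_nonneg_left (pow_le_pow_of_le_one hρ0.le hρ1.le ?_) (by positivity)
      have := Nat.div_add_mod n L
      have := Nat.mod_lt n hLpos
      omega

/-- Either exponential decay at `q` or percolation above `q`. -/
theorem dichotomy {q q1 : unitInterval} (h : (q:ℝ) < q1) (h1 : (q1:ℝ) < 1) :
    (∃ C ρ : ℝ, 0 < C ∧ 0 < ρ ∧ ρ < 1 ∧ ∀ n, th q n ≤ C * ρ ^ n) ∨ ∃ c : ℝ, 0 < c ∧ ∀ n, c ≤ th q1 n := by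
  by_cases hφ : ∀ S : Finset Vert, (0 : Vert) ∈ S → 1 ≤ phi q S
  · right
    exact ⟨_, div_pos (sub_pos.2 h) (by linarith), th_lower h h1 hφ⟩
  · left
    push Not at hφ
    obtain ⟨S, h0, hS⟩ := hφ
    exact th_decay h0 hS

end BP

end



noncomputable section

namespace BP

/-! ### Walks in the dual graph -/

inductive DWalk : Vert → List Edge → Vert → Prop
  | nil (a : Vert) : DWalk a [] a
  | cons {a b c : Vert} {e : Edge} {l : List Edge} (h : dstep e a b) (w : DWalk b l c) : DWalk a (e :: l) c

lemma DWalk.append {a b c : Vert} {l l' : List Edge} (h : DWalk a l b) (h' : DWalk b l' c) :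
    DWalk a (l ++ l') c := by
  induction h with
  | nil => exact h'
  | cons hs _ ih => exact DWalk.cons hs (ih h')

lemma DWalk.single {a b : Vert} {e : Edge} (h : dstep e a b) : DWalk a [e] b := .cons h (.nil b)

lemma DWalk.reverse {a b : Vert} {l : List Edge} (h : DWalk a l b) : DWalk b l.reverse a := by
  induction h with
  | nil => exact .nil _
  | cons hs _ ih => rw [List.reverse_cons]; exact ih.append (.single (dstep_symm hs))

lemma DWalk.split {a b : Vert} {l : List Edge} (h : DWalk a l b) : ∀ l1 l2, l = l1 ++ l2 →
    ∃ x, DWalk a l1 x ∧ DWalk x l2 b := by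
  induction h with
  | nil a =>
    intro l1 l2 h
    obtain ⟨rfl, rfl⟩ := List.append_eq_nil_iff.1 h.symm
    exact ⟨a, .nil a, .nil a⟩
  | cons hs hw ih =>
    rename_i a b c e l
    intro l1 l2 h
    cases l1 with
    | nil => exact ⟨a, .nil a, by rw [List.nil_append] at h; rw [← h]; exact DWalk.cons hs hw⟩
    | cons e' l1 =>
      simp only [List.cons_append, List.cons.injEq] at h
      obtain ⟨rfl, h⟩ := h
      obtain ⟨x, h1, h2⟩ := ih l1 l2 h
      exact ⟨x, .cons hs h1, h2⟩

lemma DWalk.nil_eq {a b : Vert} (h : DWalk a [] b) : a = b := by cases h; rfl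

lemma DWalk.cons_inv {a c : Vert} {e : Edge} {l : List Edge} (h : DWalk a (e :: l) c) :
    ∃ b, dstep e a b ∧ DWalk b l c := by
  cases h with
  | cons hs hw => exact ⟨_, hs, hw⟩

lemma DWalk.nd_le_length {a b : Vert} {l : List Edge} (h : DWalk a l b) : nd a b ≤ l.length := by
  induction h with
  | nil => simp [nd_self]
  | cons hs _ ih =>
    rename_i a b c e l _
    have := nd_tri a b c
    have := dstep_nd hs
    simp only [List.length_cons]; omega

/-- for an edge of the walk, split at this edge -/
lemma DWalk.split_at {a b : Vert} {l : List Edge} (h : DWalk a l b) {e : Edge} (he : e ∈ l) :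
    ∃ l1 l2 x y, l = l1 ++ e :: l2 ∧ DWalk a l1 x ∧ dstep e x y ∧ DWalk y l2 b := by
  obtain ⟨l1, l2, rfl⟩ := List.append_of_mem he
  obtain ⟨x, h1, h2⟩ := h.split _ _ rfl
  obtain ⟨y, h3, h4⟩ := h2.cons_inv
  exact ⟨l1, l2, x, y, rfl, h1, h3, h4⟩

lemma dstep_fst {e : Edge} {x y : Vert} (h : dstep e x y) : nd x e.1 ≤ 1 := by
  rcases h with ⟨rfl, rfl⟩ | ⟨rfl, rfl⟩
  · rw [nd_self]; omega
  · rw [nd_comm, nd_dB]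

lemma cn_of_walk {η : Config} {S : Set Vert} {a b : Vert} {l : List Edge} (h : DWalk a l b)
    (h1 : ∀ e ∈ l, η e = true ∧ e.1 ∈ S ∧ dB e ∈ S) : cn η S a b := by
  induction h with
  | nil => exact cn_refl
  | cons hs _ ih =>
    rename_i a b c e l _
    have := h1 e (by simp)
    refine Relation.ReflTransGen.head ⟨?_, ?_, e, this.1, hs⟩ (ih fun e he => h1 e (by simp [he]))
    · rcases hs with ⟨rfl, rfl⟩ | ⟨rfl, rfl⟩ <;> tauto
    · rcases hs with ⟨rfl, rfl⟩ | ⟨rfl, rfl⟩ <;> tauto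

lemma walk_of_cn {η : Config} {S : Set Vert} {a b : Vert} (h : cn η S a b) :
    ∃ l, DWalk a l b ∧ ∀ e ∈ l, η e = true ∧ e.1 ∈ S ∧ dB e ∈ S := by
  induction h with
  | refl => exact ⟨[], .nil _, by simp⟩
  | tail _ hbc ih =>
    obtain ⟨l, hl, hl2⟩ := ih
    obtain ⟨hb, hc, e, he, hs⟩ := hbc
    refine ⟨l ++ [e], hl.append (.single hs), ?_⟩
    intro e' he'
    rcases List.mem_append.1 he' with h | h
    · exact hl2 e' h
    · rw [List.mem_singleton] at h; subst h
      refine ⟨he, ?_⟩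
      rcases hs with ⟨rfl, rfl⟩ | ⟨rfl, rfl⟩ <;> tauto

/-! ### Mod 2 cochains -/

abbrev Z2 := ZMod 2

/-- parity of the number of times an edge is used -/
def Nw (l : List Edge) (e : Edge) : Z2 := (l.count e : Z2)

/-- vertex (plaquette) sum -/
def pl (N : Edge → Z2) (y : Vert) : Z2 :=
  N (y, false) + N (y + (0, 1), false) + N (y, true) + N (y + (1, 0), true)

def dA (A : Vert → Z2) (e : Edge) : Z2 := A e.1 + A (edgeTip e)

/-- delta function -/
def dl (a y : Vert) : Z2 := if y = a then 1 else 0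

lemma z2_self (a : Z2) : a + a = 0 := CharTwo.add_self_eq_zero a

lemma z2_eq_of_add {a b : Z2} (h : a + b = 0) : a = b := by revert a b; decide

lemma tip_true (x : Vert) : edgeTip (x, true) = x + (0, 1) := by simp [edgeTip]
lemma tip_false (x : Vert) : edgeTip (x, false) = x + (1, 0) := by simp [edgeTip]

lemma pl_dA (A : Vert → Z2) (y : Vert) : pl (dA A) y = 0 := by
  unfold pl dA
  simp only [tip_true, tip_false]
  rw [show y + (1, 0) + (0, 1) = y + ((0, 1) : Vert) + (1, 0) by abel]
  generalize A y = a
  generalize A (y + (1, 0)) = b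
  generalize A (y + (0, 1)) = c
  generalize A (y + (0, 1) + (1, 0)) = d
  revert a b c d; decide

lemma pl_add (N M : Edge → Z2) (y : Vert) : pl (fun e => N e + M e) y = pl N y + pl M y := by
  unfold pl; ring

lemma pl_zero (y : Vert) : pl (fun _ => 0) y = 0 := by simp [pl]

lemma pl_sum {ι : Type*} (s : Finset ι) (N : ι → Edge → Z2) (y : Vert) :
    pl (fun e => ∑ i ∈ s, N i e) y = ∑ i ∈ s, pl (N i) y := by
  simp only [pl, Finset.sum_add_distrib]

lemma dA_add (A B : Vert → Z2) (e : Edge) : dA (fun x => A x + B x) e = dA A e + dA B e := by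
  unfold dA; ring

lemma dA_sum {ι : Type*} (s : Finset ι) (A : ι → Vert → Z2) (e : Edge) :
    dA (fun x => ∑ i ∈ s, A i x) e = ∑ i ∈ s, dA (A i) e := by
  simp only [dA, Finset.sum_add_distrib]

def Ne (e0 e : Edge) : Z2 := if e = e0 then 1 else 0

lemma pl_Ne (e0 : Edge) (y : Vert) : pl (Ne e0) y = dl e0.1 y + dl (dB e0) y := by
  obtain ⟨⟨x1, x2⟩, b⟩ := e0
  obtain ⟨y1, y2⟩ := y
  cases b
  · simp only [pl, Ne, dl, dB_false, Prod.mk.injEq, Prod.mk_add_mk, and_true, add_zero]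
    simp
    simp only [show y2 + 1 = x2 ↔ y2 = x2 - 1 by omega]
  · simp only [pl, Ne, dl, dB_true, Prod.mk.injEq, Prod.mk_add_mk, and_true, add_zero]
    simp
    simp only [show y1 + 1 = x1 ↔ y1 = x1 - 1 by omega]

lemma pl_Ne_step {e : Edge} {a b : Vert} (h : dstep e a b) (y : Vert) : pl (Ne e) y = dl a y + dl b y := by
  rw [pl_Ne]
  rcases h with ⟨rfl, rfl⟩ | ⟨rfl, rfl⟩
  · rfl
  · rw [add_comm]

lemma Nw_cons (e0 : Edge) (l : List Edge) : Nw (e0 :: l) = fun e => Ne e0 e + Nw l e := by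
  funext e
  unfold Nw Ne
  rw [List.count_cons]
  by_cases h : e = e0
  · subst h; simp [add_comm]
  · have : ¬ (e0 == e) = true := by simpa using fun h' => h h'.symm
    simp [h, this]

lemma pl_Nw {a b : Vert} {l : List Edge} (h : DWalk a l b) (y : Vert) : pl (Nw l) y = dl a y + dl b y := by
  induction h with
  | nil a => simp [pl, Nw, z2_self]
  | cons hs _ ih =>
    rename_i a b c e l _
    rw [Nw_cons, pl_add, ih, pl_Ne_step hs]
    generalize dl a y = u
    generalize dl b y = v
    generalize dl c y = w
    revert u v w; decide

lemma Nw_ne_zero {l : List Edge} {e : Edge} (h : Nw l e ≠ 0) : e ∈ l := by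
  by_contra hc
  exact h (by simp [Nw, List.count_eq_zero_of_not_mem hc])

lemma Nw_nodup {l : List Edge} (h : l.Nodup) {e : Edge} : Nw l e = if e ∈ l then 1 else 0 := by
  unfold Nw
  split_ifs with he
  · rw [List.count_eq_one_of_mem h he]; rfl
  · rw [List.count_eq_zero_of_not_mem he]; rfl

/-- potential on a rectangle -/
lemma rect_potential (N : Edge → Z2) (a1 b1 a2 b2 : ℤ)
    (h : ∀ y : Vert, a1 ≤ y.1 → y.1 < b1 → a2 ≤ y.2 → y.2 < b2 → pl N y = 0) :
    ∃ B : Vert → Z2, ∀ e : Edge, a1 ≤ e.1.1 → (edgeTip e).1 ≤ b1 → a2 ≤ e.1.2 → (edgeTip e).2 ≤ b2 →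
      dA B e = N e := by
  let B : Vert → Z2 := fun x => ∑ t ∈ Finset.Ico a1 x.1, N ((t, a2), false) + ∑ s ∈ Finset.Ico a2 x.2, N ((x.1, s), true)
  have ico : ∀ (f : ℤ → Z2) (a x : ℤ), a ≤ x → ∑ t ∈ Finset.Ico a (x + 1), f t = ∑ t ∈ Finset.Ico a x, f t + f x := by
    intro f a x hx
    rw [← Finset.insert_Ico_right_eq_Ico_add_one hx, Finset.sum_insert (by simp), add_comm]
  have vert : ∀ x : Vert, a2 ≤ x.2 → B (x + (0, 1)) = B x + N (x, true) := by
    rintro ⟨x1, x2⟩ hx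
    simp only [B, Prod.mk_add_mk, add_zero]
    rw [ico _ _ _ hx]; ring
  have hor : ∀ x1 : ℤ, a1 ≤ x1 → x1 < b1 → ∀ x2, a2 ≤ x2 → x2 ≤ b2 → B (x1 + 1, x2) = B (x1, x2) + N ((x1, x2), false) := by
    intro x1 h1 h2 x2 h3
    induction x2, h3 using Int.le_induction with
    | base => intro _; simp only [B, Finset.Ico_self, Finset.sum_empty, add_zero]; rw [ico _ _ _ h1]
    | succ x2 h3 ih =>
      intro h4
      have ih := ih (by omega)
      have v1 := vert (x1 + 1, x2) h3
      have v2 := vert (x1, x2) h3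
      have hp := h (x1, x2) h1 h2 h3 (by simp only; omega)
      simp only [pl, Prod.mk_add_mk, add_zero] at v1 v2 hp
      rw [v1, v2, ih]
      revert hp
      generalize B (x1, x2) = u
      generalize N ((x1, x2), false) = v
      generalize N ((x1, x2 + 1), false) = w
      generalize N ((x1, x2), true) = z
      generalize N ((x1 + 1, x2), true) = t
      revert u v w z t; decide
  refine ⟨B, ?_⟩
  rintro ⟨⟨x1, x2⟩, b⟩ h1 h2 h3 h4
  cases b
  · rw [tip_false] at h2 h4
    simp only [Prod.mk_add_mk, add_zero] at h1 h2 h3 h4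
    have := hor x1 h1 (by omega) x2 h3 h4
    simp only [dA, tip_false, Prod.mk_add_mk, add_zero]
    rw [this, ← add_assoc, z2_self, zero_add]
  · have := vert (x1, x2) h3
    simp only [dA, tip_true]
    rw [this, ← add_assoc, z2_self, zero_add]

/-- compactly supported potential -/
lemma plane_potential (N : Edge → Z2) (z : Vert) (ρ : ℕ) (h : ∀ y, pl N y = 0)
    (hs : ∀ e, N e ≠ 0 → nd z e.1 ≤ ρ) :
    ∃ S : Vert → Z2, (∀ e, dA S e = N e) ∧ ∀ x, S x ≠ 0 → nd z x ≤ ρ + 1 := by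
  have hs' : ∀ e : Edge, (e.1.1 < z.1 - ρ ∨ z.1 + ρ < e.1.1 ∨ e.1.2 < z.2 - ρ ∨ z.2 + ρ < e.1.2) → N e = 0 := by
    intro e he
    by_contra hc
    have := nd_le.1 (hs e hc)
    omega
  set c := z.1 - ρ - 1 with hc
  let S : Vert → Z2 := fun x => ∑ t ∈ Finset.Ico c x.1, N ((t, x.2), false)
  have ico : ∀ (f : ℤ → Z2) (a x : ℤ), a ≤ x → ∑ t ∈ Finset.Ico a (x + 1), f t = ∑ t ∈ Finset.Ico a x, f t + f x := by
    intro f a x hx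
    rw [← Finset.insert_Ico_right_eq_Ico_add_one hx, Finset.sum_insert (by simp), add_comm]
  have hor : ∀ x1 x2 : ℤ, S (x1 + 1, x2) = S (x1, x2) + N ((x1, x2), false) := by
    intro x1 x2
    by_cases hx : c ≤ x1
    · simp only [S]; rw [ico _ _ _ hx]
    · simp only [S]
      rw [Finset.Ico_eq_empty (by omega), Finset.Ico_eq_empty (by omega), hs' _ (by left; simp only; omega)]
      simp
  have vert : ∀ x1 x2 : ℤ, S (x1, x2 + 1) = S (x1, x2) + N ((x1, x2), true) := by
    intro x1 x2
    by_cases hx : c ≤ x1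
    · induction x1, hx using Int.le_induction with
      | base => simp only [S, Finset.Ico_self, Finset.sum_empty]; rw [hs' _ (by left; simp only; omega)]; simp
      | succ x1 hx ih =>
        rw [hor, hor, ih]
        have hp := h (x1, x2)
        simp only [pl, Prod.mk_add_mk, add_zero] at hp
        revert hp
        generalize S (x1, x2) = u
        generalize N ((x1, x2), false) = v
        generalize N ((x1, x2 + 1), false) = w
        generalize N ((x1, x2), true) = z
        generalize N ((x1 + 1, x2), true) = t
        revert u v w z t; decide
    · simp only [S]
      rw [Finset.Ico_eq_empty (by omega), hs' _ (by left; simp only; omega)]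
      simp
  refine ⟨S, ?_, ?_⟩
  · rintro ⟨⟨x1, x2⟩, b⟩
    cases b
    · simp only [dA, tip_false, Prod.mk_add_mk, add_zero]
      rw [hor, ← add_assoc, z2_self, zero_add]
    · simp only [dA, tip_true, Prod.mk_add_mk, add_zero]
      rw [vert, ← add_assoc, z2_self, zero_add]
  · rintro ⟨x1, x2⟩ hx
    by_contra hn
    refine hx ?_
    have rowzero : ∀ x1 x2 : ℤ, (x2 < z.2 - ρ ∨ z.2 + ρ < x2) → S (x1, x2) = 0 := by
      intro x1 x2 h
      exact Finset.sum_eq_zero fun t _ => hs' _ (by simp only; omega)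
    by_cases h1 : x2 < z.2 - ρ ∨ z.2 + ρ < x2
    · exact rowzero _ _ h1
    · by_cases h2 : x1 ≤ c
      · simp only [S]; rw [Finset.Ico_eq_empty (by omega)]; simp
      · have h3 : z.1 + ρ < x1 := by
          by_contra h3
          refine hn (nd_le.2 ?_)
          simp only; push_cast; omega
        have : ∀ k : ℕ, S (x1, x2) = S (x1, x2 + k) := by
          intro k
          induction k with
          | zero => simp
          | succ k ih =>
            rw [ih]
            push_cast
            rw [← add_assoc, vert, hs' _ (by right; left; exact h3), add_zero]
        rw [this (z.2 + ρ + 1 - x2).toNat]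
        exact rowzero _ _ (by right; omega)

/-! ### Trail decomposition -/

lemma exists_edge_of_pl {N : Edge → Z2} {y : Vert} (h : pl N y ≠ 0) : ∃ e x, N e ≠ 0 ∧ dstep e x y := by
  by_contra hc
  push Not at hc
  refine h ?_
  have h1 : N (y, false) = 0 := by
    by_contra hh; exact hc _ _ hh (Or.inr ⟨rfl, rfl⟩)
  have h2 : N (y, true) = 0 := by
    by_contra hh; exact hc _ _ hh (Or.inr ⟨rfl, rfl⟩)
  have h3 : N (y + (0, 1), false) = 0 := by
    by_contra hh; exact hc _ (y + (0, 1)) hh (Or.inl ⟨rfl, by rw [dB_false]; ext <;> simp⟩)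
  have h4 : N (y + (1, 0), true) = 0 := by
    by_contra hh; exact hc _ (y + (1, 0)) hh (Or.inl ⟨rfl, by rw [dB_true]; ext <;> simp⟩)
  simp [pl, h1, h2, h3, h4]

/-- indicator cochain of a finite set -/
def Nf (F : Finset Edge) (e : Edge) : Z2 := if e ∈ F then 1 else 0

/-- good trail -/
def Trail (O : Set Vert) (l : List Edge) : Prop :=
  ∃ a b, DWalk a l b ∧ l.Nodup ∧ l ≠ [] ∧ (a = b ∨ (a ∈ O ∧ b ∈ O))

lemma trail_decomp (O : Set Vert) : ∀ (k : ℕ) (F : Finset Edge), F.card = k → (∀ y, y ∉ O → pl (Nf F) y = 0) →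
    ∃ Ls : List (List Edge), (∀ l ∈ Ls, Trail O l) ∧ Ls.flatten.Nodup ∧ ∀ e, e ∈ Ls.flatten ↔ e ∈ F := by
  intro k
  induction k using Nat.strong_induction_on with
  | _ k ih =>
  intro F hk hF
  rcases F.eq_empty_or_nonempty with rfl | ⟨e0, he0⟩
  · exact ⟨[], by simp, by simp, by simp⟩
  let Q : ℕ → Prop := fun n => ∃ a b l, DWalk a l b ∧ l.Nodup ∧ (∀ e ∈ l, e ∈ F) ∧ l.length = n
  have hQ1 : Q 1 := ⟨e0.1, dB e0, [e0], .single (Or.inl ⟨rfl, rfl⟩), by simp, by simpa using he0, rfl⟩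
  have hQb : ∀ n, Q n → n ≤ F.card := by
    rintro n ⟨a, b, l, _, hn, hl, rfl⟩
    rw [← List.toFinset_card_of_nodup hn]
    exact Finset.card_le_card fun e he => hl e (by simpa using he)
  classical
  set m := Nat.findGreatest Q F.card with hm
  have hQm : Q m := Nat.findGreatest_spec (hQb 1 hQ1) hQ1
  have hmax : ∀ n, Q n → n ≤ m := fun n hn => Nat.le_findGreatest (hQb n hn) hn
  have ext : ∀ a b l, DWalk a l b → l.Nodup → (∀ e ∈ l, e ∈ F) → l.length = m → a ≠ b → a ∈ O := by
    intro a b l hw hn hl hlm hab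
    by_contra haO
    have h1 : pl (fun e => Nf F e + Nw l e) a ≠ 0 := by
      rw [pl_add, hF a haO, pl_Nw hw, zero_add]
      simp [dl, hab]
    obtain ⟨e, x, he, hs⟩ := exists_edge_of_pl h1
    rw [Nw_nodup hn, Nf] at he
    have heF : e ∈ F ∧ e ∉ l := by
      by_cases h1 : e ∈ l
      · simp [hl e h1, h1] at he
        exact absurd (z2_self 1) he
      · refine ⟨?_, h1⟩
        by_contra h2
        simp [h1, h2] at he
    have : Q (m + 1) := ⟨x, b, e :: l, .cons hs hw, List.nodup_cons.2 ⟨heF.2, hn⟩, by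
      intro e' he'
      rcases List.mem_cons.1 he' with rfl | h
      · exact heF.1
      · exact hl _ h, by simp [hlm]⟩
    have := hmax _ this
    omega
  obtain ⟨a, b, l, hw, hn, hl, hlm⟩ := hQm
  have hends : a = b ∨ (a ∈ O ∧ b ∈ O) := by
    by_cases hab : a = b
    · exact Or.inl hab
    · refine Or.inr ⟨ext a b l hw hn hl hlm hab, ext b a l.reverse hw.reverse (List.nodup_reverse.2 hn)
        (fun e he => hl e (by simpa using he)) (by simp [hlm]) (Ne.symm hab)⟩
  have hm1 : 1 ≤ m := hmax 1 hQ1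
  have hlne : l ≠ [] := by rintro rfl; simp at hlm; omega
  set F' := F.filter (fun e => e ∉ l) with hF'
  have hNf : ∀ e, Nf F' e = Nf F e + Nw l e := by
    intro e
    rw [Nw_nodup hn]
    unfold Nf
    by_cases h1 : e ∈ l
    · simp [hF', h1, hl e h1, z2_self]
    · simp [hF', h1]
  have hF'c : F'.card < k := by
    rw [← hk]
    refine Finset.card_lt_card (Finset.ssubset_iff_subset_ne.2 ⟨Finset.filter_subset _ _, ?_⟩)
    intro heq
    obtain ⟨e, he⟩ := List.exists_mem_of_ne_nil l hlne
    have : e ∈ F' := heq ▸ hl e he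
    exact (Finset.mem_filter.1 this).2 he
  obtain ⟨Ls, h1, h2, h3⟩ := ih _ hF'c F' rfl (by
    intro y hy
    have : Nf F' = fun e => Nf F e + Nw l e := funext hNf
    rw [this, pl_add, hF y hy, pl_Nw hw, zero_add]
    rcases hends with rfl | ⟨ha, hb⟩
    · exact z2_self _
    · have h1 : y ≠ a := fun h => hy (h ▸ ha)
      have h2 : y ≠ b := fun h => hy (h ▸ hb)
      simp [dl, h1, h2])
  refine ⟨l :: Ls, ?_, ?_, ?_⟩
  · intro l' hl'
    rcases List.mem_cons.1 hl' with rfl | h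
    · exact ⟨a, b, hw, hn, hlne, hends⟩
    · exact h1 _ h
  · rw [List.flatten_cons, List.nodup_append]
    refine ⟨hn, h2, ?_⟩
    intro e he e' he' heq
    subst heq
    exact (Finset.mem_filter.1 ((h3 _).1 he')).2 he
  · intro e
    rw [List.flatten_cons, List.mem_append, h3, hF', Finset.mem_filter]
    constructor
    · rintro (h | h)
      · exact hl e h
      · exact h.1
    · intro h
      by_cases h' : e ∈ l
      · exact Or.inl h'
      · exact Or.inr ⟨h, h'⟩

end BP

end



noncomputable section

namespace BP

/-! ### Absence of percolation below `1/2` -/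

lemma pr_le_of_map (q : unitInterval) (f : Edge → Edge) (hf : Function.Injective f) {A B : Set Config}
    (hA : MeasurableSet A) (h : ∀ η : Config, (fun e => η (f e)) ∈ A → η ∈ B) : pr q A ≤ pr q B := by
  rw [← pr_reindex q f hf hA]
  exact pr_mono q h

/-- far apart points -/
def xi (R : ℕ) (i : ℕ) : Vert := ((i * (2 * R + 2) : ℕ), 0)

lemma nd_xi (R : ℕ) {i j : ℕ} (h : i < j) : 2 * R + 2 ≤ nd (xi R i) (xi R j) := by
  have h1 : (i + 1) * (2 * R + 2) ≤ j * (2 * R + 2) := Nat.mul_le_mul_right _ h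
  have h2 : (i + 1) * (2 * R + 2) = i * (2 * R + 2) + (2 * R + 2) := by ring
  unfold nd xi
  simp only
  generalize i * (2 * R + 2) = u at *
  generalize j * (2 * R + 2) = v at *
  omega

lemma disjoint_ev {a b : Vert} {R R' : ℕ} (h : R + R' < nd a b) : Disjoint (ev (box a R)) (ev (box b R')) := by
  rw [Finset.disjoint_left]
  intro e h1 h2
  rw [mem_ev, mem_box, mem_box] at h1 h2
  have := nd_tri a e.1 b
  rw [nd_comm e.1 b] at this
  omega

lemma dep_not {α : Config → Prop} {F : Set Edge} (h : Dep F α) : Dep F (fun ω => ¬ α ω) := h.comp Not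

lemma pr_no_arms (q : unitInterval) (R k : ℕ) :
    pr q {η | ∀ i < k, η ∉ Arm (xi R i) R} = (1 - th q R) ^ k ∧
    Dep (((Finset.range k).biUnion fun i => ev (box (xi R i) R) : Finset Edge) : Set Edge)
      (· ∈ {η | ∀ i < k, η ∉ Arm (xi R i) R}) := by
  classical
  induction k with
  | zero => simp [pr]; intro _ _ _; simp
  | succ k ih =>
    obtain ⟨ih1, ih2⟩ := ih
    have e1 : {η | ∀ i < k + 1, η ∉ Arm (xi R i) R} = {η | ∀ i < k, η ∉ Arm (xi R i) R} ∩ (Arm (xi R k) R)ᶜ := by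
      ext η
      simp only [mem_ofPred_eq, mem_inter_iff, mem_compl_iff]
      constructor
      · intro h; exact ⟨fun i hi => h i (by omega), h k (by omega)⟩
      · rintro ⟨h1, h2⟩ i hi
        rcases Nat.lt_succ_iff_lt_or_eq.1 hi with h | rfl
        · exact h1 i h
        · exact h2
    have d2 : Dep (ev (box (xi R k) R) : Set Edge) (· ∈ (Arm (xi R k) R)ᶜ) := dep_not (dep_arm _ _)
    constructor
    · rw [e1, pr_inter_dep q ih2 d2, ih1, pr_compl q (measurable_arm _ _), pr_arm, pow_succ]
      rw [Finset.disjoint_biUnion_left]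
      intro i hi
      exact disjoint_ev (by have := nd_xi R (Finset.mem_range.1 hi); omega)
    · rw [e1]
      refine dep_and (ih2.mono ?_) (d2.mono ?_)
      · exact_mod_cast Finset.biUnion_subset_biUnion_of_subset_left _ (Finset.range_mono (by omega))
      · exact_mod_cast Finset.subset_biUnion_of_mem (fun i => ev (box (xi R i) R)) (by simp : k ∈ Finset.range (k + 1))

lemma th_le_one (q : unitInterval) (n : ℕ) : th q n ≤ 1 := pr_le_one _ _
lemma th_nonneg (q : unitInterval) (n : ℕ) : 0 ≤ th q n := pr_nonneg _ _

lemma arms_exist {q : unitInterval} {c : ℝ} (hc : 0 < c) (h : ∀ n, c ≤ th q n) {ε : ℝ} (hε : 0 < ε) :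
    ∃ R k : ℕ, ∀ n, R ≤ n → 1 - ε ≤ pr q {η | ∃ i < k, η ∈ Arm (xi R i) n} := by
  have hc1 : c ≤ 1 := (h 0).trans (th_le_one q 0)
  obtain ⟨k, hk⟩ := exists_pow_lt_of_lt_one (half_pos hε) (show 1 - c < 1 by linarith)
  obtain ⟨R, hR⟩ : ∃ R, ∀ n, R ≤ n → k * (th q R - th q n) ≤ ε / 2 := by
    have hbdd : BddBelow (range (th q)) := ⟨0, by rintro _ ⟨n, rfl⟩; exact th_nonneg q n⟩
    have hlim := tendsto_atTop_ciInf (fun a b hab => th_anti q hab : Antitone (th q)) hbdd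
    have hpos : 0 < ε / 2 / (k + 1) := by positivity
    obtain ⟨R, hR⟩ := (hlim.eventually (gt_mem_nhds (show (⨅ i, th q i) < (⨅ i, th q i) + ε / 2 / (k + 1) by linarith))).exists
    refine ⟨R, fun n _ => ?_⟩
    have h1 : (⨅ i, th q i) ≤ th q n := ciInf_le hbdd n
    have h2 : th q R - th q n ≤ ε / 2 / (k + 1) := by linarith
    calc k * (th q R - th q n) ≤ k * (ε / 2 / (k + 1)) := mul_le_mul_of_nonneg_left h2 (Nat.cast_nonneg k)
      _ ≤ (k + 1) * (ε / 2 / (k + 1)) := by gcongr; linarith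
      _ = ε / 2 := by field_simp
  refine ⟨R, k, fun n hn => ?_⟩
  have sub : {η | ∀ i < k, η ∉ Arm (xi R i) R}ᶜ ⊆ {η | ∃ i < k, η ∈ Arm (xi R i) n} ∪
      ⋃ i ∈ Finset.range k, (Arm (xi R i) R \ Arm (xi R i) n) := by
    intro η hη
    simp only [mem_compl_iff, mem_ofPred_eq, not_forall, not_not] at hη
    obtain ⟨i, hi, hA⟩ := hη
    by_cases hn : η ∈ Arm (xi R i) n
    · exact Or.inl ⟨i, hi, hn⟩
    · right
      simp only [mem_iUnion]
      exact ⟨i, Finset.mem_range.2 hi, hA, hn⟩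
  have h1 := (pr_mono q sub).trans (pr_union_le q _ _)
  rw [pr_compl q (Dep.measurableSet (pr_no_arms q R k).2), (pr_no_arms q R k).1] at h1
  have h2 : pr q (⋃ i ∈ Finset.range k, (Arm (xi R i) R \ Arm (xi R i) n)) ≤ k * (th q R - th q n) := by
    refine (pr_biUnion_le q _ _).trans ?_
    have : ∀ i ∈ Finset.range k, pr q (Arm (xi R i) R \ Arm (xi R i) n) = th q R - th q n := by
      intro i _
      unfold pr
      rw [measureReal_sdiff (arm_anti hn) (measurable_arm _ _)]
      change pr q _ - pr q _ = _
      rw [pr_arm, pr_arm]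
    rw [Finset.sum_congr rfl this, Finset.sum_const, Finset.card_range, nsmul_eq_mul]
  have h3 : (1 - th q R) ^ k ≤ (1 - c) ^ k := pow_le_pow_left₀ (by linarith [th_le_one q R]) (by linarith [h R]) k
  have := hR n hn
  linarith

/-- connection of a small box to one side of a big box -/
def Sd (g : Vert → ℤ) (m n : ℕ) : Set Config :=
  {η | ∃ u ∈ box 0 m, ∃ b ∈ box 0 n, g b = n ∧ cn η (box 0 n : Set Vert) u b}

lemma dep_Sd (g : Vert → ℤ) (m n : ℕ) : Dep (ev (box 0 n) : Set Edge) (· ∈ Sd g m n) :=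
  dep_exists fun u => dep_and (dep_const _ _) (dep_exists fun b => dep_and (dep_const _ _)
    (dep_and (dep_const _ _) (dep_cn _ u b)))

lemma incr_Sd (g : Vert → ℤ) (m n : ℕ) : Incr (Sd g m n) := by
  rintro ω η h ⟨u, hu, b, hb, hg, hc⟩
  exact ⟨u, hu, b, hb, hg, cn_mono hc h subset_rfl⟩

def g1 (x : Vert) : ℤ := x.1
def g2 (x : Vert) : ℤ := -x.1
def g3 (x : Vert) : ℤ := x.2
def g4 (x : Vert) : ℤ := -x.2

lemma Sd_map (g g' : Vert → ℤ) (m n : ℕ) (σ : Vert → Vert) (τ : Edge → Edge)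
    (hσ : ∀ x, nd 0 (σ x) = nd 0 x) (hτ : ∀ e x y, dstep e x y → dstep (τ e) (σ x) (σ y))
    (hg : ∀ x, g' (σ x) = g x) (η : Config) (h : (fun e => η (τ e)) ∈ Sd g m n) : η ∈ Sd g' m n := by
  obtain ⟨u, hu, b, hb, hgb, hc⟩ := h
  refine ⟨σ u, by rw [mem_box, hσ]; exact mem_box.1 hu, σ b, by rw [mem_box, hσ]; exact mem_box.1 hb,
    by rw [hg, hgb], cn_mono (cn_map τ σ hτ hc) (fun _ h => h) ?_⟩
  rintro _ ⟨x, hx, rfl⟩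
  simp only [Finset.mem_coe, mem_box] at hx ⊢
  rw [hσ]; exact hx

def swv (x : Vert) : Vert := (x.2, x.1)
def swe (e : Edge) : Edge := (swv e.1, !e.2)
def nev (e : Edge) : Edge := (-(dB e), e.2)

lemma swe_inj : Function.Injective swe := by
  rintro ⟨⟨x, y⟩, b⟩ ⟨⟨x', y'⟩, b'⟩ h
  simp only [swe, swv, Prod.mk.injEq, Bool.not_eq_not] at h ⊢
  simp at h; tauto

lemma swe_step (e : Edge) (x y : Vert) (h : dstep e x y) : dstep (swe e) (swv x) (swv y) := by
  have : dB (swe e) = swv (dB e) := by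
    obtain ⟨x, b⟩ := e
    cases b <;> simp [swe, swv, dB_true, dB_false]
  unfold dstep; rw [this]
  rcases h with ⟨rfl, rfl⟩ | ⟨rfl, rfl⟩ <;> simp [swe]

lemma nev_inj : Function.Injective nev := by
  rintro ⟨⟨x, y⟩, b⟩ ⟨⟨x', y'⟩, b'⟩ h
  simp only [nev, Prod.mk.injEq] at h
  obtain ⟨h, rfl⟩ := h
  cases b <;> simpa [dB_true, dB_false] using h

lemma nev_step (e : Edge) (x y : Vert) (h : dstep e x y) : dstep (nev e) (-x) (-y) := by
  have : dB (nev e) = - e.1 := by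
    obtain ⟨⟨x1, x2⟩, b⟩ := e
    cases b <;> simp [nev, dB_true, dB_false]
  unfold dstep; rw [this]
  rcases h with ⟨rfl, rfl⟩ | ⟨rfl, rfl⟩ <;> simp [nev]

lemma pr_Sd_le (q : unitInterval) (m n : ℕ) :
    pr q (Sd g1 m n) ≤ pr q (Sd g2 m n) ∧ pr q (Sd g2 m n) ≤ pr q (Sd g1 m n) ∧
    pr q (Sd g3 m n) ≤ pr q (Sd g1 m n) ∧ pr q (Sd g4 m n) ≤ pr q (Sd g1 m n) := by
  have hm : ∀ g, MeasurableSet (Sd g m n) := fun g => (dep_Sd g m n).measurableSet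
  have hn : ∀ x, nd 0 (-x) = nd 0 x := fun x => by unfold nd; simp
  have hs : ∀ x, nd 0 (swv x) = nd 0 x := fun x => by unfold nd swv; simp [max_comm]
  have a1 := pr_le_of_map q nev nev_inj (hm g1) (Sd_map g1 g2 m n (fun x => -x) nev hn nev_step (fun x => by simp [g1, g2]))
  have a2 := pr_le_of_map q nev nev_inj (hm g2) (Sd_map g2 g1 m n (fun x => -x) nev hn nev_step (fun x => by simp [g1, g2]))
  have a3 := pr_le_of_map q swe swe_inj (hm g3) (Sd_map g3 g1 m n swv swe hs swe_step (fun x => by simp [g1, g3, swv]))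
  have a4 := pr_le_of_map q swe swe_inj (hm g4) (Sd_map g4 g2 m n swv swe hs swe_step (fun x => by simp [g2, g4, swv]))
  exact ⟨a1, a2, a3, a4.trans a2⟩

lemma harris_union (q : unitInterval) {F : Finset Edge} {A B : Set Config}
    (hf : Dep (F : Set Edge) (· ∈ A)) (hg : Dep (F : Set Edge) (· ∈ B)) (hA : Incr A) (hB : Incr B) :
    (1 - pr q A) * (1 - pr q B) ≤ 1 - pr q (A ∪ B) := by
  have h1 := pr_harris q hf hg hA hB
  have h2 : pr q (A ∪ B) + pr q (A ∩ B) = pr q A + pr q B :=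
    measureReal_union_add_inter hg.measurableSet
  nlinarith

lemma dep_or {α β : Config → Prop} {F : Set Edge} (h : Dep F α) (h' : Dep F β) :
    Dep F (fun ω => α ω ∨ β ω) := h.comp2 h' (fun a b => a ∨ b)

lemma Incr.union {A B : Set Config} (hA : Incr A) (hB : Incr B) : Incr (A ∪ B) := by
  rintro ω η h (h1 | h1)
  · exact Or.inl (hA ω η h h1)
  · exact Or.inr (hB ω η h h1)

lemma sides {q : unitInterval} {c : ℝ} (hc : 0 < c) (h : ∀ n, c ≤ th q n) {δ : ℝ} (hδ : 0 < δ) :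
    ∃ m : ℕ, ∀ n, m ≤ n → 1 - 2 * δ ≤ pr q (Sd g1 m n ∩ Sd g2 m n) := by
  obtain ⟨R, k, hRk⟩ := arms_exist hc h (pow_pos hδ 4)
  set m := k * (2 * R + 2) + R with hm
  refine ⟨m, fun n hn => ?_⟩
  have key : {η | ∃ i < k, η ∈ Arm (xi R i) (n + m)} ⊆ (Sd g1 m n ∪ Sd g2 m n) ∪ (Sd g3 m n ∪ Sd g4 m n) := by
    rintro η ⟨i, hi, b, hb, hcn⟩
    have hx : nd 0 (xi R i) ≤ m := by
      have : i * (2 * R + 2) ≤ k * (2 * R + 2) := Nat.mul_le_mul_right _ hi.le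
      unfold nd xi; simp only
      generalize i * (2 * R + 2) = u at *
      simp; omega
    have hu : xi R i ∈ box 0 m := mem_box.2 hx
    have hu' : xi R i ∈ (box 0 n : Set Vert) := by
      rw [Finset.mem_coe, mem_box]; omega
    obtain ⟨b', hb', hnb, hc'⟩ : ∃ b' ∈ box 0 n, nd 0 b' = n ∧ cn η (box 0 n : Set Vert) (xi R i) b' := by
      rcases cn_exit (U := (box 0 n : Set Vert)) hcn hu' with ⟨h1, h2⟩ | ⟨x, y, hx, hy, h1, h2, _⟩
      · exfalso
        rw [Finset.mem_coe, mem_box] at h2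
        have := nd_tri (xi R i) 0 b
        rw [nd_comm (xi R i) 0] at this
        have hpos : 0 < n + m - (n + m) ∨ nd 0 b = n := by omega
        have : nd 0 b = n ∧ nd 0 (xi R i) = m := by omega
        have h3 : i * (2 * R + 2) + (2 * R + 2) ≤ k * (2 * R + 2) := by
          calc _ = (i + 1) * (2 * R + 2) := by ring
            _ ≤ _ := Nat.mul_le_mul_right _ hi
        have h4 := this.2
        unfold nd xi at h4; simp only at h4
        generalize i * (2 * R + 2) = u at *
        simp at h4; omega
      · rw [Finset.mem_coe, mem_box] at hx hy
        obtain ⟨e, he, hs⟩ := h2.2.2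
        have := nd_tri 0 x y
        have := dstep_nd hs
        exact ⟨x, mem_box.2 hx, by omega, cn_mono h1 (fun _ h => h) inter_subset_right⟩
    have : b'.1 = n ∨ -b'.1 = n ∨ b'.2 = n ∨ -b'.2 = n := by
      unfold nd at hnb; simp at hnb; omega
    rcases this with h | h | h | h
    · exact Or.inl (Or.inl ⟨_, hu, b', hb', h, hc'⟩)
    · exact Or.inl (Or.inr ⟨_, hu, b', hb', h, hc'⟩)
    · exact Or.inr (Or.inl ⟨_, hu, b', hb', h, hc'⟩)
    · exact Or.inr (Or.inr ⟨_, hu, b', hb', h, hc'⟩)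
  have h0 := (hRk (n + m) (by omega)).trans (pr_mono q key)
  obtain ⟨s1, s2, s3, s4⟩ := pr_Sd_le q m n
  have d := fun g => dep_Sd g m n
  have i := fun g => incr_Sd g m n
  have u1 := harris_union q (d g1) (d g2) (i g1) (i g2)
  have u2 := harris_union q (d g3) (d g4) (i g3) (i g4)
  have u3 := harris_union q (A := Sd g1 m n ∪ Sd g2 m n) (B := Sd g3 m n ∪ Sd g4 m n)
    (dep_or (d g1) (d g2)) (dep_or (d g3) (d g4)) ((i g1).union (i g2)) ((i g3).union (i g4))
  have p1 : 1 - pr q (Sd g1 m n) ≤ δ := by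
    set t := 1 - pr q (Sd g1 m n) with ht
    have ht0 : 0 ≤ t := by have := pr_le_one q (Sd g1 m n); linarith
    have v1 : t * t ≤ 1 - pr q (Sd g1 m n ∪ Sd g2 m n) :=
      (mul_le_mul_of_nonneg_left (by linarith) ht0).trans u1
    have v2 : t * t ≤ 1 - pr q (Sd g3 m n ∪ Sd g4 m n) :=
      (mul_le_mul (by linarith) (by linarith) ht0 (by linarith)).trans u2
    have v3 : (t * t) * (t * t) ≤ δ ^ 4 := by
      refine (mul_le_mul v1 v2 (by positivity) (le_trans (by positivity) v1)).trans ?_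
      linarith
    by_contra hcon
    push Not at hcon
    have := pow_lt_pow_left₀ hcon hδ.le (n := 4) (by norm_num)
    nlinarith
  have p2 : 1 - pr q (Sd g2 m n) ≤ δ := by linarith
  have h2 : pr q (Sd g1 m n ∪ Sd g2 m n) + pr q (Sd g1 m n ∩ Sd g2 m n) = pr q (Sd g1 m n) + pr q (Sd g2 m n) :=
    measureReal_union_add_inter (d g2).measurableSet
  have := pr_le_one q (Sd g1 m n ∪ Sd g2 m n)
  linarith

end BP

end



noncomputable section

namespace BP

/-- horizontal crossing of a box -/
def HC (x : Vert) (M : ℕ) : Set Config :=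
  {η | ∃ a ∈ box x M, ∃ b ∈ box x M, a.1 = x.1 - M ∧ b.1 = x.1 + M ∧ cn η (box x M : Set Vert) a b}

lemma dep_HC (x : Vert) (M : ℕ) : Dep (ev (box x M) : Set Edge) (· ∈ HC x M) :=
  dep_exists fun u => dep_and (dep_const _ _) (dep_exists fun b => dep_and (dep_const _ _)
    (dep_and (dep_const _ _) (dep_and (dep_const _ _) (dep_cn _ u b))))

lemma incr_HC (x : Vert) (M : ℕ) : Incr (HC x M) := by
  rintro ω η h ⟨u, hu, b, hb, h1, h2, hc⟩
  exact ⟨u, hu, b, hb, h1, h2, cn_mono hc h subset_rfl⟩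

lemma pr_HC_le (q : unitInterval) (x : Vert) (M : ℕ) : pr q (HC x M) ≤ pr q (HC 0 M) := by
  refine pr_le_of_map q (tre (-x)) (tre_inj _) (dep_HC x M).measurableSet ?_
  rintro η ⟨a, ha, b, hb, h1, h2, hc⟩
  have h := cn_map (tre (-x)) (· + (-x)) (tre_dstep _) hc
  rw [mem_box] at ha hb
  have key : ∀ z, nd x z ≤ M → nd 0 (z + -x) ≤ M := by
    intro z hz
    have := nd_add (-x) x z
    rw [add_neg_cancel] at this
    omega
  refine ⟨a + -x, mem_box.2 (key a ha), b + -x, mem_box.2 (key b hb), ?_, ?_, cn_mono h (fun _ h => h) ?_⟩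
  · simp [h1]; ring
  · simp [h2]
  · rintro _ ⟨z, hz, rfl⟩
    exact mem_box.2 (key z (mem_box.1 hz))

/-- arms to the left and to the right -/
def LR (x : Vert) (m N : ℕ) : Set Config :=
  {η | (fun e => η (tre x e)) ∈ Sd g1 m N ∩ Sd g2 m N}

lemma LR_spec {x : Vert} {m N : ℕ} {η : Config} (h : η ∈ LR x m N) :
    ∃ u v l r : Vert, nd x u ≤ m ∧ nd x v ≤ m ∧ nd x l ≤ N ∧ nd x r ≤ N ∧ l.1 = x.1 - N ∧ r.1 = x.1 + N ∧
      cn η (box x N : Set Vert) u l ∧ cn η (box x N : Set Vert) v r := by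
  obtain ⟨⟨v, hv, r, hr, hr1, hcr⟩, ⟨u, hu, l, hl, hl1, hcl⟩⟩ := h
  have hr' := cn_map (tre x) (· + x) (tre_dstep _) hcr
  have hl' := cn_map (tre x) (· + x) (tre_dstep _) hcl
  have key : ∀ z M, nd 0 z ≤ M → nd x (z + x) ≤ M := by
    intro z M hz
    have := nd_add x 0 z
    rw [zero_add] at this
    omega
  have sub : Set.image (fun z => z + x) (box 0 N : Set Vert) ⊆ (box x N : Set Vert) := by
    rintro _ ⟨z, hz, rfl⟩
    exact mem_box.2 (key z _ (mem_box.1 hz))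
  simp only [mem_box] at *
  refine ⟨u + x, v + x, l + x, r + x, key _ _ hu, key _ _ hv, key _ _ hl, key _ _ hr, ?_, ?_,
    cn_mono hl' (fun _ h => h) sub, cn_mono hr' (fun _ h => h) sub⟩
  · simp only [g2] at hl1; simp; omega
  · simp only [g1] at hr1; simp; omega

lemma hit {η : Config} {S : Set Vert} {n : ℕ} {u l : Vert} (h : cn η S u l) (hu : nd 0 u ≤ n)
    (hl : n ≤ nd 0 l) : ∃ l', nd 0 l' = n ∧ cn η (box 0 n : Set Vert) u l' ∧ cn η S l' l := by
  rcases cn_exit (U := (box 0 n : Set Vert)) h (mem_box.2 hu) with ⟨h1, h2⟩ | ⟨x, y, hx, hy, h1, h2, h3⟩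
  · refine ⟨l, ?_, cn_mono h1 (fun _ h => h) inter_subset_right, cn_refl⟩
    have := mem_box.1 h2; omega
  · refine ⟨x, ?_, cn_mono h1 (fun _ h => h) inter_subset_right, Relation.ReflTransGen.head h2 h3⟩
    obtain ⟨_, _, e, _, hs⟩ := h2
    have h4 := dstep_nd hs
    have h5 := mem_box.1 hx
    have h6 : ¬ nd 0 y ≤ n := fun h => hy (mem_box.2 h)
    have := nd_tri 0 x y
    omega

/-- linear independence bound -/
lemma card_le_of_sep {α β : Type*} [DecidableEq α] (X : Finset α) (V : Finset β) (l r : α → β)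
    (hl : ∀ x ∈ X, l x ∈ V) (hr : ∀ x ∈ X, r x ∈ V) (g : α → β → Prop)
    (h1 : ∀ x ∈ X, ∀ y ∈ X, y ≠ x → (g x (l y) ↔ g x (r y)))
    (h2 : ∀ x ∈ X, g x (l x)) (h3 : ∀ x ∈ X, ¬ g x (r x)) : X.card ≤ V.card := by
  classical
  let w : X → (V → ℝ) := fun x => Pi.single ⟨l x, hl x x.2⟩ 1 - Pi.single ⟨r x, hr x x.2⟩ 1
  have hw : LinearIndependent ℝ w := by
    rw [Fintype.linearIndependent_iff]
    intro c hc x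
    have h4 : ∑ v : V, (if g x v then (1:ℝ) else 0) * (∑ y, c y • w y) v = 0 := by rw [hc]; simp
    have h5 : ∀ y : X, ∑ v : V, (if g x v then (1:ℝ) else 0) * w y v = if y = x then 1 else 0 := by
      intro y
      have : ∀ v : V, (if g x v then (1:ℝ) else 0) * w y v =
          (if v = ⟨l y, hl y y.2⟩ then (if g x v then (1:ℝ) else 0) else 0)
          - (if v = ⟨r y, hr y y.2⟩ then (if g x v then (1:ℝ) else 0) else 0) := by
        intro v
        simp only [w, Pi.sub_apply, Pi.single_apply]
        split_ifs <;> simp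
      rw [Finset.sum_congr rfl fun v _ => this v, Finset.sum_sub_distrib]
      simp only [Finset.sum_ite_eq', Finset.mem_univ, if_true]
      by_cases hxy : y = x
      · subst hxy
        simp [h2 y y.2, h3 y y.2]
      · have := h1 x x.2 y y.2 (fun h => hxy (Subtype.ext h))
        simp [this, hxy]
    have h6 : ∑ v : V, (if g x v then (1:ℝ) else 0) * (∑ y, c y • w y) v = c x := by
      simp only [Finset.sum_apply, Pi.smul_apply, smul_eq_mul, Finset.mul_sum]
      rw [Finset.sum_comm]
      have : ∀ y : X, ∑ v : V, (if g x v then (1:ℝ) else 0) * (c y * w y v) = c y * (if y = x then 1 else 0) := by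
        intro y
        rw [← h5 y, Finset.mul_sum]
        exact Finset.sum_congr rfl fun v _ => by ring
      rw [Finset.sum_congr rfl fun y _ => this y]
      simp
    rw [← h6, h4]
  have := hw.fintype_card_le_finrank
  simpa using this

/-- remove edges of a small box -/
def off (x : Vert) (m : ℕ) (η : Config) : Config := splice (ev (box x m) : Set Edge) η (fun _ => false)

lemma off_le {x : Vert} {m : ℕ} {η : Config} {e : Edge} (h : off x m η e = true) : η e = true := by
  unfold off at h
  by_cases he : e ∈ (ev (box x m) : Set Edge)
  · rw [splice_on he] at h; simp at h
  · rwa [splice_off he] at h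

/-- connectivity in a full box -/
lemma cn_full {η : Config} {x : Vert} {m : ℕ} (h : ∀ e ∈ ev (box x m), η e = true) :
    ∀ {u v : Vert}, nd x u ≤ m → nd x v ≤ m → cn η (box x m : Set Vert) u v := by
  have hx : ∀ k : ℕ, ∀ u v : Vert, u.2 = v.2 → nd x u ≤ m → nd x v ≤ m → u.1 + k = v.1 →
      cn η (box x m : Set Vert) u v := by
    intro k
    induction k with
    | zero =>
      intro u v h1 _ _ h2
      have : u = v := by ext <;> simp_all
      rw [this]; exact cn_refl
    | succ k ih =>
      intro u v h1 hu hv h2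
      have hm : nd x (v.1 - 1, v.2) ≤ m := by
        push_cast at h2
        rw [nd_le] at *; omega
      refine (ih u (v.1 - 1, v.2) h1 hu hm (by push_cast at h2 ⊢; omega)).tail
        ⟨mem_box.2 hm, mem_box.2 hv, (v, true), h _ ?_, Or.inr ⟨(dB_true v).symm, rfl⟩⟩
      rw [mem_ev, dB_true]; exact ⟨mem_box.2 hv, mem_box.2 hm⟩
  have hy : ∀ k : ℕ, ∀ u v : Vert, u.1 = v.1 → nd x u ≤ m → nd x v ≤ m → u.2 + k = v.2 →
      cn η (box x m : Set Vert) u v := by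
    intro k
    induction k with
    | zero =>
      intro u v h1 _ _ h2
      have : u = v := by ext <;> simp_all
      rw [this]; exact cn_refl
    | succ k ih =>
      intro u v h1 hu hv h2
      have hm : nd x (v.1, v.2 - 1) ≤ m := by
        push_cast at h2
        rw [nd_le] at *; omega
      refine (ih u (v.1, v.2 - 1) h1 hu hm (by push_cast at h2 ⊢; omega)).tail
        ⟨mem_box.2 hm, mem_box.2 hv, (v, false), h _ ?_, Or.inr ⟨(dB_false v).symm, rfl⟩⟩
      rw [mem_ev, dB_false]; exact ⟨mem_box.2 hv, mem_box.2 hm⟩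
  intro u v hu hv
  have hw : nd x (v.1, u.2) ≤ m := by rw [nd_le] at *; simp only; omega
  have a1 : cn η (box x m : Set Vert) u (v.1, u.2) := by
    rcases le_total u.1 v.1 with h1 | h1
    · exact hx (v.1 - u.1).toNat u _ rfl hu hw (by simp only; omega)
    · exact cn_symm (hx (u.1 - v.1).toNat _ _ rfl hw hu (by simp only; omega))
  have a2 : cn η (box x m : Set Vert) (v.1, u.2) v := by
    rcases le_total u.2 v.2 with h1 | h1
    · exact hy (v.2 - u.2).toNat _ _ rfl hw hv (by simp only; omega)
    · exact cn_symm (hy (u.2 - v.2).toNat _ _ rfl hv hw (by simp only; omega))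
  exact cn_trans a1 a2

/-- boundary of the box -/
def rim (n : ℕ) : Finset Vert := (box 0 n).filter (fun v => nd 0 v = n)

lemma card_rim (n : ℕ) : (rim n).card ≤ 4 * (2 * n + 1) := by
  classical
  have : rim n ⊆ (Finset.Icc (-(n:ℤ)) n).image (fun t => ((n:ℤ), t)) ∪ (Finset.Icc (-(n:ℤ)) n).image (fun t => (-(n:ℤ), t))
      ∪ (Finset.Icc (-(n:ℤ)) n).image (fun t => (t, (n:ℤ))) ∪ (Finset.Icc (-(n:ℤ)) n).image (fun t => (t, -(n:ℤ))) := by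
    rintro ⟨a, b⟩ h
    simp only [rim, Finset.mem_filter] at h
    have h2 := h.2
    simp only [Finset.mem_union, Finset.mem_image, Finset.mem_Icc, Prod.mk.injEq]
    unfold nd at h2
    simp only [Prod.fst_zero, Prod.snd_zero] at h2
    rcases (by omega : (a = n ∧ -(n:ℤ) ≤ b ∧ b ≤ n) ∨ (a = -n ∧ -(n:ℤ) ≤ b ∧ b ≤ n) ∨ (b = n ∧ -(n:ℤ) ≤ a ∧ a ≤ n) ∨ (b = -n ∧ -(n:ℤ) ≤ a ∧ a ≤ n)) with h | h | h | h
    · exact Or.inl (Or.inl (Or.inl ⟨b, h.2, h.1.symm, rfl⟩))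
    · exact Or.inl (Or.inl (Or.inr ⟨b, h.2, h.1.symm, rfl⟩))
    · exact Or.inl (Or.inr ⟨a, h.2, rfl, h.1.symm⟩)
    · exact Or.inr ⟨a, h.2, rfl, h.1.symm⟩
  refine (Finset.card_le_card this).trans ?_
  have hc : ∀ f : ℤ → Vert, ((Finset.Icc (-(n:ℤ)) n).image f).card ≤ 2 * n + 1 := by
    intro f
    refine Finset.card_image_le.trans ?_
    rw [Int.card_Icc]; omega
  refine (Finset.card_union_le _ _).trans ?_
  have h1 := Finset.card_union_le ((Finset.Icc (-(n:ℤ)) n).image (fun t => ((n:ℤ), t)) ∪ (Finset.Icc (-(n:ℤ)) n).image (fun t => (-(n:ℤ), t))) ((Finset.Icc (-(n:ℤ)) n).image (fun t => (t, (n:ℤ))))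
  have h2 := Finset.card_union_le ((Finset.Icc (-(n:ℤ)) n).image (fun t => ((n:ℤ), t))) ((Finset.Icc (-(n:ℤ)) n).image (fun t => (-(n:ℤ), t)))
  have := hc (fun t => ((n:ℤ), t)); have := hc (fun t => (-(n:ℤ), t))
  have := hc (fun t => (t, (n:ℤ))); have := hc (fun t => (t, -(n:ℤ)))
  omega

/-- deterministic bound on bad centres -/
lemma bad_centres (m n : ℕ) (X : Finset Vert) (ω η : Config)
    (h0 : ∀ x ∈ X, 0 ≤ x.1 ∧ ∀ z, nd x z ≤ m → nd 0 z ≤ n)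
    (hsep : ∀ x ∈ X, ∀ y ∈ X, x ≠ y → 2 * m < nd x y)
    (h1 : ∀ x ∈ X, ω ∈ LR x m (2 * n)) (h2 : ∀ x ∈ X, ∀ e ∈ ev (box x m), η e = true)
    (h3 : ∀ x ∈ X, cor ω (off x m η) ∉ HC x (2 * n)) : X.card ≤ 4 * (2 * n + 1) := by
  classical
  have hx0 : ∀ x ∈ X, nd 0 x ≤ n := fun x hx => (h0 x hx).2 x (by rw [nd_self]; omega)
  have hall : ∀ x : Vert, ∃ u v l r l' r' : Vert, x ∈ X → nd x u ≤ m ∧ nd x v ≤ m ∧ nd x l ≤ 2 * n ∧ nd x r ≤ 2 * n ∧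
      l.1 = x.1 - (2 * n : ℕ) ∧ r.1 = x.1 + (2 * n : ℕ) ∧ nd 0 l' = n ∧ nd 0 r' = n ∧
      cn ω (box 0 n : Set Vert) u l' ∧ cn ω (box x (2 * n) : Set Vert) l' l ∧
      cn ω (box 0 n : Set Vert) v r' ∧ cn ω (box x (2 * n) : Set Vert) r' r := by
    intro x
    by_cases hx : x ∈ X
    · obtain ⟨u, v, l, r, hu, hv, hl, hr, hl1, hr1, hc, hc'⟩ := LR_spec (h1 x hx)
      have hx1 := hx0 x hx
      have hx2 := (h0 x hx).1
      obtain ⟨l', a1, a2, a3⟩ := hit hc ((h0 x hx).2 u hu) (by unfold nd at *; simp at *; omega)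
      obtain ⟨r', b1, b2, b3⟩ := hit hc' ((h0 x hx).2 v hv) (by unfold nd at *; simp at *; omega)
      exact ⟨u, v, l, r, l', r', fun _ => ⟨hu, hv, hl, hr, hl1, hr1, a1, b1, a2, a3, b2, b3⟩⟩
    · exact ⟨0, 0, 0, 0, 0, 0, fun h => absurd h hx⟩
  choose u v l r l' r' H using hall
  have hcor1 : ∀ x : Vert, ∀ e, ω e = true → cor ω (off x m η) e = true := fun x e he => by simp [cor, he]
  refine le_trans (card_le_of_sep X (rim n) l' r' ?_ ?_ (fun x z => cn (cor ω (off x m η)) (box 0 n : Set Vert) (l' x) z) ?_ ?_ ?_) (card_rim n)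
  · intro x hx
    have := (H x hx).2.2.2.2.2.2.1
    simp [rim, mem_box, this]
  · intro x hx
    have := (H x hx).2.2.2.2.2.2.2.1
    simp [rim, mem_box, this]
  · intro x hx y hy hxy
    obtain ⟨hu, hv, -, -, -, -, -, -, c1, -, c2, -⟩ := H y hy
    have hlr : cn (cor ω (off x m η)) (box 0 n : Set Vert) (l' y) (r' y) := by
      refine cn_trans (cn_symm (cn_mono c1 (hcor1 x) subset_rfl)) (cn_trans ?_ (cn_mono c2 (hcor1 x) subset_rfl))
      have : ∀ e ∈ ev (box y m), cor ω (off x m η) e = true := by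
        intro e he
        have hd := Finset.disjoint_right.1 (disjoint_ev (a := x) (b := y) (R := m) (R' := m) (by have := hsep x hx y hy (Ne.symm hxy); omega)) he
        simp only [cor, off]
        rw [splice_off (by exact_mod_cast hd), h2 y hy e he]; simp
      exact cn_mono (cn_full this hu hv) (fun _ h => h) (fun z hz => mem_box.2 ((h0 y hy).2 z (mem_box.1 hz)))
    exact ⟨fun h => cn_trans h hlr, fun h => cn_trans h (cn_symm hlr)⟩
  · intro x hx; exact cn_refl
  · intro x hx hcn
    obtain ⟨hu, hv, hl, hr, hl1, hr1, -, -, c1, d1, c2, d2⟩ := H x hx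
    refine h3 x hx ⟨l x, mem_box.2 hl, r x, mem_box.2 hr, by rw [hl1], by rw [hr1], ?_⟩
    refine cn_trans (cn_symm (cn_mono d1 (hcor1 x) subset_rfl)) (cn_trans (cn_mono hcn (fun _ h => h) ?_) (cn_mono d2 (hcor1 x) subset_rfl))
    intro z hz
    have h4 := mem_box.1 hz
    have h5 := hx0 x hx
    have h6 := nd_tri x 0 z
    rw [nd_comm x 0] at h6
    exact mem_box.2 (by omega)


lemma dep_off (ω : Config) (x : Vert) (m N : ℕ) :
    Dep ((ev (box x N) \ ev (box x m) : Finset Edge) : Set Edge) (fun η => ind (HC x N) (cor ω (off x m η))) := by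
  classical
  intro η η' h
  refine (dep_HC x N).ind _ _ fun e he => ?_
  simp only [cor, off]
  by_cases h1 : e ∈ (ev (box x m) : Set Edge)
  · rw [splice_on h1, splice_on h1]
  · rw [splice_off h1, splice_off h1, h e (by simp only [Finset.coe_sdiff]; exact ⟨he, h1⟩)]

lemma card_ev_le (S : Finset Vert) : (ev S).card ≤ 2 * S.card := by
  unfold ev
  refine (Finset.card_filter_le _ _).trans ?_
  rw [Finset.card_product]; simp [mul_comm]

lemma crossing_sum (q s : unitInterval) (m n : ℕ) (X : Finset Vert)
    (h0 : ∀ x ∈ X, 0 ≤ x.1 ∧ ∀ z, nd x z ≤ m → nd 0 z ≤ n)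
    (hsep : ∀ x ∈ X, ∀ y ∈ X, x ≠ y → 2 * m < nd x y) :
    (s : ℝ) ^ (2 * (2 * m + 1) ^ 2) * ((X.card : ℝ) *
      (pr q (Sd g1 m (2 * n) ∩ Sd g2 m (2 * n)) - pr (oplus q s) (HC 0 (2 * n)))) ≤ 4 * (2 * n + 1) := by
  classical
  have hs := s.2.1; have hs' := s.2.2
  set σ := (s : ℝ) ^ (2 * (2 * m + 1) ^ 2) with hσ
  have hσ0 : 0 ≤ σ := pow_nonneg hs _
  have hSm : MeasurableSet (Sd g1 m (2 * n) ∩ Sd g2 m (2 * n)) :=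
    (dep_Sd g1 m (2*n)).measurableSet.inter (dep_Sd g2 m (2*n)).measurableSet
  have hLRm : ∀ x, MeasurableSet (LR x m (2 * n)) := by
    intro x
    have : Measurable (fun (η : Config) e => η (tre x e)) := by fun_prop
    exact this hSm
  let T : Vert → Set Config := fun x => {η | ∀ e ∈ ev (box x m), η e = true}
  have hT : ∀ x, Dep (ev (box x m) : Set Edge) (· ∈ T x) := by
    intro x η η' h
    simp only [T, mem_ofPred_eq, eq_iff_iff]
    exact forall₂_congr fun e he => by rw [h e he]
  have hHm : ∀ x, MeasurableSet (HC x (2 * n)) := fun x => (dep_HC x _).measurableSet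
  -- pointwise inequality
  have key : ∀ ω, ∑ x ∈ X, σ * (ind (LR x m (2 * n)) ω - ∫ η, ind (HC x (2 * n)) (cor ω η) ∂(mu s)) ≤ 4 * (2 * n + 1) := by
    intro ω
    have hdep1 : ∀ x, Dep ((ev (box x (2 * n)) \ ev (box x m) : Finset Edge) : Set Edge)
        (fun η => 1 - ind (HC x (2 * n)) (cor ω (off x m η))) := fun x => (dep_off ω x m (2 * n)).comp (fun t => 1 - t)
    have hIntg : ∀ x, Integrable (fun η => ind (LR x m (2 * n)) ω * (ind (T x) η * (1 - ind (HC x (2 * n)) (cor ω (off x m η))))) (mu s) := by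
      intro x
      have d : Dep ((ev (box x m) ∪ (ev (box x (2 * n)) \ ev (box x m)) : Finset Edge) : Set Edge) (fun η => ind (LR x m (2 * n)) ω * (ind (T x) η * (1 - ind (HC x (2 * n)) (cor ω (off x m η))))) := by
        refine (Dep.comp2 ((hT x).ind.mono ?_) ((hdep1 x).mono ?_) (fun a b => ind (LR x m (2 * n)) ω * (a * b)))
        · exact_mod_cast Finset.subset_union_left
        · exact_mod_cast Finset.subset_union_right
      exact d.integrable _
    have e1 : ∀ x ∈ X, σ * (ind (LR x m (2 * n)) ω - ∫ η, ind (HC x (2 * n)) (cor ω η) ∂(mu s)) ≤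
        ∫ η, ind (LR x m (2 * n)) ω * (ind (T x) η * (1 - ind (HC x (2 * n)) (cor ω (off x m η)))) ∂(mu s) := by
      intro x _
      rw [integral_const_mul, integral_mul_dep s (hT x).ind (hdep1 x) Finset.disjoint_sdiff,
        ← pr_eq_integral s (hT x).measurableSet, pr_all_true]
      have i1 : Integrable (fun η => ind (HC x (2 * n)) (cor ω (off x m η))) (mu s) := (dep_off ω x m (2*n)).integrable _
      have i2 : Integrable (fun η => ind (HC x (2 * n)) (cor ω η)) (mu s) :=
        Integrable.of_bound ((measurable_ind (hHm x)).comp (measurable_cor_right ω)).aestronglyMeasurable 1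
          (ae_of_all _ fun _ => ind_abs_le_one _ _)
      rw [integral_sub (integrable_const _) i1]
      simp only [integral_const, probReal_univ, smul_eq_mul, mul_one]
      have hle : ∫ η, ind (HC x (2 * n)) (cor ω (off x m η)) ∂(mu s) ≤ ∫ η, ind (HC x (2 * n)) (cor ω η) ∂(mu s) := by
        refine integral_mono i1 i2 fun η => ?_
        by_cases h1 : cor ω (off x m η) ∈ HC x (2 * n)
        · have : cor ω η ∈ HC x (2 * n) := by
            refine incr_HC _ _ _ _ (fun e he => ?_) h1
            simp only [cor, Bool.or_eq_true] at he ⊢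
            exact he.imp id off_le
          simp only; rw [ind_of_mem h1, ind_of_mem this]
        · simp only; rw [ind_of_notMem h1]; exact ind_nonneg _ _
      have hle0 : 0 ≤ ∫ η, ind (HC x (2 * n)) (cor ω (off x m η)) ∂(mu s) := integral_nonneg fun _ => ind_nonneg _ _
      have hle1 : ∫ η, ind (HC x (2 * n)) (cor ω (off x m η)) ∂(mu s) ≤ 1 := by
        calc _ ≤ ∫ η, (1:ℝ) ∂(mu s) := integral_mono i1 (integrable_const _) fun _ => ind_le_one _ _
          _ = 1 := by simp
      have hpow : σ ≤ (s : ℝ) ^ (ev (box x m)).card := by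
        refine pow_le_pow_of_le_one hs hs' ?_
        have := card_ev_le (box x m)
        rw [card_box] at this; exact this
      have := ind_nonneg (LR x m (2 * n)) ω
      have := ind_le_one (LR x m (2 * n)) ω
      generalize (∫ η, ind (HC x (2 * n)) (cor ω (off x m η)) ∂(mu s)) = I at *
      generalize (∫ η, ind (HC x (2 * n)) (cor ω η) ∂(mu s)) = J at *
      generalize ind (LR x m (2 * n)) ω = L at *
      generalize (s : ℝ) ^ (ev (box x m)).card = t at *
      calc σ * (L - J) ≤ σ * (L * (1 - I)) := by
            refine mul_le_mul_of_nonneg_left ?_ hσ0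
            nlinarith
        _ ≤ t * (L * (1 - I)) := mul_le_mul_of_nonneg_right hpow (mul_nonneg (by assumption) (by linarith))
        _ = _ := by ring
    refine (Finset.sum_le_sum e1).trans ?_
    rw [← integral_finset_sum _ fun x _ => hIntg x]
    calc _ ≤ ∫ η, (4 * (2 * n + 1) : ℝ) ∂(mu s) := by
          refine integral_mono (integrable_finset_sum _ fun x _ => hIntg x) (integrable_const _) fun η => ?_
          let X' := X.filter (fun x => ω ∈ LR x m (2 * n) ∧ η ∈ T x ∧ cor ω (off x m η) ∉ HC x (2 * n))
          have hX' : ∀ x ∈ X', x ∈ X ∧ ω ∈ LR x m (2 * n) ∧ η ∈ T x ∧ cor ω (off x m η) ∉ HC x (2 * n) := by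
            intro x hx; simpa [X'] using hx
          have hb := bad_centres m n X' ω η (fun x hx => h0 x (hX' x hx).1)
            (fun x hx y hy => hsep x (hX' x hx).1 y (hX' y hy).1) (fun x hx => (hX' x hx).2.1)
            (fun x hx => (hX' x hx).2.2.1) (fun x hx => (hX' x hx).2.2.2)
          have : ∑ x ∈ X, ind (LR x m (2 * n)) ω * (ind (T x) η * (1 - ind (HC x (2 * n)) (cor ω (off x m η)))) = (X'.card : ℝ) := by
            rw [Finset.card_filter]
            push_cast
            refine Finset.sum_congr rfl fun x _ => ?_
            by_cases a1 : ω ∈ LR x m (2 * n) <;> by_cases a2 : η ∈ T x <;> by_cases a3 : cor ω (off x m η) ∈ HC x (2 * n) <;>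
              simp [ind, a1, a2, a3]
          simp only [this]
          exact_mod_cast hb
      _ = _ := by simp
  have hi1 : ∀ x, Integrable (fun ω => ∫ η, ind (HC x (2 * n)) (cor ω η) ∂(mu s)) (mu q) := fun x => integrable_ind_cor q s (hHm x)
  have hi2 : ∀ x, Integrable (fun ω => σ * (ind (LR x m (2 * n)) ω - ∫ η, ind (HC x (2 * n)) (cor ω η) ∂(mu s))) (mu q) :=
    fun x => ((integrable_ind_of (hLRm x)).sub (hi1 x)).const_mul σ
  have h1 := integral_mono (μ := mu q) (integrable_finset_sum X fun x _ => hi2 x) (integrable_const (4 * (2 * (n:ℝ) + 1))) key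
  rw [integral_finset_sum X fun x _ => hi2 x] at h1
  simp only [integral_const, probReal_univ, smul_eq_mul, one_mul] at h1
  refine le_trans ?_ h1
  have h2 : ∀ x ∈ X, σ * (pr q (Sd g1 m (2 * n) ∩ Sd g2 m (2 * n)) - pr (oplus q s) (HC 0 (2 * n))) ≤
      ∫ ω, σ * (ind (LR x m (2 * n)) ω - ∫ η, ind (HC x (2 * n)) (cor ω η) ∂(mu s)) ∂(mu q) := by
    intro x _
    rw [integral_const_mul, integral_sub (integrable_ind_of (hLRm x)) (hi1 x), ← pr_eq_integral q (hLRm x),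
      ← integral_oplus q s _ (measurable_ind (hHm x)) (ind_abs_le_one _), ← pr_eq_integral _ (hHm x)]
    have : pr q (LR x m (2 * n)) = pr q (Sd g1 m (2 * n) ∩ Sd g2 m (2 * n)) := pr_reindex q (tre x) (tre_inj x) hSm
    rw [this]
    refine mul_le_mul_of_nonneg_left ?_ hσ0
    have := pr_HC_le (oplus q s) x (2 * n)
    linarith
  have h3 := Finset.sum_le_sum h2
  rw [Finset.sum_const, nsmul_eq_mul] at h3
  refine le_trans (le_of_eq ?_) h3
  ring

/-- square grid -/
def grid (D k : ℕ) : Finset Vert :=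
  (Finset.range k ×ˢ Finset.range k).image (fun z => (((D * z.1 : ℕ) : ℤ), ((D * z.2 : ℕ) : ℤ)))

lemma card_grid {D : ℕ} (hD : 0 < D) (k : ℕ) : (grid D k).card = k ^ 2 := by
  unfold grid
  rw [Finset.card_image_of_injective, Finset.card_product, Finset.card_range, sq]
  rintro ⟨a, b⟩ ⟨c, d⟩ h
  simp only [Prod.mk.injEq, Nat.cast_inj] at h
  rw [Nat.mul_right_inj hD.ne', Nat.mul_right_inj hD.ne'] at h
  exact Prod.ext h.1 h.2

theorem crossing_high {q s : unitInterval} {c : ℝ} (hc : 0 < c) (h : ∀ n, c ≤ th q n) (hs : 0 < (s:ℝ)) {δ : ℝ}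
    (hδ : 0 < δ) : ∃ M, 1 - 3 * δ ≤ pr (oplus q s) (HC 0 M) ∧ 1 - 3 * δ ≤ pr (oplus q s) (HC 0 (M + 2)) := by
  obtain ⟨m, hm⟩ := sides hc h hδ
  set σ := (s : ℝ) ^ (2 * (2 * m + 1) ^ 2) with hσ
  have hσ0 : 0 < σ := pow_pos hs _
  obtain ⟨k, hk⟩ := exists_nat_ge (20 * (2 * (m:ℝ) + 1) / (σ * δ) + m + 10)
  have hkpos : 0 ≤ 20 * (2 * (m:ℝ) + 1) / (σ * δ) := by positivity
  have hm0 : (0:ℝ) ≤ m := Nat.cast_nonneg m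
  have hk10 : m + 10 ≤ k := by
    have : (m:ℝ) + 10 ≤ k := by linarith
    exact_mod_cast this
  have hkn : k ≤ k * (2 * m + 1) := Nat.le_mul_of_pos_right _ (by omega)
  suffices H : ∀ n, n = k * (2 * m + 1) ∨ n = k * (2 * m + 1) + 1 → 1 - 3 * δ ≤ pr (oplus q s) (HC 0 (2 * n)) from
    ⟨2 * (k * (2 * m + 1)), H _ (Or.inl rfl), H (k * (2 * m + 1) + 1) (Or.inr rfl)⟩
  intro n hn'
  have hn : k * (2 * m + 1) ≤ n := by omega
  have hcs := crossing_sum q s m n (grid (2 * m + 1) k) ?_ ?_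
  · rw [card_grid (by omega)] at hcs
    have h1 := hm (2 * n) (by omega)
    by_contra hcon
    push Not at hcon
    have h2 : δ < pr q (Sd g1 m (2 * n) ∩ Sd g2 m (2 * n)) - pr (oplus q s) (HC 0 (2 * n)) := by linarith
    generalize pr q (Sd g1 m (2 * n) ∩ Sd g2 m (2 * n)) - pr (oplus q s) (HC 0 (2 * n)) = Δ at *
    rw [← hσ] at hcs
    have hk0 : (0:ℝ) < k := by have : 0 < k := by omega
                               exact_mod_cast this
    have hnc : (n:ℝ) ≤ k * (2 * m + 1) + 1 := by
      have : n ≤ k * (2 * m + 1) + 1 := by omega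
      exact_mod_cast this
    push_cast at hcs
    have h3 : 20 * (2 * (m:ℝ) + 1) ≤ σ * δ * k := by
      have : 20 * (2 * (m:ℝ) + 1) / (σ * δ) ≤ k := by linarith
      rw [div_le_iff₀ (by positivity)] at this
      linarith
    have hk1 : (1:ℝ) ≤ k := by have : 1 ≤ k := by omega
                               exact_mod_cast this
    have h4 : σ * (k ^ 2 * δ) < σ * (k ^ 2 * Δ) := by
      refine mul_lt_mul_of_pos_left (mul_lt_mul_of_pos_left h2 (by positivity)) hσ0
    have h5 : 20 * (2 * (m:ℝ) + 1) * k ≤ σ * (k ^ 2 * δ) := by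
      calc 20 * (2 * (m:ℝ) + 1) * k ≤ σ * δ * k * k := mul_le_mul_of_nonneg_right h3 hk0.le
        _ = _ := by ring
    nlinarith
  · intro x hx
    simp only [grid, Finset.mem_image, Finset.mem_product, Finset.mem_range] at hx
    obtain ⟨⟨i, j⟩, ⟨hi, hj⟩, rfl⟩ := hx
    refine ⟨by positivity, fun z hz => ?_⟩
    have h1 : (2 * m + 1) * i + (2 * m + 1) ≤ n := by refine le_trans ?_ hn; nlinarith
    have h2 : (2 * m + 1) * j + (2 * m + 1) ≤ n := by refine le_trans ?_ hn; nlinarith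
    unfold nd at *
    simp only [Prod.fst_zero, Prod.snd_zero] at *
    generalize (2 * m + 1) * i = a at *
    generalize (2 * m + 1) * j = b at *
    omega
  · intro x hx y hy hxy
    simp only [grid, Finset.mem_image, Finset.mem_product, Finset.mem_range] at hx hy
    obtain ⟨⟨i, j⟩, -, rfl⟩ := hx
    obtain ⟨⟨i', j'⟩, -, rfl⟩ := hy
    have : i ≠ i' ∨ j ≠ j' := by
      by_contra hcon
      push Not at hcon
      rw [hcon.1, hcon.2] at hxy
      exact hxy rfl
    have aux : ∀ a b : ℕ, a ≠ b → 2 * m < ((((2 * m + 1) * a : ℕ) : ℤ) - (((2 * m + 1) * b : ℕ) : ℤ)).natAbs := by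
      intro a b hab
      have h3 : ((((2 * m + 1) * a : ℕ) : ℤ) - (((2 * m + 1) * b : ℕ) : ℤ)) = ((2 * m + 1 : ℕ) : ℤ) * ((a:ℤ) - b) := by push_cast; ring
      rw [h3, Int.natAbs_mul]
      have h4 : 1 ≤ ((a:ℤ) - b).natAbs := by omega
      rw [Int.natAbs_natCast]
      nlinarith
    unfold nd
    rcases this with h1 | h1
    · exact lt_of_lt_of_le (aux _ _ h1) (le_max_left _ _)
    · exact lt_of_lt_of_le (aux _ _ h1) (le_max_right _ _)


/-- extended crossing -/
def XC (M : ℕ) : Set Config :=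
  {η | ∃ a b : Vert, a.1 = -M - 3 ∧ b.1 = M + 2 ∧ |a.2| ≤ M ∧ |b.2| ≤ M ∧
    cn η {x | -(M:ℤ) - 3 ≤ x.1 ∧ x.1 ≤ M + 2 ∧ |x.2| ≤ M} a b}

lemma XC_dep (M : ℕ) : Dep (ev (Finset.Icc (-(M:ℤ) - 3) (M + 2) ×ˢ Finset.Icc (-(M:ℤ)) M) : Set Edge) (· ∈ XC M) := by
  have : {x : Vert | -(M:ℤ) - 3 ≤ x.1 ∧ x.1 ≤ M + 2 ∧ |x.2| ≤ M} =
      ((Finset.Icc (-(M:ℤ) - 3) (M + 2) ×ˢ Finset.Icc (-(M:ℤ)) M : Finset Vert) : Set Vert) := by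
    ext x; simp only [Finset.mem_coe, Finset.mem_product, Finset.mem_Icc, mem_ofPred_eq, abs_le]; tauto
  unfold XC
  rw [this]
  exact dep_exists fun a => dep_exists fun b => dep_and (dep_const _ _) (dep_and (dep_const _ _)
    (dep_and (dep_const _ _) (dep_and (dep_const _ _) (dep_cn _ a b))))

lemma XC_sprinkle (q s : unitInterval) (M : ℕ) : (s : ℝ) ^ 5 * pr q (HC 0 M) ≤ pr (oplus q s) (XC M) := by
  classical
  refine sprinkle q s 5 (dep_HC 0 M).measurableSet (XC_dep M).measurableSet ?_
  rintro ω ⟨a, ha, b, hb, h1, h2, hc⟩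
  rw [mem_box, nd_le] at ha hb
  simp only [Prod.fst_zero, Prod.snd_zero, zero_sub, zero_add] at ha hb h1 h2
  obtain ⟨a1, a2⟩ := a
  obtain ⟨b1, b2⟩ := b
  simp only at *
  subst h1 h2
  refine ⟨{((-(M:ℤ), a2), true), ((-(M:ℤ) - 1, a2), true), ((-(M:ℤ) - 1 - 1, a2), true), (((M:ℤ) + 1, b2), true), (((M:ℤ) + 1 + 1, b2), true)}, Finset.card_le_five, fun η hη => ?_⟩
  have haa : |a2| ≤ M := abs_le.2 ⟨by omega, by omega⟩
  have hbb : |b2| ≤ M := abs_le.2 ⟨by omega, by omega⟩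
  refine ⟨(-(M:ℤ) - 3, a2), ((M:ℤ) + 2, b2), rfl, rfl, haa, hbb, ?_⟩
  have hmid : cn (cor ω η) {x | -(M:ℤ) - 3 ≤ x.1 ∧ x.1 ≤ M + 2 ∧ |x.2| ≤ M} (-(M:ℤ), a2) ((M:ℤ), b2) := by
    refine cn_mono hc (fun e he => by simp [cor, he]) ?_
    intro x hx
    have := nd_le.1 (mem_box.1 hx)
    simp only [Prod.fst_zero, Prod.snd_zero, zero_sub] at this
    refine ⟨by omega, by omega, abs_le.2 ⟨by omega, by omega⟩⟩
  have step : ∀ t y : ℤ, -(M:ℤ) - 3 ≤ t - 1 → t ≤ M + 2 → |y| ≤ M → ((t, y), true) ∈ ({((-(M:ℤ), a2), true), ((-(M:ℤ) - 1, a2), true), ((-(M:ℤ) - 1 - 1, a2), true), (((M:ℤ) + 1, b2), true), (((M:ℤ) + 1 + 1, b2), true)} : Finset Edge) →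
      cn (cor ω η) {x | -(M:ℤ) - 3 ≤ x.1 ∧ x.1 ≤ M + 2 ∧ |x.2| ≤ M} (t - 1, y) (t, y) := by
    intro t y ht ht' hy he
    refine Relation.ReflTransGen.single ⟨⟨ht, by simp only; omega, hy⟩, ⟨by simp only; omega, ht', hy⟩, ((t, y), true), ?_, ?_⟩
    · simp [cor, hη _ he]
    · right; exact ⟨(dB_true (t, y)).symm, rfl⟩
  have s1 := step (-(M:ℤ) - 1 - 1) a2 (by omega) (by omega) haa (by simp)
  have s2 := step (-(M:ℤ) - 1) a2 (by omega) (by omega) haa (by simp)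
  have s3 := step (-(M:ℤ)) a2 (by omega) (by omega) haa (by simp)
  have s4 := step ((M:ℤ) + 1) b2 (by omega) (by omega) hbb (by simp)
  have s5 := step ((M:ℤ) + 1 + 1) b2 (by omega) (by omega) hbb (by simp)
  rw [show (-(M:ℤ) - 1 - 1 - 1) = -(M:ℤ) - 3 by ring] at s1
  rw [show (M:ℤ) + 1 - 1 = M by ring] at s4
  rw [show (M:ℤ) + 1 + 1 - 1 = M + 1 by ring, show (M:ℤ) + 1 + 1 = M + 2 by ring] at s5
  exact cn_trans s1 (cn_trans s2 (cn_trans s3 (cn_trans hmid (cn_trans s4 s5))))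

/-- the isomorphism between the dual graph and the primal graph -/
def sg (x : Vert) : Vert := (-x.2, -x.1)
def ta (e : Edge) : Edge := (sg e.1, e.2)

lemma ta_inj : Function.Injective ta := by
  rintro ⟨⟨a, b⟩, c⟩ ⟨⟨a', b'⟩, c'⟩ h
  simp only [ta, sg, Prod.mk.injEq, neg_inj] at h ⊢
  tauto

lemma tip_ta (e : Edge) : edgeTip (ta e) = sg (dB e) := by
  obtain ⟨⟨a, b⟩, c⟩ := e
  cases c <;> simp [ta, sg, edgeTip, dB_true, dB_false] <;> ring

/-- column sums of a walk -/
lemma column_sum {a b : Vert} {l : List Edge} (h : DWalk a l b) (x1 r1 r2 : ℤ)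
    (hl : ∀ e ∈ l, r1 ≤ e.1.2 ∧ e.1.2 < r2) :
    ∑ s ∈ Finset.Ico r1 r2, Nw l ((x1, s), true) = (if a.1 < x1 then 1 else 0) + (if b.1 < x1 then 1 else 0) := by
  induction h with
  | nil a => simp [Nw, z2_self]
  | cons hs _ ih =>
    rename_i a b c e l _
    rw [Nw_cons]
    simp only [Finset.sum_add_distrib]
    rw [ih fun e he => hl e (by simp [he])]
    have h1 : ∑ s ∈ Finset.Ico r1 r2, Ne e ((x1, s), true) = (if a.1 < x1 then 1 else 0) + (if b.1 < x1 then (1:Z2) else 0) := by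
      have hr := hl e (by simp)
      obtain ⟨⟨y1, y2⟩, d⟩ := e
      simp only at hr
      have hsw : (if y1 < x1 then 1 else 0) + (if (dB ((y1, y2), d)).1 < x1 then 1 else 0) =
          (if a.1 < x1 then 1 else 0) + (if b.1 < x1 then (1:Z2) else 0) := by
        rcases hs with ⟨rfl, rfl⟩ | ⟨rfl, rfl⟩
        · rfl
        · rw [add_comm]
      rw [← hsw]
      cases d
      · simp [Ne, dB_false, z2_self]
      · rw [dB_true]
        simp only [Ne, Prod.mk.injEq, and_true]
        by_cases hx : x1 = y1
        · subst hx
          simp only [true_and, Finset.sum_ite_eq', Finset.mem_Ico, hr, and_self, if_true]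
          simp
        · simp only [hx, false_and, if_false, Finset.sum_const_zero]
          have : (y1 < x1) ↔ (y1 - 1 < x1) := by omega
          simp only [this, z2_self]
    rw [h1]
    generalize (if a.1 < x1 then (1:Z2) else 0) = u
    generalize (if b.1 < x1 then (1:Z2) else 0) = v
    generalize (if c.1 < x1 then (1:Z2) else 0) = w
    revert u v w; decide

lemma exclusive (M : ℕ) (η : Config) (h1 : η ∈ HC 0 (M + 2)) (h2 : (fun e => !(η (ta e))) ∈ XC M) : False := by
  obtain ⟨a, ha, b, hb, ha1, hb1, hc⟩ := h1
  obtain ⟨l, hw, hl⟩ := walk_of_cn hc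
  have hl' : ∀ e ∈ l, η e = true ∧ -(M:ℤ) - 2 ≤ e.1.1 ∧ e.1.1 ≤ M + 2 ∧ -(M:ℤ) - 2 ≤ e.1.2 ∧ e.1.2 ≤ M + 2 ∧
      -(M:ℤ) - 2 ≤ (dB e).1 ∧ (dB e).1 ≤ M + 2 ∧ -(M:ℤ) - 2 ≤ (dB e).2 ∧ (dB e).2 ≤ M + 2 := by
    intro e he
    obtain ⟨h1, h2, h3⟩ := hl e he
    simp only [Finset.mem_coe] at h2 h3
    rw [mem_box, nd_le] at h2 h3
    push_cast at h2 h3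
    simp only [Prod.fst_zero, Prod.snd_zero, zero_sub] at h2 h3
    refine ⟨h1, ?_⟩; omega
  push_cast at ha1 hb1
  simp only [Prod.fst_zero, Prod.snd_zero, zero_sub, zero_add] at ha1 hb1
  obtain ⟨B, hB⟩ := rect_potential (Nw l) (-M - 1) (M + 2) (-M - 2) (M + 3) (by
    intro y hy1 hy2 _ _
    rw [pl_Nw hw]
    have e1 : y ≠ a := by rintro rfl; omega
    have e2 : y ≠ b := by rintro rfl; omega
    simp [dl, e1, e2])
  -- constancy along rows
  have row : ∀ r : ℤ, (r = -M - 2 ∨ r = M + 3) → ∀ k : ℕ, (-(M:ℤ) - 1 + k ≤ M + 2) → B (-M - 1 + k, r) = B (-M - 1, r) := by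
    intro r hr k
    induction k with
    | zero => intro _; simp
    | succ k ih =>
      intro hk
      push_cast at hk
      rw [← ih (by omega)]
      have h3 := hB ((-M - 1 + k, r), false) (by simp only; omega) (by simp [edgeTip]; omega) (by simp only; omega) (by simp [edgeTip]; omega)
      have h4 : Nw l ((-M - 1 + k, r), false) = 0 := by
        by_contra hcon
        have := hl' _ (Nw_ne_zero hcon)
        rw [dB_false] at this
        simp only at this
        omega
      rw [h4] at h3
      simp only [dA, tip_false, Prod.mk_add_mk, add_zero] at h3
      have h5 := z2_eq_of_add h3
      rw [h5]; congr 2; push_cast; ring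
  -- column
  have col : ∀ k : ℕ, (-(M:ℤ) - 2 + k ≤ M + 3) → B (-M - 1, -M - 2) + B (-M - 1, -M - 2 + k) = ∑ s ∈ Finset.Ico (-(M:ℤ) - 2) (-M - 2 + k), Nw l ((-M - 1, s), true) := by
    intro k
    induction k with
    | zero => intro _; simp [z2_self]
    | succ k ih =>
      intro hk
      push_cast at hk
      have ih := ih (by omega)
      have e1 : (-(M:ℤ) - 2 + (k + 1 : ℕ)) = (-(M:ℤ) - 2 + k) + 1 := by push_cast; ring
      rw [e1, ← Finset.insert_Ico_right_eq_Ico_add_one (by omega), Finset.sum_insert (by simp), ← ih,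
        ← hB ((-M - 1, -M - 2 + k), true) (by simp) (by simp [edgeTip]; omega) (by simp only; omega) (by simp [edgeTip]; omega)]
      simp only [dA, tip_true, Prod.mk_add_mk, add_zero]
      generalize B (-M - 1, -M - 2) = u
      generalize B (-M - 1, -M - 2 + k) = v
      generalize B (-M - 1, -M - 2 + k + 1) = w
      revert u v w; decide
  have hcol := col (2 * M + 5) (by push_cast; omega)
  rw [show (-(M:ℤ) - 2 + (2 * M + 5 : ℕ)) = M + 3 by push_cast; ring, column_sum hw _ _ _ (fun e he => by have := hl' e he; omega)] at hcol
  rw [if_pos (by omega), if_neg (by omega)] at hcol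
  -- constancy along the primal path
  obtain ⟨c, d, hc1, hd1, hc2, hd2, hcd⟩ := h2
  have hconst : B (sg c) = B (sg d) := by
    clear hd1 hd2
    induction hcd with
    | refl => rfl
    | tail _ hbc ih =>
      rw [ih]
      obtain ⟨hx, hy, e, he, hs⟩ := hbc
      have hx1 := abs_le.1 hx.2.2
      have hy1 := abs_le.1 hy.2.2
      have hb : -(M:ℤ) - 1 ≤ (sg e.1).1 ∧ (sg (dB e)).1 ≤ M + 2 ∧ -(M:ℤ) - 2 ≤ (sg e.1).2 ∧ (sg (dB e)).2 ≤ M + 3 := by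
        have := hx.1; have := hx.2.1; have := hy.1; have := hy.2.1
        rcases hs with ⟨h, h'⟩ | ⟨h, h'⟩ <;> rw [← h, ← h'] <;> simp only [sg] <;> omega
      have h3 := hB (ta e) hb.1 (by rw [tip_ta]; exact hb.2.1) hb.2.2.1 (by rw [tip_ta]; exact hb.2.2.2)
      have h4 : Nw l (ta e) = 0 := by
        by_contra hcon
        have := (hl' _ (Nw_ne_zero hcon)).1
        simp [this] at he
      rw [h4, dA, tip_ta] at h3
      have h5 := z2_eq_of_add h3
      rcases hs with ⟨rfl, rfl⟩ | ⟨rfl, rfl⟩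
      · exact h5
      · exact h5.symm
  have hc2 := abs_le.1 hc2
  have hd2 := abs_le.1 hd2
  have r1 := row (M + 3) (Or.inr rfl) (-c.2 + M + 1).toNat (by omega)
  have r2 := row (-M - 2) (Or.inl rfl) (-d.2 + M + 1).toNat (by omega)
  rw [show (-(M:ℤ) - 1 + (-c.2 + M + 1).toNat, (M:ℤ) + 3) = sg c by ext <;> simp [sg] <;> omega] at r1
  rw [show (-(M:ℤ) - 1 + (-d.2 + M + 1).toNat, -(M:ℤ) - 2) = sg d by ext <;> simp [sg] <;> omega] at r2
  rw [← r1, ← r2, hconst, z2_self] at hcol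
  simp at hcol

theorem exp_decay {q : unitInterval} (hq : (q:ℝ) < 1 / 2) :
    ∃ C ρ : ℝ, 0 < C ∧ 0 < ρ ∧ ρ < 1 ∧ ∀ n, th q n ≤ C * ρ ^ n := by
  have hq0 := q.2.1
  let q1 : unitInterval := ⟨(q + 1 / 2) / 2, by constructor <;> linarith⟩
  have hq1 : (q1:ℝ) = (q + 1 / 2) / 2 := rfl
  have hlt : q < q1 := by show (q:ℝ) < q1; rw [hq1]; linarith
  rcases dichotomy hlt (show q1 < 1 by show (q1:ℝ) < 1; rw [hq1]; linarith) with h | ⟨c, hc, h⟩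
  · exact h
  exfalso
  let s : unitInterval := ⟨(1 / 2 - q1) / 2, by rw [hq1]; constructor <;> linarith⟩
  have hs : (s:ℝ) = (1 / 2 - q1) / 2 := rfl
  have hs0 : 0 < (s:ℝ) := by rw [hs, hq1]; linarith
  have hq2 : (oplus q1 s : ℝ) < 1 / 2 := by
    show 1 - (1 - (q1:ℝ)) * (1 - s) < 1 / 2
    have : 0 ≤ (q1:ℝ) * s := mul_nonneg q1.2.1 s.2.1
    nlinarith
  set q2 := oplus q1 s with hq2d
  have hq20 := q2.2.1
  have hden : 0 < 2 * (1 - (q2:ℝ)) := by linarith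
  have hinv : 1 / (2 * (1 - (q2:ℝ))) < 1 := by rw [div_lt_one hden]; linarith
  have hinv0 : 0 < 1 / (2 * (1 - (q2:ℝ))) := by positivity
  let s' : unitInterval := ⟨1 - 1 / (2 * (1 - (q2:ℝ))), by constructor <;> linarith⟩
  have hs' : (s':ℝ) = 1 - 1 / (2 * (1 - (q2:ℝ))) := rfl
  have hs'0 : 0 < (s':ℝ) := by rw [hs']; linarith
  let H : unitInterval := ⟨1 / 2, by constructor <;> norm_num⟩
  have hH : oplus q2 s' = H := by
    ext
    show 1 - (1 - (q2:ℝ)) * (1 - s') = 1 / 2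
    rw [hs']
    have : (1 - (q2:ℝ)) ≠ 0 := by linarith
    field_simp; ring
  set t := (s':ℝ) ^ 5 with ht
  have ht0 : 0 < t := pow_pos hs'0 5
  have ht1 : t ≤ 1 := pow_le_one₀ s'.2.1 s'.2.2
  obtain ⟨M, hM1, hM2⟩ := crossing_high hc h hs0 (show 0 < t / 12 by positivity)
  have e1 : pr q2 (HC 0 (M + 2)) ≤ pr H (HC 0 (M + 2)) :=
    pr_mono_param (show (q2:ℝ) ≤ 1 / 2 from hq2.le) (dep_HC _ _).measurableSet (incr_HC _ _)
  have e2 := XC_sprinkle q2 s' M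
  rw [hH] at e2
  have hXm := (XC_dep M).measurableSet
  have hpre : MeasurableSet (cnot ⁻¹' XC M) := measurable_cnot hXm
  have e3 : pr H {η | (fun e => !(η (ta e))) ∈ XC M} = pr H (XC M) := by
    have h1 : pr H {η | (fun e => η (ta e)) ∈ cnot ⁻¹' XC M} = pr H (cnot ⁻¹' XC M) := pr_reindex H ta ta_inj hpre
    have h2 : pr H (cnot ⁻¹' XC M) = pr H (XC M) := by
      unfold pr
      conv_rhs => rw [show H = unitInterval.symm H by ext; simp [H]; norm_num, ← mu_not]
      rw [map_measureReal_apply measurable_cnot hXm]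
    rw [← h2, ← h1]; rfl
  have hdisj : {η | (fun e => !(η (ta e))) ∈ XC M} ⊆ (HC 0 (M + 2))ᶜ := fun η h1 h2 => exclusive M η h2 h1
  have e4 := pr_mono H hdisj
  rw [pr_compl H (dep_HC _ _).measurableSet, e3] at e4
  rw [← hq2d] at hM1 hM2
  have : t * (1 - 3 * (t / 12)) ≤ t * pr q2 (HC 0 M) := mul_le_mul_of_nonneg_left hM1 ht0.le
  nlinarith

end BP
end



noncomputable section

namespace BP

/-! ### Linear growth of the passage times -/

lemma dep_countP (l : List Edge) : Dep (l.toFinset : Set Edge) (fun ω : Config => l.countP ω) := by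
  intro η η' h
  simp only
  refine List.countP_congr fun e he => ?_
  rw [h e (by simpa using he)]

/-- cheap walks to a large distance -/
def Low (a : Vert) (m k : ℕ) : Set Config := {ω | ∃ l b, DWalk a l b ∧ m ≤ nd a b ∧ l.countP ω ≤ k}

lemma measurable_Low (a : Vert) (m k : ℕ) : MeasurableSet (Low a m k) := by
  have : Low a m k = ⋃ l : List Edge, ⋃ b : Vert, {ω : Config | DWalk a l b ∧ m ≤ nd a b ∧ l.countP ω ≤ k} := by
    ext ω; simp [Low]
  rw [this]
  refine MeasurableSet.iUnion fun l => MeasurableSet.iUnion fun b => ?_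
  exact Dep.measurableSet (F := l.toFinset) (dep_and (dep_const _ _) (dep_and (dep_const _ _) ((dep_countP l).comp (· ≤ k))))

lemma pr_cnot (p : unitInterval) {A : Set Config} (hA : MeasurableSet A) :
    pr (unitInterval.symm p) (cnot ⁻¹' A) = pr p A := by
  unfold pr
  conv_rhs => rw [show p = unitInterval.symm (unitInterval.symm p) by simp, ← mu_not]
  rw [map_measureReal_apply measurable_cnot hA]

lemma pr_Low (p s : unitInterval) (a : Vert) (m k : ℕ) :
    (s:ℝ) ^ k * pr p (Low a m k) ≤ th (oplus (unitInterval.symm p) s) m := by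
  classical
  rw [← pr_cnot p (measurable_Low a m k), ← pr_arm _ a]
  refine sprinkle _ s k (measurable_cnot (measurable_Low a m k)) (measurable_arm _ _) ?_
  rintro η ⟨l, b, hw, hm, hk⟩
  refine ⟨(l.filter (cnot η)).toFinset, (List.toFinset_card_le _).trans (by rwa [← List.countP_eq_length_filter]), fun ζ hζ => ?_⟩
  refine arm_mem_of_cn (S := univ) (cn_of_walk hw fun e he => ⟨?_, trivial, trivial⟩) hm
  by_cases h : η e = true
  · simp [cor, h]
  · have := hζ e (by simp [he, cnot, h])
    simp [cor, this]

theorem low_prob {p : unitInterval} (hp : 1 / 2 < (p:ℝ)) :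
    ∃ (N : ℕ) (C σ : ℝ), 1 ≤ N ∧ 0 < C ∧ 0 < σ ∧ σ < 1 ∧ ∀ a m, pr p (Low a m (m / N)) ≤ C * σ ^ m := by
  have hp1 := p.2.2
  set q := unitInterval.symm p with hqd
  have hq : (q:ℝ) = 1 - p := rfl
  let s : unitInterval := ⟨(1 / 2 - q) / 2, by rw [hq]; constructor <;> linarith⟩
  have hs : (s:ℝ) = (1 / 2 - q) / 2 := rfl
  have hs0 : 0 < (s:ℝ) := by rw [hs, hq]; linarith
  have hq2 : (oplus q s : ℝ) < 1 / 2 := by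
    show 1 - (1 - (q:ℝ)) * (1 - s) < 1 / 2
    have : 0 ≤ (q:ℝ) * s := mul_nonneg q.2.1 s.2.1
    nlinarith
  obtain ⟨C, ρ, hC, hρ, hρ1, h⟩ := exp_decay hq2
  have hσ1 : Real.sqrt ρ < 1 := by rw [Real.sqrt_lt' one_pos]; simpa using hρ1
  have hσ0 : 0 < Real.sqrt ρ := Real.sqrt_pos.2 hρ
  set σ := Real.sqrt ρ with hσ
  have hσρ : σ * σ = ρ := Real.mul_self_sqrt hρ.le
  obtain ⟨N, hN⟩ := exists_pow_lt_of_lt_one hs0 hσ1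
  refine ⟨N + 1, C, σ, by omega, hC, hσ0, hσ1, fun a m => ?_⟩
  have h1 := (pr_Low p s a m (m / (N + 1))).trans (h m)
  have hN1 : σ ^ (N + 1) ≤ s := (pow_le_pow_of_le_one hσ0.le hσ1.le (Nat.le_succ N)).trans hN.le
  have h2 : σ ^ m ≤ (s:ℝ) ^ (m / (N + 1)) := by
    calc σ ^ m ≤ σ ^ ((N + 1) * (m / (N + 1))) := pow_le_pow_of_le_one hσ0.le hσ1.le (Nat.mul_div_le _ _)
      _ = (σ ^ (N + 1)) ^ (m / (N + 1)) := pow_mul _ _ _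
      _ ≤ _ := pow_le_pow_left₀ (by positivity) hN1 _
  have h3 : σ ^ m * pr p (Low a m (m / (N + 1))) ≤ σ ^ m * (C * σ ^ m) := by
    calc _ ≤ (s:ℝ) ^ (m / (N + 1)) * pr p (Low a m (m / (N + 1))) := mul_le_mul_of_nonneg_right h2 (pr_nonneg _ _)
      _ ≤ C * ρ ^ m := h1
      _ = _ := by rw [← hσρ, mul_pow]; ring
  exact le_of_mul_le_mul_left h3 (by positivity)

/-- geometric regularity -/
def Geo (N m0 : ℕ) (ω : Config) : Prop :=
  ∀ a l b, DWalk a l b → m0 ≤ nd a b → nd 0 a ≤ (nd a b) ^ 9 → nd a b < N * l.countP ω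

lemma borel_cantelli {p : unitInterval} {A : ℕ → Set Config} {f : ℕ → ℝ} (hf : Summable f)
    (h : ∀ n, pr p (A n) ≤ f n) : ∀ᵐ ω ∂(mu p), ∀ᶠ n in atTop, ω ∉ A n := by
  refine ae_eventually_notMem ?_
  have h0 : ∀ n, 0 ≤ f n := fun n => (pr_nonneg _ _).trans (h n)
  have h1 : ∀ n, (mu p) (A n) ≤ ENNReal.ofReal (f n) := by
    intro n
    rw [← ENNReal.ofReal_toReal (measure_ne_top (mu p) (A n))]
    exact ENNReal.ofReal_le_ofReal (h n)
  refine ne_top_of_le_ne_top ?_ (ENNReal.tsum_le_tsum h1)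
  rw [← ENNReal.ofReal_tsum_of_nonneg h0 hf]
  exact ENNReal.ofReal_ne_top

theorem geo_ae {p : unitInterval} (hp : 1 / 2 < (p:ℝ)) :
    ∃ (N : ℕ) (C σ : ℝ), 1 ≤ N ∧ 0 < C ∧ 0 < σ ∧ σ < 1 ∧ (∀ a m, pr p (Low a m (m / N)) ≤ C * σ ^ m) ∧
      ∀ᵐ ω ∂(mu p), ∃ m0, Geo N m0 ω := by
  obtain ⟨N, C, σ, hN, hC, hσ, hσ1, h⟩ := low_prob hp
  refine ⟨N, C, σ, hN, hC, hσ, hσ1, h, ?_⟩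
  have hsum : Summable (fun m : ℕ => 9 * C * (((m:ℝ) ^ 18 * σ ^ m) + ((m:ℝ) ^ 0 * σ ^ m))) := by
    have hn : ‖σ‖ < 1 := by rw [Real.norm_eq_abs, abs_of_pos hσ]; exact hσ1
    exact ((summable_pow_mul_geometric_of_norm_lt_one 18 hn).add (summable_pow_mul_geometric_of_norm_lt_one 0 hn)).mul_left _
  have hb := borel_cantelli (p := p) (A := fun m => ⋃ a ∈ box 0 (m ^ 9), Low a m (m / N)) hsum (by
    intro m
    refine (pr_biUnion_le p _ _).trans ((Finset.sum_le_sum fun a _ => h a m).trans ?_)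
    rw [Finset.sum_const, card_box, nsmul_eq_mul]
    push_cast
    have h1 : (2 * (m:ℝ) ^ 9 + 1) ^ 2 ≤ 9 * (m ^ 18 + 1) := by nlinarith [sq_nonneg ((m:ℝ) ^ 9 - 1)]
    calc _ ≤ (9 * ((m:ℝ) ^ 18 + 1)) * (C * σ ^ m) := mul_le_mul_of_nonneg_right h1 (by positivity)
      _ = _ := by ring)
  filter_upwards [hb] with ω hω
  obtain ⟨m0, hm0⟩ := eventually_atTop.1 hω
  refine ⟨m0, fun a l b hw hm ha => ?_⟩
  by_contra hcon
  push Not at hcon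
  refine hm0 _ hm ?_
  simp only [mem_iUnion]
  refine ⟨a, mem_box.2 ha, l, b, hw, le_rfl, ?_⟩
  rw [Nat.le_div_iff_mul_le hN]
  linarith [mul_comm N (l.countP ω)]

end BP
end



noncomputable section

namespace BP

/-! ### Passage times -/

def TT (F : Set Edge) (ω : Config) (a b : Vert) : ℕ :=
  sInf {k | ∃ l, DWalk a l b ∧ (∀ e ∈ l, e ∈ F) ∧ l.countP ω = k}

lemma TT_le {F : Set Edge} {ω : Config} {a b : Vert} {l : List Edge} (h : DWalk a l b) (hF : ∀ e ∈ l, e ∈ F) :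
    TT F ω a b ≤ l.countP ω := Nat.sInf_le ⟨l, h, hF, rfl⟩

lemma straight (a : Vert) : ∀ (n : ℕ) (b : Vert), (b.1 - a.1).natAbs + (b.2 - a.2).natAbs = n →
    ∃ l, DWalk a l b ∧ l.length = n ∧ ∀ e ∈ l, e ∈ ev (box a (nd a b)) := by
  intro n
  induction n with
  | zero =>
    intro b hb
    have : a = b := by ext <;> omega
    subst this
    exact ⟨[], .nil a, rfl, by simp⟩
  | succ n ih =>
    intro b hb
    have key : ∀ (b' : Vert) (e : Edge), dstep e b' b → (b'.1 - a.1).natAbs + (b'.2 - a.2).natAbs = n →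
        nd a b' ≤ nd a b → ∃ l, DWalk a l b ∧ l.length = n + 1 ∧ ∀ e ∈ l, e ∈ ev (box a (nd a b)) := by
      intro b' e he h1 h2
      obtain ⟨l, hl, hn, hlb⟩ := ih b' h1
      refine ⟨l ++ [e], hl.append (.single he), by simp [hn], ?_⟩
      intro e' he'
      rcases List.mem_append.1 he' with h | h
      · have := mem_ev.1 (hlb e' h)
        rw [mem_box, mem_box] at this
        rw [mem_ev, mem_box, mem_box]; omega
      · rw [List.mem_singleton] at h; subst h
        rw [mem_ev, mem_box, mem_box]
        rcases he with ⟨rfl, rfl⟩ | ⟨rfl, rfl⟩ <;> omega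
    obtain ⟨b1, b2⟩ := b
    obtain ⟨a1, a2⟩ := a
    simp only at hb key
    by_cases h1 : a1 < b1
    · refine key (b1 - 1, b2) ((b1, b2), true) (Or.inr ⟨by rw [dB_true], rfl⟩) (by simp only; omega) (by unfold nd; simp only; omega)
    by_cases h2 : b1 < a1
    · refine key (b1 + 1, b2) ((b1 + 1, b2), true) (Or.inl ⟨rfl, by rw [dB_true]; simp⟩) (by simp only; omega) (by unfold nd; simp only; omega)
    by_cases h3 : a2 < b2
    · refine key (b1, b2 - 1) ((b1, b2), false) (Or.inr ⟨by rw [dB_false], rfl⟩) (by simp only; omega) (by unfold nd; simp only; omega)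
    · refine key (b1, b2 + 1) ((b1, b2 + 1), false) (Or.inl ⟨rfl, by rw [dB_false]; simp⟩) (by simp only; omega) (by unfold nd; simp only; omega)

lemma straight' (a b : Vert) : ∃ l, DWalk a l b ∧ l.length ≤ 2 * nd a b ∧ ∀ e ∈ l, e ∈ ev (box a (nd a b)) := by
  obtain ⟨l, h1, h2, h3⟩ := straight a _ b rfl
  exact ⟨l, h1, by rw [h2]; unfold nd; omega, h3⟩

lemma ev_box_mono {a c : Vert} {r R : ℕ} (h : nd c a + r ≤ R) {e : Edge} (he : e ∈ ev (box a r)) : e ∈ ev (box c R) := by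
  rw [mem_ev, mem_box, mem_box] at *
  have := nd_tri c a e.1
  have := nd_tri c a (dB e)
  omega

lemma TT_attained {F : Set Edge} {ω : Config} {a b : Vert} (hF : (ev (box a (nd a b)) : Set Edge) ⊆ F) :
    ∃ l, DWalk a l b ∧ (∀ e ∈ l, e ∈ F) ∧ l.countP ω = TT F ω a b := by
  obtain ⟨l, h1, h2, h3⟩ := straight' a b
  exact Nat.sInf_mem (s := {k | ∃ l, DWalk a l b ∧ (∀ e ∈ l, e ∈ F) ∧ l.countP ω = k}) ⟨_, l, h1, fun e he => hF (h3 e he), rfl⟩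

lemma TT_le_nd {F : Set Edge} {ω : Config} {a b : Vert} (hF : (ev (box a (nd a b)) : Set Edge) ⊆ F) :
    TT F ω a b ≤ 2 * nd a b := by
  obtain ⟨l, h1, h2, h3⟩ := straight' a b
  exact (TT_le h1 fun e he => hF (h3 e he)).trans (List.countP_le_length.trans h2)

lemma TT_dep (F : Set Edge) (a b : Vert) : Dep F (fun ω => TT F ω a b) := by
  intro ω η h
  have : ∀ l : List Edge, (∀ e ∈ l, e ∈ F) → l.countP ω = l.countP η := fun l hl =>
    List.countP_congr fun e he => by rw [h e (hl e he)]
  have hs : {k | ∃ l, DWalk a l b ∧ (∀ e ∈ l, e ∈ F) ∧ l.countP ω = k} = {k | ∃ l, DWalk a l b ∧ (∀ e ∈ l, e ∈ F) ∧ l.countP η = k} := by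
    ext k
    constructor
    · rintro ⟨l, h1, h2, h3⟩; exact ⟨l, h1, h2, by rw [← this l h2]; exact h3⟩
    · rintro ⟨l, h1, h2, h3⟩; exact ⟨l, h1, h2, by rw [this l h2]; exact h3⟩
  show sInf _ = sInf _
  rw [hs]

lemma TT_tri {F G K : Set Edge} {ω : Config} {a b c : Vert} (hF : (ev (box a (nd a b)) : Set Edge) ⊆ F)
    (hG : (ev (box b (nd b c)) : Set Edge) ⊆ G) (h1 : F ⊆ K) (h2 : G ⊆ K) :
    TT K ω a c ≤ TT F ω a b + TT G ω b c := by
  obtain ⟨l, a1, a2, a3⟩ := TT_attained (ω := ω) hF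
  obtain ⟨l', b1, b2, b3⟩ := TT_attained (ω := ω) hG
  rw [← a3, ← b3, ← List.countP_append]
  refine TT_le (a1.append b1) fun e he => ?_
  rcases List.mem_append.1 he with h | h
  · exact h1 (a2 e h)
  · exact h2 (b2 e h)

/-- a walk can be made without repeated edges -/
lemma DWalk.nodup_sub {a b : Vert} (ω : Config) (F : Set Edge) (k : ℕ) : ∀ (n : ℕ) (l : List Edge), l.length ≤ n → DWalk a l b →
    (∀ e ∈ l, e ∈ F) → l.countP ω ≤ k →
    ∃ l', DWalk a l' b ∧ l'.Nodup ∧ (∀ e ∈ l', e ∈ F) ∧ l'.countP ω ≤ k := by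
  intro n
  induction n with
  | zero =>
    intro l hn h hF hk
    have : l = [] := List.length_eq_zero_iff.1 (by omega)
    subst this
    exact ⟨[], h, List.nodup_nil, hF, hk⟩
  | succ n ih =>
    intro l hn h hF hk
    by_cases hd : l.Nodup
    · exact ⟨l, h, hd, hF, hk⟩
    obtain ⟨e, he⟩ : ∃ e, List.Sublist [e, e] l := by
      by_contra hcon; push Not at hcon
      exact hd (List.nodup_iff_sublist.2 hcon)
    obtain ⟨l1, l2, rfl, he1, he2⟩ := List.cons_sublist_iff.1 he
    obtain ⟨l3, l4, rfl⟩ := List.append_of_mem he1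
    obtain ⟨l5, l6, rfl⟩ := List.append_of_mem (List.singleton_sublist.1 he2)
    obtain ⟨m, w1, w2⟩ := h.split _ _ rfl
    obtain ⟨x, v1, v2⟩ := w1.split _ _ rfl
    obtain ⟨y, u1, -⟩ := v2.cons_inv
    obtain ⟨x', v1', v2'⟩ := w2.split _ _ rfl
    obtain ⟨y', u1', u2'⟩ := v2'.cons_inv
    simp only [List.length_append, List.length_cons] at hn
    simp only [List.countP_append, List.countP_cons] at hk
    simp only [List.mem_append, List.mem_cons] at hF
    have hcase : x = x' ∨ x = y' := by
      rcases u1 with ⟨rfl, rfl⟩ | ⟨rfl, rfl⟩ <;> rcases u1' with ⟨rfl, rfl⟩ | ⟨rfl, rfl⟩ <;> simp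
    rcases hcase with rfl | rfl
    · refine ih (l3 ++ e :: l6) (by simp; omega) (v1.append v2') ?_ ?_
      · intro e' he'; simp only [List.mem_append, List.mem_cons] at he'; apply hF; tauto
      · simp only [List.countP_append, List.countP_cons]; omega
    · refine ih (l3 ++ l6) (by simp; omega) (v1.append u2') ?_ ?_
      · intro e' he'; simp only [List.mem_append] at he'; apply hF; tauto
      · simp only [List.countP_append]; omega

lemma closed_cover (ω : Config) {a b : Vert} {l : List Edge} (h : DWalk a l b) :
    ∃ Z : Finset Vert, Z.card ≤ l.countP ω + 1 ∧ a ∈ Z ∧ (∀ z ∈ Z, z = a ∨ ∃ e ∈ l, z = e.1 ∨ z = dB e) ∧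
      ∀ e ∈ l, ω e = false → ∃ z ∈ Z, cn (cnot ω) univ z e.1 := by
  classical
  induction h with
  | nil a => exact ⟨{a}, by simp, by simp, by simp, by simp⟩
  | cons hs hw ih =>
    rename_i a b c e l
    obtain ⟨Z, h1, h2, h3, h4⟩ := ih
    have hb : b = e.1 ∨ b = dB e := by rcases hs with ⟨rfl, rfl⟩ | ⟨rfl, rfl⟩ <;> simp
    have ha : a = e.1 ∨ a = dB e := by rcases hs with ⟨rfl, rfl⟩ | ⟨rfl, rfl⟩ <;> simp
    cases hω : ω e with
    | true =>
      refine ⟨insert a Z, ?_, by simp, ?_, ?_⟩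
      · refine (Finset.card_insert_le _ _).trans ?_
        rw [List.countP_cons, if_pos hω]; omega
      · intro z hz
        rcases Finset.mem_insert.1 hz with rfl | hz
        · left; rfl
        right
        rcases h3 z hz with rfl | ⟨e', he', h⟩
        · exact ⟨e, by simp, hb⟩
        · exact ⟨e', by simp [he'], h⟩
      · intro e' he' hω'
        rcases List.mem_cons.1 he' with rfl | he'
        · rw [hω] at hω'; cases hω'
        · obtain ⟨z, hz, h⟩ := h4 e' he' hω'
          exact ⟨z, by simp [hz], h⟩
    | false =>
      have hst : st (cnot ω) univ a b := ⟨mem_univ _, mem_univ _, e, by simp [cnot, hω], hs⟩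
      have hab : cn (cnot ω) univ a b := Relation.ReflTransGen.single hst
      refine ⟨insert a (Z.erase b), ?_, by simp, ?_, ?_⟩
      · refine (Finset.card_insert_le _ _).trans ?_
        rw [Finset.card_erase_of_mem h2, List.countP_cons]
        have : 0 < Z.card := Finset.card_pos.2 ⟨b, h2⟩
        omega
      · intro z hz
        rcases Finset.mem_insert.1 hz with rfl | hz
        · left; rfl
        right
        rcases h3 z (Finset.mem_of_mem_erase hz) with rfl | ⟨e', he', h⟩
        · exact ⟨e, by simp, hb⟩
        · exact ⟨e', by simp [he'], h⟩
      · intro e' he' hω'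
        rcases List.mem_cons.1 he' with rfl | he'
        · refine ⟨a, by simp, ?_⟩
          rcases hs with ⟨h, rfl⟩ | ⟨h, rfl⟩
          · rw [h]; exact cn_refl
          · exact hab
        · obtain ⟨z, hz, h⟩ := h4 e' he' hω'
          by_cases hzb : z = b
          · subst hzb; exact ⟨a, by simp, cn_trans hab h⟩
          · exact ⟨z, by simp [hz, hzb], h⟩

/-- walks of small cost stay in a box -/
lemma Geo.stay {N m0 : ℕ} {ω : Config} (hG : Geo N m0 ω) {a b : Vert} {l : List Edge} (h : DWalk a l b) {ρ : ℕ}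
    (h0 : m0 ≤ ρ) (hc : N * l.countP ω ≤ ρ) (ha : nd 0 a ≤ ρ ^ 9) : ∀ e ∈ l, e ∈ ev (box a ρ) := by
  intro e he
  by_contra hcon
  obtain ⟨l1, l2, x, y, rfl, w1, hs, w2⟩ := h.split_at he
  have key : ∀ (l' : List Edge) (z : Vert), DWalk a l' z → l'.countP ω ≤ (l1 ++ e :: l2).countP ω → ¬ ρ < nd a z := by
    intro l' z hw hl hz
    have := hG a l' z hw (by omega) (ha.trans (Nat.pow_le_pow_left hz.le 9))
    have := Nat.mul_le_mul_left N hl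
    omega
  have k1 := key l1 x w1 (by simp)
  have k2 := key (l1 ++ [e]) y (w1.append (.single hs)) (by simp [List.countP_append, List.countP_cons])
  rw [mem_ev, mem_box, mem_box] at hcon
  rcases hs with ⟨rfl, rfl⟩ | ⟨rfl, rfl⟩ <;> omega

lemma Geo.TT_eq {N m0 : ℕ} {ω : Config} (hG : Geo N m0 ω) {a b : Vert} {ρ : ℕ}
    (h0 : m0 ≤ ρ) (hc : N * (2 * nd a b) ≤ ρ) (ha : nd 0 a ≤ ρ ^ 9) (hρ : nd a b ≤ ρ) :
    TT univ ω a b = TT (ev (box a ρ) : Set Edge) ω a b := by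
  apply le_antisymm
  · obtain ⟨l, h1, h2, h3⟩ := TT_attained (ω := ω) (F := (ev (box a ρ) : Set Edge)) (a := a) (b := b)
      (fun e he => ev_box_mono (by rw [nd_self]; omega) he)
    rw [← h3]; exact TT_le h1 (fun _ _ => mem_univ _)
  · obtain ⟨l, h1, -, h3⟩ := TT_attained (ω := ω) (F := univ) (a := a) (b := b) (subset_univ _)
    have h4 : TT univ ω a b ≤ 2 * nd a b := TT_le_nd (subset_univ _)
    rw [← h3] at h4 ⊢
    exact TT_le h1 (hG.stay h1 h0 ((Nat.mul_le_mul_left N h4).trans hc) ha)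

end BP
end



noncomputable section

namespace BP

lemma cheb (p : unitInterval) {F : Finset Edge} {f : Config → ℝ} (hf : Dep (F : Set Edge) f) {t V : ℝ} (ht : 0 < t)
    (hV : (∫ ω, f ω ^ 2 ∂(mu p)) - (∫ ω, f ω ∂(mu p)) ^ 2 ≤ V) :
    pr p {ω | t ≤ |f ω - ∫ η, f η ∂(mu p)|} ≤ V / t ^ 2 := by
  set m := ∫ η, f η ∂(mu p)
  have i1 : Integrable f (mu p) := hf.integrable _
  have i2 : Integrable (fun ω => f ω ^ 2) (mu p) := (hf.comp (fun x => x ^ 2)).integrable _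
  have i3 : Integrable (fun ω => (f ω - m) ^ 2) (mu p) := (hf.comp (fun x => (x - m) ^ 2)).integrable _
  have h := mul_meas_ge_le_integral_of_nonneg (μ := mu p) (f := fun ω => (f ω - m) ^ 2) (Eventually.of_forall fun ω => sq_nonneg _) i3 (t ^ 2)
  have hset : {ω | t ^ 2 ≤ (f ω - m) ^ 2} = {ω | t ≤ |f ω - m|} := by
    ext ω
    simp only [mem_ofPred_eq]
    rw [sq_le_sq, abs_of_pos ht]
  rw [hset] at h
  have h2 : ∫ ω, (f ω - m) ^ 2 ∂(mu p) = (∫ ω, f ω ^ 2 ∂(mu p)) - m ^ 2 := by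
    have : ∀ ω, (f ω - m) ^ 2 = f ω ^ 2 - (2 * m) * f ω + m ^ 2 := fun ω => by ring
    simp only [this]
    have i4 : Integrable (fun ω => 2 * m * f ω) (mu p) := i1.const_mul _
    have i5 : Integrable (fun ω => f ω ^ 2 - 2 * m * f ω) (mu p) := i2.sub i4
    rw [integral_add i5 (integrable_const _), integral_sub i2 i4, integral_const_mul]
    simp
    ring
  rw [h2] at h
  rw [le_div_iff₀ (by positivity), mul_comm]
  exact h.trans hV

lemma DWalk.tre {a b : Vert} {l : List Edge} (h : DWalk a l b) (c : Vert) : DWalk (a + c) (l.map (tre c)) (b + c) := by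
  induction h with
  | nil => exact .nil _
  | cons hs _ ih => exact .cons (tre_dstep c _ _ _ hs) ih

lemma TT_tre_le (ω : Config) (a b c : Vert) (R : ℕ) (hR : nd a b ≤ R) :
    TT (ev (box (a + c) R) : Set Edge) ω (a + c) (b + c) ≤ TT (ev (box a R) : Set Edge) (fun e => ω (tre c e)) a b := by
  obtain ⟨l, h1, h2, h3⟩ := TT_attained (ω := fun e => ω (tre c e)) (F := (ev (box a R) : Set Edge)) (a := a) (b := b)
      (fun e he => ev_box_mono (by rw [nd_self]; omega) he)
  rw [← h3]
  have h4 : (l.map (tre c)).countP ω = l.countP (fun e => ω (tre c e)) := by rw [List.countP_map]; rfl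
  rw [← h4]
  refine TT_le (h1.tre c) fun e he => ?_
  obtain ⟨e', he', rfl⟩ := List.mem_map.1 he
  have := h2 e' he'
  rw [Finset.mem_coe, mem_ev, mem_box, mem_box] at *
  have e1 : (tre c e').1 = e'.1 + c := rfl
  have e2 : dB (tre c e') = dB e' + c := by simp only [dB, BP.tre]; abel
  rw [e1, e2, nd_add, nd_add]; exact this

lemma TT_tre (ω : Config) (a b c : Vert) (R : ℕ) (hR : nd a b ≤ R) :
    TT (ev (box (a + c) R) : Set Edge) ω (a + c) (b + c) = TT (ev (box a R) : Set Edge) (fun e => ω (tre c e)) a b := by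
  apply le_antisymm (TT_tre_le ω a b c R hR)
  have := TT_tre_le (fun e => ω (tre c e)) (a + c) (b + c) (-c) R (by rw [nd_add]; exact hR)
  have e3 : (fun e => ω (tre c (tre (-c) e))) = ω := by funext e; simp [tre]
  simp only [add_neg_cancel_right] at this
  rw [e3] at this
  exact this

lemma integral_TT_tre (p : unitInterval) (a b c : Vert) (R : ℕ) (hR : nd a b ≤ R) :
    ∫ ω, (TT (ev (box (a + c) R) : Set Edge) ω (a + c) (b + c) : ℝ) ∂(mu p) = ∫ ω, (TT (ev (box a R) : Set Edge) ω a b : ℝ) ∂(mu p) := by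
  simp only [TT_tre _ a b c R hR]
  conv_rhs => rw [← mu_reindex p (tre c) (tre_inj c)]
  rw [integral_map]
  · exact (measurable_pi_lambda _ fun e => measurable_pi_apply _).aemeasurable
  · exact ((TT_dep (ev (box a R) : Set Edge) a b).comp (fun k : ℕ => (k:ℝ))).measurable.aestronglyMeasurable

lemma TT_mono {F : Set Edge} {ω η : Config} {a b : Vert} (hF : (ev (box a (nd a b)) : Set Edge) ⊆ F) (h : ω ≤ η) :
    TT F ω a b ≤ TT F η a b := by
  obtain ⟨l, h1, h2, h3⟩ := TT_attained (ω := η) hF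
  rw [← h3]
  refine (TT_le h1 h2).trans (List.countP_mono_left fun e _ he => ?_)
  have := h e
  rw [he] at this
  exact Bool.eq_true_of_true_le this

lemma var_pointwise {a b : Vert} {R r : ℕ} (hR : nd a b ≤ R) (ω : Config) :
    ∑ e ∈ ev (box a R), (Dd e (fun η => (TT (ev (box a R) : Set Edge) η a b : ℝ)) ω) ^ 2 * ind {η | η e = false} ω
      ≤ 2 * (2 * R + 1) * (2 * r + 1) ^ 2 + (2 * (2 * R + 1) ^ 2) * ∑ z ∈ box a R, ind (cnot ⁻¹' Arm z r) ω := by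
  classical
  have hF : (ev (box a (nd a b)) : Set Edge) ⊆ (ev (box a R) : Set Edge) := fun e he => ev_box_mono (by rw [nd_self]; omega) he
  obtain ⟨l0, g1, g2, g3⟩ := TT_attained (ω := ω) hF
  obtain ⟨l, h1, h2, h3, h4⟩ := DWalk.nodup_sub ω _ _ _ l0 le_rfl g1 g2 g3.le
  -- pointwise bound
  have hpt : ∀ e ∈ ev (box a R), (Dd e (fun η => (TT (ev (box a R) : Set Edge) η a b : ℝ)) ω) ^ 2 * ind {η | η e = false} ω
      ≤ if e ∈ l ∧ ω e = false then (1:ℝ) else 0 := by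
    intro e he
    cases hω : ω e with
    | true =>
      rw [ind_of_notMem (by simp [hω])]; simp
    | false =>
      rw [ind_of_mem (by simp [hω]), mul_one]
      have e1 : upd e false ω = ω := by
        funext e'
        by_cases h : e' = e
        · subst h; rw [upd_self, hω]
        · rw [upd_ne h]
      have k1 : TT (ev (box a R) : Set Edge) ω a b ≤ TT (ev (box a R) : Set Edge) (upd e true ω) a b := by
        have := TT_mono hF (upd_false_le_true e ω)
        rwa [e1] at this
      have k2 : TT (ev (box a R) : Set Edge) (upd e true ω) a b ≤ TT (ev (box a R) : Set Edge) ω a b + if e ∈ l then 1 else 0 := by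
        refine (TT_le h1 h3).trans (le_trans ?_ (Nat.add_le_add_right h4 _))
        have : ∀ l' : List Edge, l'.countP (upd e true ω) ≤ l'.countP ω + l'.count e := by
          intro l'
          induction l' with
          | nil => simp
          | cons e' l' ih =>
            rw [List.countP_cons, List.countP_cons, List.count_cons]
            by_cases h : e' = e
            · subst h; simp [upd_self]; omega
            · rw [upd_ne h]; omega
        refine (this l).trans (Nat.add_le_add_left ?_ _)
        split_ifs with h
        · exact List.nodup_iff_count_le_one.1 h2 e
        · rw [List.count_eq_zero_of_not_mem h]
      unfold Dd
      rw [e1]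
      simp only [and_true]
      by_cases h : e ∈ l
      · rw [if_pos h] at k2 ⊢
        have : ((TT (ev (box a R) : Set Edge) (upd e true ω) a b : ℕ):ℝ) ≤ TT (ev (box a R) : Set Edge) ω a b + 1 := by exact_mod_cast k2
        have : ((TT (ev (box a R) : Set Edge) ω a b : ℕ):ℝ) ≤ TT (ev (box a R) : Set Edge) (upd e true ω) a b := by exact_mod_cast k1
        rw [sq_le_one_iff_abs_le_one, abs_le]; constructor <;> linarith
      · rw [if_neg h] at k2 ⊢
        rw [show TT (ev (box a R) : Set Edge) (upd e true ω) a b = TT (ev (box a R) : Set Edge) ω a b by omega]; simp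
  refine (Finset.sum_le_sum hpt).trans ?_
  rw [← Finset.sum_filter, Finset.sum_const, nsmul_eq_mul, mul_one]
  by_cases hbad : ∃ z ∈ box a R, ω ∈ cnot ⁻¹' Arm z r
  · obtain ⟨z, hz, hz2⟩ := hbad
    have k1 : (1:ℝ) ≤ ∑ z ∈ box a R, ind (cnot ⁻¹' Arm z r) ω := by
      rw [← ind_of_mem hz2]
      exact Finset.single_le_sum (f := fun z => ind (cnot ⁻¹' Arm z r) ω) (fun z _ => ind_nonneg _ _) hz
    have k2 : ((Finset.filter (fun e => e ∈ l ∧ ω e = false) (ev (box a R))).card : ℝ) ≤ 2 * (2 * R + 1) ^ 2 := by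
      have := (Finset.card_filter_le (ev (box a R)) (fun e => e ∈ l ∧ ω e = false)).trans (card_ev_le _)
      rw [card_box] at this
      exact_mod_cast this
    have k3 : (0:ℝ) ≤ 2 * (2 * R + 1) * (2 * r + 1) ^ 2 := by positivity
    have k4 : (0:ℝ) ≤ 2 * (2 * R + 1) ^ 2 := by positivity
    nlinarith
  · push Not at hbad
    obtain ⟨Z, z1, -, z3, z4⟩ := closed_cover ω h1
    have k4 : (0:ℝ) ≤ (2 * (2 * R + 1) ^ 2) * ∑ z ∈ box a R, ind (cnot ⁻¹' Arm z r) ω :=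
      mul_nonneg (by positivity) (Finset.sum_nonneg fun _ _ => ind_nonneg _ _)
    have hsub : Finset.filter (fun e => e ∈ l ∧ ω e = false) (ev (box a R)) ⊆ Z.biUnion (fun z => box z r ×ˢ (Finset.univ : Finset Bool)) := by
      intro e he
      obtain ⟨-, he1, he2⟩ := Finset.mem_filter.1 he
      obtain ⟨z, hz, hc⟩ := z4 e he1 he2
      refine Finset.mem_biUnion.2 ⟨z, hz, Finset.mem_product.2 ⟨mem_box.2 ?_, Finset.mem_univ _⟩⟩
      by_contra hcon
      refine hbad z ?_ (arm_mem_of_cn hc (by omega))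
      rcases z3 z hz with rfl | ⟨e', he', rfl | rfl⟩
      · rw [mem_box, nd_self]; omega
      · exact (mem_ev.1 (h3 e' he')).1
      · exact (mem_ev.1 (h3 e' he')).2
    have hcard := (Finset.card_le_card hsub).trans (Finset.card_biUnion_le)
    have h5 : ∑ z ∈ Z, (box z r ×ˢ (Finset.univ : Finset Bool)).card = Z.card * ((2 * r + 1) ^ 2 * 2) := by
      rw [Finset.sum_congr rfl (g := fun _ => (2 * r + 1) ^ 2 * 2), Finset.sum_const, smul_eq_mul]
      intro z _; rw [Finset.card_product, card_box]; simp
    rw [h5] at hcard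
    have h6 : Z.card ≤ 2 * R + 1 := by
      have := TT_le_nd (ω := ω) hF
      omega
    have h7 := hcard.trans (Nat.mul_le_mul_right ((2 * r + 1) ^ 2 * 2) h6)
    have h8 : ((Finset.filter (fun e => e ∈ l ∧ ω e = false) (ev (box a R))).card : ℝ) ≤ (2 * R + 1) * ((2 * r + 1) ^ 2 * 2) := by exact_mod_cast h7
    linarith

lemma var_TT (p : unitInterval) {a b : Vert} {R r : ℕ} (hR : nd a b ≤ R) :
    (∫ ω, (TT (ev (box a R) : Set Edge) ω a b : ℝ) ^ 2 ∂(mu p)) - (∫ ω, (TT (ev (box a R) : Set Edge) ω a b : ℝ) ∂(mu p)) ^ 2 ≤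
      2 * (2 * R + 1) * (2 * r + 1) ^ 2 + (2 * (2 * R + 1) ^ 4) * th (unitInterval.symm p) r := by
  classical
  set F := ev (box a R) with hFdef
  set f : Config → ℝ := fun ω => (TT (F : Set Edge) ω a b : ℝ) with hf
  have hdep : Dep (F : Set Edge) f := (TT_dep (F : Set Edge) a b).comp (fun k : ℕ => (k:ℝ))
  have hDdep : ∀ e ∈ F, Dep ((F.erase e : Finset Edge) : Set Edge) (fun ω => (Dd e f ω) ^ 2) := by
    intro e he
    have : Dep ((insert e (F.erase e) : Finset Edge) : Set Edge) f := by rw [Finset.insert_erase he]; exact hdep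
    exact ((this.upd true).comp2 (this.upd false) (fun x y => x - y)).comp (fun x => x ^ 2)
  have hidep : ∀ e, Dep (({e} : Finset Edge) : Set Edge) (ind {η : Config | η e = false}) := by
    intro e
    apply Dep.ind
    intro ω η h
    simp only [mem_ofPred_eq]
    rw [h e (by simp)]
  have hi : ∀ e, ∫ ω, ind {η : Config | η e = false} ω ∂(mu p) = 1 - (p:ℝ) := by
    intro e
    have := integral_edge p e (fun b => if b = false then 1 else 0)
    simp only [Bool.true_eq_false, if_false, if_true, mul_zero, mul_one, zero_add] at this
    rw [← this]
    congr 1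
    funext ω
    unfold ind; simp only [mem_ofPred_eq]; congr
  have hp0 := p.2.1
  have hp1 := p.2.2
  refine (efron_stein p F f hdep).trans ?_
  have h1 : ∀ e ∈ F, (p * (1 - p) : ℝ) * ∫ ω, (Dd e f ω) ^ 2 ∂(mu p) = p * ∫ ω, (Dd e f ω) ^ 2 * ind {η : Config | η e = false} ω ∂(mu p) := by
    intro e he
    rw [integral_mul_dep p (hDdep e he) (hidep e) (by simp), hi]; ring
  rw [Finset.sum_congr rfl h1, ← Finset.mul_sum]
  have hIntg : ∀ e ∈ F, Integrable (fun ω => (Dd e f ω) ^ 2 * ind {η : Config | η e = false} ω) (mu p) := by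
    intro e he
    refine Dep.integrable (F := F) (Dep.comp2 ((hDdep e he).mono (by exact_mod_cast Finset.erase_subset _ _)) ((hidep e).mono (by simpa using he)) (fun x y => x * y)) _
  rw [← integral_finsetSum _ hIntg]
  have hmA : ∀ z, MeasurableSet (cnot ⁻¹' Arm z r) := fun z => measurable_cnot (measurable_arm z r)
  have hint2 : ∀ z ∈ box a R, Integrable (ind (cnot ⁻¹' Arm z r)) (mu p) := fun z _ => integrable_ind_of (hmA z)
  have h2 : ∫ ω, ∑ e ∈ F, (Dd e f ω) ^ 2 * ind {η : Config | η e = false} ω ∂(mu p) ≤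
      ∫ ω, (2 * (2 * R + 1) * (2 * r + 1) ^ 2 + (2 * (2 * R + 1) ^ 2) * ∑ z ∈ box a R, ind (cnot ⁻¹' Arm z r) ω) ∂(mu p) := by
    refine integral_mono (integrable_finset_sum _ hIntg) ?_ (fun ω => var_pointwise hR ω)
    exact (integrable_const _).add ((integrable_finset_sum _ hint2).const_mul _)
  rw [integral_add (integrable_const _) ((integrable_finset_sum _ hint2).const_mul _), integral_const_mul (2 * (2 * (R:ℝ) + 1) ^ 2), integral_finsetSum _ hint2] at h2
  have h3 : ∀ z ∈ box a R, ∫ ω, ind (cnot ⁻¹' Arm z r) ω ∂(mu p) = th (unitInterval.symm p) r := by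
    intro z _
    rw [← pr_eq_integral p (hmA z), ← pr_arm _ z, ← pr_cnot _ (measurable_arm z r)]
    simp
  rw [Finset.sum_congr rfl h3, Finset.sum_const, card_box] at h2
  have h4 : (0:ℝ) ≤ ∫ ω, ∑ e ∈ F, (Dd e f ω) ^ 2 * ind {η : Config | η e = false} ω ∂(mu p) :=
    integral_nonneg fun ω => Finset.sum_nonneg fun e _ => mul_nonneg (sq_nonneg _) (ind_nonneg _ _)
  refine (mul_le_of_le_one_left h4 hp1).trans (h2.trans (le_of_eq ?_))
  simp
  ring

end BP
end



noncomputable section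

namespace BP

def sc (j : ℕ) (u : Vert) : Vert := ((j:ℤ) * u.1, (j:ℤ) * u.2)

lemma nd_sc (j : ℕ) (u v : Vert) : nd (sc j u) (sc j v) = j * nd u v := by
  unfold nd sc
  simp only [← mul_sub, Int.natAbs_mul, Int.natAbs_natCast]
  exact (Nat.mul_max_mul_left _ _ _)

lemma nd_sc_zero (j : ℕ) (u : Vert) : nd 0 (sc j u) = j * nd 0 u := by
  have : sc j (0:Vert) = 0 := by simp [sc]
  rw [← nd_sc, this]

lemma sc_add (j k : ℕ) (u : Vert) : sc (j + k) u = sc k u + sc j u := by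
  ext <;> simp [sc] <;> ring

lemma nd_sc_sub {i j : ℕ} (h : i ≤ j) (u : Vert) : nd (sc j u) (sc i u) = (j - i) * nd 0 u := by
  obtain ⟨k, rfl⟩ := Nat.exists_eq_add_of_le h
  rw [sc_add, show sc i u = 0 + sc i u by simp, ← add_assoc, nd_add, add_zero, nd_comm, nd_sc_zero]
  simp

lemma TT_lip (ω : Config) (a b c d : Vert) : TT univ ω a b ≤ TT univ ω c d + 2 * nd a c + 2 * nd d b := by
  have h1 := TT_tri (F := univ) (G := univ) (K := univ) (ω := ω) (a := a) (b := c) (c := b) (subset_univ _) (subset_univ _) le_rfl le_rfl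
  have h2 := TT_tri (F := univ) (G := univ) (K := univ) (ω := ω) (a := c) (b := d) (c := b) (subset_univ _) (subset_univ _) le_rfl le_rfl
  have h3 := TT_le_nd (F := univ) (ω := ω) (a := a) (b := c) (subset_univ _)
  have h4 := TT_le_nd (F := univ) (ω := ω) (a := d) (b := b) (subset_univ _)
  omega

lemma fourth_root (j : ℕ) : ∃ k, k ^ 4 ≤ j ∧ j < (k + 1) ^ 4 := by
  refine ⟨Nat.sqrt (Nat.sqrt j), ?_, ?_⟩
  · have h1 := Nat.sqrt_le' j
    have h2 := Nat.sqrt_le' (Nat.sqrt j)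
    calc _ = (Nat.sqrt (Nat.sqrt j) ^ 2) ^ 2 := by ring
      _ ≤ (Nat.sqrt j) ^ 2 := Nat.pow_le_pow_left h2 2
      _ ≤ j := h1
  · have h1 := Nat.lt_succ_sqrt' j
    have h2 := Nat.lt_succ_sqrt' (Nat.sqrt j)
    calc j < (Nat.sqrt j + 1) ^ 2 := h1
      _ ≤ ((Nat.sqrt (Nat.sqrt j) + 1) ^ 2) ^ 2 := Nat.pow_le_pow_left h2 2
      _ = _ := by ring

lemma interp {t : ℕ → ℝ} {m L : ℝ} (hL : 0 ≤ L) (hlip : ∀ i j : ℕ, i ≤ j → |t j - t i| ≤ L * ((j:ℝ) - i))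
    (h : ∀ ε > 0, ∀ᶠ k : ℕ in atTop, |t (k ^ 4) - m * (k:ℝ) ^ 4| ≤ ε * (k:ℝ) ^ 4) :
    Tendsto (fun j : ℕ => t j / j) atTop (nhds m) := by
  rw [Metric.tendsto_atTop]
  intro ε hε
  obtain ⟨k0, hk0⟩ := eventually_atTop.1 (h (ε / 4) (by positivity))
  obtain ⟨k1, hk1⟩ := exists_nat_gt (15 * (L + |m|) * 4 / ε)
  refine ⟨(max k0 k1 + 1) ^ 4, fun j hj => ?_⟩
  obtain ⟨k, hk, hk'⟩ := fourth_root j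
  have hkk : max k0 k1 < k := by
    by_contra hcon
    have : (k + 1) ^ 4 ≤ (max k0 k1 + 1) ^ 4 := Nat.pow_le_pow_left (by omega) 4
    omega
  have hk0' := hk0 k (by omega)
  have hkpos : (1:ℝ) ≤ k := by exact_mod_cast (by omega : 1 ≤ k)
  have hk1' : (k1:ℝ) ≤ k := by exact_mod_cast (by omega : k1 ≤ k)
  have hl := hlip (k ^ 4) j hk
  have hkR : ((k:ℝ)) ^ 4 ≤ j := by exact_mod_cast hk
  have hkR' : (j:ℝ) ≤ (k + 1) ^ 4 := by exact_mod_cast hk'.le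
  push_cast at hl
  have hj0 : (0:ℝ) < j := by have : (0:ℝ) < (k:ℝ) ^ 4 := by positivity
                             linarith
  have hdiff : (j:ℝ) - k ^ 4 ≤ 15 * (k:ℝ) ^ 3 := by
    have h1 : (1:ℝ) ≤ (k:ℝ) ^ 3 := one_le_pow₀ hkpos
    have h2 : (k:ℝ) ^ 2 ≤ (k:ℝ) ^ 3 := pow_le_pow_right₀ hkpos (by norm_num)
    have h3 : (k:ℝ) ≤ (k:ℝ) ^ 3 := by simpa using pow_le_pow_right₀ hkpos (show 1 ≤ 3 by norm_num)
    have : ((k:ℝ) + 1) ^ 4 = k ^ 4 + 4 * k ^ 3 + 6 * k ^ 2 + 4 * k + 1 := by ring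
    linarith
  have hsmall : (L + |m|) * ((j:ℝ) - k ^ 4) ≤ ε / 4 * (k:ℝ) ^ 4 := by
    have h0 : 0 ≤ L + |m| := by positivity
    calc (L + |m|) * ((j:ℝ) - k ^ 4) ≤ (L + |m|) * (15 * (k:ℝ) ^ 3) := mul_le_mul_of_nonneg_left hdiff h0
      _ = (15 * (L + |m|) * 4 / ε) * (ε / 4) * (k:ℝ) ^ 3 := by field_simp
      _ ≤ k * (ε / 4) * (k:ℝ) ^ 3 := by gcongr; linarith
      _ = _ := by ring
  rw [Real.dist_eq, div_sub' hj0.ne', abs_div, abs_of_pos hj0, div_lt_iff₀ hj0]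
  have e1 : t j - j * m = (t j - t (k ^ 4)) + (t (k ^ 4) - m * (k:ℝ) ^ 4) + (-(m * ((j:ℝ) - k ^ 4))) := by ring
  rw [e1]
  have e2 : |-(m * ((j:ℝ) - k ^ 4))| = |m| * ((j:ℝ) - k ^ 4) := by
    rw [abs_neg, abs_mul, abs_of_nonneg (a := (j:ℝ) - k ^ 4) (by linarith)]
  have e3 := abs_add_three (t j - t (k ^ 4)) (t (k ^ 4) - m * (k:ℝ) ^ 4) (-(m * ((j:ℝ) - k ^ 4)))
  have : ε / 4 * (k:ℝ) ^ 4 ≤ ε / 4 * j := mul_le_mul_of_nonneg_left hkR (by positivity)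
  have : 0 < ε * j := by positivity
  nlinarith

theorem passage {p : unitInterval} (hp : 1 / 2 < (p:ℝ)) (u v : Vert) :
    ∃ m : ℝ, ∀ᵐ ω ∂(mu p), Tendsto (fun j : ℕ => (TT univ ω (sc j u) (sc j v) : ℝ) / j) atTop (nhds m) := by
  obtain ⟨N, C0, σ, hN, -, -, -, -, hgeo⟩ := geo_ae hp
  obtain ⟨A, ρ, hA, hρ, hρ1, hdec⟩ := exp_decay (q := unitInterval.symm p) (by simp; linarith)
  set w : Vert := v - u with hw
  have hww : nd 0 w = nd u v := by unfold nd; simp only [hw, Prod.fst_sub, Prod.snd_sub, Prod.fst_zero, Prod.snd_zero]; omega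
  set C : ℕ := N * (2 * nd u v) + nd 0 u + 1 with hC
  have hCw : nd u v ≤ C := by nlinarith
  have hR : ∀ j, nd 0 (sc j w) ≤ C * j := fun j => by rw [nd_sc_zero, hww, mul_comm]; exact Nat.mul_le_mul_right _ hCw
  set g : ℕ → ℝ := fun j => ∫ ω, (TT (ev (box 0 (C * j)) : Set Edge) ω 0 (sc j w) : ℝ) ∂(mu p) with hg
  have hdepT : ∀ (S : Finset Edge) (a b : Vert), Dep (S : Set Edge) (fun ω => (TT (S : Set Edge) ω a b : ℝ)) :=
    fun S a b => (TT_dep (S : Set Edge) a b).comp (fun k : ℕ => (k:ℝ))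
  have hmean : ∀ (j : ℕ) (c : Vert), ∫ ω, (TT (ev (box c (C * j)) : Set Edge) ω c (sc j w + c) : ℝ) ∂(mu p) = g j := by
    intro j c
    have := integral_TT_tre p 0 (sc j w) c (C * j) (hR j)
    simpa using this
  have hsub : Subadditive g := by
    intro j k
    rw [← hmean k (sc j w), ← integral_add ((hdepT _ _ _).integrable _) ((hdepT _ _ _).integrable _)]
    refine integral_mono ((hdepT _ _ _).integrable _) (((hdepT _ _ _).integrable _).add ((hdepT _ _ _).integrable _)) fun ω => ?_
    have hsa := sc_add j k w
    have hn : nd (sc j w) (sc k w + sc j w) = nd 0 (sc k w) := by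
      conv_lhs => rw [show sc j w = 0 + sc j w by simp]
      rw [← add_assoc, nd_add, add_zero]
    have := TT_tri (ω := ω) (F := (ev (box 0 (C * j)) : Set Edge)) (G := (ev (box (sc j w) (C * k)) : Set Edge))
      (K := (ev (box 0 (C * (j + k))) : Set Edge)) (a := 0) (b := sc j w) (c := sc (j + k) w)
      (fun e he => ev_box_mono (by have := hR j; rw [nd_self]; omega) he)
      (fun e he => ev_box_mono (by rw [hsa, hn]; have := hR k; rw [nd_self]; omega) he)
      (fun e he => ev_box_mono (by rw [nd_self, mul_add]; omega) he)
      (fun e he => ev_box_mono (by have := hR j; rw [mul_add]; omega) he)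
    rw [hsa] at this
    show (TT _ ω 0 (sc (j + k) w) : ℝ) ≤ _
    rw [hsa]
    exact_mod_cast this
  have hlim := hsub.tendsto_lim ⟨0, by
    rintro _ ⟨n, rfl⟩
    exact div_nonneg (integral_nonneg fun _ => Nat.cast_nonneg _) (Nat.cast_nonneg _)⟩
  set m := hsub.lim
  refine ⟨m, ?_⟩
  have hv : ∀ j, sc j v = sc j w + sc j u := by
    intro j; ext <;> simp [sc, hw] <;> ring
  -- Borel-Cantelli
  have hbc : ∀ i : ℕ, ∀ᵐ ω ∂(mu p), ∀ᶠ n : ℕ in atTop,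
      ω ∉ {ω | (1 / ((i:ℝ) + 1)) * ((n:ℝ) + 1) ^ 4 ≤ |(TT (ev (box (sc ((n + 1) ^ 4) u) (C * (n + 1) ^ 4)) : Set Edge) ω (sc ((n + 1) ^ 4) u) (sc ((n + 1) ^ 4) v) : ℝ) - g ((n + 1) ^ 4)|} := by
    intro i
    have hs1 : Summable (fun n : ℕ => 1 / ((n:ℝ) + 1) ^ 2) := by
      have := (summable_nat_add_iff 1).2 (Real.summable_one_div_nat_pow.2 (show 1 < 2 by norm_num))
      simpa using this
    have hs2 : Summable (fun n : ℕ => ((n:ℝ) + 1) ^ 8 * ρ ^ (n + 1)) := by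
      have := (summable_nat_add_iff 1).2 (summable_pow_mul_geometric_of_norm_lt_one 8 (r := ρ) (by rw [Real.norm_eq_abs, abs_of_pos hρ]; exact hρ1))
      simpa using this
    refine borel_cantelli (((hs1.mul_left (18 * (2 * (C:ℝ) + 1))).add (hs2.mul_left (2 * (2 * (C:ℝ) + 1) ^ 4 * A))).mul_left (((i:ℝ) + 1) ^ 2)) ?_
    intro n
    set k := n + 1 with hk
    have hRk : nd (sc (k ^ 4) u) (sc (k ^ 4) v) ≤ C * k ^ 4 := by
      rw [nd_sc, mul_comm]; exact Nat.mul_le_mul_right _ hCw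
    have hvar := var_TT p (r := k) hRk
    have hc := cheb p (hdepT _ _ _) (t := (1 / ((i:ℝ) + 1)) * ((n:ℝ) + 1) ^ 4) (by positivity) hvar
    have hm := hmean (k ^ 4) (sc (k ^ 4) u)
    rw [← hv] at hm
    rw [hm] at hc
    refine hc.trans ?_
    rw [div_le_iff₀ (by positivity)]
    have hkR : ((n:ℝ) + 1) = (k:ℝ) := by rw [hk]; push_cast; ring
    rw [hkR]
    have hk1 : (1:ℝ) ≤ k := by exact_mod_cast (by omega : 1 ≤ k)
    have hkp : (0:ℝ) < k := by linarith
    have hth := hdec k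
    have hk4 : (1:ℝ) ≤ (k:ℝ) ^ 4 := one_le_pow₀ hk1
    push_cast
    have b1 : 2 * ((C:ℝ) * k ^ 4) + 1 ≤ (2 * C + 1) * k ^ 4 := by nlinarith
    have b2 : (2 * (k:ℝ) + 1) ≤ 3 * k := by linarith
    have b3 : 2 * (2 * ((C:ℝ) * k ^ 4) + 1) * (2 * (k:ℝ) + 1) ^ 2 ≤ 2 * ((2 * C + 1) * k ^ 4) * (3 * k) ^ 2 := by gcongr
    have b4 : 2 * (2 * ((C:ℝ) * k ^ 4) + 1) ^ 4 * th (unitInterval.symm p) k ≤ 2 * ((2 * C + 1) * k ^ 4) ^ 4 * (A * ρ ^ k) := by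
      gcongr
      exact th_nonneg _ _
    refine (add_le_add b3 b4).trans (le_of_eq ?_)
    have : ((i:ℝ) + 1) ≠ 0 := by positivity
    field_simp
    ring
  filter_upwards [hgeo, ae_all_iff.2 hbc] with ω hG hB
  obtain ⟨m0, hG⟩ := hG
  have hlip : ∀ i j : ℕ, i ≤ j → |(TT univ ω (sc j u) (sc j v) : ℝ) - TT univ ω (sc i u) (sc i v)| ≤ (2 * (nd 0 u : ℝ) + 2 * nd 0 v) * ((j:ℝ) - i) := by
    intro i j hij
    have h1 := TT_lip ω (sc j u) (sc j v) (sc i u) (sc i v)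
    have h2 := TT_lip ω (sc i u) (sc i v) (sc j u) (sc j v)
    rw [nd_comm (sc i v), nd_sc_sub hij, nd_sc_sub hij] at h1
    rw [nd_comm (sc i u), nd_sc_sub hij, nd_sc_sub hij] at h2
    have h1' : (TT univ ω (sc j u) (sc j v) : ℝ) ≤ TT univ ω (sc i u) (sc i v) + 2 * (((j - i : ℕ):ℝ) * nd 0 u) + 2 * (((j - i : ℕ):ℝ) * nd 0 v) := by exact_mod_cast h1
    have h2' : (TT univ ω (sc i u) (sc i v) : ℝ) ≤ TT univ ω (sc j u) (sc j v) + 2 * (((j - i : ℕ):ℝ) * nd 0 u) + 2 * (((j - i : ℕ):ℝ) * nd 0 v) := by exact_mod_cast h2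
    rw [Nat.cast_sub hij] at h1' h2'
    rw [abs_le]; constructor <;> linarith
  refine interp (t := fun j => (TT univ ω (sc j u) (sc j v) : ℝ)) (by positivity) hlip ?_
  intro ε hε
  obtain ⟨i, hi⟩ := exists_nat_one_div_lt (show 0 < ε / 2 by positivity)
  have hpow : Tendsto (fun k : ℕ => k ^ 4) atTop atTop := tendsto_pow_atTop (by norm_num)
  have hg4 : ∀ᶠ k : ℕ in atTop, |g (k ^ 4) / ((k ^ 4 : ℕ):ℝ) - m| < ε / 2 := by
    have := (hlim.comp hpow).eventually (Metric.ball_mem_nhds m (show 0 < ε / 2 by positivity))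
    filter_upwards [this] with k hk
    exact hk
  have hB' : ∀ᶠ k : ℕ in atTop, |(TT (ev (box (sc (k ^ 4) u) (C * k ^ 4)) : Set Edge) ω (sc (k ^ 4) u) (sc (k ^ 4) v) : ℝ) - g (k ^ 4)| < (1 / ((i:ℝ) + 1)) * (k:ℝ) ^ 4 := by
    obtain ⟨n0, hn0⟩ := eventually_atTop.1 (hB i)
    refine eventually_atTop.2 ⟨n0 + 1, fun k hk => ?_⟩
    obtain ⟨n, rfl⟩ : ∃ n, k = n + 1 := ⟨k - 1, by omega⟩
    have := hn0 n (by omega)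
    simp only [mem_ofPred_eq, not_le] at this
    push_cast
    exact this
  filter_upwards [hg4, hB', eventually_ge_atTop (m0 + 1)] with k h1 h2 h3
  have hk1 : 1 ≤ k := by omega
  have hkk : k ≤ k ^ 4 := Nat.le_self_pow (by norm_num) k
  have hkC : k ^ 4 ≤ C * k ^ 4 := Nat.le_mul_of_pos_left _ (by omega)
  have hT : TT univ ω (sc (k ^ 4) u) (sc (k ^ 4) v) = TT (ev (box (sc (k ^ 4) u) (C * k ^ 4)) : Set Edge) ω (sc (k ^ 4) u) (sc (k ^ 4) v) := by
    refine hG.TT_eq (by omega) ?_ ?_ ?_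
    · rw [nd_sc, show N * (2 * (k ^ 4 * nd u v)) = (N * (2 * nd u v)) * k ^ 4 by ring]
      exact Nat.mul_le_mul_right _ (by omega)
    · rw [nd_sc_zero, mul_comm]
      refine le_trans (Nat.mul_le_mul_right _ (show nd 0 u ≤ C by omega)) (Nat.le_self_pow (by norm_num) _)
    · rw [nd_sc, mul_comm]; exact Nat.mul_le_mul_right _ hCw
  rw [hT]
  have hk4 : (0:ℝ) < (k:ℝ) ^ 4 := by have : (1:ℝ) ≤ k := by exact_mod_cast hk1
                                     positivity
  push_cast at h1
  rw [div_sub' hk4.ne', abs_div, abs_of_pos hk4, div_lt_iff₀ hk4] at h1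
  have h4 : (1 / ((i:ℝ) + 1)) * (k:ℝ) ^ 4 ≤ ε / 2 * (k:ℝ) ^ 4 := mul_le_mul_of_nonneg_right hi.le hk4.le
  have h5 := abs_sub_le (TT (ev (box (sc (k ^ 4) u) (C * k ^ 4)) : Set Edge) ω (sc (k ^ 4) u) (sc (k ^ 4) v) : ℝ) (g (k ^ 4)) (m * (k:ℝ) ^ 4)
  rw [mul_comm ((k:ℝ) ^ 4) m] at h1
  linarith

end BP
end



noncomputable section

namespace BP

/-! ### Enclosing trails -/

lemma rect_const {B : Vert → Z2} {a1 b1 a2 b2 : ℤ}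
    (h : ∀ e : Edge, a1 ≤ e.1.1 → (edgeTip e).1 ≤ b1 → a2 ≤ e.1.2 → (edgeTip e).2 ≤ b2 → dA B e = 0) {x y : Vert}
    (hx : a1 ≤ x.1 ∧ x.1 ≤ b1 ∧ a2 ≤ x.2 ∧ x.2 ≤ b2) (hy : a1 ≤ y.1 ∧ y.1 ≤ b1 ∧ a2 ≤ y.2 ∧ y.2 ≤ b2) : B x = B y := by
  have key : ∀ x : Vert, (a1 ≤ x.1 ∧ x.1 ≤ b1 ∧ a2 ≤ x.2 ∧ x.2 ≤ b2) → B x = B (a1, a2) := by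
    rintro ⟨x1, x2⟩ ⟨h1, h2, h3, h4⟩
    simp only at h1 h2 h3 h4
    have e1 : ∀ k : ℕ, a1 + k ≤ b1 → B (a1 + k, x2) = B (a1, x2) := by
      intro k
      induction k with
      | zero => simp
      | succ k ih =>
        intro hk
        push_cast at hk ⊢
        rw [← ih (by omega)]
        have := h ((a1 + k, x2), false) (by simp) (by simp [tip_false]; omega) h3 (by simp [tip_false]; omega)
        rw [dA, tip_false] at this
        have := z2_eq_of_add this
        simp only [Prod.mk_add_mk, add_zero] at this
        rw [this, add_assoc]
    have e2 : ∀ k : ℕ, a2 + k ≤ b2 → B (a1, a2 + k) = B (a1, a2) := by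
      intro k
      induction k with
      | zero => simp
      | succ k ih =>
        intro hk
        push_cast at hk ⊢
        rw [← ih (by omega)]
        have := h ((a1, a2 + k), true) (by simp) (by simp [tip_true]; omega) (by simp) (by simp [tip_true]; omega)
        rw [dA, tip_true] at this
        have := z2_eq_of_add this
        simp only [Prod.mk_add_mk, add_zero] at this
        rw [this, add_assoc]
    have f1 := e1 (x1 - a1).toNat (by omega)
    have f2 := e2 (x2 - a2).toNat (by omega)
    rw [show a1 + ((x1 - a1).toNat : ℤ) = x1 by omega] at f1
    rw [show a2 + ((x2 - a2).toNat : ℤ) = x2 by omega] at f2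
    rw [f1, f2]
  rw [key x hx, key y hy]

lemma plane_const {B : Vert → Z2} (h : ∀ e, dA B e = 0) (x y : Vert) : B x = B y :=
  rect_const (a1 := min x.1 y.1) (b1 := max x.1 y.1) (a2 := min x.2 y.2) (b2 := max x.2 y.2) (fun e _ _ _ _ => h e)
    (by refine ⟨?_, ?_, ?_, ?_⟩ <;> omega) (by refine ⟨?_, ?_, ?_, ?_⟩ <;> omega)

lemma trails (O : Set Vert) (F : Finset Edge) (hF : ∀ y, y ∉ O → pl (Nf F) y = 0) :
    ∃ L : Finset (List Edge), (∀ l ∈ L, Trail O l) ∧ (∀ e, Nf F e = ∑ l ∈ L, Nw l e) ∧ (∀ l ∈ L, ∀ e ∈ l, e ∈ F) ∧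
      ∀ ω : Config, ∑ l ∈ L, l.countP ω = (F.filter (fun e => ω e = true)).card := by
  classical
  obtain ⟨Ls, h1, h2, h3⟩ := trail_decomp O _ F rfl hF
  have hnd : Ls.Nodup := by
    refine List.Pairwise.imp_of_mem ?_ (List.nodup_flatten.1 h2).2
    intro a b ha hb hab heq
    subst heq
    obtain ⟨_, _, _, _, hne, _⟩ := h1 a ha
    obtain ⟨e, he⟩ := List.exists_mem_of_ne_nil a hne
    exact hab he he
  have hcount : ∀ g : Edge → Bool, ∑ l ∈ Ls.toFinset, l.countP g = Ls.flatten.countP g := by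
    intro g
    rw [List.countP_flatten, List.sum_toFinset _ hnd]
  refine ⟨Ls.toFinset, fun l hl => h1 l (List.mem_toFinset.1 hl), fun e => ?_, fun l hl e he => ?_, fun ω => ?_⟩
  · have h4 : ∑ l ∈ Ls.toFinset, l.count e = Ls.flatten.count e := hcount _
    unfold Nw
    rw [← Nat.cast_sum, h4]
    have := Nw_nodup h2 (e := e)
    unfold Nw at this
    rw [this]
    unfold Nf
    simp only [h3]
  · exact (h3 e).1 (List.mem_flatten.2 ⟨l, List.mem_toFinset.1 hl, he⟩)
  · rw [hcount, List.countP_eq_length_filter, ← List.toFinset_card_of_nodup (h2.filter _)]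
    congr 1
    ext e
    simp only [List.mem_toFinset, List.mem_filter, h3, Finset.mem_filter]

/-- the farthest point of a walk -/
lemma DWalk.far {a b : Vert} {l : List Edge} (h : DWalk a l b) :
    ∃ l1 l2 c, l = l1 ++ l2 ∧ DWalk a l1 c ∧ DWalk c l2 b ∧ nd a b ≤ nd a c ∧ ∀ e ∈ l, e ∈ ev (box a (nd a c)) := by
  classical
  let P : Set ℕ := {k | ∃ l1 l2 c, l = l1 ++ l2 ∧ DWalk a l1 c ∧ DWalk c l2 b ∧ k = nd a c}
  have hne : P.Nonempty := ⟨_, [], l, a, rfl, .nil a, h, rfl⟩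
  have hb : BddAbove P := by
    refine ⟨l.length, ?_⟩
    rintro k ⟨l1, l2, c, rfl, h1, h2, rfl⟩
    refine h1.nd_le_length.trans ?_
    simp
  obtain ⟨l1, l2, c, e1, h1, h2, h3⟩ := Nat.sSup_mem hne hb
  have hmax : ∀ l1 l2 x, l = l1 ++ l2 → DWalk a l1 x → DWalk x l2 b → nd a x ≤ nd a c := by
    intro l1 l2 x e1 w1 w2
    rw [← h3]
    exact le_csSup hb ⟨l1, l2, x, e1, w1, w2, rfl⟩
  refine ⟨l1, l2, c, e1, h1, h2, hmax l [] b (by simp) h (.nil b), ?_⟩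
  intro e he
  obtain ⟨m1, m2, x, y, rfl, w1, hs, w2⟩ := h.split_at he
  have k1 := hmax m1 (e :: m2) x rfl w1 (.cons hs w2)
  have k2 := hmax (m1 ++ [e]) m2 y (by simp) (w1.append (.single hs)) w2
  rw [mem_ev, mem_box, mem_box]
  rcases hs with ⟨rfl, rfl⟩ | ⟨rfl, rfl⟩ <;> omega

/-- edge boundary of a finite set -/
def bde (A : Finset Vert) : Finset Edge := by
  classical
  exact ((A ∪ A.image (fun x => x - (1, 0)) ∪ A.image (fun x => x - (0, 1))) ×ˢ Finset.univ).filter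
    (fun e => (e.1 ∈ A ∧ edgeTip e ∉ A) ∨ (e.1 ∉ A ∧ edgeTip e ∈ A))

lemma mem_bde {A : Finset Vert} {e : Edge} : e ∈ bde A ↔ (e.1 ∈ A ∧ edgeTip e ∉ A) ∨ (e.1 ∉ A ∧ edgeTip e ∈ A) := by
  classical
  unfold bde
  rw [Finset.mem_filter]
  refine ⟨fun h => h.2, fun h => ⟨?_, h⟩⟩
  rw [Finset.mem_product]
  refine ⟨?_, Finset.mem_univ _⟩
  simp only [Finset.mem_union, Finset.mem_image]
  rcases h with h | h
  · exact Or.inl (Or.inl h.1)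
  · obtain ⟨x, b⟩ := e
    cases b
    · left; right; exact ⟨_, h.2, by rw [tip_false]; simp⟩
    · right; exact ⟨_, h.2, by rw [tip_true]; simp⟩

def i2 (A : Set Vert) (x : Vert) : Z2 := by
  classical
  exact if x ∈ A then 1 else 0

lemma i2_eq_zero {A : Set Vert} {x : Vert} : i2 A x = 0 ↔ x ∉ A := by
  unfold i2; split_ifs with h <;> simp [h]
lemma i2_eq_one {A : Set Vert} {x : Vert} : i2 A x = 1 ↔ x ∈ A := by
  unfold i2; split_ifs with h <;> simp [h]

lemma dA_i2 (A : Finset Vert) (e : Edge) : dA (i2 (A : Set Vert)) e = Nf (bde A) e := by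
  unfold dA Nf i2
  simp only [mem_bde, Finset.mem_coe]
  by_cases h1 : e.1 ∈ A <;> by_cases h2 : edgeTip e ∈ A <;> simp [h1, h2, z2_self]

/-- adjacency in the lattice within a set -/
def adjA (A : Set Vert) (s t : Vert) : Prop :=
  ∃ e : Edge, ((e.1 = s ∧ edgeTip e = t) ∨ (e.1 = t ∧ edgeTip e = s)) ∧ s ∈ A ∧ t ∈ A

lemma const_of_adjA {A : Set Vert} {S : Vert → Z2} (hS : ∀ e : Edge, e.1 ∈ A → edgeTip e ∈ A → dA S e = 0) {x y : Vert}
    (h : Relation.ReflTransGen (adjA A) x y) : S x = S y := by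
  induction h with
  | refl => rfl
  | tail _ h ih =>
    rw [ih]
    obtain ⟨e, he | he, h1, h2⟩ := h
    · obtain ⟨rfl, rfl⟩ := he
      exact z2_eq_of_add (hS e h1 h2)
    · obtain ⟨rfl, rfl⟩ := he
      exact (z2_eq_of_add (hS e h2 h1)).symm

lemma enclosure {ω : Config} {A : Finset Vert} (hcl : ∀ e ∈ bde A, ω e = false) {x y : Vert} (hx : x ∈ A)
    (hxy : Relation.ReflTransGen (adjA (A : Set Vert)) x y) :
    ∃ a l b, DWalk a l b ∧ l.countP ω = 0 ∧ nd x y ≤ 2 * nd a b + 2 ∧ nd x a ≤ nd a b + 1 := by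
  classical
  obtain ⟨L, h1, h2, h3, -⟩ := trails ∅ (bde A) (fun y _ => by
    rw [← pl_dA (i2 (A : Set Vert)) y]; congr 1; funext e; exact (dA_i2 A e).symm)
  have hS : ∀ l ∈ L, ∃ (a : Vert) (l1 : List Edge) (c : Vert) (S : Vert → Z2), DWalk a l1 c ∧ (∀ e ∈ l1, e ∈ bde A) ∧
      (∀ e, dA S e = Nw l e) ∧ ∀ x, S x ≠ 0 → nd a x ≤ nd a c + 1 := by
    intro l hl
    obtain ⟨a, b, hw, -, -, hab⟩ := h1 l hl
    simp only [mem_empty_iff_false, false_and, or_false] at hab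
    subst hab
    obtain ⟨l1, l2, c, e1, w1, -, -, hbox⟩ := hw.far
    obtain ⟨S, s1, s2⟩ := plane_potential (Nw l) a (nd a c) (fun y => by rw [pl_Nw hw, z2_self]) (fun e he => by
      exact mem_box.1 (mem_ev.1 (hbox e (Nw_ne_zero he))).1)
    exact ⟨a, l1, c, S, w1, fun e he => h3 l hl e (by rw [e1]; simp [he]), s1, s2⟩
  choose! a l1 c S w1 hl1 s1 s2 using hS
  -- the sum of the potentials is the indicator
  have hconst : ∀ z, i2 (A : Set Vert) z = ∑ l ∈ L, S l z := by
    have hd : ∀ e, dA (fun z => i2 (A : Set Vert) z + ∑ l ∈ L, S l z) e = 0 := by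
      intro e
      rw [dA_add, dA_i2, dA_sum, h2, Finset.sum_congr rfl (fun l hl => s1 l hl e), z2_self]
    -- a far point
    obtain ⟨M, hM⟩ : ∃ M : ℕ, (∀ z ∈ A, nd 0 z < M) ∧ ∀ l ∈ L, nd 0 (a l) + (nd (a l) (c l) + 1) < M := by
      refine ⟨A.sup (nd 0) + L.sup (fun l => nd 0 (a l) + (nd (a l) (c l) + 1)) + 1, fun z hz => ?_, fun l hl => ?_⟩
      · have := Finset.le_sup (f := nd 0) hz; omega
      · have := Finset.le_sup (f := fun l => nd 0 (a l) + (nd (a l) (c l) + 1)) hl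
        omega
    have hfar : nd 0 ((M:ℤ), (0:ℤ)) = M := by unfold nd; simp
    intro z
    have := plane_const hd z ((M:ℤ), (0:ℤ))
    have z1 : i2 (A : Set Vert) ((M:ℤ), (0:ℤ)) = 0 := i2_eq_zero.2 fun h => by
      have := hM.1 _ h; omega
    have z2 : ∑ l ∈ L, S l ((M:ℤ), (0:ℤ)) = 0 := Finset.sum_eq_zero fun l hl => by
      by_contra hne
      have k1 := s2 l hl _ hne
      have k2 := nd_tri 0 (a l) ((M:ℤ), (0:ℤ))
      have := hM.2 l hl
      omega
    rw [z1, z2, add_zero] at this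
    exact z2_eq_of_add this
  have hx1 : ∑ l ∈ L, S l x ≠ 0 := by
    rw [← hconst, i2_eq_one.2 (by exact_mod_cast hx)]; decide
  obtain ⟨l, hl, hlx⟩ := Finset.exists_ne_zero_of_sum_ne_zero hx1
  have hly : S l y ≠ 0 := by
    rw [← const_of_adjA (S := S l) (fun e he1 he2 => ?_) hxy]
    · exact hlx
    · rw [s1 l hl]
      by_contra hne
      have := mem_bde.1 (h3 l hl e (Nw_ne_zero hne))
      simp only [Finset.mem_coe] at he1 he2
      tauto
  have k1 := s2 l hl x hlx
  have k2 := s2 l hl y hly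
  refine ⟨a l, l1 l, c l, w1 l hl, ?_, ?_, ?_⟩
  · rw [List.countP_eq_zero]
    intro e he
    simp [hcl e (hl1 l hl e he)]
  · have := nd_tri x (a l) y
    rw [nd_comm x (a l)] at this
    omega
  · rw [nd_comm]; exact k1

lemma Geo.no_zero {N m0 : ℕ} {ω : Config} (hG : Geo N m0 ω) {a b : Vert} {l : List Edge} (h : DWalk a l b) (h0 : l.countP ω = 0)
    (hm : m0 ≤ nd a b) (ha : nd 0 a ≤ (nd a b) ^ 9) : False := by
  have := hG a l b h hm ha
  rw [h0] at this; omega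

lemma pow_aux {k K : ℕ} (h2 : 2 ≤ k) (hK : K ≤ k ^ 8) : K + k + 1 ≤ k ^ 9 := by
  have h1 : k + 1 ≤ k ^ 8 := by
    have : k ^ 8 = k ^ 6 * k * k := by ring
    have h6 : 1 ≤ k ^ 6 := Nat.one_le_pow _ _ (by omega)
    nlinarith [Nat.mul_le_mul h6 (le_refl (k * k))]
  have : k ^ 9 = k ^ 8 * k := by ring
  nlinarith

lemma openAdj_symm {ω : Config} {x y : Vert} (h : openAdj ω x y) : openAdj ω y x := by
  obtain ⟨e, he, h | h⟩ := h
  · exact ⟨e, he, Or.inr h⟩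
  · exact ⟨e, he, Or.inl h⟩

lemma cluster_closed (ω : Config) (U : Set Vert) (A : Finset Vert) (hA : ∀ z, z ∈ A ↔ ∃ x ∈ U, z ∈ cluster ω x) :
    ∀ e ∈ bde A, ω e = false := by
  intro e he
  by_contra hne
  have hne : ω e = true := by simpa using hne
  rcases mem_bde.1 he with ⟨h1, h2⟩ | ⟨h1, h2⟩
  · obtain ⟨x, hx, hz⟩ := (hA _).1 h1
    exact h2 ((hA _).2 ⟨x, hx, Relation.ReflTransGen.tail hz ⟨e, hne, Or.inl ⟨rfl, rfl⟩⟩⟩)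
  · obtain ⟨x, hx, hz⟩ := (hA _).1 h2
    exact h1 ((hA _).2 ⟨x, hx, Relation.ReflTransGen.tail hz ⟨e, hne, Or.inr ⟨rfl, rfl⟩⟩⟩)

lemma Geo.mem_Cinf {N m0 : ℕ} {ω : Config} (hG : Geo N m0 ω) {x y : Vert} {k : ℕ} (hk : m0 ≤ k) (h2 : 2 ≤ k)
    (hx : nd 0 x ≤ k ^ 8) (hxy : y ∈ cluster ω x) (hn : 2 * k + 2 ≤ nd x y) : x ∈ Cinf ω := by
  by_contra hfin
  have hfin : (cluster ω x).Finite := by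
    by_contra h; exact hfin h
  have hA := cluster_closed ω {x} hfin.toFinset (by intro z; simp)
  have hpath : ∀ y, y ∈ cluster ω x → Relation.ReflTransGen (adjA (hfin.toFinset : Set Vert)) x y := by
    intro y hy
    induction hy with
    | refl => exact Relation.ReflTransGen.refl
    | tail h1 h2 ih =>
      rename_i s t
      refine ih.tail ?_
      obtain ⟨e, he, h⟩ := h2
      exact ⟨e, h, by simp; exact h1, by simp; exact Relation.ReflTransGen.tail h1 ⟨e, he, h⟩⟩
  obtain ⟨a, l, b, w, w0, n1, n2⟩ := enclosure hA (x := x) (y := y) (by simp; exact Relation.ReflTransGen.refl) (hpath y hxy)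
  refine hG.no_zero w w0 (by omega) ?_
  have := nd_tri 0 x a
  have := pow_aux (k := nd a b) (K := nd 0 x) (by omega) (hx.trans (Nat.pow_le_pow_left (by omega) 8))
  omega

lemma Geo.Cinf_nonempty {N m0 : ℕ} {ω : Config} (hG : Geo N m0 ω) : ∃ x, x ∈ Cinf ω := by
  classical
  by_contra hcon
  push Not at hcon
  have hfin : ∀ x, (cluster ω x).Finite := fun x => by
    by_contra h; exact hcon x h
  set k := m0 + 2
  set A := (box 0 (2 * k + 2)).biUnion (fun x => (hfin x).toFinset) with hA
  have hcl := cluster_closed ω (box 0 (2 * k + 2) : Set Vert) A (by intro z; simp [hA])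
  have hsub : ∀ x ∈ box 0 (2 * k + 2), x ∈ A := fun x hx => by
    rw [hA, Finset.mem_biUnion]; exact ⟨x, hx, by simp; exact Relation.ReflTransGen.refl⟩
  have hpath : ∀ i : ℕ, i ≤ 2 * k + 2 → Relation.ReflTransGen (adjA (A : Set Vert)) 0 ((i:ℤ), (0:ℤ)) := by
    intro i
    induction i with
    | zero => intro _; exact Relation.ReflTransGen.refl
    | succ i ih =>
      intro hi
      refine (ih (by omega)).tail ⟨((i, 0), false), Or.inl ⟨rfl, by rw [tip_false]; simp⟩, hsub _ ?_, hsub _ ?_⟩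
      · rw [mem_box]; unfold nd; simp; omega
      · rw [mem_box]; unfold nd; simp; omega
  obtain ⟨a, l, b, w, w0, n1, n2⟩ := enclosure hcl (x := 0) (hsub 0 (by rw [mem_box, nd_self]; omega)) (hpath (2 * k + 2) le_rfl)
  have hn : nd 0 (((2 * k + 2 : ℕ):ℤ), (0:ℤ)) = 2 * k + 2 := by unfold nd; simp; omega
  rw [hn] at n1
  refine hG.no_zero w w0 (by omega) ?_
  have := pow_aux (k := nd a b) (K := 0) (by omega) (Nat.zero_le _)
  omega

end BP
end



noncomputable section

namespace BP

/-! ### Density of the infinite cluster -/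

lemma count_cheb (p : unitInterval) (Q : Finset Vert) (R : ℕ) {t : ℝ} (ht : 0 < t) :
    pr p {η | t ≤ |(∑ x ∈ Q, ind (Arm x R) η) - Q.card * th p R|} ≤ (Q.card : ℝ) * (4 * R + 1) ^ 2 / t ^ 2 := by
  classical
  have hdep : ∀ x ∈ Q, Dep ((Q.biUnion fun x => ev (box x R) : Finset Edge) : Set Edge) (ind (Arm x R)) := fun x hx =>
    (dep_arm x R).ind.mono (by exact_mod_cast Finset.subset_biUnion_of_mem (fun x => ev (box x R)) hx)
  have hf : Dep ((Q.biUnion fun x => ev (box x R) : Finset Edge) : Set Edge) (fun η => ∑ x ∈ Q, ind (Arm x R) η) := by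
    intro η η' h
    exact Finset.sum_congr rfl fun x hx => hdep x hx η η' h
  have hI : ∀ x, Integrable (ind (Arm x R)) (mu p) := fun x => ((dep_arm x R).ind).integrable _
  have hm : ∀ x, ∫ η, ind (Arm x R) η ∂(mu p) = th p R := fun x => by
    rw [← pr_eq_integral p (measurable_arm x R), pr_arm]
  have hmean : ∫ η, (∑ x ∈ Q, ind (Arm x R) η) ∂(mu p) = Q.card * th p R := by
    rw [integral_finsetSum _ (fun x _ => hI x), Finset.sum_congr rfl (fun x _ => hm x)]
    simp
  rw [← hmean]
  refine cheb p hf ht ?_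
  rw [hmean]
  have hdep2 : ∀ x ∈ Q, ∀ y ∈ Q, Integrable (fun η => ind (Arm x R) η * ind (Arm y R) η) (mu p) := fun x hx y hy =>
    ((hdep x hx).comp2 (hdep y hy) (fun a b => a * b)).integrable _
  have hsq : ∫ η, (∑ x ∈ Q, ind (Arm x R) η) ^ 2 ∂(mu p) = ∑ x ∈ Q, ∑ y ∈ Q, ∫ η, ind (Arm x R) η * ind (Arm y R) η ∂(mu p) := by
    simp_rw [sq, Finset.sum_mul_sum]
    rw [integral_finsetSum _ (fun x hx => integrable_finset_sum _ fun y hy => hdep2 x hx y hy)]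
    exact Finset.sum_congr rfl fun x hx => integral_finsetSum _ fun y hy => hdep2 x hx y hy
  have hb : ∀ x ∈ Q, ∀ y ∈ Q, ∫ η, ind (Arm x R) η * ind (Arm y R) η ∂(mu p) ≤ th p R * th p R + (if y ∈ box x (2 * R) then 1 else 0) := by
    intro x hx y hy
    split_ifs with h
    · have h1 : ∫ η, ind (Arm x R) η * ind (Arm y R) η ∂(mu p) ≤ ∫ η, (1:ℝ) ∂(mu p) := by
        refine integral_mono (hdep2 x hx y hy) (integrable_const _) fun η => ?_
        exact mul_le_one₀ (ind_le_one _ _) (ind_nonneg _ _) (ind_le_one _ _)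
      have h2 := mul_self_nonneg (th p R)
      simp at h1
      linarith
    · rw [mem_box] at h
      rw [integral_mul_dep p (dep_arm x R).ind (dep_arm y R).ind (disjoint_ev (by omega)), hm, hm]
      simp
  have hs : ∑ x ∈ Q, ∑ y ∈ Q, ∫ η, ind (Arm x R) η * ind (Arm y R) η ∂(mu p) ≤
      ∑ x ∈ Q, (Q.card * (th p R * th p R) + (4 * R + 1) ^ 2) := by
    refine Finset.sum_le_sum fun x hx => ?_
    refine (Finset.sum_le_sum fun y hy => hb x hx y hy).trans ?_
    rw [Finset.sum_add_distrib]
    refine add_le_add (by simp) ?_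
    rw [← Finset.sum_filter, Finset.sum_const, nsmul_eq_mul, mul_one]
    have : (Q.filter (fun y => y ∈ box x (2 * R))).card ≤ (4 * R + 1) ^ 2 := by
      refine (Finset.card_le_card (fun y hy => (Finset.mem_filter.1 hy).2)).trans ?_
      rw [card_box]
      apply le_of_eq; ring
    exact_mod_cast this
  rw [hsq]
  rw [Finset.sum_const, nsmul_eq_mul] at hs
  nlinarith

lemma sg_sg (x : Vert) : sg (sg x) = x := by simp [sg]
lemma ta_ta (e : Edge) : ta (ta e) = e := by simp [ta, sg_sg]
lemma nd_sg (x y : Vert) : nd (sg x) (sg y) = nd x y := by simp only [nd, sg]; omega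

lemma openAdj_iff_dstep {ω : Config} {x y : Vert} : openAdj ω x y ↔ ∃ e, ω (ta e) = true ∧ dstep e (sg x) (sg y) := by
  have h1 : ∀ e, (ta e).1 = sg e.1 := fun e => rfl
  have hs : ∀ {u v : Vert}, sg u = v ↔ v = sg u := fun {u v} => eq_comm
  have key : ∀ (e : Edge) (x y : Vert), ((ta e).1 = x ∧ edgeTip (ta e) = y) ↔ (sg x = e.1 ∧ sg y = dB e) := by
    intro e x y
    rw [h1, tip_ta]
    constructor
    · rintro ⟨rfl, rfl⟩; simp [sg_sg]
    · rintro ⟨h, h'⟩; rw [← h, ← h']; simp [sg_sg]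
  constructor
  · rintro ⟨e, he, h⟩
    refine ⟨ta e, by rw [ta_ta]; exact he, ?_⟩
    rw [← ta_ta e, key, key] at h
    unfold dstep; tauto
  · rintro ⟨e, he, h⟩
    refine ⟨ta e, he, ?_⟩
    rw [key, key]
    unfold dstep at h; tauto

lemma cluster_iff_cn {ω : Config} {x y : Vert} : y ∈ cluster ω x ↔ cn (fun e => ω (ta e)) univ (sg x) (sg y) := by
  constructor
  · intro h
    induction (h : Relation.ReflTransGen (openAdj ω) x y) with
    | refl => exact cn_refl
    | tail _ h2 ih => exact ih.tail ⟨trivial, trivial, openAdj_iff_dstep.1 h2⟩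
  · intro h
    obtain ⟨z, hz⟩ : ∃ z, z = sg y := ⟨_, rfl⟩
    have hy : y = sg z := by rw [hz, sg_sg]
    rw [← hz] at h
    rw [hy]
    clear hy hz
    induction h with
    | refl => rw [sg_sg]; exact Relation.ReflTransGen.refl
    | tail _ h2 ih =>
      refine Relation.ReflTransGen.tail ih (openAdj_iff_dstep.2 ?_)
      rw [sg_sg, sg_sg]; exact h2.2.2

lemma arm_iff {ω : Config} {x : Vert} {R : ℕ} : (fun e => ω (ta e)) ∈ Arm (sg x) R ↔ ∃ y ∈ cluster ω x, R ≤ nd x y := by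
  constructor
  · rintro ⟨b, hb, hc⟩
    refine ⟨sg b, cluster_iff_cn.2 (by rw [sg_sg]; exact cn_mono hc (fun _ h => h) (subset_univ _)), ?_⟩
    rw [← nd_sg, sg_sg]; exact hb
  · rintro ⟨y, hy, h⟩
    exact arm_mem_of_cn (cluster_iff_cn.1 hy) (by rw [nd_sg]; exact h)

lemma Cinf_far {ω : Config} {x : Vert} (h : x ∈ Cinf ω) (R : ℕ) : ∃ y ∈ cluster ω x, R ≤ nd x y := by
  by_contra hcon
  push Not at hcon
  exact h ((box x R).finite_toSet.subset fun y hy => by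
    rw [Finset.mem_coe, mem_box]; exact (hcon y hy).le)

def thet (p : unitInterval) : ℝ := ⨅ i, th p i

lemma thet_tendsto (p : unitInterval) : Tendsto (th p) atTop (nhds (thet p)) :=
  tendsto_atTop_ciInf (fun _ _ hab => th_anti p hab) ⟨0, by rintro _ ⟨n, rfl⟩; exact pr_nonneg _ _⟩

lemma thet_pos {p : unitInterval} (hp : 1 / 2 < (p : ℝ)) : 0 < thet p := by
  have h0 : 0 ≤ thet p := Real.iInf_nonneg fun i => pr_nonneg _ _
  rcases h0.lt_or_eq with h | h
  · exact h
  exfalso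
  have hx : ∀ x : Vert, ∀ᵐ ω ∂(mu p), x ∉ Cinf ω := by
    intro x
    have hle : ∀ R, pr p {ω | x ∈ Cinf ω} ≤ th p R := by
      intro R
      refine (pr_mono p (B := {ω | (fun e => ω (ta e)) ∈ Arm (sg x) R}) fun ω hω => arm_iff.2 (Cinf_far hω R)).trans ?_
      rw [pr_reindex p ta ta_inj (measurable_arm _ _), pr_arm]
    have h1 : pr p {ω | x ∈ Cinf ω} ≤ thet p := le_ciInf hle
    have h2 : pr p {ω | x ∈ Cinf ω} = 0 := le_antisymm (h ▸ h1) (pr_nonneg _ _)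
    have h3 : (mu p) {ω | x ∈ Cinf ω} = 0 := by
      unfold pr at h2
      rwa [measureReal_eq_zero_iff] at h2
    rw [ae_iff]
    simpa using h3
  obtain ⟨N, C, σ, -, -, -, -, -, hG⟩ := geo_ae hp
  obtain ⟨ω, ⟨m0, h1⟩, h2⟩ := (hG.and (ae_all_iff.2 hx)).exists
  obtain ⟨x, hx⟩ := h1.Cinf_nonempty
  exact h2 x hx

/-- the `w`-th cell of side `j` -/
def cell (j : ℕ) (w : Vert) : Finset Vert :=
  Finset.Ioc (j * (w.1 - 1)) (j * w.1) ×ˢ Finset.Ioc (j * (w.2 - 1)) (j * w.2)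

lemma mem_cell {j : ℕ} {w x : Vert} : x ∈ cell j w ↔ j * (w.1 - 1) < x.1 ∧ x.1 ≤ j * w.1 ∧ j * (w.2 - 1) < x.2 ∧ x.2 ≤ j * w.2 := by
  unfold cell; rw [Finset.mem_product, Finset.mem_Ioc, Finset.mem_Ioc]; tauto

lemma card_cell (j : ℕ) (w : Vert) : (cell j w).card = j ^ 2 := by
  unfold cell
  rw [Finset.card_product, Int.card_Ioc, Int.card_Ioc, sq]
  congr 1
  · rw [show (j:ℤ) * w.1 - j * (w.1 - 1) = j by ring]; simp
  · rw [show (j:ℤ) * w.2 - j * (w.2 - 1) = j by ring]; simp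

def k4 (j : ℕ) : ℕ := Nat.sqrt (Nat.sqrt j)

lemma k4_le (j : ℕ) : k4 j ^ 4 ≤ j := by
  have h1 := Nat.sqrt_le' (Nat.sqrt j)
  have h2 := Nat.sqrt_le' j
  calc k4 j ^ 4 = (k4 j ^ 2) ^ 2 := by ring
    _ ≤ (Nat.sqrt j) ^ 2 := Nat.pow_le_pow_left h1 2
    _ ≤ j := h2

lemma lt_k4 (j : ℕ) : j < (k4 j + 1) ^ 4 := by
  have h1 := Nat.lt_succ_sqrt' (Nat.sqrt j)
  have h2 := Nat.lt_succ_sqrt' j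
  calc j < (Nat.sqrt j + 1) ^ 2 := h2
    _ ≤ ((k4 j + 1) ^ 2) ^ 2 := Nat.pow_le_pow_left h1 2
    _ = _ := by ring

lemma k4_tendsto : Tendsto k4 atTop atTop := by
  rw [tendsto_atTop]
  intro b
  filter_upwards [eventually_ge_atTop (b ^ 4)] with j hj
  by_contra h
  have h1 := lt_k4 j
  have h2 : (k4 j + 1) ^ 4 ≤ b ^ 4 := Nat.pow_le_pow_left (by omega) 4
  omega

lemma k4_big (D : ℕ) : ∀ᶠ j in atTop, D * j ≤ k4 j ^ 8 := by
  filter_upwards [k4_tendsto.eventually_ge_atTop (16 * D + 1)] with j hk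
  have h1 := lt_k4 j
  have h2 : (k4 j + 1) ^ 4 ≤ (2 * k4 j) ^ 4 := Nat.pow_le_pow_left (by omega) 4
  have h3 : j ≤ 16 * k4 j ^ 4 := by
    have : (2 * k4 j) ^ 4 = 16 * k4 j ^ 4 := by ring
    omega
  have h4 : 16 * D ≤ k4 j ^ 4 := by
    have := Nat.le_self_pow (n := 4) (by norm_num) (k4 j); omega
  calc D * j ≤ D * (16 * k4 j ^ 4) := Nat.mul_le_mul_left _ h3
    _ = (16 * D) * k4 j ^ 4 := by ring
    _ ≤ k4 j ^ 4 * k4 j ^ 4 := Nat.mul_le_mul_right _ h4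
    _ = k4 j ^ 8 := by ring

lemma nd_cell {j : ℕ} {w x : Vert} (h : x ∈ cell j w) : nd 0 x ≤ (nd 0 w + 1) * j := by
  rw [mem_cell] at h
  have h1 : ∀ a b : ℤ, j * (a - 1) < b → b ≤ j * a → b.natAbs ≤ (a.natAbs + 1) * j := by
    intro a b ha hb
    zify
    rcases abs_cases a with ⟨e, h⟩ | ⟨e, h⟩ <;> rcases abs_cases b with ⟨e', h'⟩ | ⟨e', h'⟩ <;> rw [e, e'] <;> nlinarith
  have e1 := h1 _ _ h.1 h.2.1
  have e2 := h1 _ _ h.2.2.1 h.2.2.2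
  have e3 : nd 0 w = max w.1.natAbs w.2.natAbs := by unfold nd; simp
  have e4 : nd 0 x = max x.1.natAbs x.2.natAbs := by unfold nd; simp
  rw [e4, e3]
  refine max_le (e1.trans (Nat.mul_le_mul_right _ ?_)) (e2.trans (Nat.mul_le_mul_right _ ?_)) <;> omega

lemma density {p : unitInterval} (hp : 1 / 2 < (p : ℝ)) (w : Vert) :
    ∀ᵐ ω ∂(mu p), Tendsto (fun j : ℕ => ((Cinf ω ∩ (cell j w : Set Vert)).ncard : ℝ) / j ^ 2) atTop (nhds (thet p)) := by
  classical
  obtain ⟨N, C, σ, -, -, -, -, -, hG⟩ := geo_ae hp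
  let R : ℕ → ℕ := fun j => 2 * k4 j + 2
  let cnt : ℕ → Config → ℝ := fun j ω => ∑ x ∈ cell j w, ind (Arm (sg x) (R j)) (fun e => ω (ta e))
  have hsum : ∀ s : ℕ, ∀ᵐ ω ∂(mu p), ∀ᶠ j : ℕ in atTop, |cnt (j+1) ω - (j+1:ℕ) ^ 2 * th p (R (j+1))| < (1 / (s + 1) : ℝ) * (j+1:ℕ) ^ 2 := by
    intro s
    have hb : ∀ j : ℕ, pr p {ω | (1 / (s + 1) : ℝ) * (j+1:ℕ) ^ 2 ≤ |cnt (j+1) ω - (j+1:ℕ) ^ 2 * th p (R (j+1))|} ≤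
        (s + 1) ^ 2 * 441 * (1 / ((j + 1 : ℕ) : ℝ) ^ (3 / 2 : ℝ)) := by
      intro j
      have hc := count_cheb p ((cell (j+1) w).image sg) (R (j+1)) (t := (1 / (s + 1) : ℝ) * (j+1:ℕ) ^ 2) (by positivity)
      have hinj : Function.Injective sg := fun a b h => by rw [← sg_sg a, h, sg_sg]
      rw [Finset.card_image_of_injective _ hinj, card_cell] at hc
      have hmeas : MeasurableSet {η : Config | (1 / (s + 1) : ℝ) * (j+1:ℕ) ^ 2 ≤ |(∑ x ∈ (cell (j+1) w).image sg, ind (Arm x (R (j+1))) η) - ((j+1:ℕ) ^ 2 : ℕ) * th p (R (j+1))|} := by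
        refine measurableSet_le measurable_const ?_
        refine Measurable.abs ?_
        exact (Finset.measurable_sum _ fun x _ => measurable_ind (measurable_arm _ _)).sub_const _
      rw [← pr_reindex p ta ta_inj hmeas] at hc
      simp only [mem_ofPred_eq] at hc
      have e1 : ∀ ω : Config, ∑ x ∈ (cell (j+1) w).image sg, ind (Arm x (R (j+1))) (fun e => ω (ta e)) = cnt (j+1) ω := fun ω =>
        Finset.sum_image (fun a _ b _ h => hinj h)
      simp only [e1] at hc
      push_cast at hc ⊢
      refine hc.trans ?_
      have hj : (0:ℝ) < (j:ℝ) + 1 := by positivity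
      have hk : ((k4 (j+1) : ℕ) : ℝ) ^ 4 ≤ (j:ℝ) + 1 := by exact_mod_cast k4_le (j+1)
      have hR : (4 * (R (j+1) : ℝ) + 1) ^ 2 ≤ 441 * ((j:ℝ) + 1) ^ (1/2 : ℝ) := by
        have hk1 : (1:ℝ) ≤ k4 (j+1) := by
          have : 1 ≤ k4 (j+1) := by
            by_contra h
            have := lt_k4 (j+1)
            have h0 : k4 (j+1) = 0 := by omega
            rw [h0] at this; simp at this
          exact_mod_cast this
        have h2 : ((k4 (j+1) : ℕ) : ℝ) ^ 2 ≤ ((j:ℝ) + 1) ^ (1/2 : ℝ) := by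
          rw [← Real.sqrt_eq_rpow]
          apply Real.le_sqrt_of_sq_le
          nlinarith
        have hRe : (R (j+1) : ℝ) = 2 * k4 (j+1) + 2 := by simp only [R]; push_cast; ring
        rw [hRe]
        nlinarith
      have e32 : ((j:ℝ) + 1) ^ (3/2 : ℝ) * ((j:ℝ) + 1) ^ (1/2 : ℝ) = ((j:ℝ) + 1) ^ 2 := by
        rw [← Real.rpow_add hj]; norm_num
      have p1 : 0 < ((j:ℝ) + 1) ^ (3/2 : ℝ) := Real.rpow_pos_of_pos hj _
      have p2 : 0 < ((j:ℝ) + 1) ^ (1/2 : ℝ) := Real.rpow_pos_of_pos hj _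
      have hs : (0:ℝ) < (s:ℝ) + 1 := by positivity
      rw [div_le_iff₀ (by positivity)]
      have e5 : (s + 1 : ℝ) ^ 2 * 441 * (1 / ((j:ℝ) + 1) ^ (3/2 : ℝ)) * (1 / (s + 1 : ℝ) * ((j:ℝ) + 1) ^ 2) ^ 2
          = ((j:ℝ) + 1) ^ 2 * (441 * (((j:ℝ) + 1) ^ 2 / ((j:ℝ) + 1) ^ (3/2 : ℝ))) := by
        field_simp
      rw [e5]
      refine mul_le_mul_of_nonneg_left (hR.trans (le_of_eq ?_)) (by positivity)
      rw [← e32]; field_simp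
    have hsummable : Summable (fun j : ℕ => ((s + 1) ^ 2 * 441 * (1 / ((j + 1 : ℕ) : ℝ) ^ (3 / 2 : ℝ)) : ℝ)) :=
      (((summable_nat_add_iff 1).2 (Real.summable_one_div_nat_rpow.2 (by norm_num : (1:ℝ) < 3/2)))).mul_left _
    filter_upwards [borel_cantelli hsummable hb] with ω hω
    filter_upwards [hω] with j hj
    simpa using hj
  filter_upwards [hG, ae_all_iff.2 hsum] with ω ⟨m0, hG⟩ hω
  rw [← tendsto_add_atTop_iff_nat 1]
  have heq : ∀ᶠ j : ℕ in atTop, cnt (j+1) ω = ((Cinf ω ∩ (cell (j+1) w : Set Vert)).ncard : ℝ) := by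
    have hev : ∀ᶠ j : ℕ in atTop, m0 ≤ k4 j ∧ 2 ≤ k4 j ∧ (nd 0 w + 1) * j ≤ k4 j ^ 8 :=
      (k4_tendsto.eventually_ge_atTop m0).and ((k4_tendsto.eventually_ge_atTop 2).and (k4_big _))
    filter_upwards [(tendsto_add_atTop_nat 1).eventually hev] with j ⟨h1, h2, h3⟩
    have hiff : ∀ x ∈ cell (j+1) w, ((fun e => ω (ta e)) ∈ Arm (sg x) (R (j+1)) ↔ x ∈ Cinf ω) := by
      intro x hx
      rw [arm_iff]
      constructor
      · rintro ⟨y, hy, hn⟩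
        exact hG.mem_Cinf h1 h2 ((nd_cell hx).trans h3) hy hn
      · intro h; exact Cinf_far h _
    have : Cinf ω ∩ (cell (j+1) w : Set Vert) = (((cell (j+1) w).filter (fun x => x ∈ Cinf ω) : Finset Vert) : Set Vert) := by
      ext x; simp [and_comm]
    rw [this, Set.ncard_coe_finset, Finset.card_filter]
    push_cast
    refine Finset.sum_congr rfl fun x hx => ?_
    split_ifs with h
    · exact ind_of_mem ((hiff x hx).2 h)
    · exact ind_of_notMem fun h' => h ((hiff x hx).1 h')
  have hR : Tendsto (fun j => R (j+1)) atTop atTop := by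
    rw [tendsto_atTop]
    intro b
    filter_upwards [(tendsto_add_atTop_nat 1).eventually (k4_tendsto.eventually_ge_atTop b)] with j hj
    simp only [R]; omega
  have hth := (thet_tendsto p).comp hR
  rw [Metric.tendsto_atTop] at hth ⊢
  intro ε hε
  obtain ⟨s, hs⟩ := exists_nat_one_div_lt (half_pos hε)
  obtain ⟨J1, h1⟩ := hth (ε/2) (half_pos hε)
  obtain ⟨J2, h2⟩ := eventually_atTop.1 (heq.and (hω s))
  refine ⟨max J1 J2, fun j hj => ?_⟩
  have a1 := h1 j (le_trans (le_max_left _ _) hj)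
  obtain ⟨a2, a3⟩ := h2 j (le_trans (le_max_right _ _) hj)
  rw [a2] at a3
  rw [Real.dist_eq] at a1 ⊢
  simp only [Function.comp] at a1
  have hj0 : (0:ℝ) < ((j+1:ℕ):ℝ) ^ 2 := by positivity
  generalize ((j+1:ℕ):ℝ) ^ 2 = J at *
  generalize ((Cinf ω ∩ (cell (j+1) w : Set Vert)).ncard : ℝ) = c at *
  have a4 : |c / J - th p (R (j+1))| < 1 / (s + 1) := by
    rw [show c / J - th p (R (j+1)) = (c - J * th p (R (j+1))) / J by field_simp, abs_div, abs_of_pos hj0, div_lt_iff₀ hj0]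
    exact a3
  calc |c / J - thet p| = |(c / J - th p (R (j+1))) + (th p (R (j+1)) - thet p)| := by ring_nf
    _ ≤ _ := abs_add_le _ _
    _ < ε := by linarith

end BP
end



noncomputable section

namespace BP

/-! ### Boundary trails inside a box -/

def inB (n : ℕ) (e : Edge) : Prop := nd 0 e.1 ≤ n ∧ nd 0 (edgeTip e) ≤ n

lemma nd0_le {x : Vert} {n : ℕ} : nd 0 x ≤ n ↔ -(n:ℤ) ≤ x.1 ∧ x.1 ≤ n ∧ -(n:ℤ) ≤ x.2 ∧ x.2 ≤ n := by
  rw [nd_le]; simp only [Prod.fst_zero, Prod.snd_zero]; omega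

lemma mem_latBox {x : Vert} {n : ℕ} : x ∈ latBox n ↔ nd 0 x ≤ n := by
  rw [nd0_le]; unfold latBox
  simp only [mem_ofPred_eq, abs_le]; tauto

lemma inB_iff {n : ℕ} {e : Edge} : inB n e ↔ -(n:ℤ) ≤ e.1.1 ∧ (edgeTip e).1 ≤ n ∧ -(n:ℤ) ≤ e.1.2 ∧ (edgeTip e).2 ≤ n := by
  obtain ⟨x, b⟩ := e
  unfold inB
  rw [nd0_le, nd0_le]
  cases b
  · simp only [tip_false, Prod.fst_add, Prod.snd_add]; omega
  · simp only [tip_true, Prod.fst_add, Prod.snd_add]; omega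

def bF (n : ℕ) (A : Set Vert) : Finset Edge := by
  classical
  exact (box 0 n ×ˢ Finset.univ).filter (fun e => inB n e ∧ dA (i2 A) e ≠ 0)

lemma mem_bF {n : ℕ} {A : Set Vert} {e : Edge} : e ∈ bF n A ↔ inB n e ∧ dA (i2 A) e ≠ 0 := by
  classical
  unfold bF
  rw [Finset.mem_filter, Finset.mem_product, mem_box]
  constructor
  · exact fun h => h.2
  · exact fun h => ⟨⟨h.1.1, Finset.mem_univ _⟩, h⟩

def Out (n : ℕ) : Set Vert := {y | ¬ (-(n:ℤ) ≤ y.1 ∧ y.1 < n ∧ -(n:ℤ) ≤ y.2 ∧ y.2 < n)}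

lemma pl_congr_in {n : ℕ} {N M : Edge → Z2} (h : ∀ e, inB n e → N e = M e) {y : Vert}
    (hy : -(n:ℤ) ≤ y.1 ∧ y.1 < n ∧ -(n:ℤ) ≤ y.2 ∧ y.2 < n) : pl N y = pl M y := by
  unfold pl
  rw [h _ _, h _ _, h _ _, h _ _]
  all_goals
    rw [inB_iff]
    simp only [tip_true, tip_false, Prod.fst_add, Prod.snd_add]
    omega

lemma Nf_bF {n : ℕ} {A : Set Vert} {e : Edge} (h : inB n e) : Nf (bF n A) e = dA (i2 A) e := by
  unfold Nf
  have : ∀ z : Z2, (z ≠ 0 → z = 1) := by decide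
  split_ifs with h'
  · exact (this _ (mem_bF.1 h').2).symm
  · by_contra hne
    exact h' (mem_bF.2 ⟨h, fun h0 => hne h0.symm⟩)

/-- a located trail in the box of size `n` -/
structure BT (n : ℕ) (l : List Edge) (a b : Vert) (d : ℕ) : Prop where
  walk : DWalk a l b
  ends : a = b ∨ (a ∈ Out n ∧ b ∈ Out n)
  loc : ∀ e ∈ l, inB n e ∧ e ∈ ev (box a d)
  ha : nd 0 a ≤ n + 1
  hA : -(n:ℤ) - 1 ≤ a.1 ∧ a.1 ≤ n ∧ -(n:ℤ) - 1 ≤ a.2 ∧ a.2 ≤ n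
  hB : -(n:ℤ) - 1 ≤ b.1 ∧ b.1 ≤ n ∧ -(n:ℤ) - 1 ≤ b.2 ∧ b.2 ≤ n
  far : ∃ l1 c, DWalk a l1 c ∧ nd a c = d ∧ (∀ ω : Config, l1.countP ω ≤ l.countP ω)

lemma dual_range {n : ℕ} {e : Edge} (h : inB n e) :
    (-(n:ℤ) - 1 ≤ e.1.1 ∧ e.1.1 ≤ n ∧ -(n:ℤ) - 1 ≤ e.1.2 ∧ e.1.2 ≤ n) ∧
    (-(n:ℤ) - 1 ≤ (dB e).1 ∧ (dB e).1 ≤ n ∧ -(n:ℤ) - 1 ≤ (dB e).2 ∧ (dB e).2 ≤ n) := by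
  rw [inB_iff] at h
  obtain ⟨x, b⟩ := e
  cases b
  · simp only [tip_false, dB_false, Prod.fst_add, Prod.snd_add] at *; omega
  · simp only [tip_true, dB_true, Prod.fst_add, Prod.snd_add] at *; omega

lemma BT_of_trail {n : ℕ} {l : List Edge} (h : Trail (Out n) l) (hin : ∀ e ∈ l, inB n e) : ∃ a b d, BT n l a b d := by
  obtain ⟨a, b, hw, -, hne, hab⟩ := h
  obtain ⟨l1, l2, c, e1, w1, -, -, hbox⟩ := hw.far
  have hA : -(n:ℤ) - 1 ≤ a.1 ∧ a.1 ≤ n ∧ -(n:ℤ) - 1 ≤ a.2 ∧ a.2 ≤ n := by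
    cases hw with
    | nil => exact absurd rfl hne
    | cons hs hw' =>
      rename_i e l
      obtain ⟨r1, r2⟩ := dual_range (hin e (by simp))
      rcases hs with ⟨rfl, -⟩ | ⟨rfl, -⟩
      · exact r1
      · exact r2
  have hB : -(n:ℤ) - 1 ≤ b.1 ∧ b.1 ≤ n ∧ -(n:ℤ) - 1 ≤ b.2 ∧ b.2 ≤ n := by
    have hr := hw.reverse
    have hne' : l.reverse ≠ [] := by simpa using hne
    have hin' : ∀ e ∈ l.reverse, inB n e := fun e he => hin e (by simpa using he)
    generalize l.reverse = l' at *
    cases hr with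
    | nil => exact absurd rfl hne'
    | cons hs hw' =>
      rename_i e l
      obtain ⟨r1, r2⟩ := dual_range (hin' e (by simp))
      rcases hs with ⟨rfl, -⟩ | ⟨rfl, -⟩
      · exact r1
      · exact r2
  refine ⟨a, b, nd a c, hw, hab, fun e he => ⟨hin e he, hbox e he⟩, ?_, hA, hB, l1, c, w1, rfl, fun ω => ?_⟩
  · rw [nd0_le]; push_cast; omega
  · rw [e1, List.countP_append]; omega

lemma box_trails (n : ℕ) (A : Set Vert) : ∃ (L : Finset (List Edge)) (a b : List Edge → Vert) (d : List Edge → ℕ),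
    (∀ l ∈ L, BT n l (a l) (b l) (d l)) ∧ (∀ e, inB n e → dA (i2 A) e = ∑ l ∈ L, Nw l e) ∧
    (∀ l ∈ L, ∀ e ∈ l, e ∈ bF n A) ∧
      ∀ ω : Config, ∑ l ∈ L, l.countP ω = ((bF n A).filter (fun e => ω e = true)).card := by
  classical
  obtain ⟨L, h1, h2, h3, h4⟩ := trails (Out n) (bF n A) (fun y hy => by
    have hy' : -(n:ℤ) ≤ y.1 ∧ y.1 < n ∧ -(n:ℤ) ≤ y.2 ∧ y.2 < n := by
      by_contra h; exact hy h
    rw [pl_congr_in (M := dA (i2 A)) (fun e he => Nf_bF he) hy', pl_dA])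
  have hBT : ∀ l ∈ L, ∃ a b d, BT n l a b d := fun l hl =>
    BT_of_trail (h1 l hl) fun e he => (mem_bF.1 (h3 l hl e he)).1
  choose! a b d hBT using hBT
  exact ⟨L, a, b, d, hBT, fun e he => by rw [← Nf_bF he, h2], h3, h4⟩

lemma BT.potential {n : ℕ} {l : List Edge} {a b : Vert} {d : ℕ} (h : BT n l a b d) (hd : d + 1 < n) :
    ∃ B : Vert → Z2, (∀ e, inB n e → dA B e = Nw l e) ∧ ∀ x, nd 0 x ≤ n → B x ≠ 0 → nd a x ≤ d + 1 := by
  obtain ⟨B0, hB0⟩ := rect_potential (Nw l) (-n) n (-n) n (fun y h1 h2 h3 h4 => by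
    rw [pl_Nw h.walk]
    rcases h.ends with rfl | ⟨ha, hb⟩
    · exact z2_self _
    · have k1 : y ≠ a := fun h => by subst h; exact ha ⟨h1, h2, h3, h4⟩
      have k2 : y ≠ b := fun h => by subst h; exact hb ⟨h1, h2, h3, h4⟩
      simp [dl, k1, k2])
  have hB : ∀ e, inB n e → dA B0 e = Nw l e := fun e he => by
    obtain ⟨h1, h2, h3, h4⟩ := inB_iff.1 he
    exact hB0 e h1 h2 h3 h4
  have hzero : ∀ e, inB n e → ¬ (nd a e.1 ≤ d + 1 ∧ nd a (edgeTip e) ≤ d + 1) → dA B0 e = 0 := by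
    intro e he hn
    rw [hB e he]
    by_contra hne
    have := mem_ev.1 (h.loc e (Nw_ne_zero hne)).2
    rw [mem_box, mem_box] at this
    apply hn
    obtain ⟨⟨x1, x2⟩, b⟩ := e
    rw [nd_le, nd_le] at this ⊢
    cases b
    · simp only [tip_false, dB_false, Prod.fst_add, Prod.snd_add] at *; push_cast; omega
    · simp only [tip_true, dB_true, Prod.fst_add, Prod.snd_add] at *; push_cast; omega
  have hfree : ∀ t : ℤ, ∃ c : ℤ, -(n:ℤ) ≤ c ∧ c ≤ n ∧ ((d:ℤ) + 1 < c - t ∨ (d:ℤ) + 1 < t - c) := by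
    intro t
    by_cases ht : 0 ≤ t
    · exact ⟨-n, by omega, by omega, by omega⟩
    · exact ⟨n, by omega, by omega, by omega⟩
  obtain ⟨c1, k1, k2, k3⟩ := hfree a.1
  obtain ⟨c2, k4, k5, k6⟩ := hfree a.2
  have hcol : ∀ t s s' : ℤ, -(n:ℤ) ≤ t → t ≤ n → ((d:ℤ) + 1 < t - a.1 ∨ (d:ℤ) + 1 < a.1 - t) → -(n:ℤ) ≤ s → s ≤ n →
      -(n:ℤ) ≤ s' → s' ≤ n → B0 (t, s) = B0 (t, s') := by
    intro t s s' h1 h2 h3 h4 h5 h6 h7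
    refine rect_const (a1 := t) (b1 := t) (a2 := -n) (b2 := n) (fun e e1 e2 e3 e4 => ?_) (by simp; omega) (by simp; omega)
    refine hzero e ?_ ?_
    · rw [inB_iff]
      obtain ⟨⟨x1, x2⟩, b⟩ := e
      cases b
      · simp only [tip_false, Prod.fst_add, Prod.snd_add] at *; omega
      · simp only [tip_true, Prod.fst_add, Prod.snd_add] at *; omega
    · rw [nd_le]
      obtain ⟨⟨x1, x2⟩, b⟩ := e
      cases b
      · simp only [tip_false, Prod.fst_add, Prod.snd_add] at *; omega
      · simp only [tip_true, Prod.fst_add, Prod.snd_add] at *; push_cast; omega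
  have hrow : ∀ t s s' : ℤ, -(n:ℤ) ≤ t → t ≤ n → ((d:ℤ) + 1 < t - a.2 ∨ (d:ℤ) + 1 < a.2 - t) → -(n:ℤ) ≤ s → s ≤ n →
      -(n:ℤ) ≤ s' → s' ≤ n → B0 (s, t) = B0 (s', t) := by
    intro t s s' h1 h2 h3 h4 h5 h6 h7
    refine rect_const (a1 := -n) (b1 := n) (a2 := t) (b2 := t) (fun e e1 e2 e3 e4 => ?_) (by simp; omega) (by simp; omega)
    refine hzero e ?_ ?_
    · rw [inB_iff]
      obtain ⟨⟨x1, x2⟩, b⟩ := e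
      cases b
      · simp only [tip_false, Prod.fst_add, Prod.snd_add] at *; omega
      · simp only [tip_true, Prod.fst_add, Prod.snd_add] at *; omega
    · rw [nd_le]
      obtain ⟨⟨x1, x2⟩, b⟩ := e
      cases b
      · simp only [tip_false, Prod.fst_add, Prod.snd_add] at *; push_cast; omega
      · simp only [tip_true, Prod.fst_add, Prod.snd_add] at *; omega
  refine ⟨fun x => B0 x + B0 (c1, c2), fun e he => ?_, fun x hx hne => ?_⟩
  · rw [dA_add, hB e he]
    simp [dA, z2_self]
  · by_contra hcon
    apply hne
    rw [nd0_le] at hx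
    rw [nd_le] at hcon
    push_cast at hcon
    have hor : ((d:ℤ) + 1 < x.1 - a.1 ∨ (d:ℤ) + 1 < a.1 - x.1) ∨ ((d:ℤ) + 1 < x.2 - a.2 ∨ (d:ℤ) + 1 < a.2 - x.2) := by omega
    have : B0 x = B0 (c1, c2) := by
      rcases hor with ho | ho
      · rw [show x = (x.1, x.2) from rfl, hcol x.1 x.2 c2 (by omega) (by omega) ho (by omega) (by omega) (by omega) (by omega),
          hrow c2 x.1 c1 (by omega) (by omega) k6 (by omega) (by omega) (by omega) (by omega)]
      · rw [show x = (x.1, x.2) from rfl, hrow x.2 x.1 c1 (by omega) (by omega) ho (by omega) (by omega) (by omega) (by omega),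
          hcol c1 x.2 c2 (by omega) (by omega) k3 (by omega) (by omega) (by omega) (by omega)]
    show B0 x + B0 (c1, c2) = 0
    rw [this, z2_self]

/-- constancy on the box -/
lemma box_const {n : ℕ} {B : Vert → Z2} (h : ∀ e, inB n e → dA B e = 0) {x y : Vert} (hx : nd 0 x ≤ n) (hy : nd 0 y ≤ n) : B x = B y :=
  rect_const (a1 := -n) (b1 := n) (a2 := -n) (b2 := n) (fun e h1 h2 h3 h4 => h e (inB_iff.2 ⟨h1, h2, h3, h4⟩))
    (by rw [nd0_le] at hx; tauto) (by rw [nd0_le] at hy; tauto)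

/-- the length scale below which zero-cost walks live -/
def Sc (N n r : ℕ) (ω : Config) : Prop :=
  ∀ a l b, DWalk a l b → nd 0 a ≤ 2 * n → r ≤ nd a b → nd a b < N * l.countP ω

lemma Sc.d_le {N n r : ℕ} {ω : Config} (hS : Sc N n r ω) (hn : 1 ≤ n) {l : List Edge} {a b : Vert} {d : ℕ} (h : BT n l a b d) :
    r ≤ d → d < N * l.countP ω := by
  intro hr
  obtain ⟨l1, c, w, rfl, hle⟩ := h.far
  have := hS a l1 c w (by have := h.ha; omega) hr
  exact this.trans_le (Nat.mul_le_mul_left _ (hle ω))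

lemma Sc.d_zero {N n r : ℕ} {ω : Config} (hS : Sc N n r ω) (hn : 1 ≤ n) {l : List Edge} {a b : Vert} {d : ℕ} (h : BT n l a b d)
    (h0 : l.countP ω = 0) : d < r := by
  by_contra hc
  have := hS.d_le hn h (by omega)
  rw [h0] at this; omega

lemma Geo.sc {N m0 : ℕ} {ω : Config} (hG : Geo N m0 ω) {n r : ℕ} (hr : m0 ≤ r) (hn : 2 * n ≤ r ^ 9) : Sc N n r ω := by
  intro a l b hw ha hr'
  exact hG a l b hw (hr.trans hr') (ha.trans (hn.trans (Nat.pow_le_pow_left hr' 9)))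

lemma Cinf_adj {ω : Config} {x y : Vert} (h : openAdj ω x y) (hx : x ∈ Cinf ω) : y ∈ Cinf ω := by
  refine hx.mono fun z hz => ?_
  exact Relation.ReflTransGen.head (openAdj_symm h) hz

lemma comp_sub {ω : Config} {n : ℕ} {x : Vert} : compIn ω n x ⊆ Cinf ω ∩ latBox n := inter_subset_right

lemma comp_closed {ω : Config} {n : ℕ} {x y z : Vert} (hy : y ∈ compIn ω n x) (h : openAdj ω y z) (hz : nd 0 z ≤ n) :
    z ∈ compIn ω n x := by
  have h1 : z ∈ Ctilde ω n := ⟨Cinf_adj h hy.2.1, mem_latBox.2 hz⟩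
  exact ⟨Relation.ReflTransGen.tail hy.1 ⟨h, hy.2, h1⟩, h1⟩

/-- cochains vanishing on open edges are constant on clusters -/
lemma const_cluster {ω : Config} {S : Vert → Z2} (h : ∀ e, ω e = true → dA S e = 0) {x y : Vert} (hy : y ∈ cluster ω x) : S x = S y := by
  induction (hy : Relation.ReflTransGen (openAdj ω) x y) with
  | refl => rfl
  | tail _ h2 ih =>
    rw [ih]
    obtain ⟨e, he, h3 | h3⟩ := h2
    · have := z2_eq_of_add (h e he); rw [h3.1, h3.2] at this; exact this
    · have := z2_eq_of_add (h e he); rw [h3.1, h3.2] at this; exact this.symm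

lemma const_comp {ω : Config} {n : ℕ} {S : Vert → Z2} (h : ∀ e, inB n e → ω e = true → dA S e = 0) {x y : Vert}
    (hy : y ∈ compIn ω n x) : S x = S y := by
  have hy' : Relation.ReflTransGen (adjIn ω n) x y := hy.1
  clear hy
  induction hy' with
  | refl => rfl
  | tail _ h2 ih =>
    rw [ih]
    obtain ⟨⟨e, he, h3⟩, hb, hc⟩ := h2
    have b1 := mem_latBox.1 hb.2
    have b2 := mem_latBox.1 hc.2
    rcases h3 with h3 | h3
    · have := z2_eq_of_add (h e ⟨by rw [h3.1]; exact b1, by rw [h3.2]; exact b2⟩ he); rw [h3.1, h3.2] at this; exact this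
    · have := z2_eq_of_add (h e ⟨by rw [h3.1]; exact b2, by rw [h3.2]; exact b1⟩ he); rw [h3.1, h3.2] at this; exact this.symm

/-- all points of `Cinf` well inside the box are in the same component -/
lemma inner_comp {N n r : ℕ} {ω : Config} (hS : Sc N n r ω) (hr : 2 * r + 2 ≤ n) {x y : Vert}
    (hx : x ∈ Cinf ω) (hy : y ∈ Cinf ω) (hxn : nd 0 x + 2 * r + 2 ≤ n) (hyn : nd 0 y + 2 * r + 2 ≤ n) : y ∈ compIn ω n x := by
  classical
  by_contra hcon
  set A := compIn ω n x with hA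
  have hxA : x ∈ A := ⟨Relation.ReflTransGen.refl, hx, mem_latBox.2 (by omega)⟩
  obtain ⟨L, a, b, d, hBT, hsum, hin, -⟩ := box_trails n A
  have hclosed : ∀ e ∈ bF n A, ω e = false := by
    intro e he
    obtain ⟨hb, hd⟩ := mem_bF.1 he
    by_contra ho
    have ho : ω e = true := by simpa using ho
    apply hd
    unfold dA
    by_cases h1 : e.1 ∈ A
    · have h2 := comp_closed h1 ⟨e, ho, Or.inl ⟨rfl, rfl⟩⟩ hb.2
      rw [i2_eq_one.2 h1, i2_eq_one.2 h2]; exact z2_self _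
    · have h2 : edgeTip e ∉ A := fun h2 => h1 (comp_closed h2 ⟨e, ho, Or.inr ⟨rfl, rfl⟩⟩ hb.1)
      rw [i2_eq_zero.2 h1, i2_eq_zero.2 h2]; exact z2_self _
  have hcost : ∀ l ∈ L, l.countP ω = 0 := fun l hl => by
    rw [List.countP_eq_zero]; intro e he; simp [hclosed e (hin l hl e he)]
  have hd : ∀ l ∈ L, d l < r := fun l hl => hS.d_zero (by omega) (hBT l hl) (hcost l hl)
  have hpot : ∀ l ∈ L, ∃ B : Vert → Z2, (∀ e, inB n e → dA B e = Nw l e) ∧ ∀ x, nd 0 x ≤ n → B x ≠ 0 → nd (a l) x ≤ d l + 1 :=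
    fun l hl => (hBT l hl).potential (by have := hd l hl; omega)
  choose! B hB1 hB2 using hpot
  have hc := box_const (n := n) (B := fun z => i2 A z + ∑ l ∈ L, B l z) (fun e he => by
    rw [dA_add, dA_sum, hsum e he, Finset.sum_congr rfl (fun l hl => hB1 l hl e he), z2_self]) (x := x) (y := y) (by omega) (by omega)
  rw [i2_eq_one.2 hxA, i2_eq_zero.2 hcon] at hc
  -- some trail potential is nonzero at an inner point
  obtain ⟨z, hz, hzn, l, hl, hne⟩ : ∃ z, z ∈ Cinf ω ∧ nd 0 z + 2 * r + 2 ≤ n ∧ ∃ l ∈ L, B l z ≠ 0 := by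
    by_contra hno
    push Not at hno
    rw [Finset.sum_eq_zero (hno x hx hxn), Finset.sum_eq_zero (hno y hy hyn)] at hc
    revert hc; decide
  have hbt := hBT l hl
  have hdl := hd l hl
  have haz := hB2 l hl z (by omega) hne
  have h0a : nd 0 (a l) + r ≤ n := by
    have := nd_tri 0 z (a l); rw [nd_comm z] at this; omega
  have hclosedl : a l = b l := by
    rcases hbt.ends with h | ⟨h, -⟩
    · exact h
    · exfalso; apply h
      have : nd 0 (a l) ≤ n - 1 := by omega
      rw [nd0_le] at this
      omega
  obtain ⟨S, s1, s2⟩ := plane_potential (Nw l) (a l) (d l) (fun y => by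
      have := pl_Nw hbt.walk y
      rw [this, ← hclosedl, z2_self]) (fun e he =>
    mem_box.1 (mem_ev.1 (hbt.loc e (Nw_ne_zero he)).2).1)
  -- a point of the box away from the trail
  obtain ⟨u, hu1, hu2⟩ : ∃ u : Vert, nd 0 u ≤ n ∧ d l + 1 < nd (a l) u := by
    by_cases h : 0 ≤ (a l).1
    · exact ⟨(-n, 0), by rw [nd0_le]; simp, by unfold nd; simp only; omega⟩
    · exact ⟨(n, 0), by rw [nd0_le]; simp, by unfold nd; simp only; omega⟩
  have hSB := box_const (n := n) (B := fun z => S z + B l z) (fun e he => by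
    rw [dA_add, s1, hB1 l hl e he, z2_self]) (x := z) (y := u) (by omega) hu1
  have hSu : S u = 0 := by by_contra h; have := s2 u h; omega
  have hBu : B l u = 0 := by by_contra h; have := hB2 l hl u hu1 h; omega
  rw [hSu, hBu, add_zero] at hSB
  have hSz : S z ≠ 0 := by rw [z2_eq_of_add hSB]; exact hne
  refine hz ((box (a l) (d l + 1)).finite_toSet.subset fun y hy => ?_)
  rw [Finset.mem_coe, mem_box]
  apply s2
  rw [← const_cluster (S := S) (fun e he => ?_) hy]
  · exact hSz
  · rw [s1]
    by_contra hne
    have := hclosed e (hin l hl e (Nw_ne_zero hne))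
    rw [this] at he; cases he

end BP
end



noncomputable section

namespace BP

/-! ### The giant component and the isoperimetric inequality -/

structure Pk (N n r : ℕ) (ω : Config) (G : Set Vert) : Prop where
  sc : Sc N n r ω
  hr : 2 * r + 2 ≤ n
  hr1 : 1 ≤ r
  sub : ∀ x ∈ G, x ∈ Cinf ω ∧ nd 0 x ≤ n
  inner : ∀ x ∈ Cinf ω, nd 0 x + 2 * r + 2 ≤ n → x ∈ G
  closed : ∀ y ∈ G, ∀ z, openAdj ω y z → nd 0 z ≤ n → z ∈ G
  const : ∀ S : Vert → Z2, (∀ e, inB n e → ω e = true → dA S e = 0) → ∀ x ∈ G, ∀ y ∈ G, S x = S y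
  big : (2 * r + 1) ^ 2 < G.ncard

lemma latBox_eq (n : ℕ) : latBox n = (box 0 n : Set Vert) := by
  ext x; rw [mem_latBox, Finset.mem_coe, mem_box]

lemma latBox_finite (n : ℕ) : (latBox n).Finite := by
  rw [latBox_eq]; exact Finset.finite_toSet _

lemma latBox_ncard (n : ℕ) : (latBox n).ncard = (2 * n + 1) ^ 2 := by
  rw [latBox_eq, Set.ncard_coe_finset, card_box]

lemma compIn_finite (ω : Config) (n : ℕ) (x : Vert) : (compIn ω n x).Finite :=
  (latBox_finite n).subset (comp_sub.trans inter_subset_right)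

lemma Pk.finite {N n r : ℕ} {ω : Config} {G : Set Vert} (h : Pk N n r ω G) : G.Finite :=
  (latBox_finite n).subset fun x hx => mem_latBox.2 (h.sub x hx).2

lemma Pk.card_le {N n r : ℕ} {ω : Config} {G : Set Vert} (h : Pk N n r ω G) : G.ncard ≤ (2 * n + 1) ^ 2 := by
  rw [← latBox_ncard]
  exact Set.ncard_le_ncard (fun x hx => mem_latBox.2 (h.sub x hx).2) (latBox_finite n)

lemma giant_pk {N n r : ℕ} {ω : Config} (hS : Sc N n r ω) (hr : 2 * r + 2 ≤ n) (hr1 : 1 ≤ r)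
    (hbig : (2 * n + 1) ^ 2 < (Cinf ω ∩ latBox (n - (2 * r + 2))).ncard + (2 * (n - (2 * r + 2)) + 1) ^ 2) :
    Pk N n r ω (giant ω n) := by
  classical
  set I := Cinf ω ∩ latBox (n - (2 * r + 2)) with hI
  have hIfin : I.Finite := (latBox_finite _).subset inter_subset_right
  have hIn : ∀ x ∈ I, x ∈ Cinf ω ∧ nd 0 x + 2 * r + 2 ≤ n := fun x hx => ⟨hx.1, by have := mem_latBox.1 hx.2; omega⟩
  have hle : (2 * (n - (2 * r + 2)) + 1) ^ 2 ≤ (2 * n + 1) ^ 2 := Nat.pow_le_pow_left (by omega) 2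
  obtain ⟨x, hx⟩ : I.Nonempty := by
    rw [← Set.ncard_pos hIfin]; omega
  have hxC : x ∈ Ctilde ω n := ⟨hx.1, mem_latBox.2 (by have := (hIn x hx).2; omega)⟩
  -- the maximiser exists
  have hex : ∃ x, x ∈ Ctilde ω n ∧ ∀ y ∈ Ctilde ω n, (compIn ω n y).ncard ≤ (compIn ω n x).ncard := by
    have hfin : (Ctilde ω n).Finite := (latBox_finite n).subset inter_subset_right
    obtain ⟨z, hz, hm⟩ := hfin.exists_maximalFor (fun y => (compIn ω n y).ncard) _ ⟨x, hxC⟩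
    exact ⟨z, hz, fun y hy => by
      rcases le_total ((compIn ω n y).ncard) ((compIn ω n z).ncard) with h | h
      · exact h
      · exact hm hy h⟩
  obtain ⟨h1, h2⟩ := Classical.epsilon_spec hex
  set x0 := Classical.epsilon fun x => x ∈ Ctilde ω n ∧ ∀ y ∈ Ctilde ω n, (compIn ω n y).ncard ≤ (compIn ω n x).ncard with hx0
  have hG : giant ω n = compIn ω n x0 := rfl
  rw [hG]
  have hsubx : I ⊆ compIn ω n x := fun y hy => inner_comp hS hr hx.1 hy.1 (hIn x hx).2 (hIn y hy).2
  have hcard : I.ncard ≤ (compIn ω n x0).ncard :=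
    (Set.ncard_le_ncard hsubx (compIn_finite _ _ _)).trans (h2 x hxC)
  obtain ⟨y, hy, hyI⟩ : ∃ y ∈ compIn ω n x0, y ∈ I := by
    by_contra hno
    push Not at hno
    have hsub : compIn ω n x0 ⊆ latBox n \ latBox (n - (2 * r + 2)) := fun y hy =>
      ⟨(comp_sub hy).2, fun h => hno y hy ⟨(comp_sub hy).1, h⟩⟩
    have hc := Set.ncard_le_ncard hsub ((latBox_finite n).subset diff_subset)
    rw [Set.ncard_diff (fun z hz => mem_latBox.2 ((mem_latBox.1 hz).trans (by omega))) (latBox_finite _), latBox_ncard, latBox_ncard] at hc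
    omega
  refine ⟨hS, hr, hr1, fun x hx => ⟨(comp_sub hx).1, mem_latBox.1 (comp_sub hx).2⟩, fun z hz hzn => ?_,
    fun y hy z h hz => comp_closed hy h hz, fun S hSc u hu v hv => ?_, ?_⟩
  · have h3 := inner_comp hS hr hyI.1 hz (hIn y hyI).2 hzn
    exact ⟨Relation.ReflTransGen.trans hy.1 h3.1, h3.2⟩
  · rw [← const_comp hSc hu, ← const_comp hSc hv]
  · refine lt_of_lt_of_le ?_ hcard
    obtain ⟨t, rfl⟩ : ∃ t, n = t + (2 * r + 2) := ⟨n - (2 * r + 2), by omega⟩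
    rw [Nat.add_sub_cancel] at hbig
    nlinarith

lemma Pk.bdry {N n r : ℕ} {ω : Config} {G : Set Vert} (h : Pk N n r ω G) {H : Set Vert} (hH : H ⊆ G) :
    (edgeBdry ω G H).ncard = ((bF n H).filter (fun e => ω e = true)).card := by
  rw [← Set.ncard_coe_finset]
  congr 1
  ext e
  rw [Finset.mem_coe, Finset.mem_filter, mem_bF]
  unfold edgeBdry dA
  simp only [mem_ofPred_eq]
  constructor
  · rintro ⟨h1, h2, h3, h4⟩
    refine ⟨⟨⟨(h.sub _ h2).2, (h.sub _ h3).2⟩, ?_⟩, h1⟩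
    rcases h4 with ⟨h4, h5⟩ | ⟨h4, h5⟩
    · rw [i2_eq_one.2 h4, i2_eq_zero.2 h5]; decide
    · rw [i2_eq_zero.2 h4, i2_eq_one.2 h5]; decide
  · rintro ⟨⟨hb, hne⟩, ho⟩
    have hor : (e.1 ∈ H ∧ edgeTip e ∉ H) ∨ (e.1 ∉ H ∧ edgeTip e ∈ H) := by
      by_cases k1 : e.1 ∈ H <;> by_cases k2 : edgeTip e ∈ H
      · rw [i2_eq_one.2 k1, i2_eq_one.2 k2] at hne; exact absurd (z2_self _) hne
      · exact Or.inl ⟨k1, k2⟩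
      · exact Or.inr ⟨k1, k2⟩
      · rw [i2_eq_zero.2 k1, i2_eq_zero.2 k2] at hne; exact absurd (z2_self _) hne
    refine ⟨ho, ?_, ?_, hor⟩
    · rcases hor with h1 | h1
      · exact hH h1.1
      · exact h.closed _ (hH h1.2) _ ⟨e, ho, Or.inr ⟨rfl, rfl⟩⟩ hb.1
    · rcases hor with h1 | h1
      · exact h.closed _ (hH h1.1) _ ⟨e, ho, Or.inl ⟨rfl, rfl⟩⟩ hb.2
      · exact hH h1.2

lemma Pk.zero_trail {N n r : ℕ} {ω : Config} {G : Set Vert} (h : Pk N n r ω G) {l : List Edge} {a b : Vert} {d : ℕ} (hb : BT n l a b d)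
    (h0 : l.countP ω = 0) {B : Vert → Z2} (hB1 : ∀ e, inB n e → dA B e = Nw l e) (hB2 : ∀ x, nd 0 x ≤ n → B x ≠ 0 → nd a x ≤ d + 1) :
    ∀ x ∈ G, B x = 0 := by
  intro x hx
  by_contra hne
  have hd := h.sc.d_zero (by have := h.hr; omega) hb h0
  have hsub : G ⊆ (box a (d + 1) : Set Vert) := fun y hy => by
    rw [Finset.mem_coe, mem_box]
    apply hB2 y (h.sub y hy).2
    rw [← h.const B (fun e he ho => ?_) x hx y hy]
    · exact hne
    · rw [hB1 e he]
      by_contra hne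
      have := (List.countP_eq_zero.1 h0) e (Nw_ne_zero hne)
      exact this ho
  have hc := Set.ncard_le_ncard hsub (Finset.finite_toSet _)
  rw [Set.ncard_coe_finset, card_box] at hc
  have hbig := h.big
  have : (2 * (d + 1) + 1) ^ 2 ≤ (2 * r + 1) ^ 2 := Nat.pow_le_pow_left (by omega) 2
  omega

lemma cover_card {ι : Type*} (L : Finset ι) (a : ι → Vert) (d : ι → ℕ) {U : Set Vert}
    (h : ∀ x ∈ U, ∃ l ∈ L, nd (a l) x ≤ d l) : U.ncard ≤ ∑ l ∈ L, (2 * d l + 1) ^ 2 := by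
  classical
  have hsub : U ⊆ ((L.biUnion fun l => box (a l) (d l) : Finset Vert) : Set Vert) := fun x hx => by
    obtain ⟨l, hl, hx⟩ := h x hx
    rw [Finset.mem_coe, Finset.mem_biUnion]
    exact ⟨l, hl, mem_box.2 hx⟩
  refine (Set.ncard_le_ncard hsub (Finset.finite_toSet _)).trans ?_
  rw [Set.ncard_coe_finset]
  refine Finset.card_biUnion_le.trans (Finset.sum_le_sum fun l _ => ?_)
  rw [card_box]

lemma Pk.isop {N n r : ℕ} {ω : Config} {G : Set Vert} (h : Pk N n r ω G) {H : Set Vert} (hH : H ⊆ G) (h2 : 2 * H.ncard ≤ G.ncard) :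
    n ≤ N * (edgeBdry ω G H).ncard ∨
      H.ncard ≤ 2 * (2 * r + 3) ^ 2 * (edgeBdry ω G H).ncard + 8 * N ^ 2 * (edgeBdry ω G H).ncard ^ 2 := by
  classical
  rw [h.bdry hH]
  have hr := h.hr
  obtain ⟨L, a, b, d, hBT, hsum, hin, hcount⟩ := box_trails n H
  rw [← hcount ω]
  set E := ∑ l ∈ L, l.countP ω with hE
  have hcE : ∀ l ∈ L, l.countP ω ≤ E := fun l hl => Finset.single_le_sum (f := fun l => l.countP ω) (fun _ _ => Nat.zero_le _) hl
  by_cases hbigd : ∃ l ∈ L, n ≤ d l + 1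
  · obtain ⟨l, hl, hd⟩ := hbigd
    left
    have := h.sc.d_le (by omega) (hBT l hl) (by omega)
    have := Nat.mul_le_mul_left N (hcE l hl)
    omega
  right
  push Not at hbigd
  have hpot : ∀ l ∈ L, ∃ B : Vert → Z2, (∀ e, inB n e → dA B e = Nw l e) ∧ ∀ x, nd 0 x ≤ n → B x ≠ 0 → nd (a l) x ≤ d l + 1 :=
    fun l hl => (hBT l hl).potential (hbigd l hl)
  choose! B hB1 hB2 using hpot
  have hconst : ∀ x y, nd 0 x ≤ n → nd 0 y ≤ n → i2 H x + ∑ l ∈ L, B l x = i2 H y + ∑ l ∈ L, B l y := fun x y hx hy =>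
    box_const (n := n) (B := fun z => i2 H z + ∑ l ∈ L, B l z) (fun e he => by
      rw [dA_add, dA_sum, hsum e he, Finset.sum_congr rfl (fun l hl => hB1 l hl e he), z2_self]) hx hy
  set L' := L.filter (fun l => l.countP ω ≠ 0) with hL'
  have hcov : ∀ x ∈ G, ∑ l ∈ L, B l x ≠ 0 → ∃ l ∈ L', nd (a l) x ≤ d l + 1 := by
    intro x hx hne
    obtain ⟨l, hl, hne⟩ := Finset.exists_ne_zero_of_sum_ne_zero hne
    refine ⟨l, Finset.mem_filter.2 ⟨hl, fun h0 => hne (h.zero_trail (hBT l hl) h0 (hB1 l hl) (hB2 l hl) x hx)⟩, hB2 l hl x (h.sub x hx).2 hne⟩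
  have hbound : ∀ U ⊆ G, (∀ x ∈ U, ∑ l ∈ L, B l x ≠ 0) → U.ncard ≤ 2 * (2 * r + 3) ^ 2 * E + 8 * N ^ 2 * E ^ 2 := by
    intro U hU hx
    refine (cover_card L' a (fun l => d l + 1) fun x hxU => hcov x (hU hxU) (hx x hxU)).trans ?_
    have hterm : ∀ l ∈ L', (2 * (d l + 1) + 1) ^ 2 ≤ l.countP ω * (2 * (2 * r + 3) ^ 2 + 8 * N ^ 2 * E) := by
      intro l hl
      obtain ⟨hl, h0⟩ := Finset.mem_filter.1 hl
      have hc1 : 1 ≤ l.countP ω := Nat.one_le_iff_ne_zero.2 h0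
      have hc2 := hcE l hl
      have hd : d l ≤ r + N * l.countP ω := by
        by_cases hh : r ≤ d l
        · have := h.sc.d_le (by omega) (hBT l hl) hh; omega
        · omega
      generalize l.countP ω = c at *
      have e1 : (2 * (d l + 1) + 1) ^ 2 ≤ ((2 * r + 3) + 2 * (N * c)) ^ 2 := Nat.pow_le_pow_left (by omega) 2
      have e2 : ((2 * r + 3) + 2 * (N * c)) ^ 2 ≤ 2 * (2 * r + 3) ^ 2 + 8 * (N * c) ^ 2 := by
        zify; nlinarith [sq_nonneg ((2 * (r:ℤ) + 3) - 2 * (N * c))]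
      have e3 : 2 * (2 * r + 3) ^ 2 ≤ c * (2 * (2 * r + 3) ^ 2) := Nat.le_mul_of_pos_left _ hc1
      have e4 : 8 * (N * c) ^ 2 ≤ c * (8 * N ^ 2 * E) := by
        calc 8 * (N * c) ^ 2 = (c * (8 * N ^ 2)) * c := by ring
          _ ≤ (c * (8 * N ^ 2)) * E := Nat.mul_le_mul_left _ hc2
          _ = _ := by ring
      have := mul_add c (2 * (2 * r + 3) ^ 2) (8 * N ^ 2 * E); omega
    refine (Finset.sum_le_sum hterm).trans ?_
    rw [← Finset.sum_mul]
    have : ∑ l ∈ L', l.countP ω ≤ E := Finset.sum_le_sum_of_subset (Finset.filter_subset _ _)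
    calc _ ≤ E * (2 * (2 * r + 3) ^ 2 + 8 * N ^ 2 * E) := Nat.mul_le_mul_right _ this
      _ = _ := by ring
  have hcase : ∀ z : Z2, z = 0 ∨ z = 1 := by decide
  obtain ⟨x0, hx0⟩ : G.Nonempty := by
    rw [← Set.ncard_pos h.finite]; have := h.big; omega
  set κ := i2 H x0 + ∑ l ∈ L, B l x0 with hκ
  have hk : ∀ x ∈ G, i2 H x + ∑ l ∈ L, B l x = κ := fun x hx => hconst x x0 (h.sub x hx).2 (h.sub x0 hx0).2
  rcases hcase κ with h0 | h1
  · refine hbound H hH fun x hx hz => ?_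
    have := hk x (hH hx)
    rw [hz, h0, i2_eq_one.2 hx] at this
    revert this; decide
  · have hd : H.ncard ≤ (G \ H).ncard := by
      rw [Set.ncard_diff hH (h.finite.subset hH)]; omega
    refine hd.trans (hbound _ diff_subset fun x hx hz => ?_)
    have := hk x hx.1
    rw [hz, h1, i2_eq_zero.2 hx.2] at this
    revert this; decide

end BP
end



noncomputable section

namespace BP

/-! ### Good configurations: a priori bounds -/

structure Gd (N : ℕ) (θ : ℝ) (T : Vert → Vert → ℝ) (ω : Config) : Prop where
  geo : ∃ m0, Geo N m0 ω
  dens : ∀ w, Tendsto (fun j : ℕ => ((Cinf ω ∩ (cell j w : Set Vert)).ncard : ℝ) / (j:ℝ) ^ 2) atTop (nhds θ)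
  pass : ∀ u v, Tendsto (fun j : ℕ => (TT univ ω (sc j u) (sc j v) : ℝ) / j) atTop (nhds (T u v))

theorem good_ae {p : unitInterval} (hp : 1 / 2 < (p:ℝ)) :
    ∃ (N : ℕ) (T : Vert → Vert → ℝ), 1 ≤ N ∧ ∀ᵐ ω ∂(mu p), Gd N (thet p) T ω := by
  obtain ⟨N, C, σ, hN, -, -, -, -, h⟩ := geo_ae hp
  choose T hT using fun u : Vert × Vert => passage hp u.1 u.2
  refine ⟨N, fun u v => T (u, v), hN, ?_⟩
  have h1 : ∀ᵐ ω ∂(mu p), ∀ w, Tendsto (fun j : ℕ => ((Cinf ω ∩ (cell j w : Set Vert)).ncard : ℝ) / (j:ℝ) ^ 2) atTop (nhds (thet p)) :=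
    ae_all_iff.2 fun w => density hp w
  have h2 := ae_all_iff.2 hT
  filter_upwards [h, h1, h2] with ω a b c
  exact ⟨a, b, fun u v => c (u, v)⟩

lemma k4_sq_small (D : ℕ) : ∀ᶠ n in atTop, D * (k4 n + 1) ^ 2 ≤ n := by
  filter_upwards [k4_tendsto.eventually_ge_atTop (4 * D + 1)] with n hk
  have h1 := k4_le n
  calc D * (k4 n + 1) ^ 2 ≤ D * (2 * k4 n) ^ 2 := Nat.mul_le_mul_left _ (Nat.pow_le_pow_left (by omega) 2)
    _ = (4 * D) * k4 n ^ 2 := by ring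
    _ ≤ k4 n ^ 2 * k4 n ^ 2 := Nat.mul_le_mul_right _ (by nlinarith)
    _ = k4 n ^ 4 := by ring
    _ ≤ n := h1

variable {N : ℕ} {θ : ℝ} {T : Vert → Vert → ℝ} {ω : Config}

lemma Gd.half_cell (h : Gd N θ T ω) (hθ : 0 < θ) (w : Vert) :
    ∀ᶠ n : ℕ in atTop, θ / 16 * (n:ℝ) ^ 2 ≤ ((Cinf ω ∩ (cell (n / 2) w : Set Vert)).ncard : ℝ) := by
  have h1 := (Nat.tendsto_div_const_atTop (n := 2) (by norm_num)).eventually ((h.dens w).eventually (eventually_ge_nhds (show θ / 2 < θ by linarith)))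
  filter_upwards [h1, eventually_ge_atTop 4] with n h1 h2
  have h3 : (0:ℝ) < ((n / 2 : ℕ) : ℝ) := by
    have : 0 < n / 2 := by omega
    exact_mod_cast this
  rw [le_div_iff₀ (by positivity)] at h1
  have h4 : ((n:ℝ) - 1) / 2 ≤ ((n / 2 : ℕ) : ℝ) := by
    have : n ≤ 2 * (n / 2) + 1 := by omega
    have : (n:ℝ) ≤ 2 * ((n / 2 : ℕ) : ℝ) + 1 := by exact_mod_cast this
    linarith
  have h5 : (4:ℝ) ≤ n := by exact_mod_cast h2
  have h6 : (n:ℝ) ^ 2 / 8 ≤ ((n / 2 : ℕ) : ℝ) ^ 2 := by nlinarith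
  nlinarith

lemma cell_half {w : Vert} (hw : w = (1, 1) ∨ w = (0, 0)) {j : ℕ} {x : Vert} (hx : x ∈ cell j w) : nd 0 x ≤ j := by
  rw [mem_cell] at hx
  rw [nd0_le]
  rcases hw with rfl | rfl <;> simp only at hx <;> push_cast at hx <;> ring_nf at hx <;> omega

lemma Gd.pk (h : Gd N θ T ω) (hθ : 0 < θ) : ∀ᶠ n in atTop, Pk N n (k4 n) ω (giant ω n) := by
  obtain ⟨m0, hG⟩ := h.geo
  obtain ⟨D, hD⟩ := exists_nat_gt (24 * 16 / θ)
  filter_upwards [h.half_cell hθ (1, 1), k4_sq_small (D + 8), k4_big 2, k4_tendsto.eventually_ge_atTop (m0 + 1)] with n h1 h2 h3 h4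
  have hrr : (k4 n + 1) * 1 ≤ (k4 n + 1) ^ 2 := by rw [sq]; exact Nat.mul_le_mul_left _ (by omega)
  have e1 : (D + 8) * (k4 n + 1) ≤ n := le_trans (Nat.mul_le_mul_left _ (by omega)) h2
  have e2 : 8 * (k4 n + 1) ≤ n := le_trans (Nat.mul_le_mul_right _ (by omega)) e1
  have e3 : D * (k4 n + 1) ≤ n := le_trans (Nat.mul_le_mul_right _ (by omega)) e1
  have hsc : Sc N n (k4 n) ω := hG.sc (by omega) (h3.trans (Nat.pow_le_pow_right (by omega) (by omega)))
  refine giant_pk hsc (by omega) (by omega) ?_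
  generalize k4 n = r at *
  have hsub : Cinf ω ∩ (cell (n / 2) (1, 1) : Set Vert) ⊆ Cinf ω ∩ latBox (n - (2 * r + 2)) := by
    rintro x ⟨hx1, hx2⟩
    refine ⟨hx1, mem_latBox.2 ?_⟩
    have := cell_half (Or.inl rfl) (Finset.mem_coe.1 hx2); omega
  have hc := Set.ncard_le_ncard hsub ((latBox_finite _).inter_of_right _)
  generalize (Cinf ω ∩ latBox (n - (2 * r + 2))).ncard = c at *
  obtain ⟨k, hk⟩ : ∃ k, n = k + (2 * r + 2) := ⟨n - (2 * r + 2), by omega⟩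
  have hk' : n - (2 * r + 2) = k := by omega
  rw [hk']
  have e5 : θ / 16 * (n:ℝ) ^ 2 ≤ c := h1.trans (by exact_mod_cast hc)
  have e6 : 24 * ((r:ℝ) + 1) * n < θ / 16 * (n:ℝ) ^ 2 := by
    have f1 : (D:ℝ) * (r + 1) ≤ n := by exact_mod_cast e3
    rw [div_lt_iff₀ hθ] at hD
    have hn : (0:ℝ) < n := by
      have : 0 < n := by omega
      exact_mod_cast this
    have f2 : 24 * 16 * ((r:ℝ) + 1) < θ * n := by
      calc 24 * 16 * ((r:ℝ) + 1) < D * θ * (r + 1) := by gcongr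
        _ = θ * (D * (r + 1)) := by ring
        _ ≤ _ := by gcongr
    nlinarith
  have e7 : 24 * (r + 1) * n < c := by
    have := e6.trans_le e5
    exact_mod_cast this
  subst hk
  zify at *
  nlinarith

lemma Gd.isop (h : Gd N θ T ω) (hθ : 0 < θ) (hN : 1 ≤ N) : ∀ᶠ n in atTop, ∀ H ⊆ giant ω n, 2 * H.ncard ≤ (giant ω n).ncard →
    H.ncard ≤ 9 * N ^ 2 * n * (edgeBdry ω (giant ω n) H).ncard := by
  filter_upwards [h.pk hθ, k4_sq_small 18] with n hP hk H hH h2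
  have h1 := hP.isop hH h2
  have h3 := (Set.ncard_le_ncard hH hP.finite).trans hP.card_le
  generalize (edgeBdry ω (giant ω n) H).ncard = E at *
  generalize H.ncard = x at *
  have hn : 1 ≤ n := by have := hP.hr; omega
  have h4 : x ≤ 9 * n * n := by nlinarith
  have hN2 : 1 ≤ N ^ 2 := Nat.one_le_pow _ _ hN
  have hNN : N ≤ N ^ 2 := by nlinarith
  have hcase : n ≤ N ^ 2 * E → x ≤ 9 * N ^ 2 * n * E := fun hh => by
    calc x ≤ 9 * n * n := h4
      _ ≤ 9 * n * (N ^ 2 * E) := Nat.mul_le_mul_left _ hh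
      _ = _ := by ring
  rcases h1 with h1 | h1
  · exact hcase (h1.trans (Nat.mul_le_mul_right _ hNN))
  · by_cases hE : n ≤ E
    · exact hcase (hE.trans (Nat.le_mul_of_pos_left _ hN2))
    · push Not at hE
      have e1 : 2 * (2 * k4 n + 3) ^ 2 ≤ 18 * (k4 n + 1) ^ 2 := by
        calc 2 * (2 * k4 n + 3) ^ 2 ≤ 2 * (3 * (k4 n + 1)) ^ 2 := Nat.mul_le_mul_left _ (Nat.pow_le_pow_left (by omega) 2)
          _ = _ := by ring
      calc x ≤ _ := h1
        _ = (2 * (2 * k4 n + 3) ^ 2 + 8 * N ^ 2 * E) * E := by ring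
        _ ≤ (N ^ 2 * n + 8 * N ^ 2 * n) * E := by
          refine Nat.mul_le_mul_right _ (Nat.add_le_add ((e1.trans hk).trans (Nat.le_mul_of_pos_left _ hN2)) ?_)
          exact Nat.mul_le_mul_left _ hE.le
        _ = _ := by ring

/-- the half-space competitor -/
lemma Gd.half (h : Gd N θ T ω) (hθ : 0 < θ) : ∀ᶠ n in atTop, ∃ H ⊆ giant ω n, 0 < H.ncard ∧ 2 * H.ncard ≤ (giant ω n).ncard ∧
    θ / 16 * (n:ℝ) ^ 2 ≤ H.ncard ∧ (edgeBdry ω (giant ω n) H).ncard ≤ 3 * n := by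
  filter_upwards [h.half_cell hθ (1, 1), h.half_cell hθ (0, 0), h.pk hθ, k4_sq_small 8] with n h1 h2 hP hk
  set G := giant ω n with hGdef
  have hrr : (k4 n + 1) * 1 ≤ (k4 n + 1) ^ 2 := by rw [sq]; exact Nat.mul_le_mul_left _ (by omega)
  have hn : 1 ≤ n := by have := hP.hr; omega
  have hn' : (0:ℝ) < n := by exact_mod_cast hn
  set A : Set Vert := G ∩ {x | x.1 ≤ 0} with hA
  set B : Set Vert := G \ A with hB
  have hAfin : A.Finite := hP.finite.subset inter_subset_left
  have hBfin : B.Finite := hP.finite.subset diff_subset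
  have hAc : θ / 16 * (n:ℝ) ^ 2 ≤ A.ncard := by
    refine h2.trans ?_
    have : Cinf ω ∩ (cell (n / 2) (0, 0) : Set Vert) ⊆ A := by
      rintro x ⟨hx1, hx2⟩
      have hx2 := Finset.mem_coe.1 hx2
      have hb := cell_half (Or.inr rfl) hx2
      refine ⟨hP.inner x hx1 (by omega), ?_⟩
      rw [mem_cell] at hx2
      have := hx2.2.1
      simpa using this
    exact_mod_cast Set.ncard_le_ncard this hAfin
  have hBc : θ / 16 * (n:ℝ) ^ 2 ≤ B.ncard := by
    refine h1.trans ?_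
    have : Cinf ω ∩ (cell (n / 2) (1, 1) : Set Vert) ⊆ B := by
      rintro x ⟨hx1, hx2⟩
      have hx2 := Finset.mem_coe.1 hx2
      have hb := cell_half (Or.inl rfl) hx2
      refine ⟨hP.inner x hx1 (by omega), fun hh => ?_⟩
      rw [mem_cell] at hx2
      have h3 := hx2.1
      have h4 : x.1 ≤ 0 := hh.2
      simp only [sub_self, mul_zero] at h3
      omega
    exact_mod_cast Set.ncard_le_ncard this hBfin
  have hcard : B.ncard + A.ncard = G.ncard := Set.ncard_sdiff_add_ncard_of_subset inter_subset_left hP.finite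
  have hpos : 0 < θ / 16 * (n:ℝ) ^ 2 := by positivity
  have hEA : ∀ H ⊆ G, (∀ x ∈ G, x ∈ H ↔ x ∈ A) ∨ (∀ x ∈ G, x ∈ H ↔ x ∈ B) → (edgeBdry ω G H).ncard ≤ 3 * n := by
    intro H hH hor
    have hsub : edgeBdry ω G H ⊆ (((Finset.Icc (-(n:ℤ)) n).image fun y => (((0, y) : Vert), false) : Finset Edge) : Set Edge) := by
      rintro ⟨⟨x, y⟩, b⟩ ⟨-, he1, he2, h3⟩
      have hne : ¬ ((x ≤ 0) ↔ (edgeTip ((x, y), b)).1 ≤ 0) := by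
        intro hiff
        have hAA : ((x, y) : Vert) ∈ A ↔ edgeTip ((x, y), b) ∈ A := by
          constructor
          · exact fun hh => ⟨he2, hiff.1 hh.2⟩
          · exact fun hh => ⟨he1, hiff.2 hh.2⟩
        have hBB : ((x, y) : Vert) ∈ B ↔ edgeTip ((x, y), b) ∈ B := by
          rw [hB]; constructor
          · exact fun hh => ⟨he2, fun h' => hh.2 (hAA.2 h')⟩
          · exact fun hh => ⟨he1, fun h' => hh.2 (hAA.1 h')⟩
        rcases hor with ho | ho <;> have o1 := ho _ he1 <;> have o2 := ho _ he2 <;> simp only at o1 o2 h3 <;> tauto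
      have hb := (hP.sub _ he1).2
      rw [nd0_le] at hb
      cases b
      · simp only [edgeTip] at hne
        simp at hne hb ⊢
        omega
      · simp [edgeTip] at hne
    have := Set.ncard_le_ncard hsub (Finset.finite_toSet _)
    rw [Set.ncard_coe_finset] at this
    have h5 := this.trans Finset.card_image_le
    rw [Int.card_Icc] at h5
    omega
  by_cases hc : 2 * A.ncard ≤ G.ncard
  · exact ⟨A, inter_subset_left, by exact_mod_cast hpos.trans_le hAc, hc, hAc, hEA A inter_subset_left (Or.inl fun _ _ => Iff.rfl)⟩
  · exact ⟨B, diff_subset, by exact_mod_cast hpos.trans_le hBc, by omega, hBc, hEA B diff_subset (Or.inr fun _ _ => Iff.rfl)⟩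

lemma Phi_le {H : Set Vert} {n : ℕ} (hH : H ⊆ giant ω n) (h0 : 0 < H.ncard) (h2 : 2 * H.ncard ≤ (giant ω n).ncard) :
    Phi ω n ≤ ((edgeBdry ω (giant ω n) H).ncard : ℝ) / H.ncard := by
  refine csInf_le ⟨0, ?_⟩ ⟨H, hH, h0, h2, rfl⟩
  rintro _ ⟨H, -, -, -, rfl⟩; positivity

lemma Gd.near (h : Gd N θ T ω) (hθ : 0 < θ) {ε : ℝ} (hε : 0 < ε) : ∀ᶠ n in atTop, ∃ H ⊆ giant ω n, 0 < H.ncard ∧ 2 * H.ncard ≤ (giant ω n).ncard ∧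
    (n:ℝ) * ((edgeBdry ω (giant ω n) H).ncard / H.ncard) ≤ n * Phi ω n + ε := by
  filter_upwards [h.half hθ, eventually_ge_atTop 1] with n ⟨H, h1, h2, h3, _⟩ hn
  have hn' : (0:ℝ) < n := by exact_mod_cast hn
  obtain ⟨r, ⟨H', a1, a2, a3, rfl⟩, hr⟩ := exists_lt_of_csInf_lt (s := {r : ℝ | ∃ H : Set Vert, H ⊆ giant ω n ∧ 0 < H.ncard ∧ 2 * H.ncard ≤ (giant ω n).ncard ∧
    r = ((edgeBdry ω (giant ω n) H).ncard : ℝ) / (H.ncard : ℝ)}) ⟨_, H, h1, h2, h3, rfl⟩ (b := Phi ω n + ε / n) (by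
      have : 0 < ε / n := by positivity
      change Phi ω n < _
      linarith)
  refine ⟨H', a1, a2, a3, ?_⟩
  have := mul_le_mul_of_nonneg_left hr.le hn'.le
  rwa [mul_add, mul_div_cancel₀ _ hn'.ne'] at this

lemma Gd.phi_lower (h : Gd N θ T ω) (hθ : 0 < θ) (hN : 1 ≤ N) : ∀ᶠ n : ℕ in atTop, 1 / (9 * (N:ℝ) ^ 2) ≤ n * Phi ω n := by
  filter_upwards [h.half hθ, h.isop hθ hN, eventually_ge_atTop 1] with n ⟨H, h1, h2, h3, _⟩ hi hn
  have hn' : (0:ℝ) < n := by exact_mod_cast hn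
  have hN' : (0:ℝ) < N := by exact_mod_cast hN
  have : 1 / (9 * (N:ℝ) ^ 2) / n ≤ Phi ω n := by
    refine le_csInf ⟨_, H, h1, h2, h3, rfl⟩ ?_
    rintro _ ⟨H, a1, a2, a3, rfl⟩
    have := hi H a1 a3
    have h4 : (H.ncard : ℝ) ≤ 9 * N ^ 2 * n * (edgeBdry ω (giant ω n) H).ncard := by exact_mod_cast this
    have h5 : (0:ℝ) < H.ncard := by exact_mod_cast a2
    rw [div_div, div_le_div_iff₀ (by positivity) h5]
    linarith
  rw [div_le_iff₀ hn'] at this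
  linarith

lemma Gd.phi_upper (h : Gd N θ T ω) (hθ : 0 < θ) : ∀ᶠ n : ℕ in atTop, n * Phi ω n ≤ 48 / θ := by
  filter_upwards [h.half hθ, eventually_ge_atTop 1] with n ⟨H, h1, h2, h3, h4, h5⟩ hn
  have hn' : (0:ℝ) < n := by exact_mod_cast hn
  have h5' : ((edgeBdry ω (giant ω n) H).ncard : ℝ) ≤ 3 * n := by exact_mod_cast h5
  have h6 : (0:ℝ) < H.ncard := by exact_mod_cast h2
  calc (n:ℝ) * Phi ω n ≤ n * ((edgeBdry ω (giant ω n) H).ncard / H.ncard) := by gcongr; exact Phi_le h1 h2 h3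
    _ ≤ 48 / θ := by
      rw [← mul_div_assoc, div_le_div_iff₀ h6 hθ]
      nlinarith

/-- near-optimizers have perimeter of order `n` and volume of order `n ^ 2` -/
lemma Gd.sizes (h : Gd N θ T ω) (hθ : 0 < θ) (hN : 1 ≤ N) {C : ℝ} (hC : 0 < C) : ∃ c > 0, ∀ᶠ n : ℕ in atTop, ∀ H ⊆ giant ω n, 0 < H.ncard →
    2 * H.ncard ≤ (giant ω n).ncard → (n:ℝ) * ((edgeBdry ω (giant ω n) H).ncard / H.ncard) ≤ C →
    ((edgeBdry ω (giant ω n) H).ncard : ℝ) ≤ 9 * C * n ∧ c * (n:ℝ) ^ 2 ≤ H.ncard := by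
  obtain ⟨D, hD⟩ := exists_nat_gt (36 * C)
  have hN' : (0:ℝ) < N := by exact_mod_cast hN
  refine ⟨min (1 / (N * C)) (1 / (16 * N ^ 2 * C ^ 2)), by positivity, ?_⟩
  filter_upwards [h.pk hθ, k4_sq_small D, eventually_ge_atTop 1] with n hP hk hn H hH h0 h2 hr
  have hn' : (0:ℝ) < n := by exact_mod_cast hn
  have h3 := hP.isop hH h2
  have h4 := (Set.ncard_le_ncard hH hP.finite).trans hP.card_le
  generalize (edgeBdry ω (giant ω n) H).ncard = E at *
  generalize H.ncard = x at *
  have hx : (0:ℝ) < x := by exact_mod_cast h0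
  rw [← mul_div_assoc, div_le_iff₀ hx] at hr
  have h5 : (x:ℝ) ≤ 9 * n ^ 2 := by
    have : x ≤ 9 * n ^ 2 := by nlinarith
    exact_mod_cast this
  constructor
  · have : (n:ℝ) * E ≤ n * (9 * C * n) := by nlinarith
    exact le_of_mul_le_mul_left this hn'
  · have hE0 : (0:ℝ) ≤ E := by positivity
    rcases h3 with h3 | h3
    · have h3' : (n:ℝ) ≤ N * E := by exact_mod_cast h3
      have : (n:ℝ) ^ 2 ≤ N * C * x := by nlinarith
      calc _ ≤ 1 / (N * C) * (n:ℝ) ^ 2 := by gcongr; exact min_le_left _ _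
        _ ≤ x := by rw [one_div, inv_mul_le_iff₀ (by positivity)]; exact this
    · have h3' : (x:ℝ) ≤ 2 * (2 * k4 n + 3) ^ 2 * E + 8 * N ^ 2 * E ^ 2 := by exact_mod_cast h3
      have hk' : (D:ℝ) * (k4 n + 1) ^ 2 ≤ n := by exact_mod_cast hk
      have hr0 : (0:ℝ) ≤ k4 n := by positivity
      generalize (k4 n : ℝ) = r at *
      have e0 : 2 * (2 * r + 3) ^ 2 * E ≤ x / 2 := by
        have hr0 : 0 ≤ r := hr0
        have f1 : (2 * r + 3) ^ 2 ≤ (3 * (r + 1)) ^ 2 := pow_le_pow_left₀ (by positivity) (by linarith) 2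
        have f2 : 36 * C * ((r + 1) ^ 2 * E) ≤ C * x := by
          calc 36 * C * ((r + 1) ^ 2 * E) ≤ D * ((r + 1) ^ 2 * E) := by gcongr
            _ = D * (r + 1) ^ 2 * E := by ring
            _ ≤ n * E := by gcongr
            _ ≤ _ := hr
        have f3 : 36 * ((r + 1) ^ 2 * E) ≤ x := by
          refine le_of_mul_le_mul_left ?_ hC
          linarith
        have f4 : (2 * r + 3) ^ 2 * E ≤ (3 * (r + 1)) ^ 2 * E := by gcongr
        nlinarith
      have e1 : (E:ℝ) ^ 2 * n ^ 2 ≤ C ^ 2 * x ^ 2 := by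
        have := pow_le_pow_left₀ (by positivity) hr 2
        nlinarith
      have e2 : (x:ℝ) ≤ 16 * N ^ 2 * E ^ 2 := by linarith
      have e3 : (x:ℝ) * n ^ 2 ≤ x * (16 * N ^ 2 * C ^ 2 * x) := by
        calc (x:ℝ) * n ^ 2 ≤ 16 * N ^ 2 * E ^ 2 * n ^ 2 := by gcongr
          _ = 16 * (N:ℝ) ^ 2 * ((E:ℝ) ^ 2 * (n:ℝ) ^ 2) := by ring
          _ ≤ 16 * (N:ℝ) ^ 2 * (C ^ 2 * (x:ℝ) ^ 2) := by gcongr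
          _ = _ := by ring
      have e4 := le_of_mul_le_mul_left e3 hx
      calc _ ≤ 1 / (16 * N ^ 2 * C ^ 2) * (n:ℝ) ^ 2 := by gcongr; exact min_le_right _ _
        _ ≤ x := by rw [one_div, inv_mul_le_iff₀ (by positivity)]; exact e4

end BP
end



noncomputable section

namespace BP

/-! ### Cutting walks into pieces, L-shaped cochains, scaling -/

lemma DWalk.exit {a b s : Vert} {l : List Edge} {M : ℕ} (h : DWalk s l b) (hs : nd a s ≤ M) :
    (∀ e ∈ l, e ∈ ev (box a M)) ∨ ∃ l1 l2 c, l = l1 ++ l2 ∧ DWalk s l1 c ∧ DWalk c l2 b ∧ nd a c = M ∧ ∀ e ∈ l1, e ∈ ev (box a M) := by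
  induction h with
  | nil => left; simp
  | @cons s s' b e l hst hw ih =>
    by_cases hs' : nd a s' ≤ M
    · have hee : e ∈ ev (box a M) := by
        rw [mem_ev, mem_box, mem_box]
        rcases hst with ⟨rfl, rfl⟩ | ⟨rfl, rfl⟩
        · exact ⟨hs, hs'⟩
        · exact ⟨hs', hs⟩
      rcases ih hs' with h1 | ⟨l1, l2, c, h1, h2, h3, h4, h5⟩
      · left; intro f hf
        rcases List.mem_cons.1 hf with rfl | hf
        · exact hee
        · exact h1 f hf
      · right
        refine ⟨e :: l1, l2, c, by rw [h1]; rfl, .cons hst h2, h3, h4, ?_⟩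
        intro f hf
        rcases List.mem_cons.1 hf with rfl | hf
        · exact hee
        · exact h5 f hf
    · right
      refine ⟨[], e :: l, s, rfl, .nil _, .cons hst hw, ?_, by simp⟩
      have h1 : nd s s' ≤ 1 := by
        rcases hst with ⟨rfl, rfl⟩ | ⟨rfl, rfl⟩
        · rw [nd_dB]
        · rw [nd_comm, nd_dB]
      have := nd_tri a s s'
      omega

lemma DWalk.end_mem {a b : Vert} {l : List Edge} (h : DWalk a l b) {Q : Vert → Prop} (ha : Q a) (hQ : ∀ e ∈ l, Q e.1 ∧ Q (dB e)) : Q b := by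
  induction h with
  | nil => exact ha
  | @cons s s' b e l hst hw ih =>
    refine ih ?_ fun f hf => hQ f (List.mem_cons_of_mem _ hf)
    have := hQ e List.mem_cons_self
    rcases hst with ⟨rfl, rfl⟩ | ⟨rfl, rfl⟩
    · exact this.2
    · exact this.1

abbrev Piece : Type := Vert × List Edge × Vert

lemma pieces {M N : ℕ} (hM : 1 ≤ M) {ω : Config} {Q : Vert → Prop}
    (hc : ∀ c l c', Q c → DWalk c l c' → M ≤ nd c c' → M ≤ N * l.countP ω) : ∀ (k : ℕ) (l : List Edge), l.length ≤ k → ∀ a b, DWalk a l b → Q a →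
    (∀ e ∈ l, Q e.1 ∧ Q (dB e)) → ∃ P : List Piece,
      (∀ q ∈ P, DWalk q.1 q.2.1 q.2.2 ∧ Q q.1 ∧ Q q.2.2 ∧ ∀ e ∈ q.2.1, e ∈ ev (box q.1 M)) ∧
      (∀ f : Vert → Z2, (P.map fun q => f q.1 + f q.2.2).sum = f a + f b) ∧
      (∀ e, (P.map fun q => Nw q.2.1 e).sum = Nw l e) ∧
      (P.map fun q => q.2.1.countP ω).sum = l.countP ω ∧ P.length * M ≤ M + N * l.countP ω := by
  intro k
  induction k with
  | zero =>
    intro l hl a b h ha hQ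
    obtain rfl : l = [] := List.length_eq_zero_iff.1 (by omega)
    refine ⟨[(a, [], b)], ?_, ?_, ?_, ?_, ?_⟩
    · intro q hq; rw [List.mem_singleton] at hq; subst hq
      exact ⟨h, ha, h.end_mem ha hQ, by simp⟩
    · simp
    · simp
    · simp
    · simp
  | succ k ih =>
    intro l hl a b h ha hQ
    rcases h.exit (a := a) (M := M) (by rw [nd_self]; omega) with h1 | ⟨l1, l2, c, rfl, h2, h3, h4, h5⟩
    · refine ⟨[(a, l, b)], ?_, ?_, ?_, ?_, ?_⟩
      · intro q hq; rw [List.mem_singleton] at hq; subst hq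
        exact ⟨h, ha, h.end_mem ha hQ, h1⟩
      · simp
      · simp
      · simp
      · simp
    · have hQ1 : ∀ e ∈ l1, Q e.1 ∧ Q (dB e) := fun e he => hQ e (List.mem_append_left _ he)
      have hQ2 : ∀ e ∈ l2, Q e.1 ∧ Q (dB e) := fun e he => hQ e (List.mem_append_right _ he)
      have hQc := h2.end_mem ha hQ1
      have hlen := h2.nd_le_length
      rw [List.length_append] at hl
      obtain ⟨P, p1, p2, p3, p4, p5⟩ := ih l2 (by omega) c b h3 hQc hQ2
      refine ⟨(a, l1, c) :: P, ?_, ?_, ?_, ?_, ?_⟩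
      · intro q hq
        rcases List.mem_cons.1 hq with rfl | hq
        · exact ⟨h2, ha, hQc, h5⟩
        · exact p1 q hq
      · intro f
        rw [List.map_cons, List.sum_cons, p2]
        generalize f a = x; generalize f b = y; generalize f c = z
        revert x y z; decide
      · intro e
        rw [List.map_cons, List.sum_cons, p3]
        simp [Nw, List.count_append]
      · rw [List.map_cons, List.sum_cons, p4, List.countP_append]
      · have := hc a l1 c ha h2 (by omega)
        rw [List.length_cons, List.countP_append]
        nlinarith

/-- L-shaped cochain from `a` to `b` -/
def NL (a b : Vert) (e : Edge) : Z2 :=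
  if e.2 then (if e.1.2 = a.2 ∧ ((a.1 < e.1.1 ∧ e.1.1 ≤ b.1) ∨ (b.1 < e.1.1 ∧ e.1.1 ≤ a.1)) then 1 else 0)
  else (if e.1.1 = b.1 ∧ ((a.2 < e.1.2 ∧ e.1.2 ≤ b.2) ∨ (b.2 < e.1.2 ∧ e.1.2 ≤ a.2)) then 1 else 0)

lemma pl_NL (a b y : Vert) : pl (NL a b) y = dl a y + dl b y := by
  obtain ⟨a1, a2⟩ := a; obtain ⟨b1, b2⟩ := b; obtain ⟨y1, y2⟩ := y
  have h1 : NL (a1, a2) (b1, b2) ((y1, y2), true) + NL (a1, a2) (b1, b2) ((y1, y2) + (1, 0), true) = dl (a1, a2) (y1, y2) + dl (b1, a2) (y1, y2) := by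
    simp only [NL, dl, Prod.mk_add_mk, Prod.mk.injEq, if_true, add_zero]
    split_ifs <;> first | rfl | (exfalso; omega)
  have h2 : NL (a1, a2) (b1, b2) ((y1, y2), false) + NL (a1, a2) (b1, b2) ((y1, y2) + (0, 1), false) = dl (b1, a2) (y1, y2) + dl (b1, b2) (y1, y2) := by
    simp only [NL, dl, Prod.mk_add_mk, Prod.mk.injEq, Bool.false_eq_true, if_false, add_zero]
    split_ifs <;> first | rfl | (exfalso; omega)
  have h3 : pl (NL (a1, a2) (b1, b2)) (y1, y2) = (NL (a1, a2) (b1, b2) ((y1, y2), true) + NL (a1, a2) (b1, b2) ((y1, y2) + (1, 0), true)) +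
     (NL (a1, a2) (b1, b2) ((y1, y2), false) + NL (a1, a2) (b1, b2) ((y1, y2) + (0, 1), false)) := by unfold pl; ring
  rw [h3, h1, h2]
  generalize dl (a1, a2) (y1, y2) = x; generalize dl (b1, a2) (y1, y2) = y; generalize dl (b1, b2) (y1, y2) = z
  revert x y z; decide

/-- the support of `NL a b` lies in the bounding rectangle of `a`, `b` -/
lemma NL_supp {a b : Vert} {e : Edge} (h : NL a b e ≠ 0) :
    (e.2 = true ∧ e.1.2 = a.2 ∧ ((a.1 < e.1.1 ∧ e.1.1 ≤ b.1) ∨ (b.1 < e.1.1 ∧ e.1.1 ≤ a.1))) ∨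
    (e.2 = false ∧ e.1.1 = b.1 ∧ ((a.2 < e.1.2 ∧ e.1.2 ≤ b.2) ∨ (b.2 < e.1.2 ∧ e.1.2 ≤ a.2))) := by
  unfold NL at h
  split_ifs at h with h1 h2 h3
  · exact Or.inl ⟨h1, h2⟩
  · exact absurd rfl h
  · exact Or.inr ⟨by simpa using h1, h3⟩
  · exact absurd rfl h

lemma NL_near {a b : Vert} {e : Edge} (h : NL a b e ≠ 0) : nd a e.1 ≤ nd a b := by
  have := NL_supp h
  unfold nd; omega

/-- coarse index of the cell containing a point -/
def cl (j : ℕ) (x : Vert) : Vert := (-((-x.1) / (j:ℤ)), -((-x.2) / (j:ℤ)))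

lemma ceil_le {j : ℕ} (hj : 1 ≤ j) (x m : ℤ) : -((-x) / (j:ℤ)) ≤ m ↔ x ≤ j * m := by
  rw [neg_le, Int.le_ediv_iff_mul_le (by omega)]
  constructor <;> intro h <;> nlinarith

lemma lt_ceil {j : ℕ} (hj : 1 ≤ j) (x m : ℤ) : m < -((-x) / (j:ℤ)) ↔ j * m < x := by
  rw [← not_le, ceil_le hj, not_le]

lemma mem_cell_cl {j : ℕ} (hj : 1 ≤ j) {x w : Vert} : x ∈ cell j w ↔ cl j x = w := by
  rw [mem_cell, ← ceil_le hj, ← ceil_le hj, ← lt_ceil hj, ← lt_ceil hj, Prod.ext_iff]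
  simp only [cl]
  omega

lemma ceil_succ {j : ℕ} (hj : 1 ≤ j) (x : ℤ) :
    (x = j * -((-x) / (j:ℤ)) ∧ -((-(x + 1)) / (j:ℤ)) = -((-x) / (j:ℤ)) + 1) ∨
    ((∀ m : ℤ, x ≠ j * m) ∧ -((-(x + 1)) / (j:ℤ)) = -((-x) / (j:ℤ))) := by
  set c := -((-x) / (j:ℤ)) with hc
  have h1 : x ≤ j * c := (ceil_le hj x c).1 le_rfl
  have h2 : j * (c - 1) < x := (lt_ceil hj x _).1 (by omega)
  by_cases h : x = j * c
  · left
    refine ⟨h, le_antisymm ((ceil_le hj _ _).2 ?_) ?_⟩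
    · rw [mul_add]; omega
    · exact Int.add_one_le_iff.2 ((lt_ceil hj _ _).2 (by omega))
  · right
    have hlt : x + 1 ≤ j * c := by omega
    refine ⟨fun m hm => ?_, le_antisymm ((ceil_le hj _ _).2 hlt) ?_⟩
    · have e1 : c ≤ m := (ceil_le hj x m).2 hm.le
      have e2 : (j:ℤ) * c ≤ j * m := by gcongr
      omega
    · have := (lt_ceil hj (x + 1) (c - 1)).2 (by omega)
      omega

lemma NL_scale {j : ℕ} (hj : 1 ≤ j) (a b x : Vert) :
    (x.1 = j * (cl j x).1 → NL (sc j a) (sc j b) (x, false) = NL a b (cl j x, false)) ∧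
    (x.2 = j * (cl j x).2 → NL (sc j a) (sc j b) (x, true) = NL a b (cl j x, true)) := by
  have hj0 : (0:ℤ) < j := by omega
  have hm : ∀ u v : ℤ, (j:ℤ) * u = j * v ↔ u = v := fun u v => mul_right_inj' hj0.ne'
  constructor <;> intro h <;> simp only [NL, sc, if_true, Bool.false_eq_true, if_false]
  · have h1 : x.1 = j * b.1 ↔ (cl j x).1 = b.1 := by
      constructor
      · intro h'; exact (hm _ _).1 (by omega)
      · intro h'; rw [h, h']
    have h2 : ∀ m : ℤ, j * m < x.2 ↔ m < (cl j x).2 := fun m => (lt_ceil hj _ _).symm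
    have h3 : ∀ m : ℤ, x.2 ≤ j * m ↔ (cl j x).2 ≤ m := fun m => (ceil_le hj _ _).symm
    exact if_congr (and_congr h1 (or_congr (and_congr (h2 _) (h3 _)) (and_congr (h2 _) (h3 _)))) rfl rfl
  · have h1 : x.2 = j * a.2 ↔ (cl j x).2 = a.2 := by
      constructor
      · intro h'; exact (hm _ _).1 (by omega)
      · intro h'; rw [h, h']
    have h2 : ∀ m : ℤ, j * m < x.1 ↔ m < (cl j x).1 := fun m => (lt_ceil hj _ _).symm
    have h3 : ∀ m : ℤ, x.1 ≤ j * m ↔ (cl j x).1 ≤ m := fun m => (ceil_le hj _ _).symm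
    exact if_congr (and_congr h1 (or_congr (and_congr (h2 _) (h3 _)) (and_congr (h2 _) (h3 _)))) rfl rfl

/-- edges with both endpoints in `[-K+1, K]²` -/
def inC (K : ℤ) (e : Edge) : Prop := -K + 1 ≤ e.1.1 ∧ (edgeTip e).1 ≤ K ∧ -K + 1 ≤ e.1.2 ∧ (edgeTip e).2 ≤ K

lemma scale_dA {ι : Type} (D : Finset ι) (v v' : ι → Vert) {K j : ℕ} (hj : 1 ≤ j) {b : Vert → Z2}
    (hb : ∀ e, inC K e → dA b e = ∑ i ∈ D, NL (v i) (v' i) e) {e : Edge} (he : inC (K * j : ℕ) e) :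
    dA (fun x => b (cl j x)) e = ∑ i ∈ D, NL (sc j (v i)) (sc j (v' i)) e := by
  obtain ⟨x, d⟩ := e
  have hlow : ∀ t : ℤ, -((K * j : ℕ) : ℤ) + 1 ≤ t → -(K:ℤ) + 1 ≤ -((-t) / (j:ℤ)) := fun t ht => by
    have := (lt_ceil hj t (-(K:ℤ))).2 (by push_cast at ht; nlinarith)
    omega
  have hup : ∀ t : ℤ, t ≤ ((K * j : ℕ) : ℤ) → -((-t) / (j:ℤ)) ≤ K := fun t ht =>
    (ceil_le hj t K).2 (by push_cast at ht; nlinarith)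
  cases d with
  | false =>
    obtain ⟨h1, h2, h3, h4⟩ := he
    rw [tip_false] at h2 h4
    simp only [Prod.fst_add, Prod.snd_add, add_zero] at h1 h2 h3 h4
    simp only [dA, tip_false]
    have hsnd : (cl j (x + (1, 0))).2 = (cl j x).2 := by simp [cl]
    rcases ceil_succ hj x.1 with ⟨e1, e2⟩ | ⟨e1, e2⟩
    · have ht : cl j (x + (1, 0)) = cl j x + (1, 0) := Prod.ext e2 (by rw [hsnd]; simp)
      have := hb (cl j x, false) ⟨hlow _ h1, by
          rw [tip_false, ← ht]; exact hup _ h2, hlow _ h3, by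
          rw [tip_false, ← ht, hsnd]; exact hup _ h4⟩
      simp only [dA, tip_false] at this
      rw [ht, this]
      exact Finset.sum_congr rfl fun i _ => ((NL_scale hj _ _ x).1 e1).symm
    · have ht : cl j (x + (1, 0)) = cl j x := Prod.ext e2 hsnd
      rw [ht, z2_self]
      symm; refine Finset.sum_eq_zero fun i _ => ?_
      by_contra hne
      rcases NL_supp hne with ⟨h', -⟩ | ⟨-, h', -⟩
      · cases h'
      · exact e1 _ h'
  | true =>
    obtain ⟨h1, h2, h3, h4⟩ := he
    rw [tip_true] at h2 h4
    simp only [Prod.fst_add, Prod.snd_add, add_zero] at h1 h2 h3 h4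
    simp only [dA, tip_true]
    have hfst : (cl j (x + (0, 1))).1 = (cl j x).1 := by simp [cl]
    rcases ceil_succ hj x.2 with ⟨e1, e2⟩ | ⟨e1, e2⟩
    · have ht : cl j (x + (0, 1)) = cl j x + (0, 1) := Prod.ext (by rw [hfst]; simp) e2
      have := hb (cl j x, true) ⟨hlow _ h1, by
          rw [tip_true, ← ht, hfst]; exact hup _ h2, hlow _ h3, by
          rw [tip_true, ← ht]; exact hup _ h4⟩
      simp only [dA, tip_true] at this
      rw [ht, this]
      exact Finset.sum_congr rfl fun i _ => ((NL_scale hj _ _ x).2 e1).symm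
    · have ht : cl j (x + (0, 1)) = cl j x := Prod.ext hfst e2
      rw [ht, z2_self]
      symm; refine Finset.sum_eq_zero fun i _ => ?_
      by_contra hne
      rcases NL_supp hne with ⟨-, h', -⟩ | ⟨h', -⟩
      · exact e1 _ h'
      · cases h'

end BP
end



noncomputable section

namespace BP

/-! ### Coarse graining, deterministic part -/

def Rg (n : ℕ) (y : Vert) : Prop := -(n:ℤ) - 1 ≤ y.1 ∧ y.1 ≤ n ∧ -(n:ℤ) - 1 ≤ y.2 ∧ y.2 ≤ n

lemma Rg.nd_le {n : ℕ} {y : Vert} (h : Rg n y) : nd 0 y ≤ n + 1 := by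
  obtain ⟨h1, h2, h3, h4⟩ := h
  unfold nd; simp only [Prod.fst_zero, Prod.snd_zero]; omega

/-- removing the short trails -/
lemma Pk.short {N n r : ℕ} {ω : Config} {G : Set Vert} (h : Pk N n r ω G) {H : Set Vert} (hH : H ⊆ G) {M : ℕ} (hM : M < n) :
    ∃ (L : Finset (List Edge)) (a b : List Edge → Vert) (d : List Edge → ℕ) (A : Vert → Z2),
      (∀ l ∈ L, BT n l (a l) (b l) (d l) ∧ M ≤ d l) ∧ (∀ e, inB n e → dA A e = ∑ l ∈ L, Nw l e) ∧
      ∑ l ∈ L, l.countP ω ≤ (edgeBdry ω G H).ncard ∧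
      {x | x ∈ G ∧ A x ≠ i2 H x}.ncard ≤ (edgeBdry ω G H).ncard * ((2 * M + 1) * (2 * N + 3) + (2 * r + 1) ^ 2) := by
  classical
  rw [h.bdry hH]
  have hr := h.hr
  obtain ⟨L, a, b, d, hBT, hsum, hin, hcount⟩ := box_trails n H
  rw [← hcount ω]
  set E := ∑ l ∈ L, l.countP ω with hE
  set S := L.filter (fun l => d l < M) with hS
  have hpot : ∀ l ∈ S, ∃ B : Vert → Z2, (∀ e, inB n e → dA B e = Nw l e) ∧ ∀ x, nd 0 x ≤ n → B x ≠ 0 → nd (a l) x ≤ d l + 1 :=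
    fun l hl => (hBT l (Finset.mem_filter.1 hl).1).potential (by have := (Finset.mem_filter.1 hl).2; omega)
  choose! B hB1 hB2 using hpot
  refine ⟨L.filter (fun l => ¬ d l < M), a, b, d, fun x => i2 H x + ∑ l ∈ S, B l x, ?_, ?_, ?_, ?_⟩
  · intro l hl
    have := Finset.mem_filter.1 hl
    exact ⟨hBT l this.1, by omega⟩
  · intro e he
    rw [dA_add, dA_sum, hsum e he, Finset.sum_congr rfl (fun l hl => hB1 l hl e he),
      ← Finset.sum_filter_add_sum_filter_not L (fun l => d l < M)]
    generalize ∑ l ∈ L with ¬ d l < M, Nw l e = u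
    rw [← hS]
    generalize ∑ l ∈ S, Nw l e = v
    revert u v; decide
  · exact Finset.sum_le_sum_of_subset (Finset.filter_subset _ _)
  · set S' := S.filter (fun l => l.countP ω ≠ 0) with hS'
    have hcov : ∀ x ∈ {x | x ∈ G ∧ i2 H x + ∑ l ∈ S, B l x ≠ i2 H x}, ∃ l ∈ S', nd (a l) x ≤ d l + 1 := by
      rintro x ⟨hx, hne⟩
      have hne : ∑ l ∈ S, B l x ≠ 0 := fun h0 => hne (by rw [h0, add_zero])
      obtain ⟨l, hl, hne⟩ := Finset.exists_ne_zero_of_sum_ne_zero hne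
      refine ⟨l, Finset.mem_filter.2 ⟨hl, fun h0 => hne (h.zero_trail (hBT l (Finset.mem_filter.1 hl).1) h0 (hB1 l hl) (hB2 l hl) x hx)⟩,
        hB2 l hl x (h.sub x hx).2 hne⟩
    refine (cover_card S' a (fun l => d l + 1) hcov).trans ?_
    have hterm : ∀ l ∈ S', (2 * (d l + 1) + 1) ^ 2 ≤ l.countP ω * ((2 * M + 1) * (2 * N + 3) + (2 * r + 1) ^ 2) := by
      intro l hl
      obtain ⟨hl, h0⟩ := Finset.mem_filter.1 hl
      obtain ⟨hl, hd⟩ := Finset.mem_filter.1 hl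
      have hc1 : 1 ≤ l.countP ω := Nat.one_le_iff_ne_zero.2 h0
      rw [mul_add (l.countP ω)]
      by_cases hh : r ≤ d l
      · have h1 := h.sc.d_le (by omega) (hBT l hl) hh
        refine le_trans ?_ (Nat.le_add_right _ _)
        generalize l.countP ω = c at *
        calc (2 * (d l + 1) + 1) ^ 2 = (2 * (d l + 1) + 1) * (2 * (d l + 1) + 1) := sq _
          _ ≤ (2 * M + 1) * (c * (2 * N + 3)) := Nat.mul_le_mul (by omega) (by nlinarith)
          _ = _ := by ring
      · refine le_trans ?_ (Nat.le_add_left _ _)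
        exact (Nat.pow_le_pow_left (by omega) 2).trans (Nat.le_mul_of_pos_left _ hc1)
    refine (Finset.sum_le_sum hterm).trans ?_
    rw [← Finset.sum_mul]
    exact Nat.mul_le_mul_right _ (Finset.sum_le_sum_of_subset ((Finset.filter_subset _ _).trans (Finset.filter_subset _ _)))

/-- cutting the long trails -/
lemma cut_long {N n r M : ℕ} {ω : Config} (hS : Sc N n r ω) (hn : 1 ≤ n) (hM : 1 ≤ M) (hrM : r ≤ M)
    {L : Finset (List Edge)} {a b : List Edge → Vert} {d : List Edge → ℕ} (hL : ∀ l ∈ L, BT n l (a l) (b l) (d l) ∧ M ≤ d l) :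
    ∃ (t : ℕ) (q : Fin t → Piece),
      (∀ i, DWalk (q i).1 (q i).2.1 (q i).2.2 ∧ Rg n (q i).1 ∧ Rg n (q i).2.2 ∧ ∀ e ∈ (q i).2.1, e ∈ ev (box (q i).1 M)) ∧
      (∀ f : Vert → Z2, ∑ i, (f (q i).1 + f (q i).2.2) = ∑ l ∈ L, (f (a l) + f (b l))) ∧
      (∀ e, ∑ i, Nw (q i).2.1 e = ∑ l ∈ L, Nw l e) ∧
      ∑ i, (q i).2.1.countP ω = ∑ l ∈ L, l.countP ω ∧ t * M ≤ 2 * N * ∑ l ∈ L, l.countP ω := by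
  classical
  have hp : ∀ l ∈ L, ∃ P : List Piece,
      (∀ q ∈ P, DWalk q.1 q.2.1 q.2.2 ∧ Rg n q.1 ∧ Rg n q.2.2 ∧ ∀ e ∈ q.2.1, e ∈ ev (box q.1 M)) ∧
      (∀ f : Vert → Z2, (P.map fun q => f q.1 + f q.2.2).sum = f (a l) + f (b l)) ∧
      (∀ e, (P.map fun q => Nw q.2.1 e).sum = Nw l e) ∧
      (P.map fun q => q.2.1.countP ω).sum = l.countP ω ∧ P.length * M ≤ M + N * l.countP ω := fun l hl =>
    pieces (Q := Rg n) hM (fun c l c' hc hw hMc => by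
      have := hS c l c' hw (by have := hc.nd_le; omega) (by omega)
      omega) _ l le_rfl _ _ (hL l hl).1.walk (hL l hl).1.hA (fun e he => dual_range ((hL l hl).1.loc e he).1)
  choose! P p1 p2 p3 p4 p5 using hp
  set D : List Piece := L.toList.flatMap P with hD
  have hfin : ∀ {α : Type} [AddCommMonoid α] (f : Piece → α), ∑ i : Fin D.length, f (D.get i) = ∑ l ∈ L, ((P l).map f).sum := by
    intro α _ f
    have h1 : ∑ i : Fin D.length, f (D.get i) = (D.map f).sum := by
      rw [← Fin.sum_univ_fun_getElem]; rfl
    have h2 : ∀ Q : List (List Edge), ((Q.flatMap P).map f).sum = (Q.map fun l => ((P l).map f).sum).sum := by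
      intro Q
      induction Q with
      | nil => rfl
      | cons x Q ih => rw [List.flatMap_cons, List.map_append, List.sum_append, ih, List.map_cons, List.sum_cons]
    rw [h1, hD, h2, Finset.sum_map_toList]
  refine ⟨D.length, D.get, ?_, ?_, ?_, ?_, ?_⟩
  · intro i
    obtain ⟨l, hl, hq⟩ := List.mem_flatMap.1 (List.get_mem D i)
    exact p1 l (Finset.mem_toList.1 hl) _ hq
  · intro f
    rw [hfin (fun q => f q.1 + f q.2.2)]
    exact Finset.sum_congr rfl fun l hl => p2 l hl f
  · intro e
    rw [hfin (fun q => Nw q.2.1 e)]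
    exact Finset.sum_congr rfl fun l hl => p3 l hl e
  · rw [hfin (fun q => q.2.1.countP ω)]
    exact Finset.sum_congr rfl fun l hl => p4 l hl
  · have h1 : D.length = ∑ l ∈ L, (P l).length := by
      have := hfin (fun _ => 1)
      simpa using this
    rw [h1, Finset.sum_mul, Finset.mul_sum]
    refine Finset.sum_le_sum fun l hl => (p5 l hl).trans ?_
    have := hS.d_le hn (hL l hl).1 (hrM.trans (hL l hl).2)
    have h2 := (hL l hl).2
    have : 2 * N * l.countP ω = 2 * (N * l.countP ω) := by ring
    omega

/-- floor rounding -/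
def fl (j : ℕ) (x : Vert) : Vert := (x.1 / (j:ℤ), x.2 / (j:ℤ))

lemma fl_near {j : ℕ} (hj : 1 ≤ j) (x : Vert) : nd (sc j (fl j x)) x ≤ j := by
  have h : ∀ t : ℤ, 0 ≤ t - j * (t / j) ∧ t - j * (t / j) < j := fun t => by
    have h1 := Int.emod_add_mul_ediv t j
    have h2 := Int.emod_nonneg t (show (j:ℤ) ≠ 0 by omega)
    have h3 := Int.emod_lt_of_pos t (show (0:ℤ) < j by omega)
    omega
  have h1 := h x.1
  have h2 := h x.2
  rw [nd_le]; simp only [sc, fl]; omega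

lemma fl_nd {j L : ℕ} (hj : 1 ≤ j) {x y : Vert} (h : nd x y ≤ L * j) : nd (fl j x) (fl j y) ≤ L := by
  have hd : ∀ s t : ℤ, s - t ≤ ((L * j : ℕ):ℤ) → s / j - t / j ≤ L := fun s t hst => by
    have h1 : s / j ≤ (t + L * j) / j := Int.ediv_le_ediv (by omega) (by push_cast at hst; linarith)
    rw [Int.add_mul_ediv_right _ _ (by omega)] at h1
    omega
  rw [nd_le] at h ⊢
  exact ⟨hd _ _ h.1, hd _ _ h.2.1, hd _ _ h.2.2.1, hd _ _ h.2.2.2⟩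

lemma NL_outer {n K j : ℕ} (hj : 1 ≤ j) (hK : K * j ≤ n) {a : Vert} (ha : a ∈ Out n) {e : Edge} (he : inC (K * j : ℕ) e) :
    NL a (sc j (fl j a)) e = 0 := by
  by_contra hne
  have hs := NL_supp hne
  have hup : ∀ t : ℤ, (n:ℤ) ≤ t → ((K * j : ℕ):ℤ) ≤ j * (t / j) := fun t ht => by
    have : (K:ℤ) ≤ t / j := (Int.le_ediv_iff_mul_le (by omega)).2 (by push_cast at hK; zify at hK; linarith)
    push_cast; nlinarith
  have hlo : ∀ t : ℤ, t < -(n:ℤ) → (j:ℤ) * (t / j) < -((K * j : ℕ):ℤ) := fun t ht => by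
    have h1 := Int.mul_ediv_self_le (x := t) (k := (j:ℤ)) (by omega)
    zify at hK; push_cast; linarith
  have ha' : (n:ℤ) ≤ a.1 ∨ a.1 < -(n:ℤ) ∨ (n:ℤ) ≤ a.2 ∨ a.2 < -(n:ℤ) := by
    by_contra hc; push Not at hc; exact ha ⟨by omega, by omega, by omega, by omega⟩
  have u1 := hup a.1; have u2 := hup a.2; have l1 := hlo a.1; have l2 := hlo a.2
  simp only [sc, fl] at hs
  obtain ⟨x, bb⟩ := e
  unfold inC at he
  generalize (j:ℤ) * (a.1 / j) = A1 at *
  generalize (j:ℤ) * (a.2 / j) = A2 at *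
  generalize K * j = Q at *
  cases bb
  · rw [tip_false] at he
    simp only [Prod.fst_add, Prod.snd_add] at he
    simp at hs
    omega
  · rw [tip_true] at he
    simp only [Prod.fst_add, Prod.snd_add] at he
    simp at hs
    omega

end BP
end



noncomputable section

namespace BP

lemma fl_Out {n K j : ℕ} (hj : 1 ≤ j) (hK : K * j ≤ n) {a : Vert} (ha : a ∈ Out n) {y : Vert}
    (hy : -(K:ℤ) + 1 ≤ y.1 ∧ y.1 < K ∧ -(K:ℤ) + 1 ≤ y.2 ∧ y.2 < K) : dl (fl j a) y = 0 := by
  have hup : ∀ t : ℤ, (n:ℤ) ≤ t → (K:ℤ) ≤ t / j := fun t ht =>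
    (Int.le_ediv_iff_mul_le (by omega)).2 (by zify at hK; linarith)
  have hlo : ∀ t : ℤ, t < -(n:ℤ) → t / j < -(K:ℤ) := fun t ht =>
    Int.ediv_lt_of_lt_mul (by omega) (by zify at hK; linarith)
  have ha' : (n:ℤ) ≤ a.1 ∨ a.1 < -(n:ℤ) ∨ (n:ℤ) ≤ a.2 ∨ a.2 < -(n:ℤ) := by
    by_contra hc; push Not at hc; exact ha ⟨by omega, by omega, by omega, by omega⟩
  unfold dl
  rw [if_neg]
  intro h
  have u1 := hup a.1; have u2 := hup a.2; have l1 := hlo a.1; have l2 := hlo a.2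
  have e1 : y.1 = a.1 / j := by rw [h]; rfl
  have e2 : y.2 = a.2 / j := by rw [h]; rfl
  omega

lemma inC_inB {n m : ℕ} (h : m ≤ n) {e : Edge} (he : inC (m:ℕ) e) : inB n e := by
  rw [inB_iff]; unfold inC at he; omega

/-- coarse potential of a family of pieces -/
lemma coarse_pot {n K j L t : ℕ} (hj : 1 ≤ j) (hK : 1 ≤ K) (hKj : K * j ≤ n) {A : Vert → Z2} {D : Finset (List Edge)} {a b : List Edge → Vert}
    (hends : ∀ l ∈ D, a l = b l ∨ (a l ∈ Out n ∧ b l ∈ Out n)) (q : Fin t → Piece)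
    (hq : ∀ i, DWalk (q i).1 (q i).2.1 (q i).2.2 ∧ ∀ e ∈ (q i).2.1, e ∈ ev (box (q i).1 (L * j)))
    (hf : ∀ f : Vert → Z2, ∑ i, (f (q i).1 + f (q i).2.2) = ∑ l ∈ D, (f (a l) + f (b l)))
    (hA : ∀ e, inB n e → dA A e = ∑ i, Nw (q i).2.1 e) :
    (∀ i, nd (q i).1 (q i).2.2 ≤ L * j) ∧
    ∃ B : Vert → Z2, (∀ e, inC K e → dA B e = ∑ i, NL (fl j (q i).1) (fl j (q i).2.2) e) ∧
      ∀ x : Vert, (-((K * j : ℕ):ℤ) + 1 ≤ x.1 ∧ x.1 ≤ (K * j : ℕ) ∧ -((K * j : ℕ):ℤ) + 1 ≤ x.2 ∧ x.2 ≤ (K * j : ℕ)) →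
        (∀ i, (L + 3) * j < nd (sc j (fl j (q i).1)) x) → A x = B (cl j x) := by
  have hxx : ∀ i, nd (q i).1 (q i).2.2 ≤ L * j := fun i =>
    (hq i).1.end_mem (Q := fun y => nd (q i).1 y ≤ L * j) (by simp [nd_self]) (fun e he => by
      have := mem_ev.1 ((hq i).2 e he); rwa [mem_box, mem_box] at this)
  refine ⟨hxx, ?_⟩
  have hS : ∀ i, ∃ S : Vert → Z2, (∀ e, dA S e = Nw (q i).2.1 e + NL (q i).1 (sc j (fl j (q i).1)) e
      + NL (q i).2.2 (sc j (fl j (q i).2.2)) e + NL (sc j (fl j (q i).1)) (sc j (fl j (q i).2.2)) e) ∧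
      ∀ x, S x ≠ 0 → nd (sc j (fl j (q i).1)) x ≤ (L + 3) * j := by
    intro i
    suffices hh : _ ∧ _ by
      obtain ⟨S, h1, h2⟩ := plane_potential _ (sc j (fl j (q i).1)) ((L + 2) * j) hh.1 hh.2
      refine ⟨S, h1, fun x hx => (h2 x hx).trans ?_⟩
      nlinarith
    constructor
    · intro y
      rw [pl_add, pl_add, pl_add, pl_Nw (hq i).1, pl_NL, pl_NL, pl_NL]
      generalize dl (q i).1 y = u1; generalize dl (q i).2.2 y = u2
      generalize dl (sc j (fl j (q i).1)) y = u3; generalize dl (sc j (fl j (q i).2.2)) y = u4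
      revert u1 u2 u3 u4; decide
    · intro e he
      have n1 := fl_near hj (q i).1
      have n2 := fl_near hj (q i).2.2
      have n3 := hxx i
      have t1 := nd_tri (sc j (fl j (q i).1)) (q i).1 e.1
      have t2 := nd_tri (q i).1 (q i).2.2 e.1
      have c1 := nd_comm (sc j (fl j (q i).1)) (q i).1
      have c2 := nd_comm (sc j (fl j (q i).2.2)) (q i).2.2
      have eL : (L + 2) * j = L * j + 2 * j := by ring
      by_cases g1 : Nw (q i).2.1 e = 0
      · by_cases g2 : NL (q i).1 (sc j (fl j (q i).1)) e = 0
        · by_cases g3 : NL (q i).2.2 (sc j (fl j (q i).2.2)) e = 0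
          · have g4 : NL (sc j (fl j (q i).1)) (sc j (fl j (q i).2.2)) e ≠ 0 := by
              intro g4; apply he; simp [g1, g2, g3, g4]
            have := NL_near g4
            rw [nd_sc] at this
            have h5 := fl_nd hj n3
            have : j * nd (fl j (q i).1) (fl j (q i).2.2) ≤ j * L := Nat.mul_le_mul_left _ h5
            have : j * L = L * j := mul_comm _ _
            omega
          · have := NL_near g3; omega
        · have := NL_near g2; omega
      · have := (mem_ev.1 ((hq i).2 e (Nw_ne_zero g1))).1
        rw [mem_box] at this
        omega
  choose S hS1 hS2 using hS
  obtain ⟨B0, hB0⟩ := rect_potential (fun e => ∑ i, NL (fl j (q i).1) (fl j (q i).2.2) e) (-(K:ℤ) + 1) K (-(K:ℤ) + 1) K (by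
    intro y h1 h2 h3 h4
    rw [pl_sum, Finset.sum_congr rfl (fun i _ => pl_NL _ _ _), hf (fun z => dl (fl j z) y)]
    refine Finset.sum_eq_zero fun l hl => ?_
    rcases hends l hl with h | ⟨ha, hb⟩
    · rw [h, z2_self]
    · rw [fl_Out hj hKj ha ⟨h1, h2, h3, h4⟩, fl_Out hj hKj hb ⟨h1, h2, h3, h4⟩, add_zero])
  have hB0' : ∀ e, inC K e → dA B0 e = ∑ i, NL (fl j (q i).1) (fl j (q i).2.2) e := fun e he => hB0 e he.1 he.2.1 he.2.2.1 he.2.2.2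
  have hKj1 : 1 ≤ K * j := Nat.mul_pos hK hj
  set F : Vert → Z2 := fun x => (A x + ∑ i, S i x) + B0 (cl j x) with hF
  have hz : ∀ e, inC (K * j : ℕ) e → dA F e = 0 := by
    intro e he
    rw [hF, dA_add, dA_add, dA_sum, scale_dA Finset.univ _ _ hj hB0' he, hA e (inC_inB hKj he), Finset.sum_congr rfl (fun i _ => hS1 i e)]
    have h0 : ∑ i, (NL (q i).1 (sc j (fl j (q i).1)) e + NL (q i).2.2 (sc j (fl j (q i).2.2)) e) = 0 := by
      rw [hf (fun z => NL z (sc j (fl j z)) e)]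
      refine Finset.sum_eq_zero fun l hl => ?_
      rcases hends l hl with h | ⟨ha, hb⟩
      · rw [h, z2_self]
      · rw [NL_outer hj hKj ha he, NL_outer hj hKj hb he, add_zero]
    rw [← Finset.sum_add_distrib, ← Finset.sum_add_distrib, ← h0]
    refine Finset.sum_congr rfl fun i _ => ?_
    generalize Nw (q i).2.1 e = u1; generalize NL (q i).1 (sc j (fl j (q i).1)) e = u2
    generalize NL (q i).2.2 (sc j (fl j (q i).2.2)) e = u3
    generalize NL (sc j (fl j (q i).1)) (sc j (fl j (q i).2.2)) e = u4
    revert u1 u2 u3 u4; decide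
  refine ⟨fun x => B0 x + F (1, 1), fun e he => ?_, fun x hx hfar => ?_⟩
  · rw [dA_add, hB0' e he]
    have : dA (fun _ => F (1, 1)) e = 0 := by simp only [dA]; exact z2_self _
    rw [this, add_zero]
  · have hc := rect_const (B := F) (a1 := -((K * j : ℕ):ℤ) + 1) (b1 := (K * j : ℕ)) (a2 := -((K * j : ℕ):ℤ) + 1) (b2 := (K * j : ℕ))
      (fun e h1 h2 h3 h4 => hz e ⟨h1, h2, h3, h4⟩) hx (y := (1, 1)) (by simp only; omega)
    have h0 : ∑ i, S i x = 0 := Finset.sum_eq_zero fun i _ => by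
      by_contra hne
      have := hS2 i x hne
      have := hfar i
      omega
    rw [← hc, hF]
    simp only [h0]
    generalize A x = u; generalize B0 (cl j x) = v
    revert u v; decide

end BP
end



noncomputable section

namespace BP

/-! ### Coarse graining, counting -/

def Wc (K : ℕ) : Finset Vert := Finset.Icc (-(K:ℤ) + 1) K ×ˢ Finset.Icc (-(K:ℤ) + 1) K

lemma mem_Wc {K : ℕ} {w : Vert} : w ∈ Wc K ↔ -(K:ℤ) + 1 ≤ w.1 ∧ w.1 ≤ K ∧ -(K:ℤ) + 1 ≤ w.2 ∧ w.2 ≤ K := by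
  unfold Wc; rw [Finset.mem_product, Finset.mem_Icc, Finset.mem_Icc]; tauto

lemma card_Wc (K : ℕ) : (Wc K).card = (2 * K) ^ 2 := by
  unfold Wc
  rw [Finset.card_product, Int.card_Icc, sq]
  congr 1 <;> omega

lemma cell_filter (ω : Config) (j : ℕ) (w : Vert) [DecidablePred fun x => x ∈ Cinf ω] :
    (Cinf ω ∩ (cell j w : Set Vert)).ncard = ((cell j w).filter (fun x => x ∈ Cinf ω)).card := by
  rw [← Set.ncard_coe_finset]
  congr 1
  ext x; simp [and_comm]

lemma cells_card {ω : Config} {j : ℕ} (hj : 1 ≤ j) (D : Finset Vert) {U : Set Vert} (h : ∀ x ∈ U, x ∈ Cinf ω ∧ cl j x ∈ D) :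
    U.ncard ≤ ∑ w ∈ D, (Cinf ω ∩ (cell j w : Set Vert)).ncard := by
  classical
  have hsub : U ⊆ ((D.biUnion fun w => (cell j w).filter (fun x => x ∈ Cinf ω) : Finset Vert) : Set Vert) := fun x hx => by
    rw [Finset.mem_coe, Finset.mem_biUnion]
    exact ⟨cl j x, (h x hx).2, Finset.mem_filter.2 ⟨(mem_cell_cl hj).2 rfl, (h x hx).1⟩⟩
  refine (Set.ncard_le_ncard hsub (Finset.finite_toSet _)).trans ?_
  rw [Set.ncard_coe_finset]
  refine Finset.card_biUnion_le.trans (Finset.sum_le_sum fun w _ => ?_)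
  rw [cell_filter]

lemma layer_card {n K j : ℕ} (hn : n ≤ K * j + K) (hK : 1 ≤ K) (hj : K ≤ j) (hKj : K * j ≤ n) {U : Set Vert}
    (h : ∀ x ∈ U, nd 0 x ≤ n ∧ ¬ (-((K * j : ℕ):ℤ) + 1 ≤ x.1 ∧ x.1 ≤ (K * j : ℕ) ∧ -((K * j : ℕ):ℤ) + 1 ≤ x.2 ∧ x.2 ≤ (K * j : ℕ))) :
    U.ncard ≤ 21 * K * j ^ 2 := by
  have hsub : U ⊆ ((box 0 n \ Wc (K * j) : Finset Vert) : Set Vert) := fun x hx => by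
    rw [Finset.mem_coe, Finset.mem_sdiff, mem_box, mem_Wc]
    exact h x hx
  refine (Set.ncard_le_ncard hsub (Finset.finite_toSet _)).trans ?_
  rw [Set.ncard_coe_finset, Finset.card_sdiff_of_subset, card_box, card_Wc]
  · have h1 : (2 * n + 1) ^ 2 ≤ (2 * (K * j + K) + 1) ^ 2 := Nat.pow_le_pow_left (by omega) 2
    have h2 : (2 * (K * j + K) + 1) ^ 2 = (2 * (K * j)) ^ 2 + (2 * K + 1) * (4 * (K * j) + (2 * K + 1)) := by ring
    have h3 : (2 * K + 1) * (4 * (K * j) + (2 * K + 1)) ≤ (3 * K) * (7 * j * j) := by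
      have : K * j ≤ j * j := Nat.mul_le_mul_right _ hj
      have : 1 * j ≤ j * j := Nat.mul_le_mul_right _ (by omega)
      refine Nat.mul_le_mul (by omega) ?_
      have : 7 * j * j = 7 * (j * j) := by ring
      omega
    have h4 : (3 * K) * (7 * j * j) = 21 * K * j ^ 2 := by ring
    omega
  · intro x hx
    rw [mem_Wc] at hx
    rw [mem_box, nd0_le]
    omega

/-- uniform convergence on a finite box -/
lemma Gd.unif {N : ℕ} {θ : ℝ} {T : Vert → Vert → ℝ} {ω : Config} (h : Gd N θ T ω) {δ : ℝ} (hδ : 0 < δ) (R : ℕ) :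
    ∀ᶠ j : ℕ in atTop, 1 ≤ j ∧ (∀ u ∈ box 0 R, ∀ v ∈ box 0 R, |(TT univ ω (sc j u) (sc j v) : ℝ) - T u v * j| ≤ δ * j) ∧
      ∀ w ∈ box 0 R, |((Cinf ω ∩ (cell j w : Set Vert)).ncard : ℝ) - θ * (j:ℝ) ^ 2| ≤ δ * (j:ℝ) ^ 2 := by
  have h1 : ∀ᶠ j : ℕ in atTop, ∀ u ∈ box 0 R, ∀ v ∈ box 0 R, |(TT univ ω (sc j u) (sc j v) : ℝ) / j - T u v| ≤ δ := by
    rw [eventually_all_finset]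
    intro u _
    rw [eventually_all_finset]
    intro v _
    have := (h.pass u v).eventually (Metric.closedBall_mem_nhds _ hδ)
    simpa [Real.dist_eq] using this
  have h2 : ∀ᶠ j : ℕ in atTop, ∀ w ∈ box 0 R, |((Cinf ω ∩ (cell j w : Set Vert)).ncard : ℝ) / (j:ℝ) ^ 2 - θ| ≤ δ := by
    rw [eventually_all_finset]
    intro w _
    have := (h.dens w).eventually (Metric.closedBall_mem_nhds _ hδ)
    simpa [Real.dist_eq] using this
  filter_upwards [h1, h2, eventually_ge_atTop 1] with j a b hj
  have hj' : (0:ℝ) < j := by exact_mod_cast hj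
  refine ⟨hj, fun u hu v hv => ?_, fun w hw => ?_⟩
  · have := a u hu v hv
    rw [show (TT univ ω (sc j u) (sc j v) : ℝ) / j - T u v = ((TT univ ω (sc j u) (sc j v) : ℝ) - T u v * j) / j by field_simp,
      abs_div, abs_of_pos hj', div_le_iff₀ hj'] at this
    exact this
  · have := b w hw
    have hj2 : (0:ℝ) < (j:ℝ) ^ 2 := by positivity
    rw [show ((Cinf ω ∩ (cell j w : Set Vert)).ncard : ℝ) / (j:ℝ) ^ 2 - θ = (((Cinf ω ∩ (cell j w : Set Vert)).ncard : ℝ) - θ * (j:ℝ) ^ 2) / (j:ℝ) ^ 2 by field_simp,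
      abs_div, abs_of_pos hj2, div_le_iff₀ hj2] at this
    exact this

/-- a coarse configuration -/
structure Co (K L t : ℕ) (v v' : Fin t → Vert) (B : Vert → Z2) : Prop where
  near : ∀ i, nd (v i) (v' i) ≤ L
  rng : ∀ i, nd 0 (v i) ≤ K + 1
  rng' : ∀ i, nd 0 (v' i) ≤ K + 1
  pot : ∀ e, inC K e → dA B e = ∑ i, NL (v i) (v' i) e

/-- cells with colour `u` -/
def Wu (K : ℕ) (B : Vert → Z2) (u : Z2) : Finset Vert := by
  classical
  exact (Wc K).filter (fun w => B w = u)

lemma mem_Wu {K : ℕ} {B : Vert → Z2} {u : Z2} {w : Vert} : w ∈ Wu K B u ↔ w ∈ Wc K ∧ B w = u := by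
  classical
  unfold Wu; rw [Finset.mem_filter]

lemma Rg.fl_nd0 {n K j : ℕ} (hn : n + 1 ≤ K * j + K) (hj : K + 1 ≤ j) {y : Vert} (h : Rg n y) : nd 0 (fl j y) ≤ K + 1 := by
  obtain ⟨h1, h2, h3, h4⟩ := h
  have hup : ∀ t : ℤ, t ≤ (n:ℤ) → t / j ≤ K := fun t ht => by
    have : t / j < K + 1 := Int.ediv_lt_of_lt_mul (by omega) (by zify at hn hj; nlinarith)
    omega
  have hlo : ∀ t : ℤ, -(n:ℤ) - 1 ≤ t → -((K:ℤ) + 1) ≤ t / j := fun t ht =>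
    (Int.le_ediv_iff_mul_le (by omega)).2 (by zify at hn hj; nlinarith)
  rw [nd0_le]
  have a1 := hup _ h2; have a2 := hup _ h4; have a3 := hlo _ h1; have a4 := hlo _ h3
  simp only [fl]
  push_cast; omega

set_option maxHeartbeats 1000000 in
theorem Gd.coarse {N : ℕ} {θ : ℝ} {T : Vert → Vert → ℝ} {ω : Config} (h : Gd N θ T ω) (hθ : 0 < θ) {C0 : ℝ} (hC0 : 0 < C0) :
    ∃ C : ℝ, 0 < C ∧ ∀ L K : ℕ, 1 ≤ L → 2 * L ≤ K → ∀ᶠ n : ℕ in atTop, ∀ H ⊆ giant ω n, ((edgeBdry ω (giant ω n) H).ncard : ℝ) ≤ C0 * n →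
      ∃ (t : ℕ) (v v' : Fin t → Vert) (B : Vert → Z2), Co K L t v v' B ∧ (t:ℝ) * L ≤ C * K ∧
        (∑ i, T (v i) (v' i)) * (n / K : ℕ) ≤ (edgeBdry ω (giant ω n) H).ncard + C * K / L * (n / K : ℕ) ∧
        ∀ u : Z2, ({x | x ∈ giant ω n ∧ i2 H x = u}.ncard : ℝ) ≤ ((n / K : ℕ):ℝ) ^ 2 * (θ * (Wu K B u).card + C * K * L) := by
  classical
  refine ⟨1 + 21 + 4 * N * C0 + 20 * N * C0 + 324 * N * C0 + 2 * C0 * (6 * N + 10), by positivity, fun L K hL hLK => ?_⟩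
  have hK : 1 ≤ K := by omega
  have hK' : (1:ℝ) ≤ K := by exact_mod_cast hK
  have hL' : (1:ℝ) ≤ L := by exact_mod_cast hL
  have hN0 : (0:ℝ) ≤ N := by positivity
  have hdiv := Nat.tendsto_div_const_atTop (n := K) (by omega)
  filter_upwards [h.pk hθ, hdiv.eventually (h.unif (show (0:ℝ) < 1 by norm_num) (K + 1)),
    hdiv.eventually (h.unif (show (0:ℝ) < 1 / (4 * K) by positivity) (K + 1)), k4_sq_small (8 * K), hdiv.eventually (eventually_ge_atTop (K + 1)),
    eventually_ge_atTop 1] with n hP hu1 hu2 hk hjK hn H hH hE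
  set G := giant ω n with hG
  set E := (edgeBdry ω G H).ncard with hEdef
  set j := n / K with hjdef
  set r := k4 n with hr
  have hj : 1 ≤ j := by omega
  have hKj : K * j ≤ n := Nat.mul_div_le n K
  have hnK : n + 1 ≤ K * j + K := by
    have : n < K * (j + 1) := Nat.lt_mul_div_succ n (show 0 < K by omega)
    rw [mul_add, mul_one] at this; omega
  have hn2 : n ≤ 2 * K * j := by
    have : K * 1 ≤ K * j := Nat.mul_le_mul_left _ hj
    have : 2 * K * j = 2 * (K * j) := by ring
    omega
  have hrj : (2 * r + 1) ^ 2 ≤ j := by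
    have h1 : 8 * K * (r + 1) ^ 2 ≤ 2 * K * j := hk.trans hn2
    have h2 : 2 * K * (4 * (r + 1) ^ 2) ≤ 2 * K * j := by linarith
    have h3 := Nat.le_of_mul_le_mul_left h2 (by omega)
    have h4 : (2 * r + 1) ^ 2 ≤ (2 * (r + 1)) ^ 2 := Nat.pow_le_pow_left (by omega) 2
    have h5 : (2 * (r + 1)) ^ 2 = 4 * (r + 1) ^ 2 := by ring
    omega
  have hrM : r ≤ L * j := by
    have : 1 * j ≤ L * j := Nat.mul_le_mul_right _ hL
    have h4 : (2 * r + 1) * 1 ≤ (2 * r + 1) * (2 * r + 1) := Nat.mul_le_mul_left _ (by omega)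
    rw [← sq] at h4
    omega
  have hMn : L * j < n := by
    have h1 : 2 * L * j ≤ K * j := Nat.mul_le_mul_right _ hLK
    have h2 : 1 ≤ L * j := Nat.mul_pos hL hj
    have h3 : 2 * L * j = 2 * (L * j) := by ring
    omega
  obtain ⟨D, a, b, d, A, s1, s2, s3, s4⟩ := hP.short hH hMn
  obtain ⟨t, q, q1, q2, q3, q4, q5⟩ := cut_long hP.sc hn (Nat.mul_pos hL hj) hrM s1
  obtain ⟨hxx, B, b1, b2⟩ := coarse_pot (L := L) hj hK hKj (A := A) (D := D) (a := a) (b := b) (fun l hl => (s1 l hl).1.ends) q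
    (fun i => ⟨(q1 i).1, (q1 i).2.2.2⟩) q2 (fun e he => by rw [s2 e he, q3 e])
  set v : Fin t → Vert := fun i => fl j (q i).1 with hv
  set v' : Fin t → Vert := fun i => fl j (q i).2.2 with hv'
  have hj' : (0:ℝ) < j := by exact_mod_cast hj
  have hn2' : (n:ℝ) ≤ 2 * K * j := by exact_mod_cast hn2
  have hE2 : (E:ℝ) ≤ 2 * C0 * K * j := hE.trans (by
    have : C0 * (n:ℝ) ≤ C0 * (2 * K * j) := by gcongr
    linarith)
  have hco : Co K L t v v' B := ⟨fun i => fl_nd hj (hxx i), fun i => (q1 i).2.1.fl_nd0 hnK hjK, fun i => (q1 i).2.2.1.fl_nd0 hnK hjK, b1⟩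
  have htL : (t:ℝ) * L ≤ 4 * N * C0 * K := by
    have h1 : (t:ℝ) * (L * j) ≤ 2 * N * E := by
      have : t * (L * j) ≤ 2 * N * E := q5.trans (Nat.mul_le_mul_left _ s3)
      exact_mod_cast this
    have h2 : 2 * N * (E:ℝ) ≤ 2 * N * (2 * C0 * K * j) := by gcongr
    have h3 : (t * L : ℝ) * j ≤ (4 * N * C0 * K) * j := by linarith
    exact le_of_mul_le_mul_right h3 hj'
  refine ⟨t, v, v', B, hco, htL.trans ?_, ?_, fun u => ?_⟩
  · have : 0 ≤ (1 + 21 + 20 * N * C0 + 324 * N * C0 + 2 * C0 * (6 * N + 10)) * (K:ℝ) := by positivity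
    nlinarith
  · have hterm : ∀ i, T (v i) (v' i) * j ≤ ((q i).2.1.countP ω : ℝ) + 5 * j := by
      intro i
      have h1 := hu1.2.1 (v i) (mem_box.2 (hco.rng i)) (v' i) (mem_box.2 (hco.rng' i))
      have h2 := TT_lip ω (sc j (v i)) (sc j (v' i)) (q i).1 (q i).2.2
      have h3 := TT_le (F := univ) (ω := ω) (q1 i).1 (fun _ _ => mem_univ _)
      have h4 := fl_near hj (q i).1
      have h5 := fl_near hj (q i).2.2
      rw [nd_comm] at h5
      have h6 : TT univ ω (sc j (v i)) (sc j (v' i)) ≤ (q i).2.1.countP ω + 4 * j := by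
        have h4' : nd (sc j (v i)) (q i).1 ≤ j := h4
        have h5' : nd (q i).2.2 (sc j (v' i)) ≤ j := h5
        omega
      have h7 : (TT univ ω (sc j (v i)) (sc j (v' i)) : ℝ) ≤ ((q i).2.1.countP ω : ℝ) + 4 * j := by exact_mod_cast h6
      have := (abs_le.1 h1).1
      linarith
    have hsum : (∑ i, T (v i) (v' i)) * j ≤ (∑ i, ((q i).2.1.countP ω : ℝ)) + t * (5 * j) := by
      rw [Finset.sum_mul]
      refine (Finset.sum_le_sum fun i _ => hterm i).trans ?_
      rw [Finset.sum_add_distrib]; simp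
    have hc : (∑ i, ((q i).2.1.countP ω : ℝ)) ≤ E := by
      have : ∑ i, (q i).2.1.countP ω ≤ E := q4.le.trans s3
      exact_mod_cast this
    have h5 : (t:ℝ) * 5 ≤ (20 * N * C0) * K / L := by
      rw [le_div_iff₀ (by linarith)]; linarith
    have h6 : (20 * N * C0) * K / L ≤ (1 + 21 + 4 * N * C0 + 20 * N * C0 + 324 * N * C0 + 2 * C0 * (6 * N + 10)) * K / (L:ℝ) := by
      gcongr
      have : 0 ≤ 1 + 21 + 4 * N * C0 + 324 * N * C0 + 2 * C0 * (6 * N + 10) := by positivity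
      linarith
    have h7 : (t:ℝ) * (5 * j) ≤ (1 + 21 + 4 * N * C0 + 20 * N * C0 + 324 * N * C0 + 2 * C0 * (6 * N + 10)) * K / (L:ℝ) * j := by
      rw [← mul_assoc]; gcongr; exact h5.trans h6
    linarith
  · set U1 : Set Vert := {x | x ∈ Cinf ω ∧ cl j x ∈ Wu K B u} with hU1
    set X : Set Vert := {x | x ∈ G ∧ i2 H x = u} with hX
    have hXf : X.Finite := hP.finite.subset fun x hx => hx.1
    have hcov : X ⊆ (X ∩ {x | cl j x ∈ Wu K B u}) ∪ (X ∩ {x | A x ≠ i2 H x}) ∪ (X ∩ {x | ∃ i, nd (sc j (v i)) x ≤ (L + 3) * j}) ∪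
        (X ∩ {x | ¬ (-((K * j : ℕ):ℤ) + 1 ≤ x.1 ∧ x.1 ≤ (K * j : ℕ) ∧ -((K * j : ℕ):ℤ) + 1 ≤ x.2 ∧ x.2 ≤ (K * j : ℕ))}) := by
      intro x hx
      by_cases g1 : (-((K * j : ℕ):ℤ) + 1 ≤ x.1 ∧ x.1 ≤ (K * j : ℕ) ∧ -((K * j : ℕ):ℤ) + 1 ≤ x.2 ∧ x.2 ≤ (K * j : ℕ))
      swap
      · exact Or.inr ⟨hx, g1⟩
      left
      by_cases g2 : ∃ i, nd (sc j (v i)) x ≤ (L + 3) * j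
      · exact Or.inr ⟨hx, g2⟩
      left
      by_cases g3 : A x = i2 H x
      swap
      · exact Or.inr ⟨hx, g3⟩
      left
      refine ⟨hx, ?_⟩
      push Not at g2
      have := b2 x g1 g2
      rw [mem_ofPred_eq, mem_Wu, ← this, g3, mem_Wc]
      refine ⟨?_, hx.2⟩
      push_cast at g1
      have e1 := (lt_ceil hj x.1 (-(K:ℤ))).2 (by linarith [g1.1])
      have e2 := (ceil_le hj x.1 (K:ℤ)).2 (by linarith [g1.2.1])
      have e3 := (lt_ceil hj x.2 (-(K:ℤ))).2 (by linarith [g1.2.2.1])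
      have e4 := (ceil_le hj x.2 (K:ℤ)).2 (by linarith [g1.2.2.2])
      simp only [cl]
      omega
    have hc1 : (X ∩ {x | cl j x ∈ Wu K B u}).ncard ≤ ∑ w ∈ Wu K B u, (Cinf ω ∩ (cell j w : Set Vert)).ncard :=
      cells_card hj _ fun x hx => ⟨(hP.sub x hx.1.1).1, hx.2⟩
    have hc2 : (X ∩ {x | A x ≠ i2 H x}).ncard ≤ E * ((2 * (L * j) + 1) * (2 * N + 3) + (2 * r + 1) ^ 2) :=
      (Set.ncard_le_ncard (t := {x | x ∈ G ∧ A x ≠ i2 H x}) (fun x hx => ⟨hx.1.1, hx.2⟩) (hP.finite.subset fun x hx => hx.1)).trans s4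
    have hc3 : (X ∩ {x | ∃ i, nd (sc j (v i)) x ≤ (L + 3) * j}).ncard ≤ ∑ i : Fin t, (2 * ((L + 3) * j) + 1) ^ 2 :=
      cover_card Finset.univ (fun i => sc j (v i)) (fun _ => (L + 3) * j) fun x hx => by
        obtain ⟨i, hi⟩ := hx.2
        exact ⟨i, Finset.mem_univ _, hi⟩
    have hc4 : (X ∩ {x | ¬ (-((K * j : ℕ):ℤ) + 1 ≤ x.1 ∧ x.1 ≤ (K * j : ℕ) ∧ -((K * j : ℕ):ℤ) + 1 ≤ x.2 ∧ x.2 ≤ (K * j : ℕ))}).ncard ≤ 21 * K * j ^ 2 :=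
      layer_card (by omega) hK (by omega) hKj fun x hx => ⟨(hP.sub x hx.1.1).2, hx.2⟩
    have htot : X.ncard ≤ ∑ w ∈ Wu K B u, (Cinf ω ∩ (cell j w : Set Vert)).ncard + E * ((2 * (L * j) + 1) * (2 * N + 3) + (2 * r + 1) ^ 2)
        + ∑ i : Fin t, (2 * ((L + 3) * j) + 1) ^ 2 + 21 * K * j ^ 2 := by
      refine (Set.ncard_le_ncard hcov (hXf.subset ?_)).trans ?_
      · rintro x (((hx | hx) | hx) | hx) <;> exact hx.1
      · refine (Set.ncard_union_le _ _).trans (Nat.add_le_add ?_ hc4)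
        refine (Set.ncard_union_le _ _).trans (Nat.add_le_add ?_ hc3)
        exact (Set.ncard_union_le _ _).trans (Nat.add_le_add hc1 hc2)
    have r1 : (∑ w ∈ Wu K B u, ((Cinf ω ∩ (cell j w : Set Vert)).ncard : ℝ)) ≤ (Wu K B u).card * θ * (j:ℝ) ^ 2 + K * (j:ℝ) ^ 2 := by
      have h1 : ∀ w ∈ Wu K B u, ((Cinf ω ∩ (cell j w : Set Vert)).ncard : ℝ) ≤ θ * (j:ℝ) ^ 2 + 1 / (4 * K) * (j:ℝ) ^ 2 := by
        intro w hw
        have hw' := mem_Wc.1 (mem_Wu.1 hw).1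
        have := (abs_le.1 (hu2.2.2 w (mem_box.2 (by rw [nd0_le]; push_cast; omega)))).2
        linarith
      refine (Finset.sum_le_sum h1).trans ?_
      rw [Finset.sum_const, nsmul_eq_mul]
      have h2 : ((Wu K B u).card : ℝ) ≤ (2 * K) ^ 2 := by
        have : (Wu K B u).card ≤ (2 * K) ^ 2 := by
          rw [← card_Wc]; exact Finset.card_le_card fun w hw => (mem_Wu.1 hw).1
        exact_mod_cast this
      have h3 : ((Wu K B u).card : ℝ) * (1 / (4 * K) * (j:ℝ) ^ 2) ≤ (2 * K) ^ 2 * (1 / (4 * K) * (j:ℝ) ^ 2) := by gcongr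
      have h4 : (2 * (K:ℝ)) ^ 2 * (1 / (4 * K) * (j:ℝ) ^ 2) = K * (j:ℝ) ^ 2 := by field_simp; ring
      rw [mul_add]; linarith
    have r2 : (E:ℝ) * ((2 * (L * j) + 1) * (2 * N + 3) + (2 * r + 1) ^ 2) ≤ 2 * C0 * (6 * N + 10) * K * L * (j:ℝ) ^ 2 := by
      have h1 : ((2 * r + 1 : ℝ)) ^ 2 ≤ L * j := by
        have : ((2 * r + 1 : ℝ)) ^ 2 ≤ j := by exact_mod_cast hrj
        nlinarith
      have h2 : (2 * (L * j) + 1 : ℝ) ≤ 3 * (L * j) := by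
        have : (1:ℝ) ≤ j := by exact_mod_cast hj
        nlinarith
      calc (E:ℝ) * ((2 * (L * j) + 1) * (2 * N + 3) + (2 * r + 1) ^ 2) ≤ (2 * C0 * K * j) * (3 * (L * j) * (2 * N + 3) + L * j) := by gcongr
        _ = _ := by ring
    have r3 : (∑ i : Fin t, (2 * ((L + 3) * j) + 1 : ℝ) ^ 2) ≤ 324 * N * C0 * K * L * (j:ℝ) ^ 2 := by
      rw [Finset.sum_const, nsmul_eq_mul, Finset.card_univ, Fintype.card_fin]
      have h2 : (2 * ((L + 3) * j) + 1 : ℝ) ≤ 9 * (L * j) := by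
        have : (1:ℝ) ≤ j := by exact_mod_cast hj
        have : (j:ℝ) ≤ L * j := by nlinarith
        nlinarith
      calc (t:ℝ) * (2 * ((L + 3) * j) + 1 : ℝ) ^ 2 ≤ t * (9 * (L * j)) ^ 2 := by gcongr
        _ = (t * L) * (81 * L * (j:ℝ) ^ 2) := by ring
        _ ≤ (4 * N * C0 * K) * (81 * L * (j:ℝ) ^ 2) := by gcongr
        _ = _ := by ring
    have htot' : (X.ncard : ℝ) ≤ (∑ w ∈ Wu K B u, ((Cinf ω ∩ (cell j w : Set Vert)).ncard : ℝ)) + (E:ℝ) * ((2 * (L * j) + 1) * (2 * N + 3) + (2 * r + 1) ^ 2)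
        + (∑ i : Fin t, (2 * ((L + 3) * j) + 1 : ℝ) ^ 2) + 21 * K * (j:ℝ) ^ 2 := by exact_mod_cast htot
    have r4 : (22:ℝ) * K * (j:ℝ) ^ 2 ≤ 22 * K * L * (j:ℝ) ^ 2 := by
      have : (0:ℝ) ≤ K * (j:ℝ) ^ 2 := by positivity
      nlinarith
    have r5 : (0:ℝ) ≤ (4 * N * C0 + 20 * N * C0) * K * L * (j:ℝ) ^ 2 := by positivity
    calc (X.ncard : ℝ) ≤ (Wu K B u).card * θ * (j:ℝ) ^ 2 + 2 * C0 * (6 * N + 10) * K * L * (j:ℝ) ^ 2 + 324 * N * C0 * K * L * (j:ℝ) ^ 2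
          + 22 * K * L * (j:ℝ) ^ 2 + (4 * N * C0 + 20 * N * C0) * K * L * (j:ℝ) ^ 2 := by linarith
      _ = _ := by ring

end BP
end



noncomputable section

namespace BP

/-! ### Reconstruction -/

lemma cells_lower {ω : Config} {j : ℕ} (hj : 1 ≤ j) (D : Finset Vert) {U : Set Vert} (hU : U.Finite)
    (h : ∀ w ∈ D, ∀ x ∈ cell j w, x ∈ Cinf ω → x ∈ U) :
    ∑ w ∈ D, (Cinf ω ∩ (cell j w : Set Vert)).ncard ≤ U.ncard := by
  classical
  have hsub : ((D.biUnion fun w => (cell j w).filter (fun x => x ∈ Cinf ω) : Finset Vert) : Set Vert) ⊆ U := fun x hx => by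
    rw [Finset.mem_coe, Finset.mem_biUnion] at hx
    obtain ⟨w, hw, hx⟩ := hx
    obtain ⟨hx, hx'⟩ := Finset.mem_filter.1 hx
    exact h w hw x hx hx'
  refine le_trans ?_ (Set.ncard_le_ncard hsub hU)
  rw [Set.ncard_coe_finset, Finset.card_biUnion]
  · exact Finset.sum_le_sum fun w _ => (cell_filter ω j w).le
  · intro w _ w' _ hne
    refine Finset.disjoint_left.2 ?_
    intro x h1 h2
    have e1 := (mem_cell_cl hj).1 (Finset.mem_filter.1 h1).1
    have e2 := (mem_cell_cl hj).1 (Finset.mem_filter.1 h2).1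
    exact hne (e1.symm.trans e2)

lemma bdry_walks {m t : ℕ} {ω : Config} {G : Set Vert} (hG : ∀ x ∈ G, nd 0 x ≤ m) {A : Vert → Z2} (β : Fin t → List Edge)
    (hA : ∀ e, inB m e → dA A e = ∑ k, Nw (β k) e) (u : Z2) :
    (edgeBdry ω G {x | x ∈ G ∧ A x = u}).ncard ≤ ∑ k, (β k).countP ω := by
  classical
  have hsub : edgeBdry ω G {x | x ∈ G ∧ A x = u} ⊆ ((Finset.univ.biUnion fun k => ((β k).filter ω).toFinset : Finset Edge) : Set Edge) := by
    rintro e ⟨ho, h1, h2, h3⟩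
    have hne : dA A e ≠ 0 := by
      intro h0
      have := z2_eq_of_add h0
      rcases h3 with ⟨a, b⟩ | ⟨a, b⟩
      · exact b ⟨h2, this ▸ a.2⟩
      · exact a ⟨h1, this.symm ▸ b.2⟩
    rw [hA e ⟨hG _ h1, hG _ h2⟩] at hne
    obtain ⟨k, -, hk⟩ := Finset.exists_ne_zero_of_sum_ne_zero hne
    rw [Finset.mem_coe, Finset.mem_biUnion]
    exact ⟨k, Finset.mem_univ _, by rw [List.mem_toFinset, List.mem_filter]; exact ⟨Nw_ne_zero hk, ho⟩⟩
  refine (Set.ncard_le_ncard hsub (Finset.finite_toSet _)).trans ?_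
  rw [Set.ncard_coe_finset]
  refine Finset.card_biUnion_le.trans (Finset.sum_le_sum fun k _ => ?_)
  rw [List.countP_eq_length_filter]
  exact List.toFinset_card_le _

/-- cells that are close to a defect or to the boundary -/
lemma bad_cells {K R t : ℕ} (hK : 1 ≤ K) (v : Fin t → Vert) {D : Finset Vert} (hD : D ⊆ Wc K)
    (h : ∀ w ∈ D, (∃ i, nd (v i) w ≤ R) ∨ ¬ (-(K:ℤ) + 2 ≤ w.1 ∧ w.1 ≤ K - 1 ∧ -(K:ℤ) + 2 ≤ w.2 ∧ w.2 ≤ K - 1)) :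
    D.card ≤ t * (2 * R + 1) ^ 2 + 8 * K := by
  classical
  have hsub : D ⊆ (Finset.univ.biUnion fun i => box (v i) R) ∪ (Wc K \ Wc (K - 1)) := by
    intro w hw
    rw [Finset.mem_union, Finset.mem_biUnion, Finset.mem_sdiff]
    rcases h w hw with ⟨i, hi⟩ | hh
    · exact Or.inl ⟨i, Finset.mem_univ _, mem_box.2 hi⟩
    · refine Or.inr ⟨hD hw, fun h' => hh ?_⟩
      rw [mem_Wc] at h'
      omega
  refine (Finset.card_le_card hsub).trans ((Finset.card_union_le _ _).trans (Nat.add_le_add ?_ ?_))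
  · refine Finset.card_biUnion_le.trans ?_
    simp only [card_box, Finset.sum_const, Finset.card_univ, Fintype.card_fin, smul_eq_mul, le_refl]
  · rw [Finset.card_sdiff_of_subset, card_Wc, card_Wc]
    · obtain ⟨k, rfl⟩ := Nat.exists_eq_add_of_le' hK
      have : (2 * (k + 1)) ^ 2 = (2 * k) ^ 2 + 8 * k + 4 := by ring
      simp only [Nat.add_sub_cancel]
      omega
    · intro x hx
      rw [mem_Wc] at hx ⊢
      omega

/-- the potential at scale `i` -/
lemma recon_pot {N m0 K L t i m : ℕ} {ω : Config} (hG : Geo N m0 ω) (hN : 1 ≤ N) (hL : 1 ≤ L) {v v' : Fin t → Vert} {B : Vert → Z2} (hc : Co K L t v v' B)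
    (hi : 1 ≤ i) (hi0 : m0 ≤ i) (hi1 : K + 1 ≤ i) (hm : m + 1 ≤ K * i) :
    ∃ (A : Vert → Z2) (β : Fin t → List Edge), (∀ e, inB m e → dA A e = ∑ k, Nw (β k) e) ∧
      (∀ k, (β k).countP ω = TT univ ω (sc i (v k)) (sc i (v' k))) ∧
      ∀ x, (∀ k, 3 * N * L * i < nd (sc i (v k)) x) → A x = B (cl i x) := by
  have hβ : ∀ k, ∃ l, DWalk (sc i (v k)) l (sc i (v' k)) ∧ (∀ e ∈ l, e ∈ (univ : Set Edge)) ∧ l.countP ω = TT univ ω (sc i (v k)) (sc i (v' k)) :=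
    fun k => TT_attained (subset_univ _)
  choose β w1 _ w3 using hβ
  have hNL : 1 ≤ N * L := Nat.mul_pos hN hL
  have hiL : ∀ k, nd (sc i (v k)) (sc i (v' k)) ≤ i * L := fun k => by
    rw [nd_sc]; exact Nat.mul_le_mul_left _ (hc.near k)
  have hS : ∀ k, ∃ S : Vert → Z2, (∀ e, dA S e = Nw (β k) e + NL (sc i (v k)) (sc i (v' k)) e) ∧
      ∀ x, S x ≠ 0 → nd (sc i (v k)) x ≤ 3 * N * L * i := by
    intro k
    suffices hh : _ ∧ _ by
      obtain ⟨S, h1, h2⟩ := plane_potential _ (sc i (v k)) (2 * (N * L) * i) hh.1 hh.2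
      refine ⟨S, h1, fun x hx => (h2 x hx).trans ?_⟩
      have h3 : 1 * i ≤ (N * L) * i := Nat.mul_le_mul_right _ hNL
      have h4 : 3 * N * L * i = 2 * (N * L) * i + N * L * i := by ring
      omega
    constructor
    · intro y
      rw [pl_add, pl_Nw (w1 k), pl_NL, z2_self]
    · intro e he
      by_cases g1 : Nw (β k) e = 0
      · have g2 : NL (sc i (v k)) (sc i (v' k)) e ≠ 0 := by intro g2; apply he; simp [g1, g2]
        refine (NL_near g2).trans ((hiL k).trans ?_)
        calc i * L = 1 * L * i := by ring
          _ ≤ 2 * N * L * i := Nat.mul_le_mul_right _ (Nat.mul_le_mul_right _ (by omega))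
          _ = _ := by ring
      · have hst := hG.stay (w1 k) (ρ := 2 * (N * L) * i) (hi0.trans ?_) ?_ ?_ e (Nw_ne_zero g1)
        · have := (mem_ev.1 hst).1
          rwa [mem_box] at this
        · exact Nat.le_mul_of_pos_left _ (by omega)
        · rw [w3]
          calc N * TT univ ω (sc i (v k)) (sc i (v' k)) ≤ N * (2 * (i * L)) :=
                Nat.mul_le_mul_left _ ((TT_le_nd (subset_univ _)).trans (Nat.mul_le_mul_left _ (hiL k)))
            _ = _ := by ring
        · rw [nd_sc_zero]
          calc i * nd 0 (v k) ≤ i * i := Nat.mul_le_mul_left _ ((hc.rng k).trans hi1)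
            _ = i ^ 2 := (sq i).symm
            _ ≤ i ^ 9 := Nat.pow_le_pow_right hi (by norm_num)
            _ ≤ _ := Nat.pow_le_pow_left (Nat.le_mul_of_pos_left _ (by omega)) 9
  choose S hS1 hS2 using hS
  refine ⟨fun x => B (cl i x) + ∑ k, S k x, β, fun e he => ?_, w3, fun x hx => ?_⟩
  · have he' : inC (K * i : ℕ) e := by
      rw [inB_iff] at he; unfold inC; omega
    rw [dA_add, dA_sum, scale_dA Finset.univ _ _ hi hc.pot he', ← Finset.sum_add_distrib]
    refine Finset.sum_congr rfl fun k _ => ?_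
    rw [hS1]
    generalize Nw (β k) e = u1; generalize NL (sc i (v k)) (sc i (v' k)) e = u2
    revert u1 u2; decide
  · have h0 : ∑ k, S k x = 0 := Finset.sum_eq_zero fun k _ => by
      by_contra hne
      have := hS2 k x hne
      have := hx k
      omega
    simp only [h0, add_zero]

set_option maxHeartbeats 1000000 in
theorem Gd.recon {N : ℕ} {θ : ℝ} {T : Vert → Vert → ℝ} {ω : Config} (h : Gd N θ T ω) (hθ : 0 < θ) (hN : 1 ≤ N) {C1 : ℝ} (hC1 : 0 < C1)
    {K L t : ℕ} (hL : 1 ≤ L) (hK : 1 ≤ K) {v v' : Fin t → Vert} {B : Vert → Z2} (hc : Co K L t v v' B) (ht : (t:ℝ) * L ≤ C1 * K)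
    {s δ : ℝ} (hs : 0 < s) (hδ : 0 < δ) (hsu : ∀ u : Z2, s ≤ θ * (Wu K B u).card - (1 + θ * (81 * N ^ 2 * C1 + 8)) * K * L) :
    ∀ᶠ m : ℕ in atTop, m * Phi ω m ≤ K * (∑ i, T (v i) (v' i) + t * δ) / s := by
  classical
  obtain ⟨m0, hG⟩ := h.geo
  have hK' : (1:ℝ) ≤ K := by exact_mod_cast hK
  have hL' : (1:ℝ) ≤ L := by exact_mod_cast hL
  have hN' : (1:ℝ) ≤ N := by exact_mod_cast hN
  have hdiv : Tendsto (fun m : ℕ => m / K + 1) atTop atTop :=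
    (tendsto_add_atTop_nat 1).comp (Nat.tendsto_div_const_atTop (n := K) (by omega))
  filter_upwards [h.pk hθ, hdiv.eventually (h.unif hδ (K + 1)),
    hdiv.eventually (h.unif (show (0:ℝ) < 1 / (4 * K) by positivity) (K + 1)), k4_sq_small (K * (K + 2)), hdiv.eventually (eventually_ge_atTop (K + 1)),
    hdiv.eventually (eventually_ge_atTop m0), eventually_ge_atTop 1] with m hP hu1 hu2 hk hiK him0 hm1
  set G := giant ω m with hGdef
  set i := m / K + 1 with hidef
  set r := k4 m with hr
  have hi : 1 ≤ i := by omega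
  have hmi : m + 1 ≤ K * i := Nat.lt_mul_div_succ m (show 0 < K by omega)
  have hmi2 : K * i ≤ m + K := by
    have := Nat.mul_div_le m K
    rw [hidef, mul_add, mul_one]; omega
  have hir : K + 2 * r + 2 ≤ i := by
    have h1 : (K + 2) * (r + 1) ^ 2 ≤ m / K := by
      rw [Nat.le_div_iff_mul_le (by omega)]
      calc (K + 2) * (r + 1) ^ 2 * K = K * (K + 2) * (r + 1) ^ 2 := by ring
        _ ≤ m := hk
    have h2 : (K + 2) * (r + 1) ≤ (K + 2) * (r + 1) ^ 2 := Nat.mul_le_mul_left _ (Nat.le_self_pow (by norm_num) _)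
    have h3 : (K + 2) * (r + 1) = K * r + 2 * r + K + 2 := by ring
    have h4 : 0 ≤ K * r := Nat.zero_le _
    omega
  obtain ⟨A, β, hA, hβ, hfar⟩ := recon_pot hG hN hL hc hi him0 hiK hmi
  have hi' : (0:ℝ) < i := by exact_mod_cast hi
  have hcost : (∑ k, ((β k).countP ω : ℝ)) ≤ (∑ k, T (v k) (v' k) + t * δ) * i := by
    have h1 : ∀ k, ((β k).countP ω : ℝ) ≤ T (v k) (v' k) * i + δ * i := fun k => by
      rw [hβ k]
      have := (abs_le.1 (hu1.2.1 (v k) (mem_box.2 (hc.rng k)) (v' k) (mem_box.2 (hc.rng' k)))).2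
      linarith
    refine (Finset.sum_le_sum fun k _ => h1 k).trans ?_
    rw [Finset.sum_add_distrib, ← Finset.sum_mul]
    simp only [Finset.sum_const, Finset.card_univ, Fintype.card_fin, nsmul_eq_mul]
    linarith
  have hGm : ∀ x ∈ G, nd 0 x ≤ m := fun x hx => (hP.sub x hx).2
  have hE : ∀ u : Z2, ((edgeBdry ω G {x | x ∈ G ∧ A x = u}).ncard : ℝ) ≤ (∑ k, T (v k) (v' k) + t * δ) * i := fun u => by
    refine le_trans ?_ hcost
    exact_mod_cast bdry_walks (ω := ω) hGm β hA u
  have hfin : ∀ u : Z2, ({x | x ∈ G ∧ A x = u} : Set Vert).Finite := fun u => hP.finite.subset fun x hx => hx.1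
  have hsize : ∀ u : Z2, s * (i:ℝ) ^ 2 ≤ (({x | x ∈ G ∧ A x = u} : Set Vert).ncard : ℝ) := by
    intro u
    set bad : Vert → Prop := fun w => (∃ k, nd (v k) w ≤ 3 * N * L + 1) ∨ ¬ (-(K:ℤ) + 2 ≤ w.1 ∧ w.1 ≤ K - 1 ∧ -(K:ℤ) + 2 ≤ w.2 ∧ w.2 ≤ K - 1) with hbad
    set D := (Wu K B u).filter (fun w => ¬ bad w) with hD
    set D' := (Wu K B u).filter bad with hD'
    have hcard : D'.card + D.card = (Wu K B u).card := Finset.card_filter_add_card_filter_not (s := Wu K B u) bad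
    have hb1 : D'.card ≤ t * (2 * (3 * N * L + 1) + 1) ^ 2 + 8 * K :=
      bad_cells hK v (fun w hw => (mem_Wu.1 (Finset.mem_filter.1 hw).1).1) (fun w hw => (Finset.mem_filter.1 hw).2)
    have hlow : ∑ w ∈ D, (Cinf ω ∩ (cell i w : Set Vert)).ncard ≤ ({x | x ∈ G ∧ A x = u} : Set Vert).ncard := by
      refine cells_lower hi D (hfin u) fun w hw x hx hxC => ?_
      obtain ⟨hw, hnb⟩ := Finset.mem_filter.1 hw
      simp only [hbad, not_or, not_exists, not_not, not_le] at hnb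
      obtain ⟨hn1, hn2⟩ := hnb
      have hx' := mem_cell.1 hx
      have hi0 : (0:ℤ) ≤ i := by omega
      refine ⟨hP.inner x hxC ?_, ?_⟩
      · have e1 : (i:ℤ) * w.1 ≤ i * (K - 1) := mul_le_mul_of_nonneg_left hn2.2.1 hi0
        have e2 : (i:ℤ) * w.2 ≤ i * (K - 1) := mul_le_mul_of_nonneg_left hn2.2.2.2 hi0
        have e3 : (i:ℤ) * (-K + 1) ≤ i * (w.1 - 1) := mul_le_mul_of_nonneg_left (by omega) hi0
        have e4 : (i:ℤ) * (-K + 1) ≤ i * (w.2 - 1) := mul_le_mul_of_nonneg_left (by omega) hi0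
        have e5 : (i:ℤ) * (-K + 1) = -(K * i) + i := by ring
        have e6 : (i:ℤ) * (K - 1) = K * i - i := by ring
        have e7 : (K:ℤ) * i ≤ m + K := by exact_mod_cast hmi2
        suffices nd 0 x ≤ m - (2 * r + 2) by have := hP.hr; omega
        have hrm := hP.hr
        rw [nd0_le, Nat.cast_sub (by omega)]
        push_cast
        omega
      · rw [hfar x, (mem_cell_cl hi).1 hx, (mem_Wu.1 hw).2]
        intro k
        by_contra hcon
        push Not at hcon
        have g1 : nd x (sc i w) ≤ i := by
          have e3 : (i:ℤ) * (w.1 - 1) = i * w.1 - i := by ring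
          have e4 : (i:ℤ) * (w.2 - 1) = i * w.2 - i := by ring
          rw [nd_le]; simp only [sc]; omega
        have g2 := nd_tri (sc i (v k)) x (sc i w)
        rw [nd_sc] at g2
        have g3 : i * nd (v k) w ≤ i * (3 * N * L + 1) := by
          have : i * (3 * N * L + 1) = 3 * N * L * i + i := by ring
          omega
        have g4 := Nat.le_of_mul_le_mul_left g3 (by omega)
        have g5 := hn1 k
        omega
    have hlow' : (∑ w ∈ D, ((Cinf ω ∩ (cell i w : Set Vert)).ncard : ℝ)) ≤ (({x | x ∈ G ∧ A x = u} : Set Vert).ncard : ℝ) := by exact_mod_cast hlow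
    refine le_trans ?_ hlow'
    have h1 : ∀ w ∈ D, θ * (i:ℝ) ^ 2 - 1 / (4 * K) * (i:ℝ) ^ 2 ≤ ((Cinf ω ∩ (cell i w : Set Vert)).ncard : ℝ) := by
      intro w hw
      have hw' := mem_Wc.1 (mem_Wu.1 (Finset.mem_filter.1 hw).1).1
      have := (abs_le.1 (hu2.2.2 w (mem_box.2 (by rw [nd0_le]; push_cast; omega)))).1
      linarith
    refine le_trans ?_ (Finset.sum_le_sum h1)
    rw [Finset.sum_const, nsmul_eq_mul]
    have h2 : (D.card : ℝ) ≤ (2 * K) ^ 2 := by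
      have : D.card ≤ (2 * K) ^ 2 := by
        rw [← card_Wc]; exact Finset.card_le_card fun w hw => (mem_Wu.1 (Finset.mem_filter.1 hw).1).1
      exact_mod_cast this
    have h3 : (D.card : ℝ) * (1 / (4 * K) * (i:ℝ) ^ 2) ≤ (2 * K) ^ 2 * (1 / (4 * K) * (i:ℝ) ^ 2) := by gcongr
    have h4 : (2 * (K:ℝ)) ^ 2 * (1 / (4 * K) * (i:ℝ) ^ 2) = K * (i:ℝ) ^ 2 := by field_simp; ring
    have h5 : (D'.card : ℝ) ≤ (81 * N ^ 2 * C1 + 8) * K * L := by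
      have a1 : (D'.card : ℝ) ≤ t * (2 * (3 * N * L + 1) + 1) ^ 2 + 8 * K := by exact_mod_cast hb1
      have a2 : (2 * (3 * N * L + 1) + 1 : ℝ) ≤ 9 * (N * L) := by
        have : (1:ℝ) ≤ N * L := by nlinarith
        linarith
      calc (D'.card : ℝ) ≤ t * (2 * (3 * N * L + 1) + 1) ^ 2 + 8 * K := a1
        _ ≤ t * (9 * (N * L)) ^ 2 + 8 * K * L := by
            have a3 : (t:ℝ) * (2 * (3 * N * L + 1) + 1) ^ 2 ≤ t * (9 * (N * L)) ^ 2 := by gcongr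
            have a5 : (0:ℝ) ≤ 8 * K := by positivity
            have a4 : (8 * K:ℝ) ≤ 8 * K * L := by nlinarith
            linarith
        _ = (t * L) * (81 * N ^ 2 * L) + 8 * K * L := by ring
        _ ≤ (C1 * K) * (81 * N ^ 2 * L) + 8 * K * L := by gcongr
        _ = _ := by ring
    have h6 : (D.card : ℝ) = (Wu K B u).card - D'.card := by
      have : (D'.card : ℝ) + D.card = (Wu K B u).card := by exact_mod_cast hcard
      linarith
    have h7 : θ * (D'.card : ℝ) ≤ θ * ((81 * N ^ 2 * C1 + 8) * K * L) := by gcongr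
    have h8 : s + K ≤ θ * D.card := by
      have := hsu u
      have h9 : (K:ℝ) ≤ K * L := by nlinarith
      rw [h6]
      linarith
    have h10 : (s + K) * (i:ℝ) ^ 2 ≤ θ * D.card * (i:ℝ) ^ 2 := by gcongr
    linarith
  have hpos : ∀ u : Z2, 0 < ({x | x ∈ G ∧ A x = u} : Set Vert).ncard := fun u => by
    have h1 : (0:ℝ) < s * (i:ℝ) ^ 2 := by positivity
    exact_mod_cast h1.trans_le (hsize u)
  have hsplit : ({x | x ∈ G ∧ A x = 0} : Set Vert).ncard + ({x | x ∈ G ∧ A x = 1} : Set Vert).ncard = G.ncard := by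
    rw [← Set.ncard_union_eq _ (hfin 0) (hfin 1)]
    · congr 1
      ext x
      have : ∀ z : Z2, z = 0 ∨ z = 1 := by decide
      simp only [mem_union, mem_ofPred_eq]
      have := this (A x)
      tauto
    · rw [Set.disjoint_left]
      rintro x ⟨_, h1⟩ ⟨_, h2⟩
      rw [h1] at h2
      exact absurd h2 (by decide)
  obtain ⟨u, hu⟩ : ∃ u : Z2, 2 * ({x | x ∈ G ∧ A x = u} : Set Vert).ncard ≤ G.ncard := by
    by_cases hh : 2 * ({x | x ∈ G ∧ A x = 0} : Set Vert).ncard ≤ G.ncard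
    · exact ⟨0, hh⟩
    · exact ⟨1, by omega⟩
  have hPhi := Phi_le (ω := ω) (n := m) (H := {x | x ∈ G ∧ A x = u}) (fun x hx => hx.1) (hpos u) hu
  have hTn : 0 ≤ ∑ k, T (v k) (v' k) + t * δ := by
    have : (0:ℝ) ≤ (∑ k, T (v k) (v' k) + t * δ) * i := le_trans (by positivity) hcost
    exact nonneg_of_mul_nonneg_left this hi'
  have hmi' : (m:ℝ) ≤ K * i := by exact_mod_cast (by omega : m ≤ K * i)
  calc (m:ℝ) * Phi ω m ≤ m * (((∑ k, T (v k) (v' k) + t * δ) * i) / (s * (i:ℝ) ^ 2)) := by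
        gcongr
        refine hPhi.trans ?_
        gcongr
        · exact hE u
        · exact hsize u
    _ ≤ (K * i) * (((∑ k, T (v k) (v' k) + t * δ) * i) / (s * (i:ℝ) ^ 2)) := by gcongr
    _ = _ := by field_simp

end BP
end



noncomputable section

namespace BP

lemma arith5 {e h a b c M ε : ℝ} (hc : 0 < c) (hch : c ≤ h) (he : 0 ≤ e) (heM : e ≤ M) (ha : 0 ≤ a) (hb : 0 ≤ b)
    (hbc : b ≤ c / 2) (h1 : 2 * a / c ≤ ε / 2) (h2 : 2 * M * b / c ^ 2 ≤ ε / 2) :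
    (e + a) / (h - b) ≤ e / h + ε := by
  have hh : 0 < h := by linarith
  have hb2 : h / 2 ≤ h - b := by linarith
  have hb3 : c / 2 ≤ h - b := by linarith
  have hb4 : 0 < h - b := by linarith
  have e1 : (e + a) / (h - b) = e / h + (a / (h - b) + e * b / (h * (h - b))) := by
    field_simp; ring
  have e2 : a / (h - b) ≤ 2 * a / c := by
    rw [show 2 * a / c = a / (c / 2) by field_simp]
    gcongr
  have e3 : e * b / (h * (h - b)) ≤ 2 * M * b / c ^ 2 := by
    rw [show 2 * M * b / c ^ 2 = M * b / (c * (c / 2)) by field_simp]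
    have : 0 ≤ M := he.trans heM
    gcongr
  rw [e1]; linarith

lemma exists_big (A : ℝ) {η : ℝ} (hη : 0 < η) : ∃ L0 : ℕ, 1 ≤ L0 ∧ ∀ L : ℕ, L0 ≤ L → A / L ≤ η := by
  have h := (tendsto_const_div_atTop_nhds_zero_nat A).eventually (ge_mem_nhds hη)
  obtain ⟨L0, h0⟩ := eventually_atTop.1 h
  exact ⟨max 1 L0, le_max_left _ _, fun L hL => h0 L ((le_max_right _ _).trans hL)⟩

theorem Gd.compare {N : ℕ} {θ : ℝ} {T : Vert → Vert → ℝ} {ω ω' : Config} (h : Gd N θ T ω) (h' : Gd N θ T ω') (hθ : 0 < θ) (hN : 1 ≤ N)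
    {ε : ℝ} (hε : 0 < ε) :
    ∀ᶠ n : ℕ in atTop, ∀ᶠ m : ℕ in atTop, m * Phi ω' m ≤ n * Phi ω n + ε := by
  classical
  set C : ℝ := 48 / θ + ε / 2 with hC
  have hCp : 0 < C := by positivity
  obtain ⟨c, hc, hsz⟩ := h.sizes hθ hN hCp
  have hC0 : 0 < 9 * C := by positivity
  obtain ⟨C2, hC2, hco⟩ := h.coarse hθ hC0
  set C' : ℝ := C2 + (1 + θ * (81 * N ^ 2 * C2 + 8)) with hC'
  have hC'p : 0 < C' := by positivity
  obtain ⟨L, hL1, hL⟩ := exists_big (2 * (2 * C2) / c) (show 0 < ε / 2 / 2 by positivity)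
  have hL := hL L le_rfl
  obtain ⟨K1, -, hK1⟩ := exists_big (C' * L) (show 0 < c / 2 by positivity)
  obtain ⟨K2, -, hK2⟩ := exists_big (2 * (2 * (9 * C)) * (C' * L) / c ^ 2) (show 0 < ε / 2 / 2 by positivity)
  obtain ⟨K, hKL, hKa, hKb⟩ : ∃ K : ℕ, 2 * L ≤ K ∧ K1 ≤ K ∧ K2 ≤ K :=
    ⟨2 * L + K1 + K2, by omega, by omega, by omega⟩
  have hK1 := hK1 K hKa
  have hK2 := hK2 K hKb
  have hK : 1 ≤ K := by omega
  have hKp : (0:ℝ) < K := by exact_mod_cast hK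
  have hLp : (0:ℝ) < L := by exact_mod_cast hL1
  filter_upwards [h.near hθ (show 0 < ε / 2 by positivity), h.phi_upper hθ, hsz, hco L K hL1 hKL, eventually_ge_atTop K] with n hnear hup hsz hco hnK
  obtain ⟨H, hHG, hH0, hH2, hHn⟩ := hnear
  obtain ⟨hE, hHc⟩ := hsz H hHG hH0 hH2 (by rw [hC]; linarith)
  obtain ⟨t, v, v', B, hCo, ht, hS, hu⟩ := hco H hHG hE
  set E : ℝ := ((edgeBdry ω (giant ω n) H).ncard : ℝ) with hEd
  set j : ℕ := n / K with hj
  set S : ℝ := ∑ i, T (v i) (v' i) with hSd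
  have hE0 : 0 ≤ E := by positivity
  have hj1 : 1 ≤ j := by rw [hj]; exact (Nat.one_le_div_iff hK).2 hnK
  have hjp : (0:ℝ) < j := by exact_mod_cast hj1
  have hjn : (j:ℝ) * K ≤ n := by exact_mod_cast Nat.div_mul_le_self n K
  have hnj : (n:ℝ) ≤ 2 * (j * K) := by
    have h1 : n < K * (j + 1) := Nat.lt_mul_div_succ n hK
    have h2 : K * 1 ≤ K * j := Nat.mul_le_mul_left _ hj1
    have : n ≤ 2 * (j * K) := by nlinarith
    exact_mod_cast this
  have hHp : (0:ℝ) < H.ncard := by exact_mod_cast hH0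
  have hGf : (giant ω n).Finite := by
    by_contra hinf
    have : (giant ω n).ncard = 0 := Set.Infinite.ncard hinf
    omega
  set hh : ℝ := H.ncard / ((j:ℝ) * K) ^ 2 with hhd
  set e : ℝ := E / ((j:ℝ) * K) with hed
  have hch : c ≤ hh := by
    rw [hhd, le_div_iff₀ (by positivity)]
    have : c * ((j:ℝ) * K) ^ 2 ≤ c * (n:ℝ) ^ 2 := by gcongr
    linarith
  have heM : e ≤ 2 * (9 * C) := by
    rw [hed, div_le_iff₀ (by positivity)]
    have : 9 * C * n ≤ 9 * C * (2 * (j * K)) := by gcongr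
    linarith
  have he0 : 0 ≤ e := by positivity
  have hone : ({x | x ∈ giant ω n ∧ i2 H x = 1} : Set Vert) = H := by
    ext x; simp only [mem_ofPred_eq, i2_eq_one]
    exact ⟨fun q => q.2, fun q => ⟨hHG q, q⟩⟩
  have hzero : ({x | x ∈ giant ω n ∧ i2 H x = 0} : Set Vert) = giant ω n \ H := by
    ext x; simp only [mem_ofPred_eq, i2_eq_zero, mem_diff]
  have hlow : ∀ u : Z2, (H.ncard:ℝ) ≤ (({x | x ∈ giant ω n ∧ i2 H x = u} : Set Vert).ncard : ℝ) := by
    intro u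
    fin_cases u
    · change (H.ncard:ℝ) ≤ (({x | x ∈ giant ω n ∧ i2 H x = 0} : Set Vert).ncard : ℝ)
      rw [hzero]
      have := Set.ncard_diff_add_ncard_of_subset hHG hGf
      exact_mod_cast (by omega : H.ncard ≤ (giant ω n \ H).ncard)
    · change (H.ncard:ℝ) ≤ (({x | x ∈ giant ω n ∧ i2 H x = 1} : Set Vert).ncard : ℝ)
      rw [hone]
  set s : ℝ := (K:ℝ) ^ 2 * (hh - C' * L / K) with hsd
  have hs : 0 < s := by
    have : 0 < hh - C' * L / K := by linarith
    positivity
  have hs' : s = H.ncard / (j:ℝ) ^ 2 - C' * K * L := by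
    rw [hsd, hhd]; field_simp
  have hrec := h'.recon hθ hN hC2 hL1 hK hCo ht (s := s) (δ := 1) hs one_pos (fun u => by
    have h1 := (hlow u).trans (hu u)
    have h2 : (H.ncard:ℝ) / (j:ℝ) ^ 2 ≤ θ * (Wu K B u).card + C2 * K * L := by
      rw [div_le_iff₀ (by positivity)]; linarith
    rw [hs', hC']
    linarith)
  filter_upwards [hrec] with m hm
  have hS' : S ≤ K * e + C2 * K / L := by
    have : K * e = E / j := by rw [hed]; field_simp
    rw [this, ← sub_le_iff_le_add, le_div_iff₀ hjp]
    linarith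
  have ht' : (t:ℝ) ≤ C2 * K / L := by rw [le_div_iff₀ hLp]; exact ht
  have hm2 : K * (S + t * 1) / s ≤ (e + 2 * C2 / L) / (hh - C' * L / K) := by
    have hd : 0 < hh - C' * L / K := by linarith
    rw [show (e + 2 * C2 / L) / (hh - C' * L / K) = K * (K * e + 2 * (C2 * K / L)) / s by
      rw [hsd]; field_simp]
    have : S + t * 1 ≤ K * e + 2 * (C2 * K / L) := by linarith
    gcongr
  have hfin : (e + 2 * C2 / L) / (hh - C' * L / K) ≤ e / hh + ε / 2 := by
    refine arith5 hc hch he0 heM (by positivity) (by positivity) hK1 ?_ ?_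
    · calc _ = 2 * (2 * C2) / c / L := by field_simp
        _ ≤ _ := hL
    · calc _ = 2 * (2 * (9 * C)) * (C' * L) / c ^ 2 / K := by field_simp
        _ ≤ _ := hK2
  have heh : e / hh ≤ n * (E / H.ncard) := by
    have : e / hh = (j * K) * (E / H.ncard) := by rw [hed, hhd]; field_simp
    rw [this]; gcongr
  linarith

lemma limit_of_compare {f : ℕ → ℝ} {C : ℝ} (hf0 : ∀ᶠ n in atTop, 0 ≤ f n) (hfC : ∀ᶠ n in atTop, f n ≤ C)
    (hcmp : ∀ ε > 0, ∀ᶠ n in atTop, ∀ᶠ m in atTop, f m ≤ f n + ε) : ∃ c, Tendsto f atTop (nhds c) := by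
  apply cauchySeq_tendsto_of_complete
  -- the limit superior does not exceed the limit inferior
  have hbdd : atTop.IsBoundedUnder (· ≤ ·) f := ⟨C, hfC⟩
  have hbdd' : atTop.IsBoundedUnder (· ≥ ·) f := ⟨0, hf0⟩
  refine (tendsto_of_le_liminf_of_limsup_le (a := limsup f atTop) ?_ le_rfl hbdd hbdd').cauchySeq
  refine le_of_forall_pos_le_add fun ε hε => ?_
  have h1 : ∀ᶠ n in atTop, limsup f atTop - ε ≤ f n := by
    filter_upwards [hcmp ε hε] with n hn
    have := limsup_le_of_le hbdd'.isCoboundedUnder_le hn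
    linarith
  have := le_liminf_of_le hbdd.isCoboundedUnder_ge h1
  linarith

theorem main_mu {p : unitInterval} (hp : 1 / 2 < (p:ℝ)) :
    ∃ c : ℝ, 0 < c ∧ ∀ᵐ ω ∂(mu p), Tendsto (fun n : ℕ => (n:ℝ) * Phi ω n) atTop (nhds c) := by
  obtain ⟨N, T, hN, hae⟩ := good_ae hp
  have hθ := thet_pos hp
  obtain ⟨ω0, h0⟩ := hae.exists
  have hN' : (1:ℝ) ≤ N := by exact_mod_cast hN
  have hpos : (0:ℝ) < 1 / (9 * N ^ 2) := by positivity
  have key : ∀ ω, Gd N (thet p) T ω → ∃ c, Tendsto (fun n : ℕ => (n:ℝ) * Phi ω n) atTop (nhds c) := fun ω h =>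
    limit_of_compare ((h.phi_lower hθ hN).mono fun n hn => hpos.le.trans hn) (h.phi_upper hθ)
      fun ε hε => h.compare h hθ hN hε
  have key2 : ∀ ω ω', Gd N (thet p) T ω → Gd N (thet p) T ω' → ∀ c c', Tendsto (fun n : ℕ => (n:ℝ) * Phi ω n) atTop (nhds c) →
      Tendsto (fun n : ℕ => (n:ℝ) * Phi ω' n) atTop (nhds c') → c' ≤ c := by
    intro ω ω' h h' c c' hc hc'
    refine le_of_forall_pos_le_add fun ε hε => ?_
    have h1 : ∀ᶠ n : ℕ in atTop, c' ≤ (n:ℝ) * Phi ω n + ε := by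
      filter_upwards [h.compare h' hθ hN hε] with n hn
      exact le_of_tendsto hc' hn
    exact ge_of_tendsto (hc.add_const ε) h1
  obtain ⟨c, hc⟩ := key ω0 h0
  refine ⟨c, hpos.trans_le (ge_of_tendsto hc (h0.phi_lower hθ hN)), ?_⟩
  filter_upwards [hae] with ω h
  obtain ⟨c', hc'⟩ := key ω h
  have : c' = c := le_antisymm (key2 ω0 ω h0 h c c' hc hc') (key2 ω ω0 h h0 c' c hc' hc)
  rwa [this] at hc'

end BP
end

/-- **Benjamini's conjecture in dimension two.** For every `p ∈ (1/2, 1)` there is a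
deterministic constant `c(p) ∈ (0,∞)` such that, almost surely under the Bernoulli(`p`)
bond percolation measure, `n · Φₙ → c(p)` as `n → ∞`. -/
theorem cheeger_constant_scaling_limit (p : ℝ) (hp : 1 / 2 < p) (hp1 : p < 1)
    (P : MeasureTheory.Measure Config) (hP : IsBernoulli P p) :
    ∃ c : ℝ, 0 < c ∧
      ∀ᵐ ω ∂P, Filter.Tendsto (fun n : ℕ => (n : ℝ) * Phi ω n)
        Filter.atTop (nhds c) := by
  have h := BP.mu_of_bernoulli (by linarith) hp1.le hP
  rw [h]
  exact BP.main_mu (p := ⟨p, by linarith, hp1.le⟩) hp
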